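/- Existence of LP MFG equilibria: assume in addition that either (a) b and σ do not depend on the measure argument, or (c) O is an open interval, σ does not depend on the control argument a, and there exists c_σ > 0 with σ(t,x,m) ≥ c_σ for all (t,x,m). Then the set of LP MFG Nash equilibria is nonempty and compact (in P([0,T]×Ō) × V with the topologies of weak convergence). -/

import Mathlib

open MeasureTheory Filter Set Topology

noncomputable section

/-- Membership in `C_b^{1,2}([0,T] × closure O)`: `u` together with its partial
derivatives `ut = ∂_t u`, `ux = ∂_x u`, `uxx = ∂_xx u`, all continuous and bounded
on `[0,T] × closure O`. -/
structure IsCb12 (T : ℝ) (O : Set ℝ) (u ut ux uxx : ℝ → ℝ → ℝ) : Prop where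
  cont : ContinuousOn (fun p : ℝ × ℝ => u p.1 p.2) (Set.Icc 0 T ×ˢ closure O)
  cont_t : ContinuousOn (fun p : ℝ × ℝ => ut p.1 p.2) (Set.Icc 0 T ×ˢ closure O)
  cont_x : ContinuousOn (fun p : ℝ × ℝ => ux p.1 p.2) (Set.Icc 0 T ×ˢ closure O)
  cont_xx : ContinuousOn (fun p : ℝ × ℝ => uxx p.1 p.2) (Set.Icc 0 T ×ˢ closure O)
  deriv_t : ∀ t ∈ Set.Icc (0:ℝ) T, ∀ x ∈ closure O,
    HasDerivWithinAt (fun s => u s x) (ut t x) (Set.Icc 0 T) t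
  deriv_x : ∀ t ∈ Set.Icc (0:ℝ) T, ∀ x ∈ closure O,
    HasDerivWithinAt (fun y => u t y) (ux t x) (closure O) x
  deriv_xx : ∀ t ∈ Set.Icc (0:ℝ) T, ∀ x ∈ closure O,
    HasDerivWithinAt (fun y => ux t y) (uxx t x) (closure O) x
  bdd : ∃ C : ℝ, ∀ t ∈ Set.Icc (0:ℝ) T, ∀ x ∈ closure O,
    |u t x| ≤ C ∧ |ut t x| ≤ C ∧ |ux t x| ≤ C ∧ |uxx t x| ≤ C

/-- Membership in `V`: a flow of finite positive Borel measures on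
`closure O × A`, measurable in `t`, with integrable total mass on `[0,T]`. -/
def MemV (T : ℝ) (O A : Set ℝ) (m : ℝ → Measure (ℝ × ℝ)) : Prop :=
  (∀ t, m t Set.univ < ⊤) ∧
  (∀ t, m t ((closure O ×ˢ A)ᶜ) = 0) ∧
  (∀ B : Set (ℝ × ℝ), MeasurableSet B → Measurable fun t => m t B) ∧
  IntegrableOn (fun t => (m t Set.univ).toReal) (Set.Icc 0 T)

/-- Weak convergence of (finite) measures on `[0,T] × closure O` (tested against
bounded continuous functions). -/
def WeakConv (μn : ℕ → Measure (ℝ × ℝ)) (μ : Measure (ℝ × ℝ)) : Prop :=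
  ∀ h : ℝ × ℝ → ℝ, Continuous h → (∃ C : ℝ, ∀ p, |h p| ≤ C) →
    Tendsto (fun n => ∫ p, h p ∂(μn n)) atTop (nhds (∫ p, h p ∂μ))

/-- Convergence `mⁿ → m` in `V`: weak convergence of the associated finite
measures `m_tⁿ(dx,da)dt` on `[0,T] × closure O × A`. -/
def ConvV (T : ℝ) (mn : ℕ → ℝ → Measure (ℝ × ℝ)) (m : ℝ → Measure (ℝ × ℝ)) : Prop :=
  ∀ h : ℝ → ℝ × ℝ → ℝ, Continuous (fun q : ℝ × ℝ × ℝ => h q.1 q.2) →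
    (∃ C : ℝ, ∀ t p, |h t p| ≤ C) →
    Tendsto (fun n => ∫ t in Set.Icc 0 T, (∫ p, h t p ∂(mn n t))) atTop
      (nhds (∫ t in Set.Icc 0 T, (∫ p, h t p ∂(m t))))

/-- Mean-field structural assumptions on a coefficient
`c(t,x,m,a) = c̄(t, x, ∫ ĉ(t,y) m(dy,du), a)`: Lipschitz in `x` uniformly in the
other variables; `c̄` bounded, measurable and continuous in the variables other than
`t` for each fixed `t`; `ĉ` continuous and bounded on `[0,T] × closure O`. -/
def MFCoeff (T : ℝ) (O A : Set ℝ) (d : ℕ)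
    (c : ℝ → ℝ → Measure (ℝ × ℝ) → ℝ → ℝ)
    (cbar : ℝ → ℝ → (Fin d → ℝ) → ℝ → ℝ)
    (chat : ℝ → ℝ → Fin d → ℝ) : Prop :=
  (∃ K : ℝ, ∀ t (ν : Measure (ℝ × ℝ)) a x y, |c t x ν a - c t y ν a| ≤ K * |x - y|) ∧
  (∀ t x (ν : Measure (ℝ × ℝ)) a, c t x ν a = cbar t x (fun i => ∫ p, chat t p.1 i ∂ν) a) ∧
  (∃ C : ℝ, ∀ t x z a, |cbar t x z a| ≤ C) ∧
  Measurable (fun q : ℝ × ℝ × (Fin d → ℝ) × ℝ => cbar q.1 q.2.1 q.2.2.1 q.2.2.2) ∧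
  (∀ t, ContinuousOn (fun q : ℝ × (Fin d → ℝ) × ℝ => cbar t q.1 q.2.1 q.2.2)
      (Set.univ ×ˢ Set.univ ×ˢ A)) ∧
  ContinuousOn (fun p : ℝ × ℝ => chat p.1 p.2) (Set.Icc 0 T ×ˢ closure O) ∧
  (∃ C : ℝ, ∀ t x, ‖chat t x‖ ≤ C)

/-- Mean-field structural assumptions on the running reward
`f(t,x,m,a) = f̄(t, x, ∫ f̂(t,y) m(dy,du), a)` with `f̄` bounded, measurable,
continuous in the variables other than `t` for each fixed `t`, and `f̂` continuous
and bounded. -/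
def MFRunning (T : ℝ) (O A : Set ℝ) (d : ℕ)
    (f : ℝ → ℝ → Measure (ℝ × ℝ) → ℝ → ℝ)
    (fbar : ℝ → ℝ → (Fin d → ℝ) → ℝ → ℝ)
    (fhat : ℝ → ℝ → Fin d → ℝ) : Prop :=
  (∀ t x (ν : Measure (ℝ × ℝ)) a, f t x ν a = fbar t x (fun i => ∫ p, fhat t p.1 i ∂ν) a) ∧
  (∃ C : ℝ, ∀ t x z a, |fbar t x z a| ≤ C) ∧
  Measurable (fun q : ℝ × ℝ × (Fin d → ℝ) × ℝ => fbar q.1 q.2.1 q.2.2.1 q.2.2.2) ∧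
  (∀ t, ContinuousOn (fun q : ℝ × (Fin d → ℝ) × ℝ => fbar t q.1 q.2.1 q.2.2)
      (closure O ×ˢ Set.univ ×ˢ A)) ∧
  ContinuousOn (fun p : ℝ × ℝ => fhat p.1 p.2) (Set.Icc 0 T ×ˢ closure O) ∧
  (∃ C : ℝ, ∀ t x, ‖fhat t x‖ ≤ C)

/-- Mean-field structural assumptions on the terminal reward
`g(t,x,μ) = ḡ(t, x, ∫ ĝ(s,y) μ(ds,dy))` with `ḡ` and `ĝ` continuous and bounded. -/
def MFTerminal (T : ℝ) (O : Set ℝ) (d : ℕ)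
    (g : ℝ → ℝ → Measure (ℝ × ℝ) → ℝ)
    (gbar : ℝ → ℝ → (Fin d → ℝ) → ℝ)
    (ghat : ℝ → ℝ → Fin d → ℝ) : Prop :=
  (∀ t x (ν : Measure (ℝ × ℝ)), g t x ν = gbar t x (fun i => ∫ p, ghat p.1 p.2 i ∂ν)) ∧
  ContinuousOn (fun q : ℝ × ℝ × (Fin d → ℝ) => gbar q.1 q.2.1 q.2.2)
    (Set.Icc 0 T ×ˢ closure O ×ˢ Set.univ) ∧
  (∃ C : ℝ, ∀ t x z, |gbar t x z| ≤ C) ∧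
  ContinuousOn (fun p : ℝ × ℝ => ghat p.1 p.2) (Set.Icc 0 T ×ˢ closure O) ∧
  (∃ C : ℝ, ∀ t x, ‖ghat t x‖ ≤ C)

/-- Standing assumption on the initial measure in the mean-field setting: a
probability measure on `O` with `∫ |x|² dm₀* < ∞`. -/
def InitAssumption2 (O : Set ℝ) (m0 : Measure ℝ) : Prop :=
  IsProbabilityMeasure m0 ∧ m0 Oᶜ = 0 ∧ Integrable (fun x => x ^ 2) m0

/-- Membership in `R[m̄]`: the Fokker–Planck constraint with coefficients frozen
along the flow `m̄`. -/
def MemRm (T : ℝ) (O A : Set ℝ)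
    (b σ : ℝ → ℝ → Measure (ℝ × ℝ) → ℝ → ℝ) (m0 : Measure ℝ)
    (mbar : ℝ → Measure (ℝ × ℝ))
    (μ : Measure (ℝ × ℝ)) (m : ℝ → Measure (ℝ × ℝ)) : Prop :=
  IsProbabilityMeasure μ ∧ μ ((Set.Icc 0 T ×ˢ closure O)ᶜ) = 0 ∧ MemV T O A m ∧
  ∀ u ut ux uxx : ℝ → ℝ → ℝ, IsCb12 T O u ut ux uxx →
    ∫ p, u p.1 p.2 ∂μ
      = (∫ x, u 0 x ∂m0)
        + ∫ t in Set.Icc 0 T,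
            (∫ p, (ut t p.1 + (b t p.1 (mbar t) p.2 * ux t p.1
                + σ t p.1 (mbar t) p.2 ^ 2 / 2 * uxx t p.1)) ∂(m t))

/-- Membership in `R₀`: for every test function `u ∈ C_b^{1,2}` and every constant
`C` dominating `|L u|` uniformly over `[0,T] × closure O × M(Ō×A) × A`, the relaxed
Fokker–Planck inequality holds. -/
def MemR0 (T : ℝ) (O A : Set ℝ)
    (b σ : ℝ → ℝ → Measure (ℝ × ℝ) → ℝ → ℝ) (m0 : Measure ℝ)
    (μ : Measure (ℝ × ℝ)) (m : ℝ → Measure (ℝ × ℝ)) : Prop :=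
  IsProbabilityMeasure μ ∧ μ ((Set.Icc 0 T ×ˢ closure O)ᶜ) = 0 ∧ MemV T O A m ∧
  ∀ u ut ux uxx : ℝ → ℝ → ℝ, IsCb12 T O u ut ux uxx →
    ∀ C : ℝ,
      (∀ t ∈ Set.Icc (0:ℝ) T, ∀ x ∈ closure O, ∀ ν : Measure (ℝ × ℝ),
          ν Set.univ < ⊤ → ν ((closure O ×ˢ A)ᶜ) = 0 → ∀ a ∈ A,
          |b t x ν a * ux t x + σ t x ν a ^ 2 / 2 * uxx t x| ≤ C) →
      ∫ p, u p.1 p.2 ∂μ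
        ≤ (∫ x, u 0 x ∂m0)
          + (∫ t in Set.Icc 0 T, (∫ p, ut t p.1 ∂(m t)))
          + C * ∫ t in Set.Icc 0 T, ((m t) Set.univ).toReal

/-- The mean-field reward functional
`Γ[μ̄,m̄](μ,m) = ∫₀^T ∫ f(t,x,m̄_t,a) m_t(dx,da) dt + ∫ g(t,x,μ̄) μ(dt,dx)`. -/
def GammaMF (T : ℝ)
    (f : ℝ → ℝ → Measure (ℝ × ℝ) → ℝ → ℝ) (g : ℝ → ℝ → Measure (ℝ × ℝ) → ℝ)
    (μbar : Measure (ℝ × ℝ)) (mbar : ℝ → Measure (ℝ × ℝ))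
    (μ : Measure (ℝ × ℝ)) (m : ℝ → Measure (ℝ × ℝ)) : ℝ :=
  (∫ t in Set.Icc 0 T, ∫ p, f t p.1 (mbar t) p.2 ∂(m t)) + ∫ p, g p.1 p.2 μbar ∂μ

/-- `(μ⋆, m⋆)` is an LP MFG Nash equilibrium: `(μ⋆, m⋆) ∈ R[m⋆]` and it maximizes
`Γ[μ⋆, m⋆]` over `R[m⋆]`. -/
def IsLPNash (T : ℝ) (O A : Set ℝ)
    (b σ f : ℝ → ℝ → Measure (ℝ × ℝ) → ℝ → ℝ) (g : ℝ → ℝ → Measure (ℝ × ℝ) → ℝ)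
    (m0 : Measure ℝ)
    (μs : Measure (ℝ × ℝ)) (ms : ℝ → Measure (ℝ × ℝ)) : Prop :=
  MemRm T O A b σ m0 ms μs ms ∧
  ∀ (μ : Measure (ℝ × ℝ)) (m : ℝ → Measure (ℝ × ℝ)), MemRm T O A b σ m0 ms μ m →
    GammaMF T f g μs ms μ m ≤ GammaMF T f g μs ms μs ms

/-- The additional assumption (5)(a) or (5)(c): either `b` and `σ` do not depend on
the measure argument, or `O` is an open interval, `σ` does not depend on the control
argument and is uniformly bounded below by a positive constant. -/
def MeasIndepOrInterval (O : Set ℝ)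
    (b σ : ℝ → ℝ → Measure (ℝ × ℝ) → ℝ → ℝ) : Prop :=
  (∀ t x (ν ν' : Measure (ℝ × ℝ)) a, b t x ν a = b t x ν' a ∧ σ t x ν a = σ t x ν' a) ∨
  ((∃ c1 c2 : ℝ, c1 < c2 ∧ O = Set.Ioo c1 c2) ∧
   (∀ t x (ν : Measure (ℝ × ℝ)) a a', σ t x ν a = σ t x ν a') ∧
   (∃ cσ : ℝ, 0 < cσ ∧ ∀ t x (ν : Measure (ℝ × ℝ)) a, cσ ≤ σ t x ν a))

section
open MeasureTheory Filter Set Topology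

set_option linter.all false

/-! ### Scarf's lemma and Brouwer's theorem on the simplex -/
namespace Scarf

variable {P I : Type*} [Fintype P] [DecidableEq P] [Fintype I] [DecidableEq I]

/-- Dominant sets. -/
def Dom (v : I → P → ℕ) (ρ : Finset P) : Prop :=
  ∀ x, ∃ i, ∀ y ∈ ρ, v i x ≤ v i y

noncomputable instance (v : I → P → ℕ) (ρ : Finset P) : Decidable (Dom v ρ) := Classical.propDecidable _

lemma Dom.subset {v : I → P → ℕ} {ρ τ : Finset P} (h : Dom v ρ) (hs : τ ⊆ ρ) : Dom v τ :=
  fun x => (h x).imp fun _ hi y hy => hi y (hs hy)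

/-- Local parity: number of almost-colourful facets. -/
lemma facet_parity (c : P → I) (i0 : I) (ρ : Finset P) (hρ : ρ.card = Fintype.card I) :
    (ρ.filter fun x => (ρ.erase x).image c = Finset.univ.erase i0).card % 2
      = if ρ.image c = Finset.univ then 1 else 0 := by
  classical
  split_ifs with h
  · -- colourful
    have hinj : Set.InjOn c ρ := by
      apply Finset.injOn_of_card_image_eq
      rw [h, hρ, Finset.card_univ]
    obtain ⟨s, hs, hcs⟩ : ∃ s ∈ ρ, c s = i0 := by
      have := Finset.mem_univ i0
      rw [← h] at this
      simpa using this
    have : (ρ.filter fun x => (ρ.erase x).image c = Finset.univ.erase i0) = {s} := by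
      ext x
      simp only [Finset.mem_filter, Finset.mem_singleton]
      constructor
      · rintro ⟨hx, hxe⟩
        by_contra hne
        have : i0 ∈ (ρ.erase x).image c :=
          Finset.mem_image.2 ⟨s, Finset.mem_erase.2 ⟨fun h => hne h.symm, hs⟩, hcs⟩
        rw [hxe] at this
        simp at this
      · rintro rfl
        refine ⟨hs, ?_⟩
        ext i
        simp only [Finset.mem_image, Finset.mem_erase, Finset.mem_univ, and_true]
        constructor
        · rintro ⟨y, ⟨hy, hyρ⟩, rfl⟩ hcy
          exact hy (hinj hyρ hs (by rw [hcy, hcs]))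
        · intro hi
          have hi' := Finset.mem_univ i
          rw [← h] at hi'
          obtain ⟨y, hy, rfl⟩ := Finset.mem_image.1 hi'
          exact ⟨y, ⟨fun h => hi (by rw [h, hcs]), hy⟩, rfl⟩
    rw [this]; simp
  · rcases (ρ.filter fun x => (ρ.erase x).image c = Finset.univ.erase i0).eq_empty_or_nonempty
      with h0 | ⟨s, hs⟩
    · rw [h0]; simp
    · simp only [Finset.mem_filter] at hs
      obtain ⟨hs, hse⟩ := hs
      have hcs : c s ≠ i0 := by
        intro hcs
        apply h
        rw [← Finset.insert_erase hs, Finset.image_insert, hse, hcs]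
        simp
      have hcard : ((ρ.erase s).image c).card = (ρ.erase s).card := by
        rw [hse, Finset.card_erase_of_mem hs, Finset.card_erase_of_mem (Finset.mem_univ _), hρ,
          Finset.card_univ]
      have hinj : Set.InjOn c (ρ.erase s) := Finset.injOn_of_card_image_eq hcard
      obtain ⟨s', hs', hcs'⟩ : ∃ s' ∈ ρ.erase s, c s' = c s := by
        have : c s ∈ (ρ.erase s).image c := by rw [hse]; simp [hcs]
        simpa using this
      have hne : s' ≠ s := (Finset.mem_erase.1 hs').1
      have : (ρ.filter fun x => (ρ.erase x).image c = Finset.univ.erase i0) = {s, s'} := by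
        ext x
        simp only [Finset.mem_filter, Finset.mem_singleton, Finset.mem_insert]
        constructor
        · rintro ⟨hx, hxe⟩
          by_contra hne2
          push Not at hne2
          have hcx : c x ∈ (ρ.erase x).image c := by
            have hm : c x ∈ (ρ.erase s).image c :=
              Finset.mem_image.2 ⟨x, Finset.mem_erase.2 ⟨hne2.1, hx⟩, rfl⟩
            rw [hse] at hm; rw [hxe]; exact hm
          obtain ⟨y, hy, hyx⟩ := Finset.mem_image.1 hcx
          rw [Finset.mem_erase] at hy
          by_cases hys : y = s
          · subst hys
            have := hinj hs' (Finset.mem_coe.2 (Finset.mem_erase.2 ⟨hne2.1, hx⟩)) (hcs'.trans hyx)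
            exact hne2.2 this.symm
          · exact hy.1 (hinj (Finset.mem_coe.2 (Finset.mem_erase.2 ⟨hys, hy.2⟩))
              (Finset.mem_coe.2 (Finset.mem_erase.2 ⟨hne2.1, hx⟩)) hyx)
        · have key : (ρ.erase s').image c = (ρ.erase s).image c := by
            have hs'ρ := (Finset.mem_erase.1 hs').2
            ext i
            simp only [Finset.mem_image, Finset.mem_erase]
            constructor
            · rintro ⟨y, ⟨hy, hyρ⟩, rfl⟩
              by_cases hys : y = s
              · subst hys; exact ⟨s', ⟨hne, hs'ρ⟩, hcs'⟩
              · exact ⟨y, ⟨hys, hyρ⟩, rfl⟩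
            · rintro ⟨y, ⟨hy, hyρ⟩, rfl⟩
              by_cases hys : y = s'
              · subst hys; exact ⟨s, ⟨hne.symm, hs⟩, hcs'.symm⟩
              · exact ⟨y, ⟨hys, hyρ⟩, rfl⟩
          rintro (rfl | rfl)
          · exact ⟨hs, hse⟩
          · exact ⟨(Finset.mem_erase.1 hs').2, key.trans hse⟩
      rw [this, Finset.card_pair hne.symm]

variable (v : I → P → ℕ) (hv : ∀ i, Function.Injective (v i)) (e : I → P)
  (he : ∀ i x, v i (e i) ≤ v i x)
  (he' : ∀ i j x, j ≠ i → (∀ k, x ≠ e k) → v i x < v i (e j))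

/-- Inner doors lie in exactly two rooms. -/
lemma inner_door
    (hv : ∀ i, Function.Injective (v i))
    (he : ∀ i x, v i (e i) ≤ v i x)
    (he' : ∀ i j x, j ≠ i → (∀ k, x ≠ e k) → v i x < v i (e j))
    (τ : Finset P) (hτ : τ.card + 1 = Fintype.card I)
    (y0 : P) (hy0 : y0 ∈ τ) (hy0e : ∀ k, y0 ≠ e k) (hD : Dom v τ) :
    (Finset.univ.filter fun x => x ∉ τ ∧ Dom v (insert x τ)).card = 2 := by
  classical
  have hmin : ∀ i, ∃ y ∈ τ, ∀ z ∈ τ, v i y ≤ v i z := fun i =>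
    Finset.exists_min_image τ (v i) ⟨y0, hy0⟩
  choose mn hmnτ hmn using hmin
  -- mn is onto τ
  have hsurj : ∀ y ∈ τ, ∃ i, mn i = y := by
    intro y hy
    obtain ⟨i, hi⟩ := hD y
    exact ⟨i, hv i (le_antisymm (hmn i y hy) (hi _ (hmnτ i)))⟩
  -- the double pair
  obtain ⟨i, -, j, -, hij, hmij⟩ :=
    Finset.exists_ne_map_eq_of_card_lt_of_maps_to (s := Finset.univ) (t := τ) (f := mn)
      (by rw [Finset.card_univ]; omega) (fun a _ => hmnτ a)
  have himg : Finset.univ.image mn = τ := by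
    ext y; simp only [Finset.mem_image, Finset.mem_univ, true_and]
    exact ⟨fun ⟨a, ha⟩ => ha ▸ hmnτ a, hsurj y⟩
  -- injectivity off i and off j
  have hinj : ∀ i j : I, i ≠ j → mn i = mn j → Set.InjOn mn (Finset.univ.erase i : Finset I) := by
    intro i j hij hmij
    apply Finset.injOn_of_card_image_eq
    have : (Finset.univ.erase i).image mn = τ := by
      rw [← himg]
      ext y
      simp only [Finset.mem_image, Finset.mem_erase, Finset.mem_univ, and_true, true_and]
      constructor
      · rintro ⟨a, _, h⟩; exact ⟨a, h⟩
      · rintro ⟨a, h⟩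
        by_cases ha : a = i
        · exact ⟨j, hij.symm, by rw [← hmij, ← ha, h]⟩
        · exact ⟨a, ha, h⟩
    rw [this, Finset.card_erase_of_mem (Finset.mem_univ _), Finset.card_univ]; omega
  -- existence for one index
  have hex : ∀ i j : I, i ≠ j → mn i = mn j → ∃ x, (∀ k, k ≠ i → v k (mn k) < v k x) ∧
      v i x ≤ v i (mn i) ∧ x ∉ τ ∧ Dom v (insert x τ) ∧
      ∀ p, (∀ k, k ≠ i → v k (mn k) < v k p) → v i p ≤ v i x := by
    intro i j hij hmij
    have hne : (Finset.univ.filter fun x => ∀ k, k ≠ i → v k (mn k) < v k x).Nonempty := by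
      refine ⟨e i, ?_⟩
      simp only [Finset.mem_filter, Finset.mem_univ, true_and]
      intro k hk
      have h1 : v k y0 < v k (e i) := he' k i y0 hk.symm hy0e
      exact (hmn k y0 hy0).trans_lt h1
    obtain ⟨x, hx, hxm⟩ := Finset.exists_max_image _ (v i) hne
    simp only [Finset.mem_filter, Finset.mem_univ, true_and] at hx hxm
    have hxi : v i x ≤ v i (mn i) := by
      obtain ⟨k, hk⟩ := hD x
      by_cases hki : k = i
      · subst hki; exact hk _ (hmnτ k)
      · exact absurd (hk _ (hmnτ k)) (not_le.2 (hx k hki))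
    have hxτ : x ∉ τ := by
      intro hxτ
      have h1 := hv i (le_antisymm hxi (hmn i x hxτ))
      have h2 := hx j hij.symm
      rw [h1, ← hmij] at h2
      exact lt_irrefl _ h2
    refine ⟨x, hx, hxi, hxτ, ?_, hxm⟩
    intro p
    by_cases hp : ∀ k, k ≠ i → v k (mn k) < v k p
    · refine ⟨i, fun y hy => ?_⟩
      rcases Finset.mem_insert.1 hy with rfl | hy
      · exact hxm p hp
      · exact ((hxm p hp).trans hxi).trans (hmn i y hy)
    · push Not at hp
      obtain ⟨k, hk, hpk⟩ := hp
      refine ⟨k, fun y hy => ?_⟩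
      rcases Finset.mem_insert.1 hy with rfl | hy
      · exact hpk.trans (hx k hk).le
      · exact hpk.trans (hmn k y hy)
  obtain ⟨xi, hxi1, hxi2, hxi3, hxi4, hxi5⟩ := hex i j hij hmij
  obtain ⟨xj, hxj1, hxj2, hxj3, hxj4, hxj5⟩ := hex j i hij.symm hmij.symm
  have hne : xi ≠ xj := by
    rintro rfl
    exact absurd hxi2 (not_le.2 (hxj1 i hij))
  have : (Finset.univ.filter fun x => x ∉ τ ∧ Dom v (insert x τ)) = {xi, xj} := by
    ext x
    simp only [Finset.mem_filter, Finset.mem_univ, true_and, Finset.mem_insert,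
      Finset.mem_singleton]
    constructor
    · rintro ⟨hxτ, hxD⟩
      -- x is min for some k
      obtain ⟨k, hk⟩ := hxD x
      -- mins of insert
      have huniq : ∀ l, l ≠ k → v l (mn l) < v l x := by
        intro l hl
        by_contra hcon
        push Not at hcon
        -- l and k are both assigned to x; then τ covered by I \ {k,l}: contradiction
        have hcov : τ ⊆ ((Finset.univ.erase k).erase l).image mn := by
          intro y hy
          obtain ⟨a, ha⟩ := hxD y
          have hax : a ≠ k := by
            rintro rfl
            have h1 := ha x (Finset.mem_insert_self _ _)
            have h2 := hk y (Finset.mem_insert_of_mem hy)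
            exact hxτ (hv a (le_antisymm h2 h1) ▸ hy)
          have hal : a ≠ l := by
            rintro rfl
            have h1 := ha x (Finset.mem_insert_self _ _)
            have h2 := hcon.trans (hmn a y hy)
            exact hxτ (hv a (le_antisymm h2 h1) ▸ hy)
          refine Finset.mem_image.2 ⟨a, by simp [hax, hal], ?_⟩
          exact hv a (le_antisymm (hmn a y hy) (ha _ (Finset.mem_insert_of_mem (hmnτ a))))
        have h1 := (Finset.card_le_card hcov).trans Finset.card_image_le
        rw [Finset.card_erase_of_mem (by simp [hl]), Finset.card_erase_of_mem (Finset.mem_univ _),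
          Finset.card_univ] at h1
        have hτpos : 0 < τ.card := Finset.card_pos.2 ⟨y0, hy0⟩
        omega
      have hkij : k = i ∨ k = j := by
        by_contra hcon
        push Not at hcon
        -- mn k must be hit by another index
        obtain ⟨a, ha⟩ := hxD (mn k)
        have hak : a ≠ k := by
          rintro rfl
          have h1 := ha x (Finset.mem_insert_self _ _)
          have h2 := hk _ (Finset.mem_insert_of_mem (hmnτ a))
          exact hxτ (hv a (le_antisymm h2 h1) ▸ hmnτ a)
        have hmak : mn a = mn k :=
          hv a (le_antisymm (hmn a _ (hmnτ k)) (ha _ (Finset.mem_insert_of_mem (hmnτ a))))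
        by_cases hai : a = i
        · subst hai
          -- use j instead
          exact hcon.2 (hinj a j hij hmij (by simpa using hcon.1) (by simpa using hij.symm)
            (by rw [← hmak, hmij]))
        · exact hak (hinj i j hij hmij (by simpa using hai) (by simpa using hcon.1) hmak)
      have hfin : ∀ xk, (∀ l, l ≠ k → v l (mn l) < v l xk) →
          (∀ p, (∀ l, l ≠ k → v l (mn l) < v l p) → v k p ≤ v k xk) → x = xk := by
        intro xk h1 h2
        refine hv k (le_antisymm (h2 x huniq) ?_)
        obtain ⟨a, ha⟩ := hxD xk
        by_cases hak : a = k
        · subst hak; exact ha x (Finset.mem_insert_self _ _)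
        · exact absurd (ha _ (Finset.mem_insert_of_mem (hmnτ a))) (not_le.2 (h1 a hak))
      rcases hkij with rfl | rfl
      · exact Or.inl (hfin xi hxi1 hxi5)
      · exact Or.inr (hfin xj hxj1 hxj5)
    · rintro (rfl | rfl)
      · exact ⟨hxi3, hxi4⟩
      · exact ⟨hxj3, hxj4⟩
  rw [this, Finset.card_pair hne]

/-- The outer door lies in exactly one room. -/
lemma outer_door
    (hv : ∀ i, Function.Injective (v i))
    (he : ∀ i x, v i (e i) ≤ v i x)
    (he' : ∀ i j x, j ≠ i → (∀ k, x ≠ e k) → v i x < v i (e j))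
    (i0 : I) (y0 : P) (hy0e : ∀ k, y0 ≠ e k) :
    (Finset.univ.filter fun x => x ∉ (Finset.univ.erase i0).image e ∧
      Dom v (insert x ((Finset.univ.erase i0).image e))).card = 1 := by
  classical
  obtain ⟨x, hx, hxm⟩ := Finset.exists_max_image (Finset.univ.filter fun x => ∀ k, x ≠ e k) (v i0)
    ⟨y0, by simpa using hy0e⟩
  simp only [Finset.mem_filter, Finset.mem_univ, true_and] at hx hxm
  rw [Finset.card_eq_one]
  refine ⟨x, ?_⟩
  ext z
  simp only [Finset.mem_filter, Finset.mem_univ, true_and, Finset.mem_singleton]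
  constructor
  · rintro ⟨hz, hzD⟩
    have key : ∀ p, (∀ k, p ≠ e k) → v i0 p ≤ v i0 z := by
      intro p hp
      obtain ⟨k, hk⟩ := hzD p
      by_cases hki : k = i0
      · subst hki; exact hk z (Finset.mem_insert_self _ _)
      · have := hk (e k) (Finset.mem_insert_of_mem
          (Finset.mem_image.2 ⟨k, by simp [hki], rfl⟩))
        exact absurd (hv k (le_antisymm this (he k p))) (hp k)
    have hze : ∀ k, z ≠ e k := by
      intro k hzk
      by_cases hki : k = i0
      · subst hki; subst hzk
        have := key y0 hy0e
        exact hy0e k (hv k (le_antisymm this (he k y0)))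
      · exact hz (Finset.mem_image.2 ⟨k, by simp [hki], hzk.symm⟩)
    exact hv i0 (le_antisymm (hxm z hze) (key x hx))
  · rintro rfl
    refine ⟨?_, ?_⟩
    · intro hmem
      obtain ⟨k, _, hk⟩ := Finset.mem_image.1 hmem
      exact hx k hk.symm
    · intro p
      by_cases hp : ∃ k, p = e k
      · obtain ⟨k, rfl⟩ := hp
        exact ⟨k, fun y _ => he k y⟩
      · push Not at hp
        refine ⟨i0, fun y hy => ?_⟩
        rcases Finset.mem_insert.1 hy with rfl | hy
        · exact hxm p hp
        · obtain ⟨k, hk, rfl⟩ := Finset.mem_image.1 hy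
          exact (he' i0 k p (by simpa using hk) hp).le

/-- Scarf's lemma. -/
theorem scarf
    (hv : ∀ i, Function.Injective (v i))
    (he : ∀ i x, v i (e i) ≤ v i x)
    (he' : ∀ i j x, j ≠ i → (∀ k, x ≠ e k) → v i x < v i (e j))
    (i0 : I) (y0 : P) (hy0e : ∀ k, y0 ≠ e k) (c : P → I) (hc : ∀ i, c (e i) = i) :
    ∃ ρ : Finset P, Dom v ρ ∧ ρ.card = Fintype.card I ∧ ρ.image c = Finset.univ := by
  classical
  have hn : 0 < Fintype.card I := Fintype.card_pos_iff.2 ⟨i0⟩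
  by_contra hcon
  push Not at hcon
  let Ro : Finset (Finset P) := Finset.univ.filter fun ρ => Dom v ρ ∧ ρ.card = Fintype.card I
  let Do : Finset (Finset P) := Finset.univ.filter fun τ =>
    τ.card + 1 = Fintype.card I ∧ τ.image c = Finset.univ.erase i0
  have h1 : (∑ ρ ∈ Ro, (ρ.filter fun x => (ρ.erase x).image c = Finset.univ.erase i0).card)
      = ∑ τ ∈ Do, (Finset.univ.filter fun x => x ∉ τ ∧ Dom v (insert x τ)).card := by
    rw [← Finset.card_sigma, ← Finset.card_sigma]
    refine Finset.card_bij' (fun a _ => ⟨a.1.erase a.2, a.2⟩) (fun a _ => ⟨insert a.2 a.1, a.2⟩)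
      ?_ ?_ ?_ ?_
    · rintro ⟨ρ, x⟩ h
      simp only [Finset.mem_sigma, Finset.mem_filter, Finset.mem_univ, true_and, Ro, Do] at h ⊢
      obtain ⟨⟨hd, hcard⟩, hx, himg⟩ := h
      refine ⟨⟨?_, himg⟩, by simp, by rwa [Finset.insert_erase hx]⟩
      rw [Finset.card_erase_add_one hx, hcard]
    · rintro ⟨τ, x⟩ h
      simp only [Finset.mem_sigma, Finset.mem_filter, Finset.mem_univ, true_and, Ro, Do] at h ⊢
      obtain ⟨⟨hcard, himg⟩, hx, hd⟩ := h
      refine ⟨⟨hd, ?_⟩, by simp, by rwa [Finset.erase_insert hx]⟩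
      rw [Finset.card_insert_of_notMem hx, hcard]
    · rintro ⟨ρ, x⟩ h
      simp only [Finset.mem_sigma, Finset.mem_filter] at h
      simp [Finset.insert_erase h.2.1]
    · rintro ⟨τ, x⟩ h
      simp only [Finset.mem_sigma, Finset.mem_filter, Finset.mem_univ, true_and] at h
      simp [Finset.erase_insert h.2.1]
  have h2 : (∑ ρ ∈ Ro, (ρ.filter fun x => (ρ.erase x).image c = Finset.univ.erase i0).card) % 2
      = 0 := by
    rw [Finset.sum_nat_mod]
    rw [Finset.sum_eq_zero]
    · rfl
    intro ρ hρ
    simp only [Finset.mem_filter, Finset.mem_univ, true_and, Ro] at hρ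
    rw [facet_parity c i0 ρ hρ.2, if_neg (hcon ρ hρ.1 hρ.2)]
  have heinj : Function.Injective e := fun a b h => by
    rw [← hc a, ← hc b, h]
  let τ0 : Finset P := (Finset.univ.erase i0).image e
  have hτ0 : τ0 ∈ Do := by
    simp only [Finset.mem_filter, Finset.mem_univ, true_and, Do, τ0]
    rw [Finset.card_image_of_injective _ heinj, Finset.card_erase_add_one (Finset.mem_univ _),
      Finset.card_univ]
    refine ⟨rfl, ?_⟩
    rw [Finset.image_image]
    have : c ∘ e = id := funext hc
    rw [this, Finset.image_id]
  have h3 : (∑ τ ∈ Do, (Finset.univ.filter fun x => x ∉ τ ∧ Dom v (insert x τ)).card) % 2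
      = 1 := by
    rw [← Finset.add_sum_erase _ _ hτ0, outer_door v e hv he he' i0 y0 hy0e]
    have : (∑ τ ∈ Do.erase τ0, (Finset.univ.filter fun x => x ∉ τ ∧ Dom v (insert x τ)).card) % 2
        = 0 := by
      rw [Finset.sum_nat_mod, Finset.sum_eq_zero]
      · rfl
      intro τ hτ
      simp only [Finset.mem_erase, Finset.mem_filter, Finset.mem_univ, true_and, Do] at hτ
      obtain ⟨hne, hcard, himg⟩ := hτ
      by_cases hD : Dom v τ
      · have : ∃ y ∈ τ, ∀ k, y ≠ e k := by
          by_contra hall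
          push Not at hall
          apply hne
          apply Finset.eq_of_subset_of_card_le
          · intro y hy
            obtain ⟨k, rfl⟩ := hall y hy
            refine Finset.mem_image.2 ⟨k, ?_, rfl⟩
            rw [← himg]
            exact Finset.mem_image.2 ⟨_, hy, hc k⟩
          · simp only [τ0]
            rw [Finset.card_image_of_injective _ heinj, Finset.card_erase_of_mem (Finset.mem_univ _),
              Finset.card_univ]
            omega
        obtain ⟨y, hy, hye⟩ := this
        rw [inner_door v e hv he he' τ hcard y hy hye hD]
        rfl
      · have : (Finset.univ.filter fun x => x ∉ τ ∧ Dom v (insert x τ)) = ∅ := by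
          ext x
          simp only [Finset.mem_filter, Finset.mem_univ, true_and, Finset.notMem_empty, iff_false]
          rintro ⟨_, h⟩
          exact hD (h.subset (Finset.subset_insert _ _))
        rw [this]; simp
    omega
  rw [h1] at h2
  omega



end Scarf

lemma Scarf.grid {I : Type*} [Fintype I] (N : ℕ) [Nonempty I] (c : {x : I → Fin (N+1) // ∑ i, (x i : ℕ) = N} → I) :
    ∃ (C : Set I) (s : I → {x : I → Fin (N+1) // ∑ i, (x i : ℕ) = N}), C.Nonempty ∧
      (∀ i ∈ C, c (s i) = i) ∧
      (∀ i ∈ C, ∀ k ∈ C, ∀ j, ((s i).1 j : ℕ) ≤ (s k).1 j + Fintype.card I) ∧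
      (∀ i ∈ C, ∀ j, j ∉ C → ((s i).1 j : ℕ) ≤ Fintype.card I) := by
  classical
  let G := {x : I → Fin (N+1) // ∑ i, (x i : ℕ) = N}
  let M := Fintype.card G
  let ix : G ≃ Fin M := Fintype.equivFin G
  let iI : I ≃ Fin (Fintype.card I) := Fintype.equivFin I
  let v : I → G ⊕ I → ℕ := fun i p => Sum.elim (fun x : G => 1 + ((x.1 i : ℕ) * M + ix x))
    (fun j => if j = i then 0 else 1 + ((N+1) * M + iI j)) p
  have hvl : ∀ i x, v i (Sum.inl x) = 1 + ((x.1 i : ℕ) * M + ix x) := fun _ _ => rfl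
  have hvr : ∀ i j, v i (Sum.inr j) = if j = i then 0 else 1 + ((N+1) * M + iI j) := fun _ _ => rfl
  have hmul : ∀ (x y : G) i, (x.1 i : ℕ) * M + ix x ≤ (y.1 i : ℕ) * M + ix y →
      (x.1 i : ℕ) ≤ y.1 i := by
    intro x y i h
    have h1 := (ix y).2
    by_contra hc
    push Not at hc
    have : ((y.1 i : ℕ) + 1) * M ≤ (x.1 i : ℕ) * M := Nat.mul_le_mul_right _ hc
    rw [add_mul] at this
    omega
  have hlt : ∀ i j (x : G), j ≠ i → v i (Sum.inl x) < v i (Sum.inr j) := by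
    intro i j x hji
    rw [hvl, hvr, if_neg hji]
    have h1 := (ix x).2
    have h2 : (x.1 i : ℕ) * M ≤ N * M := Nat.mul_le_mul_right _ (Nat.lt_succ_iff.1 (x.1 i).2)
    rw [add_mul]
    omega
  have hv : ∀ i, Function.Injective (v i) := by
    intro i
    rintro (x | j) (y | k) h
    · rw [hvl, hvl] at h
      have h1 := hmul x y i (by omega)
      have h2 := hmul y x i (by omega)
      have h3 := le_antisymm h1 h2
      rw [h3] at h
      have : ix x = ix y := by apply Fin.ext; omega
      rw [ix.injective this]
    · by_cases hk : k = i
      · rw [hvl, hvr, if_pos hk] at h; omega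
      · exact absurd h (hlt i k x hk).ne
    · by_cases hk : j = i
      · rw [hvl, hvr, if_pos hk] at h; omega
      · exact absurd h (hlt i j y hk).ne'
    · rw [hvr, hvr] at h
      split_ifs at h with h1 h2 h2
      · rw [h1, h2]
      · omega
      · omega
      · have : iI j = iI k := by apply Fin.ext; omega
        rw [iI.injective this]
  have hG0 : Nonempty G := by
    obtain ⟨i0⟩ := ‹Nonempty I›
    refine ⟨⟨fun i => if i = i0 then Fin.last N else 0, ?_⟩⟩
    rw [Finset.sum_eq_single i0] <;> simp +contextual
  obtain ⟨y0⟩ := hG0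
  obtain ⟨i0⟩ := ‹Nonempty I›
  have he' : ∀ i j (x : G ⊕ I), j ≠ i → (∀ k, x ≠ Sum.inr k) → v i x < v i (Sum.inr j) := by
    rintro i j (x | k) hji hx
    · exact hlt i j x hji
    · exact absurd rfl (hx k)
  obtain ⟨ρ, hD, hcard, himg⟩ := Scarf.scarf v Sum.inr hv (fun i x => by rw [hvr, if_pos rfl]; exact Nat.zero_le _)
    he' i0 (Sum.inl y0) (by simp) (Sum.elim c id) (by simp)
  have hinj : Set.InjOn (Sum.elim c id) ρ := by
    apply Finset.injOn_of_card_image_eq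
    rw [himg, hcard, Finset.card_univ]
  let C : Set I := {i | Sum.inr i ∉ ρ}
  have hex : ∀ i, ∃ x : G, i ∈ C → (Sum.inl x ∈ ρ ∧ c x = i) := by
    intro i
    by_cases hi : i ∈ C
    · have := Finset.mem_univ i
      rw [← himg] at this
      obtain ⟨p, hp, hpc⟩ := Finset.mem_image.1 this
      rcases p with x | j
      · exact ⟨x, fun _ => ⟨hp, hpc⟩⟩
      · simp at hpc; subst hpc; exact absurd hp hi
    · exact ⟨y0, fun h => absurd h hi⟩
  choose s hs using hex
  have hdom : ∀ x : G, ∃ i ∈ C, ∀ k ∈ C, (x.1 i : ℕ) ≤ (s k).1 i := by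
    intro x
    obtain ⟨i, hi⟩ := hD (Sum.inl x)
    refine ⟨i, ?_, ?_⟩
    · intro hmem
      have := hi _ hmem
      rw [hvl, hvr, if_pos rfl] at this
      omega
    · intro k hk
      have := hi _ (hs k hk).1
      rw [hvl, hvl] at this
      exact hmul _ _ _ (by omega)
  have hCne : C.Nonempty := by
    obtain ⟨i, hi, _⟩ := hdom y0
    exact ⟨i, hi⟩
  -- minima
  have hmin : ∀ i, ∃ k ∈ C, ∀ k' ∈ C, ((s k).1 i : ℕ) ≤ (s k').1 i := by
    intro i
    obtain ⟨k, hk, hk'⟩ := Finset.exists_min_image (Finset.univ.filter (· ∈ C)) (fun k => ((s k).1 i : ℕ))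
      (by obtain ⟨i, hi⟩ := hCne; exact ⟨i, by simpa using hi⟩)
    exact ⟨k, by simpa using hk, fun k' h' => hk' k' (by simpa using h')⟩
  choose mk hmk hmk' using hmin
  let m : I → ℕ := fun i => (s (mk i)).1 i
  let CF : Finset I := Finset.univ.filter (· ∈ C)
  have hbig : N < ∑ i ∈ CF, (m i + 1) := by
    by_contra hc
    push Not at hc
    obtain ⟨i1, hi1⟩ := hCne
    have hi1F : i1 ∈ CF := by simpa [CF] using hi1
    let r := N - ∑ i ∈ CF, (m i + 1)
    let z : I → ℕ := fun i => if i ∈ CF then (m i + 1) + (if i = i1 then r else 0) else 0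
    have hz : ∑ i, z i = N := by
      simp only [z]
      rw [← Finset.sum_filter, Finset.filter_mem_eq_inter, Finset.univ_inter, Finset.sum_add_distrib,
        Finset.sum_ite_eq' CF i1 (fun _ => r), if_pos hi1F]
      omega
    have hzN : ∀ i, z i < N + 1 := fun i => by
      have := Finset.single_le_sum (f := z) (fun _ _ => Nat.zero_le _) (Finset.mem_univ i)
      omega
    obtain ⟨i, hi, hik⟩ := hdom ⟨fun i => ⟨z i, hzN i⟩, hz⟩
    have h1 := hik (mk i) (hmk i)
    have hiF : i ∈ CF := by simpa [CF] using hi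
    simp only [z, if_pos hiF] at h1
    have : m i + 1 ≤ m i := le_trans (by omega) h1
    omega
  have hbig' : N < ∑ i ∈ CF, m i + Fintype.card I := by
    rw [Finset.sum_add_distrib] at hbig
    have : ∑ i ∈ CF, 1 ≤ Fintype.card I := by
      simpa using Finset.card_le_univ CF
    omega
  have hsum : ∀ k ∈ C, ∀ j, ((s k).1 j : ℕ) ≤ (if j ∈ CF then m j else 0) + Fintype.card I := by
    intro k hk j
    have h1 : ∑ i, ((s k).1 i : ℕ) = N := (s k).2
    have h2 : ∑ i ∈ CF, m i = ∑ i, if i ∈ CF then m i else 0 := by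
      rw [← Finset.sum_filter, Finset.filter_mem_eq_inter, Finset.univ_inter]
    rw [← Finset.add_sum_erase _ _ (Finset.mem_univ j)] at h1 h2
    have h3 : ∑ i ∈ Finset.univ.erase j, (if i ∈ CF then m i else 0) ≤
        ∑ i ∈ Finset.univ.erase j, ((s k).1 i : ℕ) := by
      apply Finset.sum_le_sum
      intro i _
      split_ifs
      · exact hmk' i k hk
      · exact Nat.zero_le _
    omega
  refine ⟨C, s, hCne, fun i hi => (hs i hi).2, ?_, ?_⟩
  · intro i hi k hk j
    have h1 := hsum i hi j
    split_ifs at h1 with hj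
    · have := hmk' j k hk
      simp only [m] at h1
      omega
    · omega
  · intro i hi j hj
    have h1 := hsum i hi j
    rw [if_neg (by simpa [CF] using hj)] at h1
    omega

/-- Brouwer's fixed point theorem on the standard simplex. -/
theorem brouwer_simplex {I : Type*} [Fintype I] [Nonempty I] (f : (I → ℝ) → (I → ℝ))
    (hf : ContinuousOn f (stdSimplex ℝ I)) (hm : MapsTo f (stdSimplex ℝ I) (stdSimplex ℝ I)) :
    ∃ x ∈ stdSimplex ℝ I, f x = x := by
  classical
  have hcpt : IsCompact (stdSimplex ℝ I) := isCompact_stdSimplex ℝ I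
  have hne : (stdSimplex ℝ I).Nonempty := by
    obtain ⟨i⟩ := ‹Nonempty I›
    exact ⟨_, single_mem_stdSimplex ℝ i⟩
  let φ : (I → ℝ) → ℝ := fun x => ∑ i, max (x i - f x i) 0
  have hφ : ContinuousOn φ (stdSimplex ℝ I) := by
    refine continuousOn_finsetSum _ fun i _ => ?_
    have h1 : ContinuousOn (fun x => f x i) (stdSimplex ℝ I) :=
      (continuous_apply i).comp_continuousOn hf
    exact ((continuous_apply i).continuousOn.sub h1).sup continuousOn_const
  obtain ⟨x, hx, hmin⟩ := hcpt.exists_isMinOn hne hφ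
  have hsmall : ∀ ε > 0, φ x ≤ ε := by
    intro ε0 hε0
    set n := Fintype.card I with hn
    have hn0 : 0 < n := Fintype.card_pos
    set ε := ε0 / (2 * n) with hε
    have hεpos : 0 < ε := by positivity
    have huc := hcpt.uniformContinuousOn_of_continuous hf
    rw [Metric.uniformContinuousOn_iff] at huc
    obtain ⟨δ, hδ, hδ'⟩ := huc ε hεpos
    obtain ⟨N, hN⟩ := exists_nat_gt (n / min ε δ)
    have hmpos : 0 < min ε δ := lt_min hεpos hδ
    have hNpos : (0:ℝ) < N := lt_of_le_of_lt (by positivity) hN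
    have hnN : (n:ℝ) / N < min ε δ := by
      rw [div_lt_iff₀ hmpos] at hN
      rw [div_lt_iff₀ hNpos]; linarith
    let sc : {x : I → Fin (N+1) // ∑ i, (x i : ℕ) = N} → (I → ℝ) := fun x i => (x.1 i : ℕ) / (N:ℝ)
    have hsc : ∀ x, sc x ∈ stdSimplex ℝ I := by
      intro x
      refine ⟨fun i => by simp only [sc]; positivity, ?_⟩
      simp only [sc]
      rw [← Finset.sum_div, ← Nat.cast_sum, x.2, div_self hNpos.ne']
    have hcol : ∀ x, ∃ i, sc x i ≤ f (sc x) i := by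
      intro x
      by_contra hc
      push Not at hc
      have h1 := (hsc x).2
      have h2 := (hm (hsc x)).2
      have h3 : ∑ i, f (sc x) i < ∑ i, sc x i :=
        Finset.sum_lt_sum_of_nonempty Finset.univ_nonempty fun i _ => hc i
      linarith
    choose c hc using hcol
    obtain ⟨C, s, ⟨i0, hi0⟩, hs1, hs2, hs3⟩ := Scarf.grid N c
    have hle : φ x ≤ φ (sc (s i0)) := hmin (hsc _)
    refine hle.trans ?_
    have hterm : ∀ j, max (sc (s i0) j - f (sc (s i0)) j) 0 ≤ 2 * ε := by
      intro j
      apply max_le _ (by positivity)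
      by_cases hj : j ∈ C
      · have hclose : ∀ k, |sc (s i0) k - sc (s j) k| < min ε δ := by
          intro k
          refine lt_of_le_of_lt ?_ hnN
          have h1 : ((s i0).1 k : ℝ) ≤ ((s j).1 k : ℕ) + n := by
            exact_mod_cast hs2 i0 hi0 j hj k
          have h2 : ((s j).1 k : ℝ) ≤ ((s i0).1 k : ℕ) + n := by
            exact_mod_cast hs2 j hj i0 hi0 k
          simp only [sc]
          rw [← sub_div, abs_div, abs_of_pos hNpos]
          gcongr
          rw [abs_le]; constructor <;> linarith
        have hd : dist (sc (s i0)) (sc (s j)) < δ := by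
          rw [dist_pi_lt_iff hδ]
          intro k
          rw [Real.dist_eq]
          exact (hclose k).trans_le (min_le_right _ _)
        have h1 := hδ' _ (hsc _) _ (hsc _) hd
        have h2 := (dist_pi_lt_iff hεpos).1 h1 j
        rw [Real.dist_eq, abs_lt] at h2
        have h3 := hc (s j)
        rw [hs1 j hj] at h3
        have h4 := (abs_lt.1 ((hclose j).trans_le (min_le_left _ _)))
        linarith [h2.1, h4.2]
      · have h0 := (hm (hsc (s i0))).1 j
        have h1 : ((s i0).1 j : ℝ) ≤ n := by exact_mod_cast hs3 i0 hi0 j hj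
        have h2 : sc (s i0) j ≤ n / N := by
          simp only [sc]; gcongr
        have := hnN.trans_le (min_le_left _ _)
        linarith
    calc φ (sc (s i0)) ≤ ∑ i : I, 2 * ε := Finset.sum_le_sum fun i _ => hterm i
      _ = ε0 := by
        rw [Finset.sum_const, Finset.card_univ, nsmul_eq_mul, hε]
        have : (n:ℝ) ≠ 0 := by positivity
        rw [← hn]
        field_simp
  have hφ0 : φ x ≤ 0 := le_of_forall_pos_le_add (by simpa using hsmall)
  have hle : ∀ i, x i ≤ f x i := by
    intro i
    have h1 : max (x i - f x i) 0 ≤ φ x :=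
      Finset.single_le_sum (f := fun i => max (x i - f x i) 0) (fun _ _ => le_max_right _ _) (Finset.mem_univ i)
    have := le_max_left (x i - f x i) 0
    linarith
  refine ⟨x, hx, ?_⟩
  have hsum : ∑ i, x i = ∑ i, f x i := by rw [hx.2, (hm hx).2]
  funext i
  exact ((Finset.sum_eq_sum_iff_of_le fun i _ => hle i).1 hsum i (Finset.mem_univ i)).symm
end

section
open MeasureTheory Filter Set Topology

set_option linter.all false

/-! ### Carathéodory functions -/

lemma stronglyMeasurable_toC {E : Type*} [TopologicalSpace E] [SecondCountableTopology E]
    [CompactSpace E] [T2Space E] (X : ℝ → C(E, ℝ)) (h : ∀ p, Measurable fun t => X t p) :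
    StronglyMeasurable X := by
  letI : MeasurableSpace C(E, ℝ) := borel _
  haveI : BorelSpace C(E, ℝ) := ⟨rfl⟩
  have hball : ∀ (f : C(E, ℝ)) (r : ℝ), 0 ≤ r → MeasurableSet (X ⁻¹' (Metric.closedBall f r)) := by
    intro f r hr
    obtain ⟨D, hDc, hDd⟩ := TopologicalSpace.exists_countable_dense E
    have : X ⁻¹' (Metric.closedBall f r) = ⋂ p ∈ D, {t | |X t p - f p| ≤ r} := by
      ext t
      simp only [mem_preimage, Metric.mem_closedBall, mem_iInter, mem_setOf_eq]
      rw [ContinuousMap.dist_le hr]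
      constructor
      · intro h p _; exact h p
      · intro h p
        have hcl : IsClosed {p | dist (X t p) (f p) ≤ r} :=
          isClosed_le ((X t).continuous.dist f.continuous) continuous_const
        have : closure D ⊆ {p | dist (X t p) (f p) ≤ r} := hcl.closure_subset_iff.2 fun p hp => h p hp
        exact this (hDd p)
    rw [this]
    exact MeasurableSet.biInter hDc fun p _ =>
      measurableSet_le ((h p).sub_const _).abs measurable_const
  have : Measurable X := by
    refine measurable_of_isOpen fun U hU => ?_
    obtain ⟨D, hDc, hDd⟩ := TopologicalSpace.exists_countable_dense C(E, ℝ)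
    have : U = ⋃ q ∈ D, ⋃ m ∈ {m : ℕ | Metric.closedBall q (1 / ((m:ℝ) + 1)) ⊆ U},
        Metric.closedBall q (1 / ((m:ℝ) + 1)) := by
      apply Subset.antisymm
      · intro f hf
        obtain ⟨ε, hε, hεU⟩ := Metric.isOpen_iff.1 hU f hf
        obtain ⟨m, hm⟩ := exists_nat_one_div_lt (half_pos hε)
        obtain ⟨q, hqD, hq⟩ := hDd.exists_dist_lt f (ε := 1 / ((m:ℝ)+1)) (by positivity)
        simp only [mem_iUnion]
        refine ⟨q, hqD, m, fun g hg => hεU ?_, ?_⟩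
        · rw [Metric.mem_closedBall] at hg
          rw [Metric.mem_ball]
          calc dist g f ≤ dist g q + dist q f := dist_triangle _ _ _
            _ < ε := by rw [dist_comm q f]; linarith
        · rw [Metric.mem_closedBall]; exact hq.le
      · simp only [iUnion_subset_iff]
        intro q _ m hm
        exact hm
    rw [this]
    simp only [preimage_iUnion]
    refine MeasurableSet.biUnion hDc fun q _ => MeasurableSet.biUnion (Set.to_countable _) fun m _ => ?_
    exact hball _ _ (by positivity)
  exact this.stronglyMeasurable

/-- Slices of a Carathéodory function as continuous maps on a compact set. -/
noncomputable def toC (K : Set (ℝ × ℝ)) (G : ℝ → ℝ × ℝ → ℝ) (h : ∀ t, ContinuousOn (G t) K) (t : ℝ) :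
    C(K, ℝ) := ⟨K.restrict (G t), continuousOn_iff_continuous_restrict.1 (h t)⟩

lemma stronglyMeasurable_toC' {K : Set (ℝ × ℝ)} (hK : IsCompact K) (G : ℝ → ℝ × ℝ → ℝ)
    (h : ∀ t, ContinuousOn (G t) K) (hm : ∀ p, Measurable fun t => G t p) :
    StronglyMeasurable (toC K G h) := by
  haveI : CompactSpace K := isCompact_iff_compactSpace.1 hK
  exact stronglyMeasurable_toC _ fun p => hm p

/-- Uniform convergence of Carathéodory functions composed with converging parameters. -/
lemma sup_conv {K : Set (ℝ × ℝ)} (hK : IsCompact K) (T : ℝ) (C : ℝ)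
    (G : ℕ → ℝ → ℝ × ℝ → ℝ) (h : ∀ n t, ContinuousOn (G n t) K) (hm : ∀ n p, Measurable fun t => G n t p)
    (hC : ∀ n t p, |G n t p| ≤ C)
    (hlim : ∀ᵐ t ∂(volume.restrict (Icc 0 T)), ∀ ε > 0, ∀ᶠ n in atTop, ∀ p ∈ K, |G n t p| ≤ ε) :
    ∃ hh : ℕ → ℝ → ℝ, (∀ n, Measurable (hh n)) ∧ (∀ n t, 0 ≤ hh n t) ∧ (∀ n t, hh n t ≤ C) ∧
      (∀ n t, ∀ p ∈ K, |G n t p| ≤ hh n t) ∧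
      Tendsto (fun n => ∫ t in Icc 0 T, hh n t) atTop (𝓝 0) := by
  haveI : CompactSpace K := isCompact_iff_compactSpace.1 hK
  have hC0 : 0 ≤ C := (abs_nonneg _).trans (hC 0 0 0)
  refine ⟨fun n t => ‖toC K (G n) (h n) t‖, fun n => ?_, fun n t => norm_nonneg _, ?_, ?_, ?_⟩
  · exact (stronglyMeasurable_toC' hK _ (h n) (hm n)).norm.measurable
  · intro n t
    exact (ContinuousMap.norm_le _ hC0).2 fun p => hC n t p
  · intro n t p hp
    exact (toC K (G n) (h n) t).norm_coe_le_norm ⟨p, hp⟩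
  · have : (∫ t in Icc 0 T, (0:ℝ)) = 0 := by simp
    conv => enter [3, 1]; rw [← this]
    apply tendsto_integral_of_dominated_convergence (fun _ => C)
    · intro n
      exact (stronglyMeasurable_toC' hK _ (h n) (hm n)).norm.aestronglyMeasurable
    · exact integrable_const _
    · intro n
      refine Eventually.of_forall fun t => ?_
      rw [norm_norm]
      exact (ContinuousMap.norm_le _ hC0).2 fun p => hC n t p
    · filter_upwards [hlim] with t ht
      rw [Metric.tendsto_atTop]
      intro ε hε
      obtain ⟨N, hN⟩ := eventually_atTop.1 (ht (ε/2) (half_pos hε))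
      refine ⟨N, fun n hn => ?_⟩
      rw [Real.dist_eq, sub_zero, abs_of_nonneg (norm_nonneg _)]
      refine lt_of_le_of_lt ((ContinuousMap.norm_le _ (half_pos hε).le).2 fun p => hN n hn p p.2) (by linarith)

/-- Approximation of a bounded Carathéodory function by smooth functions. -/
lemma carath_approx {K : Set (ℝ × ℝ)} (hK : IsCompact K) (T : ℝ) (C : ℝ) (G : ℝ → ℝ × ℝ → ℝ)
    (h : ∀ t, ContinuousOn (G t) K) (hm : ∀ p, Measurable fun t => G t p)
    (hC : ∀ t p, |G t p| ≤ C) (ε : ℝ) (hε : 0 < ε) :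
    ∃ (F : ℝ × ℝ × ℝ → ℝ) (hh : ℝ → ℝ), ContDiff ℝ 2 F ∧ (∀ q, |F q| ≤ C + 1) ∧ Measurable hh ∧
      (∀ t, 0 ≤ hh t ∧ hh t ≤ 2 * C + 1) ∧ (∀ t, ∀ p ∈ K, |F (t, p) - G t p| ≤ hh t) ∧
      ∫ t in Icc 0 T, hh t ≤ ε := by
  haveI : CompactSpace K := isCompact_iff_compactSpace.1 hK
  have hC0 : 0 ≤ C := (abs_nonneg _).trans (hC 0 0)
  set X := toC K G h with hX
  have hXm := stronglyMeasurable_toC' hK G h hm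
  have hXn : ∀ t, ‖X t‖ ≤ C := fun t => (ContinuousMap.norm_le _ hC0).2 fun p => hC t p
  have hXi : Integrable X (volume.restrict (Icc 0 T)) :=
    Integrable.of_bound hXm.aestronglyMeasurable C (Eventually.of_forall hXn)
  obtain ⟨Y, hY, hYi⟩ := hXi.exists_boundedContinuous_integral_sub_le (half_pos hε)
  -- extend Y by Tietze
  let Y0 : C((univ ×ˢ K : Set (ℝ × ℝ × ℝ)), ℝ) :=
    ⟨fun q => max (-C) (min C (Y q.1.1 ⟨q.1.2, q.2.2⟩)), by
      have : Continuous fun q : (univ ×ˢ K : Set (ℝ × ℝ × ℝ)) => Y q.1.1 ⟨q.1.2, q.2.2⟩ := by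
        have h1 : Continuous fun q : ℝ × K => Y q.1 q.2 :=
          ContinuousEval.continuous_eval.comp ((Y.continuous.comp continuous_fst).prodMk continuous_snd)
        exact h1.comp ((continuous_fst.comp continuous_subtype_val).prodMk
          (Continuous.subtype_mk (continuous_snd.comp continuous_subtype_val) _))
      exact continuous_const.max (continuous_const.min this)⟩
  have hcl : IsClosed (univ ×ˢ K : Set (ℝ × ℝ × ℝ)) := isClosed_univ.prod hK.isClosed
  obtain ⟨Z, hZ1, hZ2⟩ := Y0.exists_restrict_eq_forall_mem_of_closed (t := Icc (-C) C) 
    (fun q => ⟨le_max_left _ _, max_le (by linarith) (min_le_left _ _)⟩) ⟨0, by constructor <;> linarith⟩ hcl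
  set η := min 1 (ε / (2 * (T.toNNReal + 1))) with hη
  have hηpos : 0 < η := lt_min one_pos (by positivity)
  obtain ⟨F, hF, hFd, -⟩ := Z.continuous.exists_contDiff_approx 2 (continuous_const (y := η))
    (fun _ => hηpos)
  have hFd' : ∀ q, |F q - Z q| < η := fun q => by rw [← Real.dist_eq]; exact hFd q
  have hη1 : η ≤ 1 := min_le_left _ _
  refine ⟨F, fun t => min (2 * C + 1) (‖X t - Y t‖ + η), hF, ?_, ?_, ?_, ?_, ?_⟩
  · intro q
    have h1 := abs_lt.1 (hFd' q)
    have h2 := hZ1 q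
    rw [abs_le]; constructor <;> linarith [h1.1, h1.2, h2.1, h2.2]
  · refine measurable_const.min (Measurable.add_const ?_ _)
    exact (hXm.sub Y.continuous.stronglyMeasurable).norm.measurable
  · intro t
    exact ⟨le_min (by linarith) (by positivity), min_le_left _ _⟩
  · intro t p hp
    have hGp := abs_le.1 (hC t p)
    have h1 := abs_lt.1 (hFd' (t, p))
    have h2 := hZ1 (t, p)
    refine le_min ?_ ?_
    · rw [abs_le]; constructor <;> linarith [h1.1, h1.2, h2.1, h2.2]
    · have h3 : Z (t, p) = max (-C) (min C (Y t ⟨p, hp⟩)) := by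
        have := congrArg (fun f => f ⟨(t, p), ⟨mem_univ _, hp⟩⟩) hZ2
        exact this
      have h4 : |G t p - Y t ⟨p, hp⟩| ≤ ‖X t - Y t‖ := (X t - Y t).norm_coe_le_norm ⟨p, hp⟩
      have h5 : |Z (t, p) - G t p| ≤ |G t p - Y t ⟨p, hp⟩| := by
        rw [h3]
        generalize Y t ⟨p, hp⟩ = y
        rw [abs_sub_comm (G t p)]
        have e1 : G t p = max (-C) (min C (G t p)) := by
          rw [min_eq_right hGp.2, max_eq_right hGp.1]
        conv_lhs => rw [e1]
        exact (abs_max_sub_max_le_max _ _ _ _).trans (max_le (by simp)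
          ((abs_min_sub_min_le_max _ _ _ _).trans (max_le (by simp) le_rfl)))
      calc |F (t, p) - G t p| ≤ |F (t, p) - Z (t, p)| + |Z (t, p) - G t p| := abs_sub_le _ _ _
        _ ≤ ‖X t - Y t‖ + η := by have := hFd' (t, p); linarith
  · have hi : Integrable (fun t => ‖X t - Y t‖ + η) (volume.restrict (Icc 0 T)) :=
      (hXi.sub hYi).norm.add (integrable_const _)
    calc ∫ t in Icc 0 T, min (2 * C + 1) (‖X t - Y t‖ + η) ≤ ∫ t in Icc 0 T, (‖X t - Y t‖ + η) := by
          apply integral_mono_of_nonneg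
          · exact Eventually.of_forall fun t => le_min (by simp; linarith) (by simp; positivity)
          · exact hi
          · exact Eventually.of_forall fun t => min_le_right _ _
      _ = (∫ t in Icc 0 T, ‖X t - Y t‖) + T.toNNReal * η := by
          have := integral_add (hXi.sub hYi).norm (integrable_const η)
          simp only [Pi.sub_apply] at this
          rw [this]
          simp [Measure.real, Real.volume_Icc, ENNReal.ofReal]
      _ ≤ ε / 2 + ε / 2 := by
          gcongr
          have : η ≤ ε / (2 * (T.toNNReal + 1)) := min_le_right _ _
          rw [le_div_iff₀ (by positivity)] at this
          nlinarith [hηpos, T.toNNReal.2]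
      _ = ε := by ring
end

section
open MeasureTheory Filter Set Topology

set_option linter.all false

open ProbabilityTheory

/-! ### States -/

/-- A (normalised) pair `(μ, m)`. -/
structure St (T : ℝ) (O A : Set ℝ) where
  μ : Measure (ℝ × ℝ)
  κ : Kernel ℝ (ℝ × ℝ)
  hμ : IsProbabilityMeasure μ
  hμs : μ ((Icc 0 T ×ˢ closure O)ᶜ) = 0
  hκ : ∀ t, κ t univ ≤ 1
  hκs : ∀ t, κ t ((closure O ×ˢ A)ᶜ) = 0

namespace St

variable {T : ℝ} {O A : Set ℝ} (y : St T O A)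

instance : IsProbabilityMeasure y.μ := y.hμ

instance : IsFiniteKernel y.κ := ⟨⟨1, ENNReal.one_lt_top, y.hκ⟩⟩

/-- The associated measure on `(t,x,a)`. -/
noncomputable def Q : Measure (ℝ × ℝ × ℝ) := (volume.restrict (Icc 0 T)) ⊗ₘ y.κ

instance : IsFiniteMeasure y.Q := by unfold Q; infer_instance

lemma μ_ae : ∀ᵐ p ∂y.μ, p.1 ∈ Icc 0 T ∧ p.2 ∈ closure O := by
  have := y.hμs
  rw [ae_iff]
  exact this

lemma Q_ae (hA : MeasurableSet A) : ∀ᵐ q ∂y.Q, q.1 ∈ Icc 0 T ∧ q.2.1 ∈ closure O ∧ q.2.2 ∈ A := by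
  have hms : MeasurableSet {q : ℝ × ℝ × ℝ | q.1 ∈ Icc 0 T ∧ q.2.1 ∈ closure O ∧ q.2.2 ∈ A} := by
    have : {q : ℝ × ℝ × ℝ | q.1 ∈ Icc 0 T ∧ q.2.1 ∈ closure O ∧ q.2.2 ∈ A}
      = Icc 0 T ×ˢ (closure O ×ˢ A) := by ext; simp
    rw [this]
    exact measurableSet_Icc.prod (isClosed_closure.measurableSet.prod hA)
  unfold Q
  rw [Measure.ae_compProd_iff hms]
  filter_upwards [ae_restrict_mem measurableSet_Icc] with t ht
  have : ∀ᵐ p ∂(y.κ t), p ∈ closure O ×ˢ A := by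
    rw [ae_iff]; exact y.hκs t
  filter_upwards [this] with p hp
  exact ⟨ht, hp.1, hp.2⟩

lemma lintegral_time_le (h : ℝ → ENNReal) (hh : Measurable h) :
    ∫⁻ q, h q.1 ∂y.Q ≤ ∫⁻ t in Icc 0 T, h t := by
  unfold Q
  rw [Measure.lintegral_compProd (f := fun q : ℝ × ℝ × ℝ => h q.1) (hh.comp measurable_fst)]
  apply lintegral_mono
  intro t
  simp only [lintegral_const]
  calc h t * y.κ t univ ≤ h t * 1 := by gcongr; exact y.hκ t
    _ = h t := mul_one _

lemma Q_univ : y.Q univ ≤ ENNReal.ofReal T := by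
  have := y.lintegral_time_le (fun _ => 1) measurable_const
  simpa using this

lemma integral_time_le (h : ℝ → ℝ) (hh : Measurable h) (h0 : ∀ t, 0 ≤ h t)
    (hi : IntegrableOn h (Icc 0 T)) :
    ∫ q, h q.1 ∂y.Q ≤ ∫ t in Icc 0 T, h t := by
  rw [integral_eq_lintegral_of_nonneg_ae (f := fun q : ℝ × ℝ × ℝ => h q.1)
      (Eventually.of_forall fun q => h0 q.1)
    (hh.comp measurable_fst).aestronglyMeasurable,
    integral_eq_lintegral_of_nonneg_ae (f := h) (Eventually.of_forall fun q => h0 q)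
    hh.aestronglyMeasurable]
  apply ENNReal.toReal_mono
  · exact (hi.lintegral_lt_top).ne
  · exact y.lintegral_time_le (fun t => ENNReal.ofReal (h t)) hh.ennreal_ofReal

lemma integral_Q (h : ℝ × ℝ × ℝ → ℝ) (hh : Integrable h y.Q) :
    ∫ q, h q ∂y.Q = ∫ t in Icc 0 T, ∫ p, h (t, p) ∂(y.κ t) := by
  unfold Q at hh ⊢
  exact Measure.integral_compProd hh

lemma integrable_bdd {X : Type*} [MeasurableSpace X] (ν : Measure X) [IsFiniteMeasure ν]
    (h : X → ℝ) (hm : Measurable h) (C : ℝ) (hC : ∀ q, |h q| ≤ C) : Integrable h ν :=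
  Integrable.of_bound hm.aestronglyMeasurable C (Eventually.of_forall hC)

lemma κ_real_le (t : ℝ) : (y.κ t).real univ ≤ 1 := by
  have := ENNReal.toReal_mono ENNReal.one_ne_top (y.hκ t)
  simpa [Measure.real] using this

lemma abs_int_κ_le (h : ℝ × ℝ → ℝ) (C : ℝ) (hC : ∀ p, |h p| ≤ C) (t : ℝ) :
    |∫ p, h p ∂(y.κ t)| ≤ C := by
  have hC0 : 0 ≤ C := (abs_nonneg _).trans (hC 0)
  have := norm_integral_le_of_norm_le_const (μ := y.κ t) (f := h) (C := C) (Eventually.of_forall hC)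
  rw [Real.norm_eq_abs] at this
  refine this.trans ?_
  have := y.κ_real_le t
  nlinarith

lemma measurable_int_κ (h : ℝ → ℝ × ℝ → ℝ) (hh : Measurable fun q : ℝ × ℝ × ℝ => h q.1 q.2) :
    Measurable fun t => ∫ p, h t p ∂(y.κ t) :=
  (StronglyMeasurable.integral_kernel_prod_right' (κ := y.κ) (f := fun q : ℝ × ℝ × ℝ => h q.1 q.2)
    hh.stronglyMeasurable).measurable

/-- Statistics along the flow. -/
noncomputable def z {ι : Type*} (hat : ι → ℝ × ℝ → ℝ) (t : ℝ) : ι → ℝ :=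
  fun i => ∫ p, hat i (t, p.1) ∂(y.κ t)

lemma measurable_z {ι : Type*} [Countable ι] (hat : ι → ℝ × ℝ → ℝ) (hc : ∀ i, Continuous (hat i)) :
    Measurable (y.z hat) := by
  rw [measurable_pi_iff]
  intro i
  apply y.measurable_int_κ (fun t p => hat i (t, p.1))
  exact ((hc i).measurable).comp (by fun_prop)

lemma abs_z_le {ι : Type*} (hat : ι → ℝ × ℝ → ℝ) (H : ℝ) (hH : ∀ i p, |hat i p| ≤ H) (t : ℝ) (i : ι) :
    |y.z hat t i| ≤ H := y.abs_int_κ_le (fun p => hat i (t, p.1)) H (fun p => hH i _) t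

/-- Convex combinations. -/
noncomputable def mix {J : Type*} [Fintype J] (w : J → ℝ) (hw : w ∈ stdSimplex ℝ J) (ys : J → St T O A) :
    St T O A where
  μ := ∑ j, ENNReal.ofReal (w j) • (ys j).μ
  κ := ⟨fun t => ∑ j, ENNReal.ofReal (w j) • (ys j).κ t, by
    refine Measure.measurable_of_measurable_coe _ fun s hs => ?_
    simp only [Measure.coe_finsetSum, Finset.sum_apply, Measure.smul_apply, smul_eq_mul]
    exact Finset.measurable_fun_sum _ fun j _ => ((ys j).κ.measurable_coe hs).const_mul _⟩
  hμ := by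
    constructor
    simp only [Measure.coe_finsetSum, Finset.sum_apply, Measure.smul_apply, smul_eq_mul, measure_univ,
      mul_one]
    rw [← ENNReal.ofReal_sum_of_nonneg fun j _ => hw.1 j, hw.2, ENNReal.ofReal_one]
  hμs := by
    simp [Measure.coe_finsetSum, Finset.sum_apply, Measure.smul_apply, (ys _).hμs]
  hκ := by
    intro t
    change (∑ j, ENNReal.ofReal (w j) • (ys j).κ t) univ ≤ 1
    simp only [Measure.coe_finsetSum, Finset.sum_apply, Measure.smul_apply, smul_eq_mul]
    calc ∑ j, ENNReal.ofReal (w j) * (ys j).κ t univ ≤ ∑ j, ENNReal.ofReal (w j) * 1 := by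
          gcongr with j _; exact (ys j).hκ t
      _ = 1 := by
        simp only [mul_one]
        rw [← ENNReal.ofReal_sum_of_nonneg fun j _ => hw.1 j, hw.2, ENNReal.ofReal_one]
  hκs := by
    intro t
    change (∑ j, ENNReal.ofReal (w j) • (ys j).κ t) _ = 0
    simp [Measure.coe_finsetSum, Finset.sum_apply, Measure.smul_apply, (ys _).hκs]

section mix
variable {J : Type*} [Fintype J] (w : J → ℝ) (hw : w ∈ stdSimplex ℝ J) (ys : J → St T O A)

lemma mix_κ (t : ℝ) : (mix w hw ys).κ t = ∑ j, ENNReal.ofReal (w j) • (ys j).κ t := rfl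

lemma int_sum {X : Type*} [MeasurableSpace X] (ν : J → Measure X) (h : X → ℝ)
    (hi : ∀ j, Integrable h (ν j)) (hw : w ∈ stdSimplex ℝ J) :
    ∫ q, h q ∂(∑ j, ENNReal.ofReal (w j) • ν j) = ∑ j, w j * ∫ q, h q ∂(ν j) := by
  rw [integral_finsetSum_measure]
  · refine Finset.sum_congr rfl fun j _ => ?_
    rw [integral_smul_measure, ENNReal.toReal_ofReal (hw.1 j), smul_eq_mul]
  · intro j _
    exact (hi j).smul_measure ENNReal.ofReal_ne_top

lemma mix_int_μ (h : ℝ × ℝ → ℝ) (hm : Measurable h) (C : ℝ) (hC : ∀ q, |h q| ≤ C) :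
    ∫ p, h p ∂(mix w hw ys).μ = ∑ j, w j * ∫ p, h p ∂(ys j).μ :=
  int_sum w _ h (fun j => integrable_bdd _ h hm C hC) hw

lemma mix_int_κ (h : ℝ × ℝ → ℝ) (hm : Measurable h) (C : ℝ) (hC : ∀ q, |h q| ≤ C) (t : ℝ) :
    ∫ p, h p ∂(mix w hw ys).κ t = ∑ j, w j * ∫ p, h p ∂(ys j).κ t := by
  rw [mix_κ]
  exact int_sum w _ h (fun j => integrable_bdd _ h hm C hC) hw

lemma mix_int_Q (h : ℝ × ℝ × ℝ → ℝ) (hm : Measurable h) (C : ℝ) (hC : ∀ q, |h q| ≤ C) :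
    ∫ p, h p ∂(mix w hw ys).Q = ∑ j, w j * ∫ p, h p ∂(ys j).Q := by
  rw [integral_Q _ _ (integrable_bdd _ h hm C hC)]
  have : ∀ t, ∫ p, h (t, p) ∂(mix w hw ys).κ t = ∑ j, w j * ∫ p, h (t, p) ∂(ys j).κ t :=
    fun t => mix_int_κ w hw ys (fun p => h (t, p)) (hm.comp (by fun_prop)) C (fun _ => hC _) t
  simp_rw [this]
  rw [integral_finsetSum]
  · refine Finset.sum_congr rfl fun j _ => ?_
    rw [integral_const_mul, ← integral_Q _ _ (integrable_bdd _ h hm C hC)]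
  · intro j _
    apply Integrable.const_mul
    refine integrable_bdd _ _ ((ys j).measurable_int_κ (fun t p => h (t, p)) hm) C fun t => ?_
    exact (ys j).abs_int_κ_le (fun p => h (t, p)) C (fun p => hC _) t

lemma mix_z {ι : Type*} (hat : ι → ℝ × ℝ → ℝ) (hc : ∀ i, Continuous (hat i)) (H : ℝ)
    (hH : ∀ i p, |hat i p| ≤ H) (t : ℝ) (i : ι) :
    (mix w hw ys).z hat t i = ∑ j, w j * (ys j).z hat t i :=
  mix_int_κ w hw ys (fun p => hat i (t, p.1)) ((hc i).measurable.comp (by fun_prop)) H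
    (fun p => hH i _) t

end mix

end St
end

section
open MeasureTheory Filter Set Topology
open ProbabilityTheory
set_option linter.all false

/-! ### Weak convergence -/

/-- Weak convergence. -/
def WC {X : Type*} [TopologicalSpace X] [MeasurableSpace X] (νn : ℕ → Measure X) (ν : Measure X) : Prop :=
  ∀ h : X → ℝ, Continuous h → (∃ C : ℝ, ∀ p, |h p| ≤ C) →
    Tendsto (fun n => ∫ p, h p ∂(νn n)) atTop (𝓝 (∫ p, h p ∂ν))

theorem weak_subseq_prob {X : Type*} [TopologicalSpace X] [TopologicalSpace.MetrizableSpace X]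
    [TopologicalSpace.SeparableSpace X] [MeasurableSpace X] [BorelSpace X]
    (P : ℕ → ProbabilityMeasure X)
    (hP : ∀ ε : ENNReal, 0 < ε → ∃ K, IsCompact K ∧ ∀ n, (P n : Measure X) Kᶜ ≤ ε) :
    ∃ φ : ℕ → ℕ, StrictMono φ ∧ ∃ Q : ProbabilityMeasure X, WC (fun n => (P (φ n) : Measure X)) Q := by
  have hc : IsCompact (closure (range P)) := by
    apply isCompact_closure_of_isTightMeasureSet
    rw [isTightMeasureSet_iff_exists_isCompact_measure_compl_le]
    intro ε hε
    obtain ⟨K, hK, h⟩ := hP ε hε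
    refine ⟨K, hK, ?_⟩
    rintro _ ⟨_, ⟨n, rfl⟩, rfl⟩
    exact h n
  have := hc.isSeqCompact (x := P) (fun n => subset_closure (mem_range_self n))
  obtain ⟨Q, _, φ, hφ, hQ⟩ := this
  refine ⟨φ, hφ, Q, ?_⟩
  rw [ProbabilityMeasure.tendsto_iff_forall_integral_tendsto] at hQ
  rintro h hc ⟨C, hC⟩
  exact hQ (BoundedContinuousFunction.ofNormedAddCommGroup h hc C hC)

theorem weak_subseq {X : Type*} [TopologicalSpace X] [TopologicalSpace.MetrizableSpace X]
    [SecondCountableTopology X] [MeasurableSpace X] [BorelSpace X] [Nonempty X]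
    (ν : ℕ → Measure X) (c : ENNReal) (hc0 : c ≠ 0) (hct : c ≠ ⊤) (hν : ∀ n, ν n univ ≤ c)
    (hP : ∀ ε : ENNReal, 0 < ε → ∃ K, IsCompact K ∧ ∀ n, ν n Kᶜ ≤ ε) :
    ∃ φ : ℕ → ℕ, StrictMono φ ∧ ∃ Q : Measure X, IsFiniteMeasure Q ∧ WC (fun n => ν (φ n)) Q := by
  classical
  obtain ⟨x0⟩ := ‹Nonempty X›
  have hfin : ∀ n, IsFiniteMeasure (ν n) := fun n => ⟨(hν n).trans_lt hct.lt_top⟩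
  have hmi : Measurable (fun x : X => (x, true)) := by fun_prop
  let P0 : ℕ → Measure (X × Bool) := fun n =>
    c⁻¹ • ((ν n).map (fun x => (x, true)) + (c - ν n univ) • Measure.dirac (x0, false))
  have hprob : ∀ n, IsProbabilityMeasure (P0 n) := by
    intro n
    constructor
    simp only [P0, Measure.smul_apply, Measure.add_apply, smul_eq_mul, measure_univ, mul_one]
    rw [Measure.map_apply hmi MeasurableSet.univ, preimage_univ, add_tsub_cancel_of_le (hν n)]
    exact ENNReal.inv_mul_cancel hc0 hct
  let P : ℕ → ProbabilityMeasure (X × Bool) := fun n => ⟨P0 n, hprob n⟩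
  obtain ⟨φ, hφ, Q, hQ⟩ := weak_subseq_prob P (by
    intro ε hε
    obtain ⟨K, hK, h⟩ := hP (c * ε) (by positivity)
    refine ⟨(K ∪ {x0}) ×ˢ univ, (hK.union isCompact_singleton).prod isCompact_univ, fun n => ?_⟩
    change P0 n _ ≤ ε
    have hKm : MeasurableSet ((K ∪ {x0}) ×ˢ (univ : Set Bool)) :=
      (hK.union isCompact_singleton).measurableSet.prod MeasurableSet.univ
    simp only [P0, Measure.smul_apply, Measure.add_apply, smul_eq_mul]
    rw [Measure.map_apply hmi hKm.compl, Measure.dirac_apply' _ hKm.compl]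
    have h1 : ν n ((fun x => (x, true)) ⁻¹' ((K ∪ {x0}) ×ˢ univ)ᶜ) ≤ c * ε := by
      refine (measure_mono ?_).trans (h n)
      intro x hx; simp at hx; exact hx.2
    have h2 : indicator ((K ∪ {x0}) ×ˢ univ : Set (X × Bool))ᶜ (1 : X × Bool → ENNReal) (x0, false) = 0 := by
      simp
    rw [h2, mul_zero, add_zero]
    calc c⁻¹ * _ ≤ c⁻¹ * (c * ε) := by gcongr
      _ = ε := by rw [← mul_assoc, ENNReal.inv_mul_cancel hc0 hct, one_mul])
  have hms : MeasurableSet (Prod.snd ⁻¹' {true} : Set (X × Bool)) :=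
    measurable_snd (measurableSet_singleton _)
  refine ⟨φ, hφ, c • ((Q : Measure (X × Bool)).restrict (Prod.snd ⁻¹' {true})).map Prod.fst, ?_, ?_⟩
  · exact Measure.smul_finite _ hct
  rintro h hcont ⟨C, hC⟩
  have hC0 : 0 ≤ C := (abs_nonneg _).trans (hC x0)
  let H : X × Bool → ℝ := fun p => if p.2 = true then h p.1 else 0
  have hHc : Continuous H := by
    have e : H = fun p => h p.1 * (if p.2 = true then (1:ℝ) else 0) := by
      funext p; simp only [H]; split_ifs <;> simp
    rw [e]
    exact (hcont.comp continuous_fst).mul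
      ((continuous_of_discreteTopology (f := fun b : Bool => if b = true then (1:ℝ) else 0)).comp continuous_snd)
  have hHb : ∀ p, |H p| ≤ C := by
    intro p; simp only [H]; split_ifs
    · exact hC _
    · simpa using hC0
  have := (hQ H hHc ⟨C, hHb⟩).const_mul c.toReal
  have e1 : ∀ n, c.toReal * ∫ p, H p ∂(P n : Measure (X × Bool)) = ∫ x, h x ∂(ν n) := by
    intro n
    change c.toReal * ∫ p, H p ∂(P0 n) = _
    simp only [P0]
    rw [integral_smul_measure, integral_add_measure, integral_map hmi.aemeasurable hHc.aestronglyMeasurable,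
      integral_smul_measure, integral_dirac]
    · simp only [H, if_true]
      simp only [smul_eq_mul, ENNReal.toReal_inv]
      have : c.toReal ≠ 0 := ENNReal.toReal_ne_zero.2 ⟨hc0, hct⟩
      simp
      field_simp
    · have : IsFiniteMeasure ((ν n).map (fun x => (x, true))) := inferInstance
      exact St.integrable_bdd _ H hHc.measurable C hHb
    · have : IsFiniteMeasure ((c - ν n univ) • Measure.dirac (x0, false)) :=
        Measure.smul_finite _ (ENNReal.sub_ne_top hct)
      exact St.integrable_bdd _ H hHc.measurable C hHb
  have e2 : c.toReal * ∫ p, H p ∂(Q : Measure (X × Bool)) =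
      ∫ x, h x ∂(c • ((Q : Measure (X × Bool)).restrict (Prod.snd ⁻¹' {true})).map Prod.fst) := by
    rw [integral_smul_measure, integral_map measurable_fst.aemeasurable hcont.aestronglyMeasurable,
      ← integral_indicator hms, smul_eq_mul]
    congr 1
    apply integral_congr_ae
    refine Eventually.of_forall fun p => ?_
    by_cases hp : p.2 = true <;> simp [H, hp, indicator]
  simp only [e1, e2] at this
  exact this
end

section
open MeasureTheory Filter Set Topology
open ProbabilityTheory
set_option linter.all false

theorem WC.support {X : Type*} [MetricSpace X] [MeasurableSpace X] [BorelSpace X]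
    {νn : ℕ → Measure X} {ν : Measure X} [IsFiniteMeasure ν] (h : WC νn ν) (S : Set X) (hS : IsClosed S)
    (h0 : ∀ n, νn n Sᶜ = 0) : ν Sᶜ = 0 := by
  rcases S.eq_empty_or_nonempty with rfl | hne
  · simp only [compl_empty, Measure.measure_univ_eq_zero] at h0 ⊢
    have := h (fun _ => 1) continuous_const ⟨1, by simp⟩
    simp only [h0] at this
    simp only [integral_zero_measure] at this
    have h1 := tendsto_nhds_unique this tendsto_const_nhds
    simp at h1
    simpa [Measure.real, ENNReal.toReal_eq_zero_iff] using h1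
  · let f : X → ℝ := fun x => min 1 (Metric.infDist x S)
    have hf0 : ∀ x, 0 ≤ f x := fun x => le_min zero_le_one Metric.infDist_nonneg
    have hfc : Continuous f := continuous_const.min (Metric.continuous_infDist_pt S)
    have hfb : ∀ x, |f x| ≤ 1 := fun x => by rw [abs_of_nonneg (hf0 x)]; exact min_le_left _ _
    have hz : ∀ x ∈ S, f x = 0 := fun x hx => by
      simp [f, Metric.infDist_zero_of_mem hx]
    have h1 := h f hfc ⟨1, hfb⟩
    have h2 : ∀ n, ∫ p, f p ∂(νn n) = 0 := by
      intro n
      rw [integral_eq_zero_of_ae]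
      have : ∀ᵐ x ∂(νn n), x ∈ S := by rw [ae_iff]; exact h0 n
      filter_upwards [this] with x hx using hz x hx
    simp only [h2] at h1
    have h3 := (tendsto_nhds_unique h1 tendsto_const_nhds)
    rw [integral_eq_zero_iff_of_nonneg hf0 (St.integrable_bdd _ f hfc.measurable 1 hfb)] at h3
    have : ∀ᵐ x ∂ν, x ∈ S := by
      filter_upwards [h3] with x hx
      have h4 : f x = 0 := hx
      rw [hS.mem_iff_infDist_zero hne]
      rcases min_choice 1 (Metric.infDist x S) with h5 | h5
      · simp only [f, h5] at h4; norm_num at h4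
      · simpa only [f, h5] using h4
    rw [ae_iff] at this; exact this

theorem measure_le_of_cont {ν1 ν2 : Measure ℝ} [IsFiniteMeasure ν1] [IsFiniteMeasure ν2]
    (h : ∀ f : ℝ → ℝ, Continuous f → (∀ x, 0 ≤ f x) → (∀ x, f x ≤ 1) → ∫ x, f x ∂ν1 ≤ ∫ x, f x ∂ν2) :
    ν1 ≤ ν2 := by
  have hcl : ∀ F : Set ℝ, IsClosed F → ν1 F ≤ ν2 F := by
    intro F hF
    have hp : ∀ n : ℕ, (0:ℝ) < 1 / ((n:ℝ) + 1) := fun n => by positivity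
    have hl := tendsto_lintegral_thickenedIndicator_of_isClosed ν2 hF hp
      tendsto_one_div_add_atTop_nhds_zero_nat
    refine ge_of_tendsto' hl fun n => ?_
    refine (measure_le_lintegral_thickenedIndicator ν1 hF.measurableSet (hp n)).trans ?_
    let g := thickenedIndicator (hp n) F
    have := h (fun x => (g x : ℝ)) (by fun_prop) (fun x => (g x).2) (fun x => by
      have := thickenedIndicator_le_one (hp n) F x
      have h2 : g x ≤ 1 := this
      exact_mod_cast h2)
    have hgc : Continuous (fun x => (g x : ℝ)) := by fun_prop
    rw [integral_eq_lintegral_of_nonneg_ae (f := fun x => (g x : ℝ)) (Eventually.of_forall fun x => (g x).2) hgc.aestronglyMeasurable,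
      integral_eq_lintegral_of_nonneg_ae (f := fun x => (g x : ℝ)) (Eventually.of_forall fun x => (g x).2) hgc.aestronglyMeasurable] at this
    simp only [ENNReal.ofReal_coe_nnreal] at this
    have hfin : ∀ ν : Measure ℝ, IsFiniteMeasure ν → ∫⁻ x, (g x : ENNReal) ∂ν ≠ ⊤ := by
      intro ν _
      exact (g.lintegral_lt_top_of_nnreal ν).ne
    exact (ENNReal.toReal_le_toReal (hfin _ inferInstance) (hfin _ inferInstance)).1 this
  rw [Measure.le_iff]
  intro s hs
  rw [hs.measure_eq_iSup_isClosed_of_ne_top (measure_ne_top _ _)]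
  refine iSup_le fun F => iSup_le fun hF => iSup_le fun hc => ?_
  exact (hcl F hc).trans (measure_mono hF)

theorem disint (T : ℝ) (Q : Measure (ℝ × ℝ × ℝ)) [IsFiniteMeasure Q]
    (hle : Q.fst ≤ volume.restrict (Icc 0 T)) (S : Set (ℝ × ℝ)) (hS : MeasurableSet S)
    (hQS : Q (univ ×ˢ S)ᶜ = 0) :
    ∃ κ : Kernel ℝ (ℝ × ℝ), (∀ t, κ t univ ≤ 1) ∧ (∀ t, κ t Sᶜ = 0) ∧
      (volume.restrict (Icc 0 T)) ⊗ₘ κ = Q := by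
  set lam : Measure ℝ := volume.restrict (Icc 0 T) with hlam
  let ρ := Q.fst.rnDeriv lam
  have hρm : Measurable ρ := Measure.measurable_rnDeriv _ _
  have hρ1 : ρ ≤ᵐ[lam] 1 := Measure.rnDeriv_le_one_of_le hle
  have hρQ : lam.withDensity ρ = Q.fst :=
    Measure.withDensity_rnDeriv_eq _ _ (Measure.absolutelyContinuous_of_le hle)
  let ck := Q.condKernel
  let κ : Kernel ℝ (ℝ × ℝ) := ⟨fun t => (min (ρ t) 1) • (ck t).restrict S, by
    refine Measure.measurable_of_measurable_coe _ fun s hs => ?_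
    simp only [Measure.smul_apply, smul_eq_mul]
    simp only [Measure.restrict_apply hs]
    exact (hρm.min measurable_const).mul (ck.measurable_coe (hs.inter hS))⟩
  have hκ : ∀ t, κ t = (min (ρ t) 1) • (ck t).restrict S := fun t => rfl
  have hk1 : ∀ t, κ t univ ≤ 1 := by
    intro t
    rw [hκ, Measure.smul_apply, smul_eq_mul]
    calc min (ρ t) 1 * (ck t).restrict S univ ≤ 1 * 1 := by
          gcongr
          · exact min_le_right _ _
          · rw [Measure.restrict_apply_univ]; exact prob_le_one
      _ = 1 := one_mul 1
  refine ⟨κ, hk1, ?_, ?_⟩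
  · intro t
    rw [hκ, Measure.smul_apply, Measure.restrict_apply hS.compl]
    simp
  · have : IsFiniteKernel κ := ⟨⟨1, ENNReal.one_lt_top, hk1⟩⟩
    ext s hs
    rw [Measure.compProd_apply hs]
    have hs' : MeasurableSet (s ∩ univ ×ˢ S) := hs.inter (MeasurableSet.univ.prod hS)
    have e1 : Q s = Q (s ∩ univ ×ˢ S) := by
      rw [measure_inter_conull]; exact hQS
    have e2 : Q (s ∩ univ ×ˢ S) = ∫⁻ t, ck t (Prod.mk t ⁻¹' (s ∩ univ ×ˢ S)) ∂(Q.fst) := by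
      conv_lhs => rw [← Q.disintegrate Q.condKernel]
      rw [Measure.compProd_apply hs']
    rw [e1, e2, ← hρQ, lintegral_withDensity_eq_lintegral_mul _ hρm
      (Kernel.measurable_kernel_prodMk_left hs')]
    apply lintegral_congr_ae
    filter_upwards [hρ1] with t ht
    rw [hκ, Measure.smul_apply, smul_eq_mul, Measure.restrict_apply (measurable_prodMk_left hs)]
    simp only [Pi.mul_apply]
    have ht' : ρ t ≤ 1 := ht
    rw [min_eq_left ht']
    congr 2
    ext p; simp

theorem WC.integral_nonneg_le {X : Type*} [TopologicalSpace X] [MeasurableSpace X]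
    {νn : ℕ → Measure X} {ν : Measure X} (h : WC νn ν) (f : X → ℝ) (hf : Continuous f)
    (hb : ∃ C : ℝ, ∀ p, |f p| ≤ C) (c : ℝ) (hc : ∀ n, ∫ x, f x ∂(νn n) ≤ c) : ∫ x, f x ∂ν ≤ c :=
  le_of_tendsto' (h f hf hb) hc

/-- Weak limits of states are states. -/
theorem limit_state {T : ℝ} {O A : Set ℝ} (hA : IsCompact A) (y : ℕ → St T O A)
    (μ : Measure (ℝ × ℝ)) (Q : Measure (ℝ × ℝ × ℝ)) [IsFiniteMeasure μ] [IsFiniteMeasure Q]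
    (h1 : WC (fun n => (y n).μ) μ) (h2 : WC (fun n => (y n).Q) Q) :
    ∃ x : St T O A, x.μ = μ ∧ x.Q = Q := by
  have hprob : IsProbabilityMeasure μ := by
    have := h1 (fun _ => 1) continuous_const ⟨1, by simp⟩
    simp only [integral_const, probReal_univ, smul_eq_mul, mul_one] at this
    have h3 := tendsto_nhds_unique this tendsto_const_nhds
    constructor
    simpa [Measure.real, ENNReal.toReal_eq_one_iff] using h3
  have hμs := h1.support (Icc 0 T ×ˢ closure O) (isClosed_Icc.prod isClosed_closure) (fun n => (y n).hμs)
  have hQs : Q (Icc 0 T ×ˢ (closure O ×ˢ A))ᶜ = 0 := by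
    apply h2.support _ (isClosed_Icc.prod (isClosed_closure.prod hA.isClosed))
    intro n
    have := (y n).Q_ae hA.measurableSet
    rw [ae_iff] at this
    exact this
  have hfst : Q.fst ≤ volume.restrict (Icc 0 T) := by
    apply measure_le_of_cont
    intro f hf hf0 hf1
    have hfb : ∀ t, |f t| ≤ 1 := fun t => by rw [abs_of_nonneg (hf0 t)]; exact hf1 t
    rw [Measure.fst, integral_map measurable_fst.aemeasurable hf.aestronglyMeasurable]
    apply h2.integral_nonneg_le (fun q => f q.1) (hf.comp continuous_fst) ⟨1, fun q => hfb q.1⟩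
    intro n
    exact (y n).integral_time_le f hf.measurable hf0 (St.integrable_bdd _ f hf.measurable 1 hfb)
  obtain ⟨κ, k1, k2, k3⟩ := disint T Q hfst (closure O ×ˢ A)
    (isClosed_closure.measurableSet.prod hA.measurableSet) (by
      refine measure_mono_null ?_ hQs
      apply compl_subset_compl.2
      exact prod_mono (subset_univ _) subset_rfl)
  exact ⟨⟨μ, κ, hprob, hμs, k1, k2⟩, rfl, k3⟩

/-- Weak convergence of states. -/
def St.Conv {T : ℝ} {O A : Set ℝ} (y : ℕ → St T O A) (x : St T O A) : Prop :=
  WC (fun n => (y n).μ) x.μ ∧ WC (fun n => (y n).Q) x.Q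

theorem WC.comp_sub {X : Type*} [TopologicalSpace X] [MeasurableSpace X]
    {νn : ℕ → Measure X} {ν : Measure X} (h : WC νn ν) {φ : ℕ → ℕ} (hφ : Tendsto φ atTop atTop) :
    WC (fun n => νn (φ n)) ν := fun f hf hb => (h f hf hb).comp hφ

theorem St.Conv.comp_sub {T : ℝ} {O A : Set ℝ} {y : ℕ → St T O A} {x : St T O A} (h : St.Conv y x)
    {φ : ℕ → ℕ} (hφ : Tendsto φ atTop atTop) : St.Conv (fun n => y (φ n)) x :=
  ⟨h.1.comp_sub hφ, h.2.comp_sub hφ⟩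

/-- Compactness of tight families of states. -/
theorem state_subseq {T : ℝ} (hT : 0 < T) {O A : Set ℝ} (hA : IsCompact A) (y : ℕ → St T O A)
    (ht : ∀ ε : ENNReal, 0 < ε → ∃ R : ℝ, ∀ n, (y n).μ {p | R < |p.2|} ≤ ε ∧ (y n).Q {q | R < |q.2.1|} ≤ ε) :
    ∃ φ : ℕ → ℕ, StrictMono φ ∧ ∃ x : St T O A, St.Conv (fun n => y (φ n)) x := by
  obtain ⟨φ, hφ, μ, hμf, hμ⟩ := weak_subseq (fun n => (y n).μ) 1 one_ne_zero ENNReal.one_ne_top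
    (fun n => by simp) (by
      intro ε hε
      obtain ⟨R, hR⟩ := ht ε hε
      refine ⟨Icc 0 T ×ˢ Icc (-R) R, isCompact_Icc.prod isCompact_Icc, fun n => ?_⟩
      refine le_trans (measure_mono_ae ?_) (hR n).1
      filter_upwards [(y n).μ_ae] with p hp hp2
      have : ¬ (p ∈ Icc 0 T ×ˢ Icc (-R) R) := hp2
      change R < |p.2|
      by_contra hc
      exact this ⟨hp.1, abs_le.1 (not_lt.1 hc)⟩)
  obtain ⟨ψ, hψ, Q, hQf, hQ⟩ := weak_subseq (fun n => (y (φ n)).Q) (ENNReal.ofReal T)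
    (by simpa using hT) ENNReal.ofReal_ne_top
    (fun n => (y (φ n)).Q_univ) (by
      intro ε hε
      obtain ⟨R, hR⟩ := ht ε hε
      refine ⟨Icc 0 T ×ˢ (Icc (-R) R ×ˢ A), isCompact_Icc.prod (isCompact_Icc.prod hA), fun n => ?_⟩
      refine le_trans (measure_mono_ae ?_) (hR (φ n)).2
      filter_upwards [(y (φ n)).Q_ae hA.measurableSet] with p hp hp2
      have : ¬ (p ∈ Icc 0 T ×ˢ (Icc (-R) R ×ˢ A)) := hp2
      change R < |p.2.1|
      by_contra hc
      exact this ⟨hp.1, abs_le.1 (not_lt.1 hc), hp.2.2⟩)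
  have hμ' := hμ.comp_sub hψ.tendsto_atTop
  obtain ⟨x, rfl, rfl⟩ := limit_state hA (fun n => y (φ (ψ n))) μ Q hμ' hQ
  exact ⟨φ ∘ ψ, hφ.comp hψ, x, hμ', hQ⟩
end

section
open MeasureTheory Filter Set Topology
open ProbabilityTheory
set_option linter.all false

/-! ### Test functions -/

theorem tietze_bdd {X : Type*} [TopologicalSpace X] [NormalSpace X] (S : Set X) (hS : IsClosed S)
    (f : X → ℝ) (hf : ContinuousOn f S) (C : ℝ) (hC0 : 0 ≤ C) (hC : ∀ x ∈ S, |f x| ≤ C) :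
    ∃ g : X → ℝ, Continuous g ∧ (∀ x, |g x| ≤ C) ∧ ∀ x ∈ S, g x = f x := by
  obtain ⟨g, hg⟩ := ContinuousMap.exists_restrict_eq hS (⟨S.restrict f, hf.restrict⟩ : C(S, ℝ))
  refine ⟨fun x => max (-C) (min (g x) C), by fun_prop, fun x => ?_, fun x hx => ?_⟩
  · rw [abs_le]
    refine ⟨le_max_left _ _, max_le (by linarith) (min_le_right _ _)⟩
  · have h1 : g x = f x := by
      exact congrArg (fun k : C(S, ℝ) => k ⟨x, hx⟩) hg
    have := abs_le.1 (hC x hx)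
    simp only [h1]
    rw [min_eq_left this.2, max_eq_right this.1]

/-- Test functions with globally continuous and bounded extensions. -/
structure Tst (T : ℝ) (O : Set ℝ) (u ut ux uxx : ℝ → ℝ → ℝ) : Prop where
  is : IsCb12 T O u ut ux uxx
  c : Continuous fun p : ℝ × ℝ => u p.1 p.2
  ct : Continuous fun p : ℝ × ℝ => ut p.1 p.2
  cx : Continuous fun p : ℝ × ℝ => ux p.1 p.2
  cxx : Continuous fun p : ℝ × ℝ => uxx p.1 p.2
  b : ∃ C : ℝ, 0 ≤ C ∧ ∀ t x, |u t x| ≤ C ∧ |ut t x| ≤ C ∧ |ux t x| ≤ C ∧ |uxx t x| ≤ C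

theorem IsCb12.ext {T : ℝ} {O : Set ℝ} {u ut ux uxx : ℝ → ℝ → ℝ} (h : IsCb12 T O u ut ux uxx) :
    ∃ v vt vx vxx, Tst T O v vt vx vxx ∧ ∀ t ∈ Icc 0 T, ∀ x ∈ closure O,
      v t x = u t x ∧ vt t x = ut t x ∧ vx t x = ux t x ∧ vxx t x = uxx t x := by
  obtain ⟨C, hC⟩ := h.bdd
  have hcl : IsClosed (Icc 0 T ×ˢ closure O) := isClosed_Icc.prod isClosed_closure
  have hC' : ∀ t ∈ Icc 0 T, ∀ x ∈ closure O, |u t x| ≤ |C| ∧ |ut t x| ≤ |C| ∧ |ux t x| ≤ |C| ∧ |uxx t x| ≤ |C| := by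
    intro t ht x hx
    have := hC t ht x hx
    have h2 := le_abs_self C
    exact ⟨this.1.trans h2, this.2.1.trans h2, this.2.2.1.trans h2, this.2.2.2.trans h2⟩
  obtain ⟨v, v1, v2, v3⟩ := tietze_bdd _ hcl _ h.cont |C| (abs_nonneg C) (fun p hp => (hC' p.1 hp.1 p.2 hp.2).1)
  obtain ⟨vt, vt1, vt2, vt3⟩ := tietze_bdd _ hcl _ h.cont_t |C| (abs_nonneg C) (fun p hp => (hC' p.1 hp.1 p.2 hp.2).2.1)
  obtain ⟨vx, vx1, vx2, vx3⟩ := tietze_bdd _ hcl _ h.cont_x |C| (abs_nonneg C) (fun p hp => (hC' p.1 hp.1 p.2 hp.2).2.2.1)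
  obtain ⟨vxx, vxx1, vxx2, vxx3⟩ := tietze_bdd _ hcl _ h.cont_xx |C| (abs_nonneg C) (fun p hp => (hC' p.1 hp.1 p.2 hp.2).2.2.2)
  refine ⟨fun t x => v (t, x), fun t x => vt (t, x), fun t x => vx (t, x), fun t x => vxx (t, x),
    ⟨⟨v1.continuousOn, vt1.continuousOn, vx1.continuousOn, vxx1.continuousOn, ?_, ?_, ?_, ?_⟩, v1, vt1, vx1, vxx1, ?_⟩, ?_⟩
  · intro t ht x hx
    have := h.deriv_t t ht x hx
    rw [← vt3 (t, x) ⟨ht, hx⟩] at this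
    exact this.congr (fun s hs => v3 (s, x) ⟨hs, hx⟩) (v3 (t, x) ⟨ht, hx⟩)
  · intro t ht x hx
    have := h.deriv_x t ht x hx
    rw [← vx3 (t, x) ⟨ht, hx⟩] at this
    exact this.congr (fun s hs => v3 (t, s) ⟨ht, hs⟩) (v3 (t, x) ⟨ht, hx⟩)
  · intro t ht x hx
    have := h.deriv_xx t ht x hx
    rw [← vxx3 (t, x) ⟨ht, hx⟩] at this
    exact this.congr (fun s hs => vx3 (t, s) ⟨ht, hs⟩) (vx3 (t, x) ⟨ht, hx⟩)
  · exact ⟨|C|, fun t _ x _ => ⟨v2 _, vt2 _, vx2 _, vxx2 _⟩⟩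
  · exact ⟨|C|, abs_nonneg C, fun t x => ⟨v2 _, vt2 _, vx2 _, vxx2 _⟩⟩
  · intro t ht x hx
    exact ⟨v3 (t, x) ⟨ht, hx⟩, vt3 (t, x) ⟨ht, hx⟩, vx3 (t, x) ⟨ht, hx⟩, vxx3 (t, x) ⟨ht, hx⟩⟩

/-- The feasibility constraint with frozen coefficients. -/
def Feas {T : ℝ} {O A : Set ℝ} (m0 : Measure ℝ) (β s : ℝ × ℝ × ℝ → ℝ) (y : St T O A) : Prop :=
  ∀ u ut ux uxx, Tst T O u ut ux uxx →
    ∫ p, u p.1 p.2 ∂y.μ = ∫ x, u 0 x ∂m0 +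
      ∫ q, (ut q.1 q.2.1 + (β q * ux q.1 q.2.1 + s q ^ 2 / 2 * uxx q.1 q.2.1)) ∂y.Q

/-- The compact convex set. -/
def InK {T : ℝ} {O A : Set ℝ} (m0 : Measure ℝ) (CL : ℝ) (y : St T O A) : Prop :=
  ∀ u ut ux uxx, Tst T O u ut ux uxx → ∀ C,
    (∀ t ∈ Icc 0 T, ∀ x ∈ closure O, CL * (|ux t x| + |uxx t x|) ≤ C) →
    ∫ p, u p.1 p.2 ∂y.μ ≤ ∫ x, u 0 x ∂m0 + ∫ q, ut q.1 q.2.1 ∂y.Q + C * T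

section
variable {T : ℝ} {O A : Set ℝ} {m0 : Measure ℝ}

theorem Tst.meas {u ut ux uxx : ℝ → ℝ → ℝ} (h : Tst T O u ut ux uxx) :
    Measurable (fun q : ℝ × ℝ × ℝ => u q.1 q.2.1) ∧ Measurable (fun q : ℝ × ℝ × ℝ => ut q.1 q.2.1) ∧
    Measurable (fun q : ℝ × ℝ × ℝ => ux q.1 q.2.1) ∧ Measurable (fun q : ℝ × ℝ × ℝ => uxx q.1 q.2.1) :=
  ⟨h.c.measurable.comp (g := fun p : ℝ × ℝ => u p.1 p.2) (f := fun q : ℝ × ℝ × ℝ => (q.1, q.2.1)) (by fun_prop),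
   h.ct.measurable.comp (g := fun p : ℝ × ℝ => ut p.1 p.2) (f := fun q : ℝ × ℝ × ℝ => (q.1, q.2.1)) (by fun_prop),
   h.cx.measurable.comp (g := fun p : ℝ × ℝ => ux p.1 p.2) (f := fun q : ℝ × ℝ × ℝ => (q.1, q.2.1)) (by fun_prop),
   h.cxx.measurable.comp (g := fun p : ℝ × ℝ => uxx p.1 p.2) (f := fun q : ℝ × ℝ × ℝ => (q.1, q.2.1)) (by fun_prop)⟩

theorem Feas.inK (hT : 0 ≤ T) (hA : MeasurableSet A) (CL : ℝ) (β s : ℝ × ℝ × ℝ → ℝ) (hβ : Measurable β) (hs : Measurable s)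
    (hβC : ∀ q, |β q| ≤ CL) (hsC : ∀ q, s q ^ 2 / 2 ≤ CL) (y : St T O A) (hy : Feas m0 β s y) :
    InK m0 CL y := by
  intro u ut ux uxx h C hC
  rw [hy u ut ux uxx h]
  obtain ⟨D, hD0, hD⟩ := h.b
  obtain ⟨-, m2, m3, m4⟩ := h.meas
  have hCL : 0 ≤ CL := (abs_nonneg _).trans (hβC 0)
  have hpt : ∀ q : ℝ × ℝ × ℝ, |β q * ux q.1 q.2.1 + s q ^ 2 / 2 * uxx q.1 q.2.1|
      ≤ CL * (|ux q.1 q.2.1| + |uxx q.1 q.2.1|) := by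
    intro q
    calc _ ≤ |β q * ux q.1 q.2.1| + |s q ^ 2 / 2 * uxx q.1 q.2.1| := abs_add_le _ _
      _ ≤ CL * |ux q.1 q.2.1| + CL * |uxx q.1 q.2.1| := by
        rw [abs_mul, abs_mul, abs_of_nonneg (by positivity : 0 ≤ s q ^ 2 / 2)]
        gcongr
        · exact hβC q
        · exact hsC q
      _ = _ := by ring
  have hi1 : Integrable (fun q : ℝ × ℝ × ℝ => ut q.1 q.2.1) y.Q :=
    St.integrable_bdd _ _ m2 D (fun q => (hD _ _).2.1)
  have hi2 : Integrable (fun q : ℝ × ℝ × ℝ => β q * ux q.1 q.2.1 + s q ^ 2 / 2 * uxx q.1 q.2.1) y.Q := by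
    refine St.integrable_bdd _ _ ((hβ.mul m3).add (((hs.pow_const 2).div_const 2).mul m4)) (CL * (D + D)) (fun q => (hpt q).trans ?_)
    gcongr
    · exact (hD _ _).2.2.1
    · exact (hD _ _).2.2.2
  rw [integral_add hi1 hi2, add_assoc]
  gcongr
  by_cases hO : ∃ x, x ∈ closure O
  · obtain ⟨x0, hx0⟩ := hO
    have hC0 : 0 ≤ C := le_trans (by positivity) (hC 0 ⟨le_rfl, hT⟩ x0 hx0)
    calc _ ≤ ∫ q, C ∂y.Q := by
          apply integral_mono_ae hi2 (integrable_const C)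
          filter_upwards [y.Q_ae hA] with q hq
          exact (le_abs_self _).trans ((hpt q).trans (hC _ hq.1 _ hq.2.1))
      _ = y.Q.real univ * C := by simp
      _ ≤ T * C := by
          gcongr
          have := ENNReal.toReal_mono ENNReal.ofReal_ne_top y.Q_univ
          rwa [ENNReal.toReal_ofReal hT] at this
      _ = C * T := mul_comm _ _
  · exfalso
    have h1 := y.μ_ae
    obtain ⟨p, hp⟩ := h1.exists
    exact hO ⟨_, hp.2⟩

theorem InK.mix {CL : ℝ} {J : Type*} [Fintype J] (w : J → ℝ) (hw : w ∈ stdSimplex ℝ J) (ys : J → St T O A)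
    (hy : ∀ j, InK m0 CL (ys j)) : InK m0 CL (St.mix w hw ys) := by
  intro u ut ux uxx h C hC
  obtain ⟨D, hD0, hD⟩ := h.b
  rw [St.mix_int_μ w hw ys _ h.c.measurable D (fun q => (hD _ _).1),
    St.mix_int_Q w hw ys _ h.meas.2.1 D (fun q => (hD _ _).2.1)]
  have e : ∫ x, u 0 x ∂m0 + ∑ j, w j * ∫ q, ut q.1 q.2.1 ∂(ys j).Q + C * T
      = ∑ j, w j * (∫ x, u 0 x ∂m0 + ∫ q, ut q.1 q.2.1 ∂(ys j).Q + C * T) := by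
    simp only [mul_add, Finset.sum_add_distrib, ← Finset.sum_mul, hw.2, one_mul]
  rw [e]
  apply Finset.sum_le_sum
  intro j _
  exact mul_le_mul_of_nonneg_left (hy j u ut ux uxx h C hC) (hw.1 j)

/-- The cutoff. -/
noncomputable def psi (R x : ℝ) : ℝ := x ^ 2 / (R ^ 2 + x ^ 2)
noncomputable def psi1 (R x : ℝ) : ℝ := 2 * x * R ^ 2 / (R ^ 2 + x ^ 2) ^ 2
noncomputable def psi2 (R x : ℝ) : ℝ := 2 * R ^ 2 * (R ^ 2 - 3 * x ^ 2) / (R ^ 2 + x ^ 2) ^ 3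

lemma psi_cont (R : ℝ) (hR : 1 ≤ R) : Continuous (psi R) ∧ Continuous (psi1 R) ∧ Continuous (psi2 R) := by
  have h : ∀ x : ℝ, R ^ 2 + x ^ 2 ≠ 0 := fun x => by positivity
  refine ⟨?_, ?_, ?_⟩
  · unfold psi; exact Continuous.div (by fun_prop) (by fun_prop) h
  · unfold psi1; exact Continuous.div (by fun_prop) (by fun_prop) (fun x => pow_ne_zero _ (h x))
  · unfold psi2; exact Continuous.div (by fun_prop) (by fun_prop) (fun x => pow_ne_zero _ (h x))

lemma psi_nonneg (R x : ℝ) : 0 ≤ psi R x := by unfold psi; positivity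
lemma psi_le (R : ℝ) (hR : 1 ≤ R) (x : ℝ) : psi R x ≤ 1 := by
  unfold psi; rw [div_le_one (by positivity)]; nlinarith
lemma psi_abs (R : ℝ) (hR : 1 ≤ R) (x : ℝ) : |psi R x| ≤ 1 := by
  rw [abs_of_nonneg (psi_nonneg _ _)]; exact psi_le R hR x
lemma psi1_abs (R : ℝ) (hR : 1 ≤ R) (x : ℝ) : |psi1 R x| ≤ 1 / R := by
  unfold psi1
  rw [abs_div, abs_of_pos (by positivity : 0 < (R ^ 2 + x ^ 2) ^ 2), div_le_div_iff₀ (by positivity) (by positivity),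
    abs_mul, abs_mul, abs_of_nonneg (by positivity : (0:ℝ) ≤ R ^ 2), abs_two, one_mul]
  have h1 : 2 * |x| * R ≤ R ^ 2 + x ^ 2 := by nlinarith [sq_nonneg (|x| - R), sq_abs x]
  have h2 : R ^ 2 ≤ R ^ 2 + x ^ 2 := by nlinarith
  calc 2 * |x| * R ^ 2 * R = (2 * |x| * R) * R ^ 2 := by ring
    _ ≤ (R ^ 2 + x ^ 2) * (R ^ 2 + x ^ 2) := by gcongr
    _ = _ := by ring
lemma psi2_abs (R : ℝ) (hR : 1 ≤ R) (x : ℝ) : |psi2 R x| ≤ 6 / R := by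
  unfold psi2
  rw [abs_div, abs_of_pos (by positivity : 0 < (R ^ 2 + x ^ 2) ^ 3), div_le_div_iff₀ (by positivity) (by positivity),
    abs_mul, abs_of_nonneg (by positivity : (0:ℝ) ≤ 2 * R ^ 2)]
  have h1 : |R ^ 2 - 3 * x ^ 2| ≤ 3 * (R ^ 2 + x ^ 2) := by
    rw [abs_le]; constructor <;> nlinarith
  have h2 : R ≤ R ^ 2 + x ^ 2 := by nlinarith
  have h3 : R ^ 2 ≤ R ^ 2 + x ^ 2 := by nlinarith
  calc 2 * R ^ 2 * |R ^ 2 - 3 * x ^ 2| * R ≤ 2 * (R ^ 2 + x ^ 2) * (3 * (R ^ 2 + x ^ 2)) * (R ^ 2 + x ^ 2) := by gcongr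
    _ = _ := by ring

lemma psi_deriv (R : ℝ) (hR : 1 ≤ R) (x : ℝ) : HasDerivAt (psi R) (psi1 R x) x := by
  have h : R ^ 2 + x ^ 2 ≠ 0 := by positivity
  unfold psi psi1
  have := ((hasDerivAt_id x).pow 2).div (((hasDerivAt_id x).pow 2).const_add (R ^ 2)) h
  refine HasDerivAt.congr_deriv this ?_
  simp only [id, Pi.pow_apply]
  field_simp
  push_cast
  ring
lemma psi1_deriv (R : ℝ) (hR : 1 ≤ R) (x : ℝ) : HasDerivAt (psi1 R) (psi2 R x) x := by
  have h : R ^ 2 + x ^ 2 ≠ 0 := by positivity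
  unfold psi1 psi2
  have := (((hasDerivAt_id x).const_mul 2).mul_const (R^2)).div ((((hasDerivAt_id x).pow 2).const_add (R ^ 2)).pow 2) (pow_ne_zero 2 h)
  refine HasDerivAt.congr_deriv this ?_
  simp only [id, Pi.pow_apply]
  field_simp
  push_cast
  ring

lemma Tst_prod (η η' : ℝ → ℝ) (χ χ1 χ2 : ℝ → ℝ) (hη : Continuous η) (hη' : Continuous η')
    (hχ : Continuous χ) (hχ1 : Continuous χ1) (hχ2 : Continuous χ2)
    (d1 : ∀ t ∈ Icc 0 T, HasDerivWithinAt η (η' t) (Icc 0 T) t) (d2 : ∀ x, HasDerivAt χ (χ1 x) x) (d3 : ∀ x, HasDerivAt χ1 (χ2 x) x)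
    (C : ℝ) (b1 : ∀ t, |η t| ≤ C ∧ |η' t| ≤ C) (b2 : ∀ x, |χ x| ≤ C ∧ |χ1 x| ≤ C ∧ |χ2 x| ≤ C) :
    Tst T O (fun t x => η t * χ x) (fun t x => η' t * χ x) (fun t x => η t * χ1 x) (fun t x => η t * χ2 x) := by
  have hC : 0 ≤ C := (abs_nonneg _).trans (b1 0).1
  have hb : ∀ t x, |η t * χ x| ≤ C * C ∧ |η' t * χ x| ≤ C * C ∧ |η t * χ1 x| ≤ C * C ∧ |η t * χ2 x| ≤ C * C := by
    intro t x
    have h1 := b1 t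
    have h2 := b2 x
    simp only [abs_mul]
    refine ⟨mul_le_mul h1.1 h2.1 (abs_nonneg _) hC, mul_le_mul h1.2 h2.1 (abs_nonneg _) hC,
      mul_le_mul h1.1 h2.2.1 (abs_nonneg _) hC, mul_le_mul h1.1 h2.2.2 (abs_nonneg _) hC⟩
  refine ⟨⟨?_, ?_, ?_, ?_, ?_, ?_, ?_, ⟨C * C, fun t _ x _ => hb t x⟩⟩, ?_, ?_, ?_, ?_, ⟨C * C, by positivity, hb⟩⟩
  · exact Continuous.continuousOn (by fun_prop)
  · exact Continuous.continuousOn (by fun_prop)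
  · exact Continuous.continuousOn (by fun_prop)
  · exact Continuous.continuousOn (by fun_prop)
  · intro t ht x hx
    exact (d1 t ht).mul_const _
  · intro t ht x hx
    exact ((d2 x).const_mul _).hasDerivWithinAt
  · intro t ht x hx
    exact ((d3 x).const_mul _).hasDerivWithinAt
  all_goals fun_prop

lemma Tst_psi (R : ℝ) (hR : 1 ≤ R) : Tst T O (fun t x => 1 * psi R x) (fun t x => 0 * psi R x) (fun t x => 1 * psi1 R x) (fun t x => 1 * psi2 R x) := by
  obtain ⟨c1, c2, c3⟩ := psi_cont R hR
  refine Tst_prod (fun _ => 1) (fun _ => 0) (psi R) (psi1 R) (psi2 R) continuous_const continuous_const c1 c2 c3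
    (fun t _ => (hasDerivAt_const t 1).hasDerivWithinAt) (psi_deriv R hR) (psi1_deriv R hR) 6 (by norm_num) ?_
  intro x
  have h1 : 1 / R ≤ 1 := by rw [div_le_one (by linarith)]; exact hR
  have h2 : 6 / R ≤ 6 := by rw [div_le_iff₀ (by linarith)]; linarith
  refine ⟨(psi_abs R hR x).trans (by norm_num), (psi1_abs R hR x).trans (by linarith), (psi2_abs R hR x).trans h2⟩

/-- globally bounded affine-in-time function -/
lemma clampT (hT : 0 ≤ T) : ∃ η : ℝ → ℝ, Continuous η ∧ (∀ t ∈ Icc 0 T, η t = T - t) ∧ ∀ t, |η t| ≤ T :=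
  let ⟨g, h1, h2, h3⟩ := tietze_bdd (Icc 0 T) isClosed_Icc (fun t => T - t) (by fun_prop) T hT
    (fun t ht => by rw [abs_of_nonneg (by linarith [ht.2])]; linarith [ht.1])
  ⟨g, h1, h3, h2⟩

lemma psi_tail_set {X : Type*} [MeasurableSpace X] (ν : Measure X) [IsFiniteMeasure ν] (R : ℝ) (hR : 1 ≤ R)
    (x : X → ℝ) (hx : Measurable x) : ν.real {p | R < |x p|} ≤ 2 * ∫ p, psi R (x p) ∂ν := by
  have hi : Integrable (fun p => psi R (x p)) ν :=
    St.integrable_bdd _ _ ((psi_cont R hR).1.measurable.comp hx) 1 (fun p => psi_abs R hR _)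
  have := mul_meas_ge_le_integral_of_nonneg (Eventually.of_forall fun p => psi_nonneg R (x p)) hi (1/2)
  have h2 : ν.real {p | R < |x p|} ≤ ν.real {p | 1/2 ≤ psi R (x p)} := by
    refine measureReal_mono ?_ (measure_ne_top _ _)
    intro p hp
    have hp : R < |x p| := hp
    change 1/2 ≤ psi R (x p)
    unfold psi
    rw [div_le_div_iff₀ (by norm_num) (by positivity)]
    have : R ^ 2 ≤ x p ^ 2 := by rw [← sq_abs (x p)]; gcongr
    linarith
  linarith

lemma psi_m0 [IsFiniteMeasure m0] : Tendsto (fun n : ℕ => ∫ x, psi ((n:ℝ) + 1) x ∂m0) atTop (𝓝 0) := by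
  have : Tendsto (fun n : ℕ => ∫ x, psi ((n:ℝ) + 1) x ∂m0) atTop (𝓝 (∫ x, (0:ℝ) ∂m0)) := by
    apply tendsto_integral_of_dominated_convergence (fun _ => (1:ℝ))
    · intro n
      exact (psi_cont _ (by linarith [(Nat.cast_nonneg n : (0:ℝ) ≤ n)])).1.aestronglyMeasurable
    · exact integrable_const _
    · intro n
      exact Eventually.of_forall fun x => psi_abs _ (by linarith [(Nat.cast_nonneg n : (0:ℝ) ≤ n)]) x
    · refine Eventually.of_forall fun x => ?_
      have h1 : Tendsto (fun n : ℕ => x ^ 2 * (1 / ((n:ℝ) + 1))) atTop (𝓝 (x ^ 2 * 0)) :=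
        tendsto_one_div_add_atTop_nhds_zero_nat.const_mul _
      rw [mul_zero] at h1
      refine squeeze_zero (fun n => psi_nonneg _ _) (fun n => ?_) h1
      have hn : (0:ℝ) ≤ n := Nat.cast_nonneg n
      unfold psi
      rw [mul_one_div]
      apply div_le_div_of_nonneg_left (sq_nonneg x) (by positivity)
      nlinarith [sq_nonneg x]
  simpa using this

/-- Uniform tails on `K`. -/
theorem InK.tail (hT : 0 ≤ T) (hA : MeasurableSet A) [IsProbabilityMeasure m0] (CL : ℝ) (hCL : 0 ≤ CL) (ε : ℝ) (hε : 0 < ε) :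
    ∃ R : ℝ, 1 ≤ R ∧ ∀ y : St T O A, InK m0 CL y →
      y.μ.real {p | R < |p.2|} ≤ ε ∧ y.Q.real {q | R < |q.2.1|} ≤ ε := by
  have h1 : Tendsto (fun n : ℕ => 2 * (1 + T) * (∫ x, psi ((n:ℝ) + 1) x ∂m0 + CL * 7 * T * (1 / ((n:ℝ) + 1)))) atTop (𝓝 (2 * (1 + T) * (0 + CL * 7 * T * 0))) :=
    (psi_m0.add (tendsto_one_div_add_atTop_nhds_zero_nat.const_mul _)).const_mul _
  rw [mul_zero, add_zero, mul_zero] at h1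
  obtain ⟨n, hn⟩ := (h1.eventually (gt_mem_nhds hε)).exists
  set R : ℝ := (n:ℝ) + 1 with hRdef
  have hR : 1 ≤ R := by linarith [(Nat.cast_nonneg n : (0:ℝ) ≤ n)]
  set τ := ∫ x, psi R x ∂m0 + CL * 7 * T * (1 / R) with hτ
  have hm0 : 0 ≤ ∫ x, psi R x ∂m0 := integral_nonneg fun x => psi_nonneg R x
  have hτ0 : 0 ≤ τ := by positivity
  have hder : ∀ x, CL * (|psi1 R x| + |psi2 R x|) ≤ CL * 7 * (1 / R) := by
    intro x
    have e : CL * 7 * (1 / R) = CL * (1 / R + 6 / R) := by ring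
    rw [e]
    gcongr
    · exact psi1_abs R hR x
    · exact psi2_abs R hR x
  refine ⟨R, hR, fun y hy => ⟨?_, ?_⟩⟩
  · have h := hy _ _ _ _ (Tst_psi R hR) (CL * 7 * (1 / R)) (fun t _ x _ => by simpa using hder x)
    simp only [one_mul, zero_mul, integral_zero, add_zero] at h
    refine (psi_tail_set y.μ R hR Prod.snd measurable_snd).trans ?_
    have : ∫ p, psi R p.2 ∂y.μ ≤ τ := by rw [hτ]; linarith
    nlinarith
  · obtain ⟨η, e1, e2, e3⟩ := clampT hT
    obtain ⟨c1, c2, c3⟩ := psi_cont R hR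
    have hC6 : ∀ x, |psi R x| ≤ 6 + T ∧ |psi1 R x| ≤ 6 + T ∧ |psi2 R x| ≤ 6 + T := by
      intro x
      have h1 : 1 / R ≤ 1 := by rw [div_le_one (by linarith)]; exact hR
      have h2 : 6 / R ≤ 6 := by rw [div_le_iff₀ (by linarith)]; linarith
      refine ⟨(psi_abs R hR x).trans (by linarith), (psi1_abs R hR x).trans (by linarith), (psi2_abs R hR x).trans (by linarith)⟩
    have htst : Tst T O _ _ _ _ := Tst_prod (T := T) (O := O) η (fun _ => -1) (psi R) (psi1 R) (psi2 R) e1 continuous_const c1 c2 c3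
      (fun t ht => by
        have : HasDerivWithinAt (fun t => T - t) (-1) (Icc 0 T) t := by
          simpa using ((hasDerivAt_id t).const_sub T).hasDerivWithinAt
        exact this.congr e2 (e2 t ht)) (psi_deriv R hR) (psi1_deriv R hR) (6 + T)
      (fun t => ⟨(e3 t).trans (by linarith), by simp; linarith⟩) hC6
    have h := hy _ _ _ _ htst (T * (CL * 7 * (1 / R))) (fun t ht x _ => by
      simp only [abs_mul, ← mul_add]
      rw [← mul_assoc, mul_comm CL, mul_assoc]
      have := hder x
      have h3 := e3 t
      gcongr)
    simp only [neg_mul, one_mul, integral_neg] at h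
    have h4 : 0 ≤ ∫ p, η p.1 * psi R p.2 ∂y.μ := by
      apply integral_nonneg_of_ae
      filter_upwards [y.μ_ae] with p hp
      have : η p.1 = T - p.1 := e2 _ hp.1
      simp only [this, Pi.zero_apply]
      exact mul_nonneg (by linarith [hp.1.2]) (psi_nonneg _ _)
    rw [integral_const_mul, e2 0 ⟨le_rfl, hT⟩, sub_zero] at h
    refine (psi_tail_set y.Q R hR (fun q => q.2.1) (by fun_prop)).trans ?_
    have : ∫ p, psi R p.2.1 ∂y.Q ≤ T * τ := by rw [hτ]; nlinarith
    nlinarith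

/-- Sequential compactness of `K` (without membership of the limit). -/
theorem InK.subseq (hT : 0 < T) (hA : IsCompact A) [IsProbabilityMeasure m0] (CL : ℝ) (hCL : 0 ≤ CL)
    (y : ℕ → St T O A) (hy : ∀ n, InK m0 CL (y n)) :
    ∃ φ : ℕ → ℕ, StrictMono φ ∧ ∃ x : St T O A, St.Conv (fun n => y (φ n)) x := by
  apply state_subseq hT hA
  intro ε hε
  obtain ⟨e, he0, he⟩ : ∃ e : ℝ, 0 < e ∧ ENNReal.ofReal e ≤ ε := by
    rcases eq_or_ne ε ⊤ with rfl | h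
    · exact ⟨1, one_pos, le_top⟩
    · exact ⟨ε.toReal, ENNReal.toReal_pos hε.ne' h, by rw [ENNReal.ofReal_toReal h]⟩
  obtain ⟨R, -, hR⟩ := InK.tail (T := T) (O := O) (A := A) (m0 := m0) hT.le hA.measurableSet CL hCL e he0
  refine ⟨R, fun n => ⟨le_trans ?_ he, le_trans ?_ he⟩⟩
  · rw [ENNReal.le_ofReal_iff_toReal_le (measure_ne_top _ _) he0.le]; exact (hR _ (hy n)).1
  · rw [ENNReal.le_ofReal_iff_toReal_le (measure_ne_top _ _) he0.le]; exact (hR _ (hy n)).2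

/-- `K` is closed. -/
theorem InK.closed (CL : ℝ) (y : ℕ → St T O A) (hy : ∀ n, InK m0 CL (y n)) (x : St T O A)
    (h : St.Conv y x) : InK m0 CL x := by
  intro u ut ux uxx hu C hC
  obtain ⟨D, hD0, hD⟩ := hu.b
  have h1 := h.1 _ hu.c ⟨D, fun p => (hD _ _).1⟩
  have h2 := h.2 (fun q => ut q.1 q.2.1) (hu.ct.comp (g := fun p : ℝ × ℝ => ut p.1 p.2) (f := fun q : ℝ × ℝ × ℝ => (q.1, q.2.1)) (by fun_prop)) ⟨D, fun p => (hD _ _).2.1⟩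
  exact le_of_tendsto_of_tendsto' h1 ((h2.const_add _).add_const _) (fun n => hy n u ut ux uxx hu C hC)
end
end

section
open MeasureTheory Filter Set Topology
open ProbabilityTheory
set_option linter.all false

/-! ### Continuity of Carathéodory functionals -/

section
variable {T : ℝ} {O A : Set ℝ} {m0 : Measure ℝ}

lemma tail_bound (hA : MeasurableSet A) (y : St T O A) (R : ℝ) (G : ℝ × ℝ × ℝ → ℝ) (hG : Measurable G) (C : ℝ) (hC : ∀ q, |G q| ≤ C)
    (hh : ℝ → ℝ) (hm : Measurable hh) (h0 : ∀ t, 0 ≤ hh t) (D : ℝ) (hD : ∀ t, hh t ≤ D)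
    (hb : ∀ t, ∀ p ∈ (closure O ∩ Icc (-R) R) ×ˢ A, |G (t, p)| ≤ hh t) :
    ∫ q, |G q| ∂y.Q ≤ (∫ t in Icc 0 T, hh t) + C * y.Q.real {q | R < |q.2.1|} := by
  have hC0 : 0 ≤ C := (abs_nonneg _).trans (hC 0)
  have hhb : ∀ t, |hh t| ≤ D := fun t => by rw [abs_of_nonneg (h0 t)]; exact hD t
  have hi : Integrable hh (volume.restrict (Icc 0 T)) := St.integrable_bdd _ hh hm D hhb
  have hms : MeasurableSet {q : ℝ × ℝ × ℝ | R < |q.2.1|} :=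
    measurableSet_lt measurable_const (by fun_prop)
  have hi1 : Integrable (fun q : ℝ × ℝ × ℝ => hh q.1) y.Q :=
    St.integrable_bdd _ _ (hm.comp measurable_fst) D (fun q => hhb q.1)
  have hi2 : Integrable (fun q : ℝ × ℝ × ℝ => C * indicator {q : ℝ × ℝ × ℝ | R < |q.2.1|} (fun _ => (1:ℝ)) q) y.Q :=
    ((integrable_const (1:ℝ)).indicator hms).const_mul C
  calc ∫ q, |G q| ∂y.Q ≤ ∫ q, (hh q.1 + C * indicator {q : ℝ × ℝ × ℝ | R < |q.2.1|} (fun _ => (1:ℝ)) q) ∂y.Q := by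
        apply integral_mono_ae (St.integrable_bdd _ _ hG C hC).abs (hi1.add hi2)
        filter_upwards [y.Q_ae hA] with q hq
        by_cases hR : R < |q.2.1|
        · simp only [Pi.add_apply, indicator, mem_setOf_eq, hR, if_true, mul_one]
          linarith [hC q, h0 q.1]
        · simp only [Pi.add_apply, indicator, mem_setOf_eq, hR, if_false, mul_zero, add_zero]
          exact hb q.1 q.2 ⟨⟨hq.2.1, abs_le.1 (not_lt.1 hR)⟩, hq.2.2⟩
    _ = ∫ q, hh q.1 ∂y.Q + C * y.Q.real {q | R < |q.2.1|} := by
        rw [integral_add hi1 hi2, integral_const_mul, integral_indicator hms]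
        simp
    _ ≤ _ := by
        gcongr
        exact y.integral_time_le hh hm h0 hi

lemma compact_slab (hA : IsCompact A) (R : ℝ) : IsCompact ((closure O ∩ Icc (-R) R) ×ˢ A) :=
  (isCompact_Icc.inter_left isClosed_closure).prod hA

/-- CONT(ii). -/
theorem cont_Q (hT : 0 ≤ T) (hA : IsCompact A) [IsProbabilityMeasure m0] (CL : ℝ) (hCL : 0 ≤ CL)
    (y : ℕ → St T O A) (hy : ∀ n, InK m0 CL (y n)) (x : St T O A) (h : St.Conv y x)
    (G : ℝ × ℝ × ℝ → ℝ) (hG : Measurable G) (C : ℝ) (hC : ∀ q, |G q| ≤ C)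
    (hc : ∀ t, ContinuousOn (fun p => G (t, p)) (closure O ×ˢ A)) :
    Tendsto (fun n => ∫ q, G q ∂(y n).Q) atTop (𝓝 (∫ q, G q ∂x.Q)) := by
  have hx := InK.closed CL y hy x h
  have hC0 : 0 ≤ C := (abs_nonneg _).trans (hC 0)
  rw [Metric.tendsto_atTop]
  intro ε hε
  obtain ⟨R, hR1, hR⟩ := InK.tail (T := T) (O := O) (A := A) (m0 := m0) hT hA.measurableSet CL hCL
    (ε / (8 * (2 * C + 1))) (by positivity)
  obtain ⟨F, hh, f1, f2, f3, f4, f5, f6⟩ := carath_approx (compact_slab (O := O) hA R) T C (fun t p => G (t, p))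
    (fun t => (hc t).mono (prod_mono inter_subset_left subset_rfl)) (fun p => hG.comp (by fun_prop)) (fun t p => hC _)
    (ε / 8) (by positivity)
  have key : ∀ z : St T O A, InK m0 CL z → |∫ q, G q ∂z.Q - ∫ q, F q ∂z.Q| ≤ ε / 4 := by
    intro z hz
    have hFb : ∀ q, |F q - G q| ≤ 2 * C + 1 := fun q => by
      calc |F q - G q| ≤ |F q| + |G q| := abs_sub _ _
        _ ≤ _ := by linarith [f2 q, hC q]
    have i1 := St.integrable_bdd z.Q G hG C hC
    have i2 := St.integrable_bdd z.Q F f1.continuous.measurable (C + 1) f2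
    rw [abs_sub_comm, ← integral_sub i2 i1]
    refine (abs_integral_le_integral_abs).trans ?_
    refine (tail_bound hA.measurableSet z R (fun q => F q - G q) (f1.continuous.measurable.sub hG) (2 * C + 1) hFb hh f3
      (fun t => (f4 t).1) (2 * C + 1) (fun t => (f4 t).2) f5).trans ?_
    have h2 := (hR z hz).2
    calc _ ≤ ε / 8 + (2 * C + 1) * (ε / (8 * (2 * C + 1))) := by gcongr
      _ = ε / 4 := by field_simp; ring
  have hF := h.2 F f1.continuous ⟨_, f2⟩
  rw [Metric.tendsto_atTop] at hF
  obtain ⟨N, hN⟩ := hF (ε / 4) (by positivity)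
  refine ⟨N, fun n hn => ?_⟩
  have a1 := key (y n) (hy n)
  have a2 := key x hx
  have a3 := hN n hn
  rw [Real.dist_eq] at a3 ⊢
  rw [abs_lt] at a3 ⊢
  rw [abs_le] at a1 a2
  constructor <;> linarith [a1.1, a1.2, a2.1, a2.2, a3.1, a3.2]

variable {ι : Type*} [Fintype ι]

/-- CONT(i), uniform form. -/
theorem sup_close (T : ℝ) (Kc : Set (ℝ × ℝ)) (hK : IsCompact Kc) (F : ℝ → ℝ → (ι → ℝ) → ℝ → ℝ)
    (hF : Measurable fun q : ℝ × ℝ × (ι → ℝ) × ℝ => F q.1 q.2.1 q.2.2.1 q.2.2.2)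
    (C : ℝ) (hC : ∀ t x z a, |F t x z a| ≤ C)
    (hc : ∀ t, ContinuousOn (fun q : (ι → ℝ) × ℝ × ℝ => F t q.2.1 q.1 q.2.2) (univ ×ˢ Kc))
    (H : ℝ) (ζ0 : ℝ → ι → ℝ) (hζ0 : Measurable ζ0) (hb0 : ∀ t, ‖ζ0 t‖ ≤ H) (τ : ℝ) (hτ : 0 < τ) :
    ∃ δ > 0, ∀ ζ : ℝ → ι → ℝ, Measurable ζ → (∀ t, ‖ζ t‖ ≤ H) → ∫ t in Icc 0 T, ‖ζ t - ζ0 t‖ < δ →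
      ∃ hh : ℝ → ℝ, Measurable hh ∧ (∀ t, 0 ≤ hh t) ∧ (∀ t, hh t ≤ 2 * C) ∧
        (∀ t, ∀ p ∈ Kc, |F t p.1 (ζ t) p.2 - F t p.1 (ζ0 t) p.2| ≤ hh t) ∧ ∫ t in Icc 0 T, hh t ≤ τ := by
  by_contra hcon
  push Not at hcon
  have hcon' : ∀ n : ℕ, _ := fun n => hcon (1 / ((n:ℝ) + 1)) (by positivity)
  choose ζ z1 z2 z3 z4 using hcon'
  have hi : ∀ n, Integrable (fun t => ζ n t - ζ0 t) (volume.restrict (Icc 0 T)) := by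
    intro n
    refine Integrable.of_bound ((z1 n).sub hζ0).aestronglyMeasurable (H + H) (Eventually.of_forall fun t => ?_)
    exact (norm_sub_le _ _).trans (add_le_add (z2 n t) (hb0 t))
  have hi0 : Integrable ζ0 (volume.restrict (Icc 0 T)) :=
    Integrable.of_bound hζ0.aestronglyMeasurable H (Eventually.of_forall hb0)
  have hlim : Tendsto (fun n => eLpNorm (ζ n - ζ0) 1 (volume.restrict (Icc 0 T))) atTop (𝓝 0) := by
    have e : ∀ n, eLpNorm (ζ n - ζ0) 1 (volume.restrict (Icc 0 T))
        = ENNReal.ofReal (∫ t in Icc 0 T, ‖ζ n t - ζ0 t‖) := by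
      intro n
      rw [eLpNorm_one_eq_lintegral_enorm, ofReal_integral_norm_eq_lintegral_enorm (hi n)]
      rfl
    simp only [e]
    rw [← ENNReal.ofReal_zero]
    apply ENNReal.tendsto_ofReal
    refine squeeze_zero (fun n => integral_nonneg fun t => norm_nonneg _) (fun n => (z3 n).le)
      tendsto_one_div_add_atTop_nhds_zero_nat
  have hmeas := tendstoInMeasure_of_tendsto_eLpNorm one_ne_zero
    (fun n => (z1 n).aestronglyMeasurable) hζ0.aestronglyMeasurable hlim
  obtain ⟨φ, hφ, hae⟩ := hmeas.exists_seq_tendsto_ae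
  obtain ⟨hh, k1, k2, k3, k4, k5⟩ := sup_conv hK T (2 * C)
    (fun n t p => F t p.1 (ζ (φ n) t) p.2 - F t p.1 (ζ0 t) p.2)
    (by
      intro n t
      have hz : ∀ z : ι → ℝ, ContinuousOn (fun p : ℝ × ℝ => F t p.1 z p.2) Kc := by
        intro z
        exact (hc t).comp (f := fun p : ℝ × ℝ => (z, p)) (by fun_prop) (fun p hp => ⟨mem_univ _, hp⟩)
      exact (hz _).sub (hz _))
    (by
      intro n p
      apply Measurable.sub
      · exact hF.comp (f := fun t => (t, p.1, ζ (φ n) t, p.2))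
          (measurable_id.prodMk (measurable_const.prodMk ((z1 _).prodMk measurable_const)))
      · exact hF.comp (f := fun t => (t, p.1, ζ0 t, p.2))
          (measurable_id.prodMk (measurable_const.prodMk (hζ0.prodMk measurable_const))))
    (by
      intro n t p
      calc _ ≤ |F t p.1 (ζ (φ n) t) p.2| + |F t p.1 (ζ0 t) p.2| := abs_sub _ _
        _ ≤ _ := by linarith [hC t p.1 (ζ (φ n) t) p.2, hC t p.1 (ζ0 t) p.2])
    (by
      filter_upwards [hae] with t ht ε hε
      have hcpt : IsCompact ((Metric.closedBall (0 : ι → ℝ) H) ×ˢ Kc) := (isCompact_closedBall _ _).prod hK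
      have huc := hcpt.uniformContinuousOn_of_continuous ((hc t).mono (prod_mono (subset_univ _) subset_rfl))
      rw [Metric.uniformContinuousOn_iff] at huc
      obtain ⟨δ, hδ, hu⟩ := huc ε hε
      rw [Metric.tendsto_atTop] at ht
      obtain ⟨N, hN⟩ := ht δ hδ
      refine eventually_atTop.2 ⟨N, fun n hn p hp => ?_⟩
      have := hu (ζ (φ n) t, p) ⟨by simpa using z2 _ t, hp⟩ (ζ0 t, p) ⟨by simpa using hb0 t, hp⟩
        (by rw [Prod.dist_eq, dist_self]; exact max_lt (hN n hn) hδ)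
      rw [Real.dist_eq] at this
      exact this.le)
  obtain ⟨n, hn⟩ := (k5.eventually (gt_mem_nhds hτ)).exists
  exact absurd (z4 (φ n) (hh n) (k1 n) (fun t => k2 n t) (fun t => k3 n t) (k4 n)) (not_lt.2 hn.le)

/-- CONT(i). -/
theorem cont_coeff (hT : 0 ≤ T) (hA : IsCompact A) [IsProbabilityMeasure m0] (CL : ℝ) (hCL : 0 ≤ CL)
    (F : ℝ → ℝ → (ι → ℝ) → ℝ → ℝ)
    (hF : Measurable fun q : ℝ × ℝ × (ι → ℝ) × ℝ => F q.1 q.2.1 q.2.2.1 q.2.2.2)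
    (C : ℝ) (hC : ∀ t x z a, |F t x z a| ≤ C)
    (hc : ∀ t, ContinuousOn (fun q : (ι → ℝ) × ℝ × ℝ => F t q.2.1 q.1 q.2.2) (univ ×ˢ (closure O ×ˢ A)))
    (H : ℝ) (ζ0 : ℝ → ι → ℝ) (hζ0 : Measurable ζ0) (hb0 : ∀ t, ‖ζ0 t‖ ≤ H) (τ : ℝ) (hτ : 0 < τ) :
    ∃ δ > 0, ∀ ζ : ℝ → ι → ℝ, Measurable ζ → (∀ t, ‖ζ t‖ ≤ H) → ∫ t in Icc 0 T, ‖ζ t - ζ0 t‖ < δ →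
      ∀ y : St T O A, InK m0 CL y →
        ∫ q, |F q.1 q.2.1 (ζ q.1) q.2.2 - F q.1 q.2.1 (ζ0 q.1) q.2.2| ∂y.Q ≤ τ := by
  have hC0 : 0 ≤ C := (abs_nonneg _).trans (hC 0 0 0 0)
  obtain ⟨R, hR1, hR⟩ := InK.tail (T := T) (O := O) (A := A) (m0 := m0) hT hA.measurableSet CL hCL
    (τ / (2 * (2 * C + 1))) (by positivity)
  obtain ⟨δ, hδ, hmain⟩ := sup_close T _ (compact_slab (O := O) hA R) F hF C hC
    (fun t => (hc t).mono (prod_mono subset_rfl (prod_mono inter_subset_left subset_rfl))) H ζ0 hζ0 hb0 (τ / 2) (by positivity)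
  refine ⟨δ, hδ, fun ζ hζ hb hd y hy => ?_⟩
  obtain ⟨hh, k1, k2, k3, k4, k5⟩ := hmain ζ hζ hb hd
  have hm : ∀ ζ : ℝ → ι → ℝ, Measurable ζ → Measurable (fun q : ℝ × ℝ × ℝ => F q.1 q.2.1 (ζ q.1) q.2.2) := by
    intro ζ hζ
    exact hF.comp (f := fun q : ℝ × ℝ × ℝ => (q.1, q.2.1, ζ q.1, q.2.2))
      (measurable_fst.prodMk (measurable_snd.fst.prodMk ((hζ.comp measurable_fst).prodMk measurable_snd.snd)))
  refine (tail_bound hA.measurableSet y R _ ((hm ζ hζ).sub (hm ζ0 hζ0)) (2 * C + 1) (fun q => ?_) hh k1 k2 (2 * C) k3 k4).trans ?_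
  · refine (abs_sub _ _).trans ?_
    linarith [hC q.1 q.2.1 (ζ q.1) q.2.2, hC q.1 q.2.1 (ζ0 q.1) q.2.2]
  · have h2 := (hR y hy).2
    calc _ ≤ τ / 2 + (2 * C + 1) * (τ / (2 * (2 * C + 1))) := by gcongr
      _ = τ := by field_simp; ring
end
end

section
open MeasureTheory Filter Set Topology
open ProbabilityTheory
set_option linter.all false

/-! ### Bounded variation argument -/

lemma ibp_aux (T : ℝ) (hT : 0 < T) (p p' : ℝ → ℝ) (hp' : Continuous p') (hp : ∀ t, HasDerivAt p (p' t) t)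
    (c L : ℝ) (hc : ∀ t, |p t| ≤ c) (hL : ∀ t, |p' t| ≤ L) (D : ℝ → ℝ) (hD : Measurable D) (B : ℝ) (hB : ∀ t, |D t| ≤ B) :
    |∫ t in Icc 0 T, p t * D t| ≤ c * |∫ t in Icc 0 T, D t| +
      L * ∫ r in Icc 0 T, |∫ t in Icc 0 T, (if t ≤ r then 1 else 0) * D t| := by
  have hpc : Continuous p := continuous_iff_continuousAt.2 fun t => (hp t).continuousAt
  have hiD : Integrable D (volume.restrict (Icc 0 T)) := St.integrable_bdd _ D hD B hB
  have hm2 : Measurable fun z : ℝ × ℝ => (if z.1 ≤ z.2 then (1:ℝ) else 0) :=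
    Measurable.ite (measurableSet_le measurable_fst measurable_snd) measurable_const measurable_const
  have hL0 : 0 ≤ L := (abs_nonneg _).trans (hL 0)
  have hB0 : 0 ≤ B := (abs_nonneg _).trans (hB 0)
  have hb2 : ∀ z : ℝ × ℝ, |(if z.1 ≤ z.2 then (1:ℝ) else 0)| ≤ 1 := by
    intro z; split_ifs <;> simp
  have hrep : ∀ t ∈ Icc 0 T, p t = p T - ∫ r in Icc 0 T, (if t ≤ r then 1 else 0) * p' r := by
    intro t ht
    have h1 : ∫ r in t..T, p' r = p T - p t :=
      intervalIntegral.integral_eq_sub_of_hasDerivAt (fun r _ => hp r) (hp'.intervalIntegrable _ _)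
    have h2 : ∫ r in Icc 0 T, (if t ≤ r then 1 else 0) * p' r = ∫ r in t..T, p' r := by
      rw [intervalIntegral.integral_of_le ht.2, ← integral_Icc_eq_integral_Ioc]
      rw [← integral_indicator measurableSet_Icc, ← integral_indicator measurableSet_Icc]
      congr 1
      ext r
      by_cases h1 : t ≤ r <;> by_cases h2 : r ≤ T <;> by_cases h3 : 0 ≤ r <;> simp [indicator, h1, h2, h3]
      exact absurd (ht.1.trans h1) h3
    rw [h2, h1]; ring
  have e1 : ∫ t in Icc 0 T, p t * D t = p T * (∫ t in Icc 0 T, D t) -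
      ∫ t in Icc 0 T, ∫ r in Icc 0 T, (if t ≤ r then 1 else 0) * p' r * D t := by
    rw [← integral_const_mul, ← integral_sub]
    · apply setIntegral_congr_fun measurableSet_Icc
      intro t ht
      simp only
      rw [hrep t ht, integral_mul_const]
      ring
    · exact hiD.const_mul _
    · have : Integrable (fun t => (p T - p t) * D t) (volume.restrict (Icc 0 T)) :=
        St.integrable_bdd _ _ ((measurable_const.sub hpc.measurable).mul hD) ((c + c) * B) (fun t => by
          rw [abs_mul]
          have h1 : |p T - p t| ≤ c + c := (abs_sub _ _).trans (add_le_add (hc _) (hc _))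
          exact mul_le_mul h1 (hB t) (abs_nonneg _) ((abs_nonneg _).trans h1))
      refine this.congr ?_
      filter_upwards [ae_restrict_mem measurableSet_Icc] with t ht
      rw [integral_mul_const]
      have := hrep t ht
      rw [show p T - p t = ∫ r in Icc 0 T, (if t ≤ r then 1 else 0) * p' r by linarith]
  have e2 : ∫ t in Icc 0 T, ∫ r in Icc 0 T, (if t ≤ r then 1 else 0) * p' r * D t
      = ∫ r in Icc 0 T, p' r * ∫ t in Icc 0 T, (if t ≤ r then 1 else 0) * D t := by
    rw [integral_integral_swap]
    · congr 1
      ext r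
      rw [← integral_const_mul]
      congr 1
      ext t
      ring
    · refine St.integrable_bdd _ _ ((hm2.mul (hp'.measurable.comp measurable_snd)).mul (hD.comp measurable_fst)) (1 * L * B) ?_
      intro z
      simp only [Function.uncurry, abs_mul]
      have := hb2 z
      gcongr
      · exact hL _
      · exact hB _
  rw [e1, e2]
  refine (abs_sub _ _).trans (add_le_add ?_ ?_)
  · rw [abs_mul]; gcongr; exact hc T
  · refine (abs_integral_le_integral_abs).trans ?_
    rw [← integral_const_mul]
    have hEm : Measurable fun r => ∫ t in Icc 0 T, (if t ≤ r then (1:ℝ) else 0) * D t := by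
      have : StronglyMeasurable (fun z : ℝ × ℝ => (if z.2 ≤ z.1 then (1:ℝ) else 0) * D z.2) :=
        ((Measurable.ite (measurableSet_le measurable_snd measurable_fst) measurable_const measurable_const).mul
          (hD.comp measurable_snd)).stronglyMeasurable
      exact (this.integral_prod_right' (ν := volume.restrict (Icc 0 T))).measurable
    have hEb : ∀ r, |∫ t in Icc 0 T, (if t ≤ r then (1:ℝ) else 0) * D t| ≤ B * T := by
      intro r
      have := norm_integral_le_of_norm_le_const (μ := volume.restrict (Icc 0 T)) (f := fun t => (if t ≤ r then (1:ℝ) else 0) * D t) (C := B)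
        (Eventually.of_forall fun t => by
          rw [Real.norm_eq_abs, abs_mul]
          have := hb2 (t, r)
          simp only at this
          calc _ ≤ 1 * B := mul_le_mul this (hB t) (abs_nonneg _) zero_le_one
            _ = B := one_mul _)
      simpa [Measure.real, hT.le] using this
    apply integral_mono_of_nonneg (Eventually.of_forall fun r => abs_nonneg _)
    · exact ((St.integrable_bdd _ _ hEm (B * T) hEb).abs).const_mul L
    · refine Eventually.of_forall fun r => ?_
      simp only [abs_mul]
      gcongr
      exact hL r

theorem bv_l1 (T : ℝ) (hT : 0 < T) (D : ℕ → ℝ → ℝ) (hD : ∀ n, Measurable (D n)) (B : ℝ) (hB : ∀ n t, |D n t| ≤ B)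
    (M : ℝ) (hM0 : 0 ≤ M)
    (hM : ∀ n, ∀ η η' : ℝ → ℝ, Continuous η → Continuous η' → (∀ t, HasDerivAt η (η' t) t) →
      ∀ e, (∀ t, |η t| ≤ e) → (∃ e', ∀ t, |η' t| ≤ e') → |∫ t in Icc 0 T, η' t * D n t| ≤ M * e)
    (hl : ∀ r, Tendsto (fun n => ∫ t in Icc 0 T, (if t ≤ r then 1 else 0) * D n t) atTop (𝓝 0)) :
    Tendsto (fun n => ∫ t in Icc 0 T, |D n t|) atTop (𝓝 0) := by
  have hB0 : 0 ≤ B := (abs_nonneg _).trans (hB 0 0)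
  have hiD : ∀ n, Integrable (D n) (volume.restrict (Icc 0 T)) := fun n => St.integrable_bdd _ _ (hD n) B (hB n)
  have hb2 : ∀ t r : ℝ, |(if t ≤ r then (1:ℝ) else 0)| ≤ 1 := by
    intro t r; split_ifs <;> simp
  -- main bound
  have main : ∀ n, ∀ h > 0, ∀ ε > 0, ∫ t in Icc 0 T, |D n t| ≤ B * ε + (M * (2 * h) + (2 * |∫ t in Icc 0 T, D n t| +
      4 / h * ∫ r in Icc 0 T, |∫ t in Icc 0 T, (if t ≤ r then 1 else 0) * D n t|)) := by
    intro n h hh0 ε hε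
    let sg : ℝ → ℝ := fun t => if 0 ≤ D n t then (1:ℝ) else -1
    have hsm : Measurable sg :=
      Measurable.ite (measurableSet_le measurable_const (hD n)) measurable_const measurable_const
    have hsg1 : ∀ t, |sg t| ≤ 1 := by
      intro t; simp only [sg]; split_ifs <;> simp
    have hsg2 : ∀ t, |D n t| = sg t * D n t := by
      intro t; simp only [sg]; split_ifs with h
      · rw [abs_of_nonneg h, one_mul]
      · rw [abs_of_neg (not_le.1 h)]; ring
    obtain ⟨F, hh, f1, f2, f3, f4, f5, f6⟩ := carath_approx (isCompact_singleton (x := (0 : ℝ × ℝ))) T 1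
      (fun t _ => sg t) (fun t => continuousOn_const)
      (fun p => hsm) (fun t p => hsg1 t) ε hε
    let s : ℝ → ℝ := fun t => F (t, 0)
    have hsc : Continuous s := f1.continuous.comp (by fun_prop)
    have hs2 : ∀ t, |s t| ≤ 2 := fun t => (f2 _).trans (by norm_num)
    let S : ℝ → ℝ := fun t => ∫ r in (0:ℝ)..t, s r
    have hS : ∀ t, HasDerivAt S (s t) t := fun t => hsc.integral_hasStrictDerivAt 0 t |>.hasDerivAt
    have hScont : Continuous S := continuous_iff_continuousAt.2 fun t => (hS t).continuousAt
    have hSlip : ∀ a b, |S a - S b| ≤ 2 * |a - b| := by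
      intro a b
      have : LipschitzWith 2 S := lipschitzWith_of_nnnorm_deriv_le (fun t => (hS t).differentiableAt) (fun t => by
        rw [(hS t).deriv]
        have := hs2 t
        rw [← NNReal.coe_le_coe]
        simpa using this)
      simpa [Real.dist_eq] using this.dist_le_mul a b
    let SS : ℝ → ℝ := fun t => ∫ r in (0:ℝ)..t, S r
    have hSS : ∀ t, HasDerivAt SS (S t) t := fun t => hScont.integral_hasStrictDerivAt 0 t |>.hasDerivAt
    let η : ℝ → ℝ := fun t => S t - (SS (t + h) - SS t) / h
    let p : ℝ → ℝ := fun t => (S (t + h) - S t) / h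
    let p' : ℝ → ℝ := fun t => (s (t + h) - s t) / h
    have hsh : ∀ (f f' : ℝ → ℝ), (∀ t, HasDerivAt f (f' t) t) → ∀ t, HasDerivAt (fun t => (f (t + h) - f t) / h) ((f' (t + h) - f' t) / h) t := by
      intro f f' hf t
      exact (((hf (t + h)).comp_add_const t h).sub (hf t)).div_const h
    have hp : ∀ t, HasDerivAt p (p' t) t := hsh S s hS
    have hη : ∀ t, HasDerivAt η (s t - p t) t := fun t => (hS t).sub (hsh SS S hSS t)
    have hp'c : Continuous p' := by fun_prop
    have hpc : Continuous p := by fun_prop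
    have hp2 : ∀ t, |p t| ≤ 2 := by
      intro t
      simp only [p, abs_div, abs_of_pos hh0]
      rw [div_le_iff₀ hh0]
      have := hSlip (t + h) t
      rwa [add_sub_cancel_left, abs_of_pos hh0] at this
    have hp'4 : ∀ t, |p' t| ≤ 4 / h := by
      intro t
      simp only [p', abs_div, abs_of_pos hh0]
      gcongr
      exact (abs_sub _ _).trans (by linarith [hs2 (t + h), hs2 t])
    have hηb : ∀ t, |η t| ≤ 2 * h := by
      intro t
      obtain ⟨ξ, hξ, e⟩ := exists_hasDerivAt_eq_slope SS S (by linarith : t < t + h)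
        (fun r _ => (hSS r).continuousAt.continuousWithinAt) (fun r _ => hSS r)
      rw [add_sub_cancel_left] at e
      simp only [η, ← e]
      refine (hSlip t ξ).trans ?_
      rw [abs_of_nonpos (by linarith [hξ.1])]
      linarith [hξ.2]
    have k1 := hM n η (fun t => s t - p t) (continuous_iff_continuousAt.2 fun t => (hη t).continuousAt) (hsc.sub hpc) hη (2 * h) hηb
      ⟨4, fun t => (abs_sub _ _).trans (by linarith [hs2 t, hp2 t])⟩
    have k2 := ibp_aux T hT p p' hp'c hp 2 (4 / h) hp2 hp'4 (D n) (hD n) B (hB n)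
    have i1 : Integrable (fun t => (s t - p t) * D n t) (volume.restrict (Icc 0 T)) :=
      St.integrable_bdd _ _ ((hsc.sub hpc).measurable.mul (hD n)) (4 * B) (fun t => by
        rw [abs_mul]
        have h1 : |s t - p t| ≤ 4 := (abs_sub _ _).trans (by linarith [hs2 t, hp2 t])
        exact mul_le_mul h1 (hB n t) (abs_nonneg _) (by norm_num))
    have i2 : Integrable (fun t => p t * D n t) (volume.restrict (Icc 0 T)) :=
      St.integrable_bdd _ _ (hpc.measurable.mul (hD n)) (2 * B) (fun t => by
        rw [abs_mul]
        exact mul_le_mul (hp2 t) (hB n t) (abs_nonneg _) (by norm_num))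
    have i3 : Integrable hh (volume.restrict (Icc 0 T)) :=
      St.integrable_bdd _ _ f3 3 (fun t => by rw [abs_of_nonneg (f4 t).1]; linarith [(f4 t).2])
    have k3 : ∫ t in Icc 0 T, |D n t| ≤ ∫ t in Icc 0 T, (B * hh t + ((s t - p t) * D n t + p t * D n t)) := by
      apply integral_mono (hiD n).abs ((i3.const_mul B).add (i1.add i2))
      intro t
      simp only [Pi.add_apply]
      have h1 := hsg2 t
      have h2 := f5 t 0 rfl
      have h3 : (sg t - s t) * D n t ≤ hh t * B := by
        refine (le_abs_self _).trans ?_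
        rw [abs_mul, abs_sub_comm]
        exact mul_le_mul h2 (hB n t) (abs_nonneg _) (f4 t).1
      rw [h1]
      nlinarith
    have i12 : Integrable (fun t => (s t - p t) * D n t + p t * D n t) (volume.restrict (Icc 0 T)) := i1.add i2
    rw [integral_add (i3.const_mul B) i12, integral_add i1 i2, integral_const_mul] at k3
    refine k3.trans (add_le_add (by gcongr) (add_le_add ?_ ?_))
    · exact (le_abs_self _).trans k1
    · exact (le_abs_self _).trans k2
  have hE : ∀ n r, |∫ t in Icc 0 T, (if t ≤ r then (1:ℝ) else 0) * D n t| ≤ B * T := by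
    intro n r
    have := norm_integral_le_of_norm_le_const (μ := volume.restrict (Icc 0 T)) (f := fun t => (if t ≤ r then (1:ℝ) else 0) * D n t) (C := B)
        (Eventually.of_forall fun t => by
          rw [Real.norm_eq_abs, abs_mul]
          have := hb2 t r
          calc _ ≤ 1 * B := mul_le_mul this (hB n t) (abs_nonneg _) zero_le_one
            _ = B := one_mul _)
    simpa [Measure.real, hT.le] using this
  have hEm : ∀ n, Measurable fun r => ∫ t in Icc 0 T, (if t ≤ r then (1:ℝ) else 0) * D n t := by
    intro n
    have : StronglyMeasurable (fun z : ℝ × ℝ => (if z.2 ≤ z.1 then (1:ℝ) else 0) * D n z.2) :=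
        ((Measurable.ite (measurableSet_le measurable_snd measurable_fst) measurable_const measurable_const).mul
          ((hD n).comp measurable_snd)).stronglyMeasurable
    exact (this.integral_prod_right' (ν := volume.restrict (Icc 0 T))).measurable
  have l1 : Tendsto (fun n => ∫ t in Icc 0 T, D n t) atTop (𝓝 0) := by
    refine (hl T).congr fun n => ?_
    apply setIntegral_congr_fun measurableSet_Icc
    intro t ht
    simp [ht.2]
  have l2 : Tendsto (fun n => ∫ r in Icc 0 T, |∫ t in Icc 0 T, (if t ≤ r then (1:ℝ) else 0) * D n t|) atTop (𝓝 0) := by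
    have := tendsto_integral_of_dominated_convergence (μ := volume.restrict (Icc 0 T)) (f := fun _ => (0:ℝ))
      (F := fun n r => |∫ t in Icc 0 T, (if t ≤ r then (1:ℝ) else 0) * D n t|) (fun _ => B * T)
      (fun n => (hEm n).abs.aestronglyMeasurable) (integrable_const _)
      (fun n => Eventually.of_forall fun r => by rw [Real.norm_eq_abs, abs_abs]; exact hE n r)
      (Eventually.of_forall fun r => by simpa using (hl r).abs)
    simpa using this
  rw [Metric.tendsto_atTop]
  intro ε hε
  set h : ℝ := ε / (4 * (2 * M + 1)) with hh
  have hh0 : 0 < h := by positivity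
  have l3 : Tendsto (fun n => (2 * |∫ t in Icc 0 T, D n t| +
      4 / h * ∫ r in Icc 0 T, |∫ t in Icc 0 T, (if t ≤ r then (1:ℝ) else 0) * D n t|)) atTop (𝓝 0) := by
    have := (l1.abs.const_mul 2).add (l2.const_mul (4 / h))
    simpa using this
  obtain ⟨N, hN⟩ := Metric.tendsto_atTop.1 l3 (ε / 4) (by positivity)
  refine ⟨N, fun n hn => ?_⟩
  have h1 := main n h hh0 (ε / (4 * (B + 1))) (by positivity)
  have h2 := hN n hn
  rw [Real.dist_eq, sub_zero] at h2 ⊢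
  rw [abs_of_nonneg (integral_nonneg fun t => abs_nonneg _)]
  have h3 := (abs_lt.1 h2).2
  have h4 : B * (ε / (4 * (B + 1))) ≤ ε / 4 := by
    rw [← mul_div_assoc, div_le_div_iff₀ (by positivity) (by positivity)]; nlinarith
  have h5 : M * (2 * h) ≤ ε / 4 := by
    rw [hh, show M * (2 * (ε / (4 * (2 * M + 1)))) = (2 * M * ε) / (4 * (2 * M + 1)) by ring, div_le_div_iff₀ (by positivity) (by positivity)]; nlinarith
  linarith
end

section
open MeasureTheory Filter Set Topology
open ProbabilityTheory
set_option linter.all false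

section
variable {T : ℝ} {O A : Set ℝ} {m0 : Measure ℝ}

lemma hasDerivAt_slice1 (χ : ℝ × ℝ → ℝ) (h : Differentiable ℝ χ) (t x : ℝ) :
    HasDerivAt (fun s => χ (s, x)) (fderiv ℝ χ (t, x) (1, 0)) t := by
  have h1 : HasDerivAt (fun s : ℝ => (s, x)) ((1 : ℝ), (0 : ℝ)) t := (hasDerivAt_id t).prodMk (hasDerivAt_const t x)
  exact (h (t, x)).hasFDerivAt.comp_hasDerivAt t h1

lemma hasDerivAt_slice2 (χ : ℝ × ℝ → ℝ) (h : Differentiable ℝ χ) (t x : ℝ) :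
    HasDerivAt (fun s => χ (t, s)) (fderiv ℝ χ (t, x) (0, 1)) x := by
  have h1 : HasDerivAt (fun s : ℝ => (t, s)) ((0 : ℝ), (1 : ℝ)) x := (hasDerivAt_const x t).prodMk (hasDerivAt_id x)
  exact (h (t, x)).hasFDerivAt.comp_hasDerivAt x h1

lemma Cc2 (χ : ℝ × ℝ → ℝ) (h : ContDiff ℝ 2 χ) (hs : HasCompactSupport χ) :
    ∃ χt χx χxx : ℝ × ℝ → ℝ, Continuous χt ∧ Continuous χx ∧ Continuous χxx ∧
      (∀ t x, HasDerivAt (fun s => χ (s, x)) (χt (t, x)) t) ∧ (∀ t x, HasDerivAt (fun s => χ (t, s)) (χx (t, x)) x) ∧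
      (∀ t x, HasDerivAt (fun s => χx (t, s)) (χxx (t, x)) x) ∧
      ∃ C, 0 ≤ C ∧ ∀ p, |χ p| ≤ C ∧ |χt p| ≤ C ∧ |χx p| ≤ C ∧ |χxx p| ≤ C := by
  have hf : ContDiff ℝ 1 (fderiv ℝ χ) := h.fderiv_right (by norm_num)
  have e : ∀ v : ℝ × ℝ, ContDiff ℝ 1 (fun p => fderiv ℝ χ p v) := fun v => hf.clm_apply contDiff_const
  have es : ∀ (f : ℝ × ℝ → ℝ), HasCompactSupport f → ∀ v : ℝ × ℝ, HasCompactSupport (fun p => fderiv ℝ f p v) :=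
    fun f hf v => hf.fderiv_apply ℝ v
  have e2 : Continuous (fun p => fderiv ℝ (fun p => fderiv ℝ χ p (0, 1)) p (0, 1)) :=
    ((e (0,1)).continuous_fderiv (by norm_num)).clm_apply continuous_const
  refine ⟨fun p => fderiv ℝ χ p (1, 0), fun p => fderiv ℝ χ p (0, 1), fun p => fderiv ℝ (fun p => fderiv ℝ χ p (0, 1)) p (0, 1),
    (e _).continuous, (e _).continuous, e2, ?_, ?_, ?_, ?_⟩
  · exact fun t x => hasDerivAt_slice1 χ (h.differentiable (by norm_num)) t x
  · exact fun t x => hasDerivAt_slice2 χ (h.differentiable (by norm_num)) t x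
  · exact fun t x => hasDerivAt_slice2 _ ((e (0,1)).differentiable (by norm_num)) t x
  · obtain ⟨C1, h1⟩ := hs.exists_bound_of_continuous h.continuous
    obtain ⟨C2, h2⟩ := (es χ hs (1,0)).exists_bound_of_continuous (e _).continuous
    obtain ⟨C3, h3⟩ := (es χ hs (0,1)).exists_bound_of_continuous (e _).continuous
    obtain ⟨C4, h4⟩ := (es _ (es χ hs (0,1)) (0,1)).exists_bound_of_continuous e2
    refine ⟨max (max C1 C2) (max C3 C4), ?_, fun p => ⟨?_, ?_, ?_, ?_⟩⟩
    · exact ((norm_nonneg _).trans (h1 0)).trans ((le_max_left _ _).trans (le_max_left _ _))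
    · exact (h1 p).trans ((le_max_left _ _).trans (le_max_left _ _))
    · exact (h2 p).trans ((le_max_right _ _).trans (le_max_left _ _))
    · exact (h3 p).trans ((le_max_left _ _).trans (le_max_right _ _))
    · exact (h4 p).trans ((le_max_right _ _).trans (le_max_right _ _))

/-- smooth compactly supported approximation on the slab -/
lemma smooth_hat (T : ℝ) (hat : ℝ × ℝ → ℝ) (hc : Continuous hat) (C : ℝ) (hC : ∀ p, |hat p| ≤ C) (R ε : ℝ) (hε : 0 < ε) :
    ∃ (χ : ℝ × ℝ → ℝ) (hh : ℝ → ℝ), ContDiff ℝ 2 χ ∧ HasCompactSupport χ ∧ (∀ p, |χ p| ≤ C + 1) ∧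
      Measurable hh ∧ (∀ t, 0 ≤ hh t ∧ hh t ≤ 2 * C + 1) ∧ (∀ t, ∀ x ∈ Icc (-R) R, |hat (t, x) - χ (t, x)| ≤ hh t) ∧
      ∫ t in Icc 0 T, hh t ≤ ε := by
  have hC0 : 0 ≤ C := (abs_nonneg _).trans (hC 0)
  obtain ⟨F, hh, f1, f2, f3, f4, f5, f6⟩ := carath_approx (isCompact_Icc.prod (isCompact_singleton (x := (0:ℝ))) : IsCompact (Icc (-R) R ×ˢ {(0:ℝ)})) T C
      (fun t p => hat (t, p.1)) (fun t => (hc.comp (by fun_prop)).continuousOn)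
      (fun p => (hc.comp (by fun_prop : Continuous fun t : ℝ => (t, p.1))).measurable) (fun t p => hC _) ε hε
  let φ : ContDiffBump (0 : ℝ × ℝ) := ⟨|R| + |T| + 1, |R| + |T| + 2, by positivity, by linarith⟩
  have hφ : ∀ p : ℝ × ℝ, p.1 ∈ Icc 0 T → p.2 ∈ Icc (-R) R → φ p = 1 := by
    intro p h1 h2
    apply φ.one_of_mem_closedBall
    rw [mem_closedBall_zero_iff, Prod.norm_def]
    refine max_le ?_ ?_
    · rw [Real.norm_eq_abs, abs_le]
      have := le_abs_self T; have := abs_nonneg R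
      constructor <;> simp only [φ] <;> linarith [h1.1, h1.2]
    · rw [Real.norm_eq_abs, abs_le]
      have := le_abs_self R; have := abs_nonneg T
      constructor <;> simp only [φ] <;> linarith [h2.1, h2.2]
  have hχb : ∀ p : ℝ × ℝ, |F (p.1, p.2, 0) * φ p| ≤ C + 1 := by
    intro p
    rw [abs_mul, abs_of_nonneg φ.nonneg]
    have := f2 (p.1, p.2, 0)
    have := φ.le_one (x := p)
    have := φ.nonneg (x := p)
    nlinarith [abs_nonneg (F (p.1, p.2, 0))]
  refine ⟨fun p => F (p.1, p.2, 0) * φ p, fun t => if t ∈ Icc 0 T then hh t else 2 * C + 1, ?_, ?_, hχb, ?_, ?_, ?_, ?_⟩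
  · exact (f1.comp (by fun_prop)).mul φ.contDiff
  · exact φ.hasCompactSupport.mul_left
  · exact Measurable.ite measurableSet_Icc f3 measurable_const
  · intro t; dsimp only; split_ifs with h
    · exact f4 t
    · constructor <;> linarith
  · intro t x hx
    dsimp only; split_ifs with h
    · have := f5 t (x, 0) ⟨hx, rfl⟩
      rw [hφ (t, x) h hx, mul_one, abs_sub_comm]
      exact this
    · refine (abs_sub _ _).trans ?_
      have := hC (t, x); have := hχb (t, x); simp only at this
      linarith
  · refine le_trans (le_of_eq ?_) f6
    apply setIntegral_congr_fun measurableSet_Icc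
    intro t ht
    simp only [ht, if_true]

/-- One-sided bounded variation estimate. -/
lemma InK.bv (hT : 0 ≤ T) [IsProbabilityMeasure m0] (CL : ℝ) (hCL : 0 ≤ CL) (χ : ℝ × ℝ → ℝ) (h : ContDiff ℝ 2 χ) (hs : HasCompactSupport χ) :
    ∃ M, 0 ≤ M ∧ ∀ y : St T O A, InK m0 CL y → ∀ η η' : ℝ → ℝ, Continuous η → Continuous η' → (∀ t, HasDerivAt η (η' t) t) →
      ∀ e, (∀ t, |η t| ≤ e) → (∃ e', ∀ t, |η' t| ≤ e') → |∫ q, η' q.1 * χ (q.1, q.2.1) ∂y.Q| ≤ M * e := by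
  obtain ⟨χt, χx, χxx, ct, cx, cxx, dt, dx, dxx, C, hC0, hC⟩ := Cc2 χ h hs
  refine ⟨2 * C + C * T + CL * (2 * C) * T, by positivity, ?_⟩
  intro y hy
  have key : ∀ η η' : ℝ → ℝ, Continuous η → Continuous η' → (∀ t, HasDerivAt η (η' t) t) →
      ∀ e, (∀ t, |η t| ≤ e) → (∃ e', ∀ t, |η' t| ≤ e') → -∫ q, η' q.1 * χ (q.1, q.2.1) ∂y.Q ≤ (2 * C + C * T + CL * (2 * C) * T) * e := by
    intro η η' hη hη' dη e he ⟨e', he'⟩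
    have he0 : 0 ≤ e := (abs_nonneg _).trans (he 0)
    have he0' : 0 ≤ e' := (abs_nonneg _).trans (he' 0)
    have b : ∀ (p : ℝ → ℝ) (q : ℝ × ℝ → ℝ) (E : ℝ), (∀ t, |p t| ≤ E) → (∀ z, |q z| ≤ C) → ∀ t x, |p t * q (t, x)| ≤ E * C := by
      intro p q E h1 h2 t x
      rw [abs_mul]
      exact mul_le_mul (h1 t) (h2 _) (abs_nonneg _) ((abs_nonneg _).trans (h1 t))
    have b1 := b η χ e he (fun p => (hC p).1)
    have b2 := b η χt e he (fun p => (hC p).2.1)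
    have b3 := b η' χ e' he' (fun p => (hC p).1)
    have b4 := b η χx e he (fun p => (hC p).2.2.1)
    have b5 := b η χxx e he (fun p => (hC p).2.2.2)
    have hB : ∀ t x, |η t * χ (t, x)| ≤ e * C + e' * C ∧ |η' t * χ (t, x) + η t * χt (t, x)| ≤ e * C + e' * C ∧
        |η t * χx (t, x)| ≤ e * C + e' * C ∧ |η t * χxx (t, x)| ≤ e * C + e' * C := by
      intro t x
      have h1 : 0 ≤ e * C := by positivity
      have h2 : 0 ≤ e' * C := by positivity
      refine ⟨(b1 t x).trans (by linarith), (abs_add_le _ _).trans (by linarith [b2 t x, b3 t x]), (b4 t x).trans (by linarith), (b5 t x).trans (by linarith)⟩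
    have c1 : Continuous fun p : ℝ × ℝ => η p.1 * χ (p.1, p.2) := (hη.comp continuous_fst).mul h.continuous
    have c2 : Continuous fun p : ℝ × ℝ => η' p.1 * χ (p.1, p.2) + η p.1 * χt (p.1, p.2) :=
      ((hη'.comp continuous_fst).mul h.continuous).add ((hη.comp continuous_fst).mul ct)
    have c3 : Continuous fun p : ℝ × ℝ => η p.1 * χx (p.1, p.2) := (hη.comp continuous_fst).mul cx
    have c4 : Continuous fun p : ℝ × ℝ => η p.1 * χxx (p.1, p.2) := (hη.comp continuous_fst).mul cxx
    have hTst : Tst T O (fun t x => η t * χ (t, x)) (fun t x => η' t * χ (t, x) + η t * χt (t, x)) (fun t x => η t * χx (t, x)) (fun t x => η t * χxx (t, x)) := by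
      refine ⟨⟨c1.continuousOn, c2.continuousOn, c3.continuousOn, c4.continuousOn, ?_, ?_, ?_, ⟨_, fun t _ x _ => hB t x⟩⟩, c1, c2, c3, c4, ⟨_, by positivity, hB⟩⟩
      · intro t _ x _
        exact ((dη t).mul (dt t x)).hasDerivWithinAt
      · intro t _ x _
        exact ((dx t x).const_mul (η t)).hasDerivWithinAt
      · intro t _ x _
        exact ((dxx t x).const_mul (η t)).hasDerivWithinAt
    have k := hy _ _ _ _ hTst (CL * (2 * (e * C))) (fun t _ x _ => by
      gcongr; linarith [b4 t x, b5 t x])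
    have i1 : Integrable (fun q : ℝ × ℝ × ℝ => η' q.1 * χ (q.1, q.2.1)) y.Q :=
      St.integrable_bdd _ _ (Continuous.measurable ((hη'.comp continuous_fst).mul (h.continuous.comp (by fun_prop)))) _ (fun q => b3 _ _)
    have i2 : Integrable (fun q : ℝ × ℝ × ℝ => η q.1 * χt (q.1, q.2.1)) y.Q :=
      St.integrable_bdd _ _ (Continuous.measurable ((hη.comp continuous_fst).mul (ct.comp (by fun_prop)))) _ (fun q => b2 _ _)
    rw [integral_add i1 i2] at k
    have k1 : |∫ p : ℝ × ℝ, η p.1 * χ (p.1, p.2) ∂y.μ| ≤ e * C := by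
      have := norm_integral_le_of_norm_le_const (μ := y.μ) (f := fun p : ℝ × ℝ => η p.1 * χ (p.1, p.2)) (C := e * C) (Eventually.of_forall fun p => b1 _ _)
      simpa using this
    have k2 : |∫ x, η 0 * χ (0, x) ∂m0| ≤ e * C := by
      have := norm_integral_le_of_norm_le_const (μ := m0) (f := fun x => η 0 * χ (0, x)) (C := e * C) (Eventually.of_forall fun p => b1 _ _)
      simpa using this
    have k3 : |∫ q : ℝ × ℝ × ℝ, η q.1 * χt (q.1, q.2.1) ∂y.Q| ≤ e * C * T := by
      have := norm_integral_le_of_norm_le_const (μ := y.Q) (f := fun q : ℝ × ℝ × ℝ => η q.1 * χt (q.1, q.2.1)) (C := e * C) (Eventually.of_forall fun p => b2 _ _)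
      refine this.trans ?_
      gcongr
      have := ENNReal.toReal_mono ENNReal.ofReal_ne_top y.Q_univ
      rwa [ENNReal.toReal_ofReal hT] at this
    have := abs_le.1 k1; have := abs_le.1 k2; have := abs_le.1 k3
    nlinarith
  intro η η' hη hη' dη e he hx
  rw [abs_le]
  constructor
  · linarith [key η η' hη hη' dη e he hx]
  · have := key (fun t => - η t) (fun t => - η' t) hη.neg hη'.neg (fun t => (dη t).neg) e (fun t => by rw [abs_neg]; exact he t)
      (by obtain ⟨e', h⟩ := hx; exact ⟨e', fun t => by rw [abs_neg]; exact h t⟩)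
    simp only [neg_mul, integral_neg, neg_neg] at this
    exact this

/-- scalar version of the strong convergence of the statistics, smooth case -/
lemma z_conv_smooth (hT : 0 < T) (hA : IsCompact A) [IsProbabilityMeasure m0] (CL : ℝ) (hCL : 0 ≤ CL)
    (y : ℕ → St T O A) (hy : ∀ n, InK m0 CL (y n)) (x : St T O A) (h : St.Conv y x)
    (χ : ℝ × ℝ → ℝ) (hχ : ContDiff ℝ 2 χ) (hs : HasCompactSupport χ) :
    Tendsto (fun n => ∫ t in Icc 0 T, |(∫ p, χ (t, p.1) ∂((y n).κ t)) - ∫ p, χ (t, p.1) ∂(x.κ t)|) atTop (𝓝 0) := by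
  have hx := InK.closed CL y hy x h
  obtain ⟨_, _, _, _, _, _, _, _, _, C, hC0, hC⟩ := Cc2 χ hχ hs
  obtain ⟨M, hM0, hM⟩ := InK.bv (T := T) (O := O) (A := A) (m0 := m0) hT.le CL hCL χ hχ hs
  have hχm : Measurable fun q : ℝ × ℝ × ℝ => χ (q.1, q.2.1) := (hχ.continuous.comp (by fun_prop)).measurable
  have hzm : ∀ w : St T O A, Measurable fun t => ∫ p, χ (t, p.1) ∂(w.κ t) := fun w =>
    w.measurable_int_κ (fun t p => χ (t, p.1)) hχm
  have hzb : ∀ w : St T O A, ∀ t, |∫ p, χ (t, p.1) ∂(w.κ t)| ≤ C := fun w t => w.abs_int_κ_le (fun p => χ (t, p.1)) C (fun p => (hC _).1) t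
  have conv : ∀ (w : St T O A) (η : ℝ → ℝ), Measurable η → ∀ e, (∀ t, |η t| ≤ e) →
      ∫ q, η q.1 * χ (q.1, q.2.1) ∂w.Q = ∫ t in Icc 0 T, η t * ∫ p, χ (t, p.1) ∂(w.κ t) := by
    intro w η hη e he
    rw [w.integral_Q (fun q => η q.1 * χ (q.1, q.2.1))]
    · simp only [integral_const_mul]
    · exact St.integrable_bdd _ _ ((hη.comp measurable_fst).mul hχm) (e * C) (fun q => by
        rw [abs_mul]; exact mul_le_mul (he _) (hC _).1 (abs_nonneg _) ((abs_nonneg _).trans (he 0)))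
  have hIntg : ∀ (w : St T O A) (η : ℝ → ℝ), Measurable η → ∀ e, (∀ t, |η t| ≤ e) →
      Integrable (fun t => η t * ∫ p, χ (t, p.1) ∂(w.κ t)) (volume.restrict (Icc 0 T)) := by
    intro w η hη e he
    exact St.integrable_bdd _ _ (hη.mul (hzm w)) (e * C) (fun q => by
        rw [abs_mul]; exact mul_le_mul (he _) (hzb w _) (abs_nonneg _) ((abs_nonneg _).trans (he 0)))
  have diff : ∀ n (η : ℝ → ℝ), Measurable η → ∀ e, (∀ t, |η t| ≤ e) →
      ∫ t in Icc 0 T, η t * ((∫ p, χ (t, p.1) ∂((y n).κ t)) - ∫ p, χ (t, p.1) ∂(x.κ t)) =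
      ∫ q, η q.1 * χ (q.1, q.2.1) ∂(y n).Q - ∫ q, η q.1 * χ (q.1, q.2.1) ∂x.Q := by
    intro n η hη e he
    rw [conv _ η hη e he, conv _ η hη e he, ← integral_sub (hIntg _ η hη e he) (hIntg _ η hη e he)]
    simp only [mul_sub]
  apply bv_l1 T hT _ (fun n => (hzm _).sub (hzm _)) (C + C) (fun n t => (abs_sub _ _).trans (add_le_add (hzb _ _) (hzb _ _))) (M + M) (by positivity)
  · intro n η η' hη hη' dη e he ⟨e', he'⟩
    simp only [Pi.sub_apply]
    rw [diff n η' hη'.measurable e' he']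
    refine (abs_sub _ _).trans ?_
    have h1 := hM (y n) (hy n) η η' hη hη' dη e he ⟨e', he'⟩
    have h2 := hM x hx η η' hη hη' dη e he ⟨e', he'⟩
    linarith
  · intro r
    have hm : Measurable fun t : ℝ => (if t ≤ r then (1:ℝ) else 0) :=
      Measurable.ite measurableSet_Iic measurable_const measurable_const
    have hb : ∀ t : ℝ, |(if t ≤ r then (1:ℝ) else 0)| ≤ 1 := by intro t; split_ifs <;> simp
    have k := cont_Q hT.le hA CL hCL y hy x h (fun q => (if q.1 ≤ r then (1:ℝ) else 0) * χ (q.1, q.2.1))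
      ((hm.comp measurable_fst).mul hχm) (1 * C) (fun q => by
        rw [abs_mul]; exact mul_le_mul (hb _) (hC _).1 (abs_nonneg _) zero_le_one)
      (fun t => Continuous.continuousOn (by
        have : Continuous fun p : ℝ × ℝ => χ (t, p.1) := hχ.continuous.comp (by fun_prop)
        exact Continuous.mul (continuous_const (y := if t ≤ r then (1:ℝ) else 0)) this))
    have k2 := k.sub_const (∫ q, (if q.1 ≤ r then (1:ℝ) else 0) * χ (q.1, q.2.1) ∂x.Q)
    rw [sub_self] at k2
    refine k2.congr fun n => ?_
    simp only [Pi.sub_apply]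
    rw [diff n (fun t => if t ≤ r then (1:ℝ) else 0) hm 1 hb]

lemma z_conv1 (hT : 0 < T) (hA : IsCompact A) [IsProbabilityMeasure m0] (CL : ℝ) (hCL : 0 ≤ CL)
    (y : ℕ → St T O A) (hy : ∀ n, InK m0 CL (y n)) (x : St T O A) (h : St.Conv y x)
    (hat : ℝ × ℝ → ℝ) (hc : Continuous hat) (C : ℝ) (hC : ∀ p, |hat p| ≤ C) :
    Tendsto (fun n => ∫ t in Icc 0 T, |(∫ p, hat (t, p.1) ∂((y n).κ t)) - ∫ p, hat (t, p.1) ∂(x.κ t)|) atTop (𝓝 0) := by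
  have hx := InK.closed CL y hy x h
  have hC0 : 0 ≤ C := (abs_nonneg _).trans (hC 0)
  rw [Metric.tendsto_atTop]
  intro ε hε
  obtain ⟨R, hR, htail⟩ := InK.tail (T := T) (O := O) (A := A) (m0 := m0) hT.le hA.measurableSet CL hCL (ε / (8 * (2 * C + 1))) (by positivity)
  obtain ⟨χ, hh, c1, c2, c3, c4, c5, c6, c7⟩ := smooth_hat T hat hc C hC R (ε / 8) (by positivity)
  have hχm : Measurable fun q : ℝ × ℝ × ℝ => χ (q.1, q.2.1) := (c1.continuous.comp (by fun_prop)).measurable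
  have hhm : Measurable fun q : ℝ × ℝ × ℝ => hat (q.1, q.2.1) := (hc.comp (by fun_prop)).measurable
  have hdb : ∀ p, |hat p - χ p| ≤ 2 * C + 1 := fun p => (abs_sub _ _).trans (by linarith [hC p, c3 p])
  have est : ∀ w : St T O A, InK m0 CL w → ∫ t in Icc 0 T, (∫ p, |hat (t, p.1) - χ (t, p.1)| ∂(w.κ t)) ≤ ε / 4 := by
    intro w hw
    have := tail_bound hA.measurableSet w R (fun q => hat (q.1, q.2.1) - χ (q.1, q.2.1)) (hhm.sub hχm) (2 * C + 1) (fun q => hdb _) hh c4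
      (fun t => (c5 t).1) (2 * C + 1) (fun t => (c5 t).2) (fun t p hp => c6 t p.1 hp.1.2)
    have e := w.integral_Q (fun q => |hat (q.1, q.2.1) - χ (q.1, q.2.1)|)
      (St.integrable_bdd _ _ (hhm.sub hχm).abs (2 * C + 1) (fun q => by rw [abs_abs]; exact hdb _))
    simp only at e
    rw [← e]
    have h2 := (htail w hw).2
    have h3 : (2 * C + 1) * w.Q.real {q | R < |q.2.1|} ≤ ε / 8 := by
      calc _ ≤ (2 * C + 1) * (ε / (8 * (2 * C + 1))) := by gcongr
        _ = ε / 8 := by field_simp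
    linarith
  obtain ⟨N, hN⟩ := Metric.tendsto_atTop.1 (z_conv_smooth hT hA CL hCL y hy x h χ c1 c2) (ε / 4) (by positivity)
  refine ⟨N, fun n hn => ?_⟩
  have h1 := hN n hn
  rw [Real.dist_eq, sub_zero, abs_of_nonneg (integral_nonneg fun t => abs_nonneg _)] at h1 ⊢
  have mz : ∀ (w : St T O A) (g : ℝ × ℝ × ℝ → ℝ), Measurable g → ∀ D, (∀ q, |g q| ≤ D) →
      Integrable (fun t => ∫ p, g (t, p) ∂(w.κ t)) (volume.restrict (Icc 0 T)) := by
    intro w g hg D hD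
    exact St.integrable_bdd _ _ (w.measurable_int_κ (fun t p => g (t, p)) hg) D (fun t => w.abs_int_κ_le (fun p => g (t, p)) D (fun p => hD _) t)
  have i1 := fun w : St T O A => mz w (fun q => hat (q.1, q.2.1)) hhm C (fun q => hC _)
  have i2 := fun w : St T O A => mz w (fun q => χ (q.1, q.2.1)) hχm (C + 1) (fun q => c3 _)
  have i3 := fun w : St T O A => mz w (fun q => |hat (q.1, q.2.1) - χ (q.1, q.2.1)|) (hhm.sub hχm).abs (2 * C + 1) (fun q => by rw [abs_abs]; exact hdb _)
  simp only at i1 i2 i3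
  have i4 : Integrable (fun t => |(∫ p, χ (t, p.1) ∂((y n).κ t)) - ∫ p, χ (t, p.1) ∂(x.κ t)|) (volume.restrict (Icc 0 T)) := ((i2 _).sub (i2 _)).abs
  have i5 : Integrable (fun t => (∫ p, |hat (t, p.1) - χ (t, p.1)| ∂((y n).κ t)) + ∫ p, |hat (t, p.1) - χ (t, p.1)| ∂(x.κ t)) (volume.restrict (Icc 0 T)) := (i3 _).add (i3 _)
  have pt : ∀ (w : St T O A) t, |(∫ p, hat (t, p.1) ∂(w.κ t)) - ∫ p, χ (t, p.1) ∂(w.κ t)| ≤ ∫ p, |hat (t, p.1) - χ (t, p.1)| ∂(w.κ t) := by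
    intro w t
    rw [← integral_sub]
    · exact abs_integral_le_integral_abs
    · exact St.integrable_bdd _ _ (hc.comp (by fun_prop)).measurable C (fun q => hC _)
    · exact St.integrable_bdd _ _ (c1.continuous.comp (by fun_prop)).measurable (C + 1) (fun q => c3 _)
  have big : ∫ t in Icc 0 T, |(∫ p, hat (t, p.1) ∂((y n).κ t)) - ∫ p, hat (t, p.1) ∂(x.κ t)| ≤
      ∫ t in Icc 0 T, (|(∫ p, χ (t, p.1) ∂((y n).κ t)) - ∫ p, χ (t, p.1) ∂(x.κ t)| +
        ((∫ p, |hat (t, p.1) - χ (t, p.1)| ∂((y n).κ t)) + ∫ p, |hat (t, p.1) - χ (t, p.1)| ∂(x.κ t))) := by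
    apply integral_mono ((i1 _).sub (i1 _)).abs (i4.add i5)
    intro t
    simp only [Pi.add_apply, Pi.sub_apply]
    have a1 := pt (y n) t
    have a2 := pt x t
    set a := ∫ p, hat (t, p.1) ∂((y n).κ t)
    set b := ∫ p, hat (t, p.1) ∂(x.κ t)
    set c := ∫ p, χ (t, p.1) ∂((y n).κ t)
    set d := ∫ p, χ (t, p.1) ∂(x.κ t)
    have e : a - b = (c - d) + ((a - c) - (b - d)) := by ring
    rw [e]
    exact (abs_add_le _ _).trans (by gcongr; exact (abs_sub _ _).trans (add_le_add a1 a2))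
  rw [integral_add i4 i5, integral_add (i3 _) (i3 _)] at big
  linarith [est (y n) (hy n), est x hx]

theorem z_conv {ι : Type*} [Fintype ι] (hT : 0 < T) (hA : IsCompact A) [IsProbabilityMeasure m0] (CL : ℝ) (hCL : 0 ≤ CL)
    (y : ℕ → St T O A) (hy : ∀ n, InK m0 CL (y n)) (x : St T O A) (h : St.Conv y x)
    (hat : ι → ℝ × ℝ → ℝ) (hc : ∀ i, Continuous (hat i)) (C : ℝ) (hC : ∀ i p, |hat i p| ≤ C) :
    Tendsto (fun n => ∫ t in Icc 0 T, ‖(y n).z hat t - x.z hat t‖) atTop (𝓝 0) := by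
  have k : Tendsto (fun n => ∑ i, ∫ t in Icc 0 T, |(y n).z hat t i - x.z hat t i|) atTop (𝓝 (∑ i : ι, 0)) :=
    tendsto_finsetSum _ fun i _ => z_conv1 hT hA CL hCL y hy x h (hat i) (hc i) C (hC i)
  rw [Finset.sum_const_zero] at k
  refine squeeze_zero (fun n => integral_nonneg fun t => norm_nonneg _) (fun n => ?_) k
  have hi : ∀ i, Integrable (fun t => |(y n).z hat t i - x.z hat t i|) (volume.restrict (Icc 0 T)) := by
    intro i
    have m := fun w : St T O A => (measurable_pi_apply i).comp (w.measurable_z hat hc)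
    exact St.integrable_bdd _ _ ((m (y n)).sub (m x)).abs (C + C) (fun t => by
      rw [abs_abs]
      exact (abs_sub _ _).trans (add_le_add ((y n).abs_z_le hat C hC t i) (x.abs_z_le hat C hC t i)))
  rw [← integral_finsetSum _ (fun i _ => hi i)]
  apply integral_mono_of_nonneg (Eventually.of_forall fun t => norm_nonneg _)
  · exact integrable_finsetSum _ fun i _ => hi i
  · refine Eventually.of_forall fun t => ?_
    dsimp only
    rw [pi_norm_le_iff_of_nonneg (Finset.sum_nonneg fun i _ => abs_nonneg _)]
    intro i
    exact Finset.single_le_sum (f := fun i => |(y n).z hat t i - x.z hat t i|) (fun i _ => abs_nonneg _) (Finset.mem_univ i)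
end
end

section
open MeasureTheory Filter Set Topology
open ProbabilityTheory
set_option linter.all false

lemma HB_point {E : Type*} [AddCommGroup E] [Module ℝ E] (N : E → ℝ) (hhom : ∀ c : ℝ, 0 < c → ∀ x, N (c • x) = c * N x)
    (hadd : ∀ x y, N (x + y) ≤ N x + N y) (h0 : N 0 = 0) (e : E) :
    ∃ g : E →ₗ[ℝ] ℝ, g e = N e ∧ ∀ x, g x ≤ N x := by
  have H : ∀ c : ℝ, c • e = 0 → (RingHom.id ℝ) c • N e = 0 := by
    intro c hc
    rcases smul_eq_zero.1 hc with h | h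
    · simp [h]
    · simp [h, h0]
  obtain ⟨g, g1, g2⟩ := exists_extension_of_le_sublinear (LinearPMap.mkSpanSingleton' (σ := RingHom.id ℝ) e (N e) H) N hhom hadd (by
    rintro ⟨x, hx⟩
    obtain ⟨c, rfl⟩ := Submodule.mem_span_singleton.1 hx
    rw [LinearPMap.mkSpanSingleton'_apply]
    simp only [RingHom.id_apply, smul_eq_mul]
    rcases lt_trichotomy c 0 with h | h | h
    · have h1 := hadd (c • e) ((-c) • e)
      rw [← add_smul, add_neg_cancel, zero_smul, h0, hhom (-c) (by linarith)] at h1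
      linarith
    · simp [h, h0]
    · rw [hhom c h])
  refine ⟨g, ?_, g2⟩
  have := g1 ⟨e, Submodule.mem_span_singleton_self e⟩
  exact this.trans (LinearPMap.mkSpanSingleton'_apply_self e (N e) H _)

theorem riesz_compact {X : Type*} [MetricSpace X] [ProperSpace X] [MeasurableSpace X] [BorelSpace X] (S : Set X) (hS : IsCompact S)
    (Λ : C(X, ℝ) →ₗ[ℝ] ℝ) (hpos : ∀ φ : C(X, ℝ), (∀ x ∈ S, 0 ≤ φ x) → 0 ≤ Λ φ) :
    ∃ ν : Measure X, IsFiniteMeasure ν ∧ ν Sᶜ = 0 ∧ ∀ φ : C(X, ℝ), ∫ x, φ x ∂ν = Λ φ := by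
  let L0 : CompactlySupportedContinuousMap X ℝ →ₗ[ℝ] ℝ :=
    { toFun := fun f => Λ f.toContinuousMap
      map_add' := fun f g => by rw [← map_add]; rfl
      map_smul' := fun c f => by rw [RingHom.id_apply, ← map_smul]; rfl }
  let L : CompactlySupportedContinuousMap X ℝ →ₚ[ℝ] ℝ := PositiveLinearMap.mk₀ L0 (fun f hf => hpos _ (fun x _ => hf x))
  have hL : ∀ f, L f = Λ f.toContinuousMap := fun f => rfl
  let ν := RealRMK.rieszMeasure L
  have hzero : ∀ φ ψ : C(X, ℝ), (∀ x ∈ S, φ x = ψ x) → Λ φ = Λ ψ := by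
    intro φ ψ h
    have h1 := hpos (φ - ψ) (fun x hx => by simp [h x hx])
    have h2 := hpos (ψ - φ) (fun x hx => by simp [h x hx])
    rw [map_sub] at h1 h2
    linarith
  have hsupp : ν Sᶜ = 0 := by
    have hr : ν.Regular := by infer_instance
    rw [hS.isClosed.isOpen_compl.measure_eq_iSup_isCompact]
    simp only [ENNReal.iSup_eq_zero]
    intro K hK hKc
    obtain ⟨f, f1, f2, f3, f4⟩ := exists_continuous_one_zero_of_isCompact hKc hS.isClosed (disjoint_left.2 fun x hx => hK hx)
    have := RealRMK.rieszMeasure_le_of_eq_one L (f := ⟨f, f3⟩) (fun x => (f4 x).1) hKc (fun x hx => f1 hx)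
    rw [hL] at this
    have e : Λ f = 0 := by
      rw [hzero f 0 (fun x hx => f2 hx), map_zero]
    have e2 : Λ (⟨f, f3⟩ : CompactlySupportedContinuousMap X ℝ).toContinuousMap = 0 := e
    rw [e2, ENNReal.ofReal_zero] at this
    exact le_antisymm this zero_le
  have hfin : IsFiniteMeasure ν := by
    constructor
    calc ν univ ≤ ν S + ν Sᶜ := by rw [← union_compl_self S]; exact measure_union_le _ _
      _ < ⊤ := by rw [hsupp, add_zero]; exact hS.measure_lt_top
  refine ⟨ν, hfin, hsupp, fun φ => ?_⟩
  obtain ⟨f, f1, -, f3, f4⟩ := exists_continuous_one_zero_of_isCompact hS isClosed_empty (disjoint_empty S)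
  have hc : HasCompactSupport (φ * f : C(X, ℝ)) := by
    have : HasCompactSupport (fun x => φ x * f x) := f3.mul_left
    exact this
  have k := RealRMK.integral_rieszMeasure L ⟨φ * f, hc⟩
  rw [hL] at k
  have e1 : Λ (φ * f) = Λ φ := hzero _ _ (fun x hx => by simp [f1 hx])
  have e2 : Λ (⟨φ * f, hc⟩ : CompactlySupportedContinuousMap X ℝ).toContinuousMap = Λ φ := e1
  rw [← e2, ← k]
  apply integral_congr_ae
  have : ∀ᵐ x ∂ν, x ∈ S := by rw [ae_iff]; exact hsupp
  filter_upwards [this] with x hx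
  have : f x = 1 := f1 hx
  change φ x = φ x * f x
  rw [this, mul_one]
end

section
open MeasureTheory Filter Set Topology
open ProbabilityTheory
set_option linter.all false

section dual
variable {T : ℝ} {O A : Set ℝ} {m0 : Measure ℝ}

lemma Tst.add {u ut ux uxx v vt vx vxx : ℝ → ℝ → ℝ} (h : Tst T O u ut ux uxx) (k : Tst T O v vt vx vxx) :
    Tst T O (fun t x => u t x + v t x) (fun t x => ut t x + vt t x) (fun t x => ux t x + vx t x) (fun t x => uxx t x + vxx t x) := by
  obtain ⟨C, hC0, hC⟩ := h.b
  obtain ⟨D, hD0, hD⟩ := k.b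
  have hB : ∀ t x, |u t x + v t x| ≤ C + D ∧ |ut t x + vt t x| ≤ C + D ∧ |ux t x + vx t x| ≤ C + D ∧ |uxx t x + vxx t x| ≤ C + D := by
    intro t x
    obtain ⟨a1, a2, a3, a4⟩ := hC t x
    obtain ⟨b1, b2, b3, b4⟩ := hD t x
    exact ⟨(abs_add_le _ _).trans (by linarith), (abs_add_le _ _).trans (by linarith), (abs_add_le _ _).trans (by linarith), (abs_add_le _ _).trans (by linarith)⟩
  have c1 := h.c.add k.c
  have c2 := h.ct.add k.ct
  have c3 := h.cx.add k.cx
  have c4 := h.cxx.add k.cxx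
  exact ⟨⟨c1.continuousOn, c2.continuousOn, c3.continuousOn, c4.continuousOn, fun t ht x hx => (h.is.deriv_t t ht x hx).add (k.is.deriv_t t ht x hx),
    fun t ht x hx => (h.is.deriv_x t ht x hx).add (k.is.deriv_x t ht x hx), fun t ht x hx => (h.is.deriv_xx t ht x hx).add (k.is.deriv_xx t ht x hx), ⟨_, fun t _ x _ => hB t x⟩⟩,
    c1, c2, c3, c4, ⟨_, add_nonneg hC0 hD0, hB⟩⟩

lemma Tst.smul {u ut ux uxx : ℝ → ℝ → ℝ} (h : Tst T O u ut ux uxx) (c : ℝ) :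
    Tst T O (fun t x => c * u t x) (fun t x => c * ut t x) (fun t x => c * ux t x) (fun t x => c * uxx t x) := by
  obtain ⟨C, hC0, hC⟩ := h.b
  have hB : ∀ t x, |c * u t x| ≤ |c| * C ∧ |c * ut t x| ≤ |c| * C ∧ |c * ux t x| ≤ |c| * C ∧ |c * uxx t x| ≤ |c| * C := by
    intro t x
    obtain ⟨a1, a2, a3, a4⟩ := hC t x
    simp only [abs_mul]
    refine ⟨?_, ?_, ?_, ?_⟩ <;> gcongr
  have c1 := (continuous_const (y := c)).mul h.c
  have c2 := (continuous_const (y := c)).mul h.ct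
  have c3 := (continuous_const (y := c)).mul h.cx
  have c4 := (continuous_const (y := c)).mul h.cxx
  exact ⟨⟨c1.continuousOn, c2.continuousOn, c3.continuousOn, c4.continuousOn, fun t ht x hx => (h.is.deriv_t t ht x hx).const_mul c,
    fun t ht x hx => (h.is.deriv_x t ht x hx).const_mul c, fun t ht x hx => (h.is.deriv_xx t ht x hx).const_mul c, ⟨_, fun t _ x _ => hB t x⟩⟩,
    c1, c2, c3, c4, ⟨_, by positivity, hB⟩⟩

lemma Tst_time (η η' : ℝ → ℝ) (hη : Continuous η) (hη' : Continuous η')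
    (d1 : ∀ t ∈ Icc 0 T, HasDerivWithinAt η (η' t) (Icc 0 T) t) (C : ℝ) (b1 : ∀ t, |η t| ≤ C ∧ |η' t| ≤ C) :
    Tst T O (fun t x => η t) (fun t x => η' t) (fun t x => 0) (fun t x => 0) := by
  have hC : 0 ≤ C := (abs_nonneg _).trans (b1 0).1
  have c1 : Continuous fun p : ℝ × ℝ => η p.1 := hη.comp continuous_fst
  have c2 : Continuous fun p : ℝ × ℝ => η' p.1 := hη'.comp continuous_fst
  exact ⟨⟨c1.continuousOn, c2.continuousOn, continuousOn_const, continuousOn_const, fun t ht x _ => d1 t ht,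
    fun t _ x _ => (hasDerivAt_const x _).hasDerivWithinAt, fun t _ x _ => (hasDerivAt_const x _).hasDerivWithinAt, ⟨C, fun t _ x _ => ⟨(b1 t).1, (b1 t).2, by simpa, by simpa⟩⟩⟩,
    c1, c2, continuous_const, continuous_const, ⟨C, hC, fun t x => ⟨(b1 t).1, (b1 t).2, by simpa, by simpa⟩⟩⟩

/-- linear time test function `b + a (T - t)` -/
lemma Tst_lin (hT : 0 ≤ T) (a b : ℝ) : ∃ η : ℝ → ℝ, (∀ t ∈ Icc 0 T, η t = b + a * (T - t)) ∧
    Tst T O (fun t x => η t) (fun t x => -a) (fun t x => 0) (fun t x => 0) := by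
  obtain ⟨η, e1, e2, e3⟩ := clampT hT
  refine ⟨fun t => b + a * η t, fun t ht => by simp only [e2 t ht], ?_⟩
  refine Tst_time (fun t => b + a * η t) (fun _ => -a) (by fun_prop) continuous_const ?_ (|b| + |a| * T + |a|) ?_
  · intro t ht
    have : HasDerivWithinAt (fun t => b + a * (T - t)) (-a) (Icc 0 T) t := by
      simpa using ((((hasDerivAt_id t).const_sub T).const_mul a).const_add b).hasDerivWithinAt
    exact this.congr (fun t ht => by rw [e2 t ht]) (by rw [e2 t ht])
  · intro t
    have h1 : |a * η t| ≤ |a| * T := by rw [abs_mul]; gcongr; exact e3 t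
    have h2 : 0 ≤ |a| * T := by positivity
    have h3 := abs_nonneg a
    have h4 := abs_nonneg b
    refine ⟨(abs_add_le _ _).trans (by linarith), by rw [abs_neg]; linarith⟩

/-- Values of supersolutions. -/
def DS (T : ℝ) (O A : Set ℝ) (m0 : Measure ℝ) (β s : ℝ × ℝ × ℝ → ℝ) (e : C(ℝ × ℝ × ℝ, ℝ) × C(ℝ × ℝ, ℝ)) : Set ℝ :=
  {r | ∃ u ut ux uxx, Tst T O u ut ux uxx ∧
    (∀ q ∈ Icc 0 T ×ˢ closure O ×ˢ A, e.1 q ≤ -(ut q.1 q.2.1 + (β q * ux q.1 q.2.1 + s q ^ 2 / 2 * uxx q.1 q.2.1))) ∧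
    (∀ p ∈ Icc 0 T ×ˢ closure O, e.2 p ≤ u p.1 p.2) ∧ r = ∫ x, u 0 x ∂m0}

lemma Tst.int0 [IsFiniteMeasure m0] {u ut ux uxx : ℝ → ℝ → ℝ} (h : Tst T O u ut ux uxx) : Integrable (fun x => u 0 x) m0 := by
  obtain ⟨C, hC0, hC⟩ := h.b
  exact St.integrable_bdd _ _ (h.c.comp (continuous_const (y := (0:ℝ)) |>.prodMk continuous_id)).measurable C (fun x => (hC 0 x).1)

lemma DS_lower (hT : 0 ≤ T) [IsProbabilityMeasure m0] (hm0 : m0 Oᶜ = 0) {β s : ℝ × ℝ × ℝ → ℝ} {e : C(ℝ × ℝ × ℝ, ℝ) × C(ℝ × ℝ, ℝ)} {r C : ℝ}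
    (hr : r ∈ DS T O A m0 β s e) (hC : ∀ p ∈ Icc 0 T ×ˢ closure O, -C ≤ e.2 p) : -C ≤ r := by
  obtain ⟨u, ut, ux, uxx, h, h1, h2, rfl⟩ := hr
  have hO : ∀ᵐ x ∂m0, x ∈ O := by rw [ae_iff]; exact hm0
  calc -C = ∫ x, -C ∂m0 := by simp
    _ ≤ _ := by
      apply integral_mono_ae (integrable_const _) h.int0
      filter_upwards [hO] with x hx
      have hp : ((0:ℝ), x) ∈ Icc 0 T ×ˢ closure O := ⟨⟨le_rfl, hT⟩, subset_closure hx⟩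
      exact (hC _ hp).trans (h2 _ hp)

lemma DS_bdd (hT : 0 ≤ T) (hX : IsCompact (closure O)) [IsProbabilityMeasure m0] (hm0 : m0 Oᶜ = 0) (β s : ℝ × ℝ × ℝ → ℝ) (e : C(ℝ × ℝ × ℝ, ℝ) × C(ℝ × ℝ, ℝ)) :
    BddBelow (DS T O A m0 β s e) := by
  obtain ⟨C, hC⟩ := (isCompact_Icc.prod hX).exists_bound_of_continuousOn (f := e.2) (s := Icc 0 T ×ˢ closure O) e.2.continuous.continuousOn
  exact ⟨-C, fun r hr => DS_lower hT hm0 hr (fun p hp => (abs_le.1 (hC p hp)).1)⟩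

lemma DS_nonempty (hT : 0 ≤ T) (hX : IsCompact (closure O)) (hA : IsCompact A) [IsProbabilityMeasure m0] (β s : ℝ × ℝ × ℝ → ℝ) (e : C(ℝ × ℝ × ℝ, ℝ) × C(ℝ × ℝ, ℝ)) :
    (DS T O A m0 β s e).Nonempty := by
  obtain ⟨C, hC⟩ := (isCompact_Icc.prod hX).exists_bound_of_continuousOn (f := e.2) (s := Icc 0 T ×ˢ closure O) e.2.continuous.continuousOn
  obtain ⟨D, hD⟩ := (isCompact_Icc.prod (hX.prod hA)).exists_bound_of_continuousOn (f := e.1) (s := Icc 0 T ×ˢ closure O ×ˢ A) e.1.continuous.continuousOn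
  obtain ⟨η, h1, h2⟩ := Tst_lin (O := O) hT |D| C
  refine ⟨_, _, _, _, _, h2, ?_, ?_, rfl⟩
  · intro q hq
    have := (abs_le.1 (hD q hq)).2
    simp only [mul_zero, add_zero, neg_neg]
    exact this.trans (le_abs_self D)
  · intro p hp
    have := (abs_le.1 (hC p hp)).2
    rw [h1 p.1 hp.1]
    have : 0 ≤ |D| * (T - p.1) := mul_nonneg (abs_nonneg _) (by linarith [hp.1.2])
    linarith

lemma DS_smul {β s : ℝ × ℝ × ℝ → ℝ} {e : C(ℝ × ℝ × ℝ, ℝ) × C(ℝ × ℝ, ℝ)} {r : ℝ} (c : ℝ) (hc : 0 ≤ c)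
    (hr : r ∈ DS T O A m0 β s e) : c * r ∈ DS T O A m0 β s (c • e) := by
  obtain ⟨u, ut, ux, uxx, h, h1, h2, rfl⟩ := hr
  refine ⟨_, _, _, _, h.smul c, ?_, ?_, ?_⟩
  · intro q hq
    have := mul_le_mul_of_nonneg_left (h1 q hq) hc
    simp only [Prod.smul_fst, ContinuousMap.coe_smul, Pi.smul_apply, smul_eq_mul]
    linarith
  · intro p hp
    have := mul_le_mul_of_nonneg_left (h2 p hp) hc
    simpa using this
  · rw [integral_const_mul]

lemma DS_add [IsProbabilityMeasure m0] {β s : ℝ × ℝ × ℝ → ℝ} {e e' : C(ℝ × ℝ × ℝ, ℝ) × C(ℝ × ℝ, ℝ)} {r r' : ℝ}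
    (hr : r ∈ DS T O A m0 β s e) (hr' : r' ∈ DS T O A m0 β s e') : r + r' ∈ DS T O A m0 β s (e + e') := by
  obtain ⟨u, ut, ux, uxx, h, h1, h2, rfl⟩ := hr
  obtain ⟨v, vt, vx, vxx, k, k1, k2, rfl⟩ := hr'
  refine ⟨_, _, _, _, h.add k, ?_, ?_, ?_⟩
  · intro q hq
    have a1 := h1 q hq
    have a2 := k1 q hq
    simp only [Prod.fst_add, ContinuousMap.add_apply]
    linarith
  · intro p hp
    have a1 := h2 p hp
    have a2 := k2 p hp
    simp only [Prod.snd_add, ContinuousMap.add_apply]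
    linarith
  · rw [integral_add h.int0 k.int0]

theorem dual (hT : 0 < T) (hX : IsCompact (closure O)) (hA : IsCompact A) [IsProbabilityMeasure m0] (hm0 : m0 Oᶜ = 0)
    (β s f : ℝ × ℝ × ℝ → ℝ) (g : ℝ × ℝ → ℝ) (hβ : Continuous β) (hs : Continuous s) (hf : Continuous f) (hg : Continuous g) :
    ∃ y : St T O A, Feas m0 β s y ∧ ∀ ε > 0, ∃ u ut ux uxx, Tst T O u ut ux uxx ∧
      (∀ q ∈ Icc 0 T ×ˢ closure O ×ˢ A, ut q.1 q.2.1 + (β q * ux q.1 q.2.1 + s q ^ 2 / 2 * uxx q.1 q.2.1) ≤ - f q) ∧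
      (∀ p ∈ Icc 0 T ×ˢ closure O, g p ≤ u p.1 p.2) ∧
      ∫ x, u 0 x ∂m0 ≤ ∫ q, f q ∂y.Q + ∫ p, g p ∂y.μ + ε := by
  set N : C(ℝ × ℝ × ℝ, ℝ) × C(ℝ × ℝ, ℝ) → ℝ := fun e => sInf (DS T O A m0 β s e) with hN
  have hbd := fun e => DS_bdd (A := A) hT.le hX hm0 β s e
  have hne := fun e => DS_nonempty (m0 := m0) hT.le hX hA β s e
  have hadd : ∀ x y, N (x + y) ≤ N x + N y := by
    intro x y
    have : N (x + y) - N y ≤ N x := by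
      apply le_csInf (hne x)
      intro r hr
      have : N (x + y) - r ≤ N y := by
        apply le_csInf (hne y)
        intro r' hr'
        have := csInf_le (hbd (x + y)) (DS_add hr hr')
        linarith
      linarith
    linarith
  have hom1 : ∀ c : ℝ, 0 < c → ∀ x, N (c • x) ≤ c * N x := by
    intro c hc x
    rw [← div_le_iff₀' hc]
    apply le_csInf (hne x)
    intro r hr
    rw [div_le_iff₀' hc]
    exact csInf_le (hbd _) (DS_smul c hc.le hr)
  have hhom : ∀ c : ℝ, 0 < c → ∀ x, N (c • x) = c * N x := by
    intro c hc x
    apply le_antisymm (hom1 c hc x)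
    have := hom1 c⁻¹ (inv_pos.2 hc) (c • x)
    rw [inv_smul_smul₀ hc.ne'] at this
    rwa [← div_eq_inv_mul, le_div_iff₀' hc] at this
  have Tst0 : Tst T O (fun _ _ => 0) (fun _ _ => 0) (fun _ _ => 0) (fun _ _ => 0) := by
    exact Tst_time (fun _ => 0) (fun _ => 0) continuous_const continuous_const (fun t _ => (hasDerivAt_const t _).hasDerivWithinAt) 0 (by simp)
  have hneg : ∀ e : C(ℝ × ℝ × ℝ, ℝ) × C(ℝ × ℝ, ℝ), (∀ q ∈ Icc 0 T ×ˢ closure O ×ˢ A, e.1 q ≤ 0) → (∀ p ∈ Icc 0 T ×ˢ closure O, e.2 p ≤ 0) → N e ≤ 0 := by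
    intro e h1 h2
    apply csInf_le (hbd e)
    exact ⟨_, _, _, _, Tst0, by simpa using h1, by simpa using h2, by simp⟩
  have h0 : N 0 = 0 := by
    apply le_antisymm (hneg 0 (by simp) (by simp))
    apply le_csInf (hne 0)
    intro r hr
    have := DS_lower (C := 0) hT.le hm0 hr (by simp)
    simpa using this
  obtain ⟨G, G1, G2⟩ := HB_point N hhom hadd h0 (⟨f, hf⟩, ⟨g, hg⟩)
  have hpos : ∀ e : C(ℝ × ℝ × ℝ, ℝ) × C(ℝ × ℝ, ℝ), (∀ q ∈ Icc 0 T ×ˢ closure O ×ˢ A, 0 ≤ e.1 q) → (∀ p ∈ Icc 0 T ×ˢ closure O, 0 ≤ e.2 p) → 0 ≤ G e := by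
    intro e h1 h2
    have := (G2 (-e)).trans (hneg (-e) (by simpa using h1) (by simpa using h2))
    rw [map_neg] at this
    linarith
  have hS1 : IsCompact (Icc 0 T ×ˢ closure O ×ˢ A) := isCompact_Icc.prod (hX.prod hA)
  have hS2 : IsCompact (Icc 0 T ×ˢ closure O) := isCompact_Icc.prod hX
  obtain ⟨ν1, f1, z1, i1⟩ := riesz_compact (Icc 0 T ×ˢ closure O ×ˢ A) hS1 (G.comp (LinearMap.inl ℝ _ _)) (by
    intro φ h
    exact hpos (φ, 0) h (by simp))
  obtain ⟨ν2, f2, z2, i2⟩ := riesz_compact (Icc 0 T ×ˢ closure O) hS2 (G.comp (LinearMap.inr ℝ _ _)) (by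
    intro φ h
    exact hpos (0, φ) (by simp) h)
  have hG : ∀ φ ψ, G (φ, ψ) = ∫ q, φ q ∂ν1 + ∫ p, ψ p ∂ν2 := by
    intro φ ψ
    rw [i1, i2]
    simp only [LinearMap.comp_apply, LinearMap.inl_apply, LinearMap.inr_apply]
    rw [← map_add]
    simp
  have FP1 : ∀ u ut ux uxx, Tst T O u ut ux uxx → ∫ p, u p.1 p.2 ∂ν2 - ∫ q, (ut q.1 q.2.1 + (β q * ux q.1 q.2.1 + s q ^ 2 / 2 * uxx q.1 q.2.1)) ∂ν1 ≤ ∫ x, u 0 x ∂m0 := by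
    intro u ut ux uxx h
    have cpr : Continuous fun q : ℝ × ℝ × ℝ => (q.1, q.2.1) := by fun_prop
    have cc : Continuous fun q : ℝ × ℝ × ℝ => -(ut q.1 q.2.1 + (β q * ux q.1 q.2.1 + s q ^ 2 / 2 * uxx q.1 q.2.1)) := by
      have c1 := h.ct.comp cpr
      have c2 := h.cx.comp cpr
      have c3 := h.cxx.comp cpr
      have c4 : Continuous fun q => s q ^ 2 / 2 := (hs.pow 2).div_const 2
      exact (c1.add ((hβ.mul c2).add (c4.mul c3))).neg
    have k1 := G2 (⟨_, cc⟩, ⟨_, h.c⟩)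
    have k2 : N (⟨_, cc⟩, ⟨_, h.c⟩) ≤ ∫ x, u 0 x ∂m0 := csInf_le (hbd _) ⟨u, ut, ux, uxx, h, fun q _ => le_rfl, fun p _ => le_rfl, rfl⟩
    rw [hG] at k1
    simp only [ContinuousMap.coe_mk] at k1
    rw [integral_neg] at k1
    linarith
  have FP : ∀ u ut ux uxx, Tst T O u ut ux uxx → ∫ p, u p.1 p.2 ∂ν2 = ∫ x, u 0 x ∂m0 + ∫ q, (ut q.1 q.2.1 + (β q * ux q.1 q.2.1 + s q ^ 2 / 2 * uxx q.1 q.2.1)) ∂ν1 := by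
    intro u ut ux uxx h
    have k1 := FP1 _ _ _ _ h
    have k2 := FP1 _ _ _ _ (h.smul (-1))
    have e : ∀ q : ℝ × ℝ × ℝ, (-1 * ut q.1 q.2.1 + (β q * (-1 * ux q.1 q.2.1) + s q ^ 2 / 2 * (-1 * uxx q.1 q.2.1))) =
      (-1) * (ut q.1 q.2.1 + (β q * ux q.1 q.2.1 + s q ^ 2 / 2 * uxx q.1 q.2.1)) := fun q => by ring
    simp only [e] at k2
    simp only [integral_const_mul] at k2
    linarith
  have hμ1 : IsProbabilityMeasure ν2 := by
    have := FP _ _ _ _ (Tst_time (fun _ => 1) (fun _ => 0) continuous_const continuous_const (fun t _ => (hasDerivAt_const t _).hasDerivWithinAt) 1 (by simp))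
    simp at this
    constructor
    rw [measureReal_def] at this
    rw [← ENNReal.ofReal_toReal (measure_ne_top ν2 univ), this, ENNReal.ofReal_one]
  have ae1 : ∀ᵐ q ∂ν1, q ∈ Icc 0 T ×ˢ closure O ×ˢ A := by rw [ae_iff]; exact z1
  have ae2 : ∀ᵐ q ∂ν2, q ∈ Icc 0 T ×ˢ closure O := by rw [ae_iff]; exact z2
  have hmarg : ν1.fst ≤ volume.restrict (Icc 0 T) := by
    apply measure_le_of_cont
    intro h hc h0 h1
    rw [Measure.fst, integral_map measurable_fst.aemeasurable hc.aestronglyMeasurable]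
    have hIntg : ∀ a b, IntervalIntegrable h volume a b := fun a b => hc.intervalIntegrable a b
    have hFc : Continuous fun t => ∫ r in (0:ℝ)..t, h r := intervalIntegral.continuous_primitive hIntg 0
    have hd : ∀ t, HasDerivAt (fun t => ∫ r in (0:ℝ)..t, h r) (h t) t := fun t => 
      intervalIntegral.integral_hasDerivAt_right (hIntg _ _) (hc.stronglyMeasurableAtFilter _ _) hc.continuousAt
    set I := ∫ r in (0:ℝ)..T, h r with hI
    have hI2 : ∫ r in Icc 0 T, h r = I := by rw [hI, intervalIntegral.integral_of_le hT.le, integral_Icc_eq_integral_Ioc]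
    have hmono : ∀ t ∈ Icc 0 T, ∫ r in (0:ℝ)..t, h r ≤ I := by
      intro t ht
      rw [hI, ← intervalIntegral.integral_add_adjacent_intervals (hIntg 0 t) (hIntg t T)]
      have := intervalIntegral.integral_nonneg (μ := volume) ht.2 (fun r _ => h0 r)
      linarith
    have hpos' : ∀ t ∈ Icc 0 T, 0 ≤ ∫ r in (0:ℝ)..t, h r := by
      intro t ht
      exact intervalIntegral.integral_nonneg ht.1 (fun r _ => h0 r)
    have hI0 : 0 ≤ I := hpos' T ⟨hT.le, le_rfl⟩
    obtain ⟨η, e1, e2, e3⟩ := tietze_bdd (Icc 0 T) isClosed_Icc (fun t => I - ∫ r in (0:ℝ)..t, h r) (by fun_prop) I hI0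
      (fun t ht => by rw [abs_of_nonneg (by linarith [hmono t ht])]; linarith [hpos' t ht])
    have k := FP _ _ _ _ (Tst_time η (fun t => - h t) e1 hc.neg (fun t ht => by
      have := ((hd t).const_sub I).hasDerivWithinAt (s := Icc 0 T)
      exact this.congr e3 (e3 t ht)) (I + 1) (fun t => ⟨(e2 t).trans (by linarith), by rw [abs_neg, abs_of_nonneg (h0 t)]; linarith [h1 t]⟩))
    simp only [mul_zero, add_zero] at k
    rw [integral_neg] at k
    have k3 : 0 ≤ ∫ p, η p.1 ∂ν2 := by
      apply integral_nonneg_of_ae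
      filter_upwards [ae2] with p hp
      have := e3 p.1 hp.1
      simp only [this]
      simp only [Pi.zero_apply]
      linarith [hmono p.1 hp.1]
    have k4 : ∫ x, η 0 ∂m0 = I := by
      rw [e3 0 ⟨le_rfl, hT.le⟩]; simp
    rw [k4] at k
    rw [hI2]
    linarith
  obtain ⟨κ, κ1, κ2, κ3⟩ := disint T ν1 hmarg (closure O ×ˢ A) (isClosed_closure.measurableSet.prod hA.measurableSet) (by
    refine measure_mono_null ?_ z1
    intro q hq hq'
    exact hq ⟨trivial, hq'.2⟩)
  let y : St T O A := ⟨ν2, κ, hμ1, z2, κ1, κ2⟩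
  have hyQ : y.Q = ν1 := κ3
  refine ⟨y, ?_, ?_⟩
  · intro u ut ux uxx h
    rw [hyQ]
    exact FP u ut ux uxx h
  · intro ε hε
    rw [hyQ]
    have k := hG ⟨f, hf⟩ ⟨g, hg⟩
    rw [G1] at k
    obtain ⟨r, ⟨u, ut, ux, uxx, h, h1, h2, rfl⟩, hr⟩ := exists_lt_of_csInf_lt (hne (⟨f, hf⟩, ⟨g, hg⟩)) (lt_add_of_pos_right (N (⟨f, hf⟩, ⟨g, hg⟩)) hε)
    refine ⟨u, ut, ux, uxx, h, fun q hq => by linarith [show f q ≤ _ from h1 q hq], h2, ?_⟩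
    rw [k] at hr
    exact hr.le
end dual
end

section
open MeasureTheory Filter Set Topology
open ProbabilityTheory
set_option linter.all false

lemma param_deriv {a b p q : ℝ} (hab : a ≤ b) (w w' : ℝ → ℝ → ℝ) (hw : Continuous fun z : ℝ × ℝ => w z.1 z.2)
    (hw' : Continuous fun z : ℝ × ℝ => w' z.1 z.2)
    (hd : ∀ t ∈ Icc p q, ∀ y ∈ Icc a b, HasDerivWithinAt (fun t => w t y) (w' t y) (Icc p q) t) :
    ∀ t ∈ Icc p q, HasDerivWithinAt (fun t => ∫ y in a..b, w t y) (∫ y in a..b, w' t y) (Icc p q) t := by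
  have hc1 : ∀ t, Continuous fun y => w t y := fun t => hw.comp (continuous_const (y := t) |>.prodMk continuous_id)
  have hc1' : ∀ t, Continuous fun y => w' t y := fun t => hw'.comp (continuous_const (y := t) |>.prodMk continuous_id)
  have hc2' : ∀ y, Continuous fun t => w' t y := fun y => hw'.comp (continuous_id.prodMk (continuous_const (y := y)))
  have hc2 : ∀ y, Continuous fun t => w t y := fun y => hw.comp (continuous_id.prodMk (continuous_const (y := y)))
  have hI : Continuous fun t => ∫ y in a..b, w' t y := 
    intervalIntegral.continuous_parametric_intervalIntegral_of_continuous' (f := w') hw' a b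
  have key : ∀ t ∈ Icc p q, (∫ y in a..b, w t y) = (∫ y in a..b, w p y) + ∫ r in p..t, ∫ y in a..b, w' r y := by
    intro t ht
    have e1 : (∫ r in p..t, ∫ y in a..b, w' r y) = ∫ y in a..b, ∫ r in p..t, w' r y := by
      apply intervalIntegral_intervalIntegral_swap
      have : IntegrableOn (fun z : ℝ × ℝ => w' z.1 z.2) (uIcc p t ×ˢ uIcc a b) :=
        hw'.continuousOn.integrableOn_compact (isCompact_uIcc.prod isCompact_uIcc)
      exact this.mono_set (prod_mono uIoc_subset_uIcc uIoc_subset_uIcc)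
    rw [e1, ← intervalIntegral.integral_add ((hc1 p).intervalIntegrable _ _)]
    · apply intervalIntegral.integral_congr
      intro y hy
      rw [uIcc_of_le hab] at hy
      simp only
      rw [intervalIntegral.integral_eq_sub_of_hasDerivAt_of_le ht.1 (f := fun r => w r y) (hc2 y).continuousOn]
      · ring
      · intro r hr
        have hr2 : Icc p q ∈ 𝓝 r := Icc_mem_nhds hr.1 (hr.2.trans_le ht.2)
        exact (hd r ⟨hr.1.le, (hr.2.trans_le ht.2).le⟩ y hy).hasDerivAt hr2
      · exact (hc2' y).intervalIntegrable _ _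
    · apply Continuous.intervalIntegrable
      apply intervalIntegral.continuous_parametric_intervalIntegral_of_continuous' (f := fun y r => w' r y)
      exact hw'.comp continuous_swap
  intro t ht
  have := (intervalIntegral.integral_hasDerivAt_right (hI.intervalIntegrable p t) (hI.stronglyMeasurableAtFilter _ _) hI.continuousAt).const_add (∫ y in a..b, w p y)
  exact (this.hasDerivWithinAt (s := Icc p q)).congr key (key t ht)

lemma cont_exp_div {X : Type*} [TopologicalSpace X] {U : X → ℝ} (h : Continuous U) (ε : ℝ) : Continuous fun q => Real.exp (-U q / ε) := 
  Real.continuous_exp.comp (h.neg.div_const ε)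

lemma exp_div_deriv {U : ℝ → ℝ} {U' : ℝ} {S : Set ℝ} {t : ℝ} (ε : ℝ) (h : HasDerivWithinAt U U' S t) :
    HasDerivWithinAt (fun r => Real.exp (-U r / ε)) (-(1 / ε) * (U' * Real.exp (-U t / ε))) S t := by
  have := (h.neg.div_const ε).exp
  refine this.congr_deriv ?_
  simp only [Pi.neg_apply]
  ring

theorem softmin {c1 c2 T ε : ℝ} (hc : c1 < c2) (hε : 0 < ε) (U Ut Ux Uxx : ℝ × ℝ × ℝ → ℝ)
    (cU : Continuous U) (cUt : Continuous Ut) (cUx : Continuous Ux) (cUxx : Continuous Uxx)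
    (dt : ∀ t ∈ Icc 0 T, ∀ x ∈ Icc c1 c2, ∀ y ∈ Icc c1 c2, HasDerivWithinAt (fun r => U (r, x, y)) (Ut (t, x, y)) (Icc 0 T) t)
    (dx : ∀ t ∈ Icc 0 T, ∀ x ∈ Icc c1 c2, ∀ y ∈ Icc c1 c2, HasDerivWithinAt (fun r => U (t, r, y)) (Ux (t, x, y)) (Icc c1 c2) x)
    (dxx : ∀ t ∈ Icc 0 T, ∀ x ∈ Icc c1 c2, ∀ y ∈ Icc c1 c2, HasDerivWithinAt (fun r => Ux (t, r, y)) (Uxx (t, x, y)) (Icc c1 c2) x)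
    (e et ex exx : Fin 2 → ℝ × ℝ → ℝ)
    (ce : ∀ i, Continuous (e i)) (cet : ∀ i, Continuous (et i)) (cex : ∀ i, Continuous (ex i)) (cexx : ∀ i, Continuous (exx i))
    (det : ∀ i, ∀ t ∈ Icc 0 T, ∀ x ∈ Icc c1 c2, HasDerivWithinAt (fun r => e i (r, x)) (et i (t, x)) (Icc 0 T) t)
    (dex : ∀ i, ∀ t ∈ Icc 0 T, ∀ x ∈ Icc c1 c2, HasDerivWithinAt (fun r => e i (t, r)) (ex i (t, x)) (Icc c1 c2) x)
    (dexx : ∀ i, ∀ t ∈ Icc 0 T, ∀ x ∈ Icc c1 c2, HasDerivWithinAt (fun r => ex i (t, r)) (exx i (t, x)) (Icc c1 c2) x) :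
    ∃ W Wt Wx Wxx : ℝ → ℝ → ℝ, IsCb12 T (Ioo c1 c2) W Wt Wx Wxx ∧
      ∀ t x, ∃ Z, 0 < Z ∧ Z = (∫ y in c1..c2, Real.exp (-U (t, x, y) / ε)) + ∑ i, Real.exp (-e i (t, x) / ε) ∧ W t x = - ε * Real.log Z ∧
        Z * Wx t x = (∫ y in c1..c2, Ux (t, x, y) * Real.exp (-U (t, x, y) / ε)) + ∑ i, ex i (t, x) * Real.exp (-e i (t, x) / ε) ∧
        ∀ b s f : ℝ, Z * (Wt t x + (b * Wx t x + s ^ 2 / 2 * Wxx t x) + f) =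
          (∫ y in c1..c2, (Ut (t, x, y) + b * Ux (t, x, y) + s ^ 2 / 2 * Uxx (t, x, y) - s ^ 2 / (2 * ε) * (Ux (t, x, y) - Wx t x) ^ 2 + f) * Real.exp (-U (t, x, y) / ε))
          + ∑ i, (et i (t, x) + b * ex i (t, x) + s ^ 2 / 2 * exx i (t, x) - s ^ 2 / (2 * ε) * (ex i (t, x) - Wx t x) ^ 2 + f) * Real.exp (-e i (t, x) / ε) := by
  have hcl : closure (Ioo c1 c2) = Icc c1 c2 := closure_Ioo hc.ne
  set E : ℝ × ℝ × ℝ → ℝ := fun q => Real.exp (-U q / ε) with hE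
  set Ei : Fin 2 → ℝ × ℝ → ℝ := fun i p => Real.exp (-e i p / ε) with hEi
  have cE : Continuous E := cont_exp_div cU ε
  have cEi : ∀ i, Continuous (Ei i) := fun i => cont_exp_div (ce i) ε
  -- averages
  let Av : (ℝ × ℝ × ℝ → ℝ) → (Fin 2 → ℝ × ℝ → ℝ) → ℝ × ℝ → ℝ := fun h a p =>
    (∫ y in c1..c2, h (p.1, p.2, y) * E (p.1, p.2, y)) + ∑ i, a i p * Ei i p
  have cAv : ∀ h a, Continuous h → (∀ i, Continuous (a i)) → Continuous (Av h a) := by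
    intro h a hh ha
    refine Continuous.add ?_ (continuous_finset_sum _ fun i _ => (ha i).mul (cEi i))
    apply intervalIntegral.continuous_parametric_intervalIntegral_of_continuous' (f := fun (p : ℝ × ℝ) y => h (p.1, p.2, y) * E (p.1, p.2, y))
    have k : Continuous fun z : (ℝ × ℝ) × ℝ => (z.1.1, z.1.2, z.2) := by fun_prop
    exact (hh.comp k).mul (cE.comp k)
  let Z : ℝ × ℝ → ℝ := Av (fun _ => 1) (fun _ _ => 1)
  let It := Av Ut et
  let Ix := Av Ux ex
  let Ixx := Av (fun q => Uxx q - 1 / ε * Ux q ^ 2) (fun i p => exx i p - 1 / ε * ex i p ^ 2)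
  have cZ : Continuous Z := cAv _ _ continuous_const (fun i => continuous_const)
  have cIt : Continuous It := cAv _ _ cUt cet
  have cIx : Continuous Ix := cAv _ _ cUx cex
  have cIxx : Continuous Ixx := cAv _ _ (cUxx.sub (continuous_const.mul (cUx.pow 2))) (fun i => (cexx i).sub (continuous_const.mul ((cex i).pow 2)))
  have hZ0 : ∀ p, 0 < Z p := by
    intro p
    have h1 : 0 ≤ ∫ y in c1..c2, (1:ℝ) * E (p.1, p.2, y) := intervalIntegral.integral_nonneg hc.le (fun y _ => by rw [one_mul]; exact (Real.exp_pos _).le)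
    have h2 : 0 < ∑ i, (1:ℝ) * Ei i p := Finset.sum_pos (fun i _ => by rw [one_mul]; exact Real.exp_pos _) Finset.univ_nonempty
    exact add_pos_of_nonneg_of_pos h1 h2
  have comp2 : ∀ (h : ℝ × ℝ × ℝ → ℝ), Continuous h → ∀ x, Continuous fun z : ℝ × ℝ => h (z.1, x, z.2) := fun h hh x => hh.comp (by fun_prop)
  have comp1 : ∀ (h : ℝ × ℝ × ℝ → ℝ), Continuous h → ∀ t, Continuous fun z : ℝ × ℝ => h (t, z.1, z.2) := fun h hh x => hh.comp (by fun_prop)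
  have dZt : ∀ t ∈ Icc 0 T, ∀ x ∈ Icc c1 c2, HasDerivWithinAt (fun r => Z (r, x)) (-(1 / ε) * It (t, x)) (Icc 0 T) t := by
    intro t ht x hx
    have k1 := param_deriv hc.le (p := 0) (q := T) (fun t y => 1 * E (t, x, y)) (fun t y => -(1 / ε) * (Ut (t, x, y) * E (t, x, y)))
      (continuous_const.mul (comp2 E cE x)) (continuous_const.mul ((comp2 Ut cUt x).mul (comp2 E cE x))) (by
        intro t ht y hy
        simp only [one_mul]
        exact exp_div_deriv ε (dt t ht x hx y hy)) t ht
    have k2 : HasDerivWithinAt (fun r => ∑ i, 1 * Ei i (r, x)) (∑ i, -(1 / ε) * (et i (t, x) * Ei i (t, x))) (Icc 0 T) t := by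
      apply HasDerivWithinAt.fun_sum
      intro i _
      simp only [one_mul]
      exact exp_div_deriv ε (det i t ht x hx)
    refine (k1.add k2).congr_deriv ?_
    rw [intervalIntegral.integral_const_mul, ← Finset.mul_sum, ← mul_add]
  have dZx : ∀ t ∈ Icc 0 T, ∀ x ∈ Icc c1 c2, HasDerivWithinAt (fun r => Z (t, r)) (-(1 / ε) * Ix (t, x)) (Icc c1 c2) x := by
    intro t ht x hx
    have k1 := param_deriv hc.le (p := c1) (q := c2) (fun x y => 1 * E (t, x, y)) (fun x y => -(1 / ε) * (Ux (t, x, y) * E (t, x, y)))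
      (continuous_const.mul (comp1 E cE t)) (continuous_const.mul ((comp1 Ux cUx t).mul (comp1 E cE t))) (by
        intro x hx y hy
        simp only [one_mul]
        exact exp_div_deriv ε (dx t ht x hx y hy)) x hx
    have k2 : HasDerivWithinAt (fun r => ∑ i, 1 * Ei i (t, r)) (∑ i, -(1 / ε) * (ex i (t, x) * Ei i (t, x))) (Icc c1 c2) x := by
      apply HasDerivWithinAt.fun_sum
      intro i _
      simp only [one_mul]
      exact exp_div_deriv ε (dex i t ht x hx)
    refine (k1.add k2).congr_deriv ?_
    rw [intervalIntegral.integral_const_mul, ← Finset.mul_sum, ← mul_add]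
  have dIx : ∀ t ∈ Icc 0 T, ∀ x ∈ Icc c1 c2, HasDerivWithinAt (fun r => Ix (t, r)) (Ixx (t, x)) (Icc c1 c2) x := by
    intro t ht x hx
    have k1 := param_deriv hc.le (p := c1) (q := c2) (fun x y => Ux (t, x, y) * E (t, x, y)) (fun x y => (Uxx (t, x, y) - 1 / ε * Ux (t, x, y) ^ 2) * E (t, x, y))
      ((comp1 Ux cUx t).mul (comp1 E cE t)) (((comp1 Uxx cUxx t).sub (continuous_const.mul ((comp1 Ux cUx t).pow 2))).mul (comp1 E cE t)) (by
        intro x hx y hy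
        refine ((dxx t ht x hx y hy).mul (exp_div_deriv ε (dx t ht x hx y hy))).congr_deriv ?_
        simp only [hE]
        ring) x hx
    have k2 : HasDerivWithinAt (fun r => ∑ i, ex i (t, r) * Ei i (t, r)) (∑ i, (exx i (t, x) - 1 / ε * ex i (t, x) ^ 2) * Ei i (t, x)) (Icc c1 c2) x := by
      apply HasDerivWithinAt.fun_sum
      intro i _
      refine ((dexx i t ht x hx).mul (exp_div_deriv ε (dex i t ht x hx))).congr_deriv ?_
      simp only [hEi]
      ring
    exact k1.add k2
  have cW : Continuous fun p => - ε * Real.log (Z p) := continuous_const.mul (cZ.log fun p => (hZ0 p).ne')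
  have cWt : Continuous fun p => It p / Z p := cIt.div cZ fun p => (hZ0 p).ne'
  have cWx : Continuous fun p => Ix p / Z p := cIx.div cZ fun p => (hZ0 p).ne'
  have cWxx : Continuous fun p => Ixx p / Z p + 1 / ε * (Ix p / Z p) ^ 2 := (cIxx.div cZ fun p => (hZ0 p).ne').add (continuous_const.mul (cWx.pow 2))
  refine ⟨fun t x => - ε * Real.log (Z (t, x)), fun t x => It (t, x) / Z (t, x), fun t x => Ix (t, x) / Z (t, x), fun t x => Ixx (t, x) / Z (t, x) + 1 / ε * (Ix (t, x) / Z (t, x)) ^ 2, ?_, ?_⟩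
  · rw [show T = T from rfl]
    refine ⟨cW.continuousOn, cWt.continuousOn, cWx.continuousOn, cWxx.continuousOn, ?_, ?_, ?_, ?_⟩
    · rw [hcl]
      intro t ht x hx
      refine (((dZt t ht x hx).log (hZ0 _).ne').const_mul (-ε)).congr_deriv ?_
      have := (hZ0 (t, x)).ne'
      field_simp
    · rw [hcl]
      intro t ht x hx
      refine (((dZx t ht x hx).log (hZ0 _).ne').const_mul (-ε)).congr_deriv ?_
      have := (hZ0 (t, x)).ne'
      field_simp
    · rw [hcl]
      intro t ht x hx
      refine ((dIx t ht x hx).div (dZx t ht x hx) (hZ0 _).ne').congr_deriv ?_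
      have := (hZ0 (t, x)).ne'
      field_simp
      ring
    · rw [hcl]
      have hK : IsCompact (Icc 0 T ×ˢ Icc c1 c2) := isCompact_Icc.prod isCompact_Icc
      obtain ⟨C1, h1⟩ := hK.exists_bound_of_continuousOn cW.continuousOn
      obtain ⟨C2, h2⟩ := hK.exists_bound_of_continuousOn cWt.continuousOn
      obtain ⟨C3, h3⟩ := hK.exists_bound_of_continuousOn cWx.continuousOn
      obtain ⟨C4, h4⟩ := hK.exists_bound_of_continuousOn cWxx.continuousOn
      refine ⟨max (max C1 C2) (max C3 C4), fun t ht x hx => ⟨(h1 (t, x) ⟨ht, hx⟩).trans ?_, (h2 (t, x) ⟨ht, hx⟩).trans ?_, (h3 (t, x) ⟨ht, hx⟩).trans ?_, (h4 (t, x) ⟨ht, hx⟩).trans ?_⟩⟩ <;> simp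
  · intro t x
    have hZp := hZ0 (t, x)
    refine ⟨Z (t, x), hZp, ?_, rfl, ?_, ?_⟩
    · simp only [Z, Av, one_mul, hE, hEi]
    · rw [mul_div_cancel₀ _ hZp.ne']
    · intro b s f
      set P := Ix (t, x) / Z (t, x) with hP
      have hPZ : Ix (t, x) = P * Z (t, x) := by rw [hP, div_mul_cancel₀ _ hZp.ne']
      have cc : ∀ (h : ℝ × ℝ × ℝ → ℝ), Continuous h → IntervalIntegrable (fun y => h (t, x, y) * E (t, x, y)) volume c1 c2 := by
        intro h hh
        apply Continuous.intervalIntegrable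
        exact (hh.mul cE).comp (by fun_prop)
      -- linearity
      have lin : (∫ y in c1..c2, (Ut (t, x, y) + b * Ux (t, x, y) + s ^ 2 / 2 * Uxx (t, x, y) - s ^ 2 / (2 * ε) * (Ux (t, x, y) - P) ^ 2 + f) * E (t, x, y))
          = (∫ y in c1..c2, Ut (t, x, y) * E (t, x, y)) + (b + s ^ 2 / ε * P) * (∫ y in c1..c2, Ux (t, x, y) * E (t, x, y))
            + s ^ 2 / 2 * (∫ y in c1..c2, (Uxx (t, x, y) - 1 / ε * Ux (t, x, y) ^ 2) * E (t, x, y)) + (f - s ^ 2 / (2 * ε) * P ^ 2) * (∫ y in c1..c2, 1 * E (t, x, y)) := by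
        have i1 := cc Ut cUt
        have i2 := (cc Ux cUx).const_mul (b + s ^ 2 / ε * P)
        have i3 := (cc (fun q => Uxx q - 1 / ε * Ux q ^ 2) (cUxx.sub (continuous_const.mul (cUx.pow 2)))).const_mul (s ^ 2 / 2)
        have i4 := (cc (fun _ => 1) continuous_const).const_mul (f - s ^ 2 / (2 * ε) * P ^ 2)
        rw [← intervalIntegral.integral_const_mul, ← intervalIntegral.integral_const_mul, ← intervalIntegral.integral_const_mul,
          ← intervalIntegral.integral_add i1 i2, ← intervalIntegral.integral_add (i1.add i2) i3, ← intervalIntegral.integral_add ((i1.add i2).add i3) i4]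
        apply intervalIntegral.integral_congr
        intro y _
        simp only
        field_simp
        ring
      have lin2 : (∑ i, (et i (t, x) + b * ex i (t, x) + s ^ 2 / 2 * exx i (t, x) - s ^ 2 / (2 * ε) * (ex i (t, x) - P) ^ 2 + f) * Ei i (t, x))
          = (∑ i, et i (t, x) * Ei i (t, x)) + (b + s ^ 2 / ε * P) * (∑ i, ex i (t, x) * Ei i (t, x))
            + s ^ 2 / 2 * (∑ i, (exx i (t, x) - 1 / ε * ex i (t, x) ^ 2) * Ei i (t, x)) + (f - s ^ 2 / (2 * ε) * P ^ 2) * (∑ i, 1 * Ei i (t, x)) := by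
        simp only [Finset.mul_sum, ← Finset.sum_add_distrib]
        apply Finset.sum_congr rfl
        intro i _
        field_simp
        ring
      rw [lin, lin2]
      have a1 : It (t, x) = (∫ y in c1..c2, Ut (t, x, y) * E (t, x, y)) + ∑ i, et i (t, x) * Ei i (t, x) := rfl
      have a2 : Ix (t, x) = (∫ y in c1..c2, Ux (t, x, y) * E (t, x, y)) + ∑ i, ex i (t, x) * Ei i (t, x) := rfl
      have a3 : Ixx (t, x) = (∫ y in c1..c2, (Uxx (t, x, y) - 1 / ε * Ux (t, x, y) ^ 2) * E (t, x, y)) + ∑ i, (exx i (t, x) - 1 / ε * ex i (t, x) ^ 2) * Ei i (t, x) := rfl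
      have a4 : Z (t, x) = (∫ y in c1..c2, 1 * E (t, x, y)) + ∑ i, 1 * Ei i (t, x) := rfl
      have lhs : Z (t, x) * (It (t, x) / Z (t, x) + (b * P + s ^ 2 / 2 * (Ixx (t, x) / Z (t, x) + 1 / ε * P ^ 2)) + f)
          = It (t, x) + (b + s ^ 2 / ε * P) * Ix (t, x) + s ^ 2 / 2 * Ixx (t, x) + (f - s ^ 2 / (2 * ε) * P ^ 2) * Z (t, x) := by
        rw [hPZ]
        field_simp
        ring
      rw [lhs, a1, a2, a3, a4]
      ring
end

section
open MeasureTheory Filter Set Topology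
open ProbabilityTheory
set_option linter.all false

lemma algA (ε ut uy uyy b β βy s σ σy fx fy P r lam lam' lam0 K d Lf D : ℝ) (hε : 0 < ε) (hlam0 : 0 < lam0) (hlam : lam0 ≤ lam) (hK : 0 ≤ K) (hd : 0 ≤ d)
    (hsup : ut + (β * uy + σ ^ 2 / 2 * uyy) ≤ - fy) (hb : |b - β| ≤ K * |r| + d) (hs : |s - σ| ≤ K * |r| + d) (hf : |fx - fy| ≤ Lf * |r|)
    (hlam' : lam' = -(2 * K ^ 2 + 2 * K + 2) * lam) (hβy : |βy| ≤ D) (hσy : |σy| ≤ D) :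
    ut + lam' * r ^ 2 + b * (2 * lam * r) + s ^ 2 / 2 * (2 * lam) - s ^ 2 / (2 * ε) * (2 * lam * r - P) ^ 2 + fx ≤
      (ε * βy - σ * σy * (uy - 2 * lam * r) - σ ^ 2 / 2 * (uyy + 2 * lam) - s * σy * (2 * lam * r - P) + 2 * lam * (s * σ))
      + (ε * β - σ ^ 2 / 2 * (uy - 2 * lam * r) - s * σ * (2 * lam * r - P)) * (-(uy - 2 * lam * r) / ε)
      + (ε * (D ^ 2 / 2 + D) + 3 * lam * d ^ 2 + Lf ^ 2 / (4 * lam0)) := by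
  have hl : 0 < lam := hlam0.trans_le hlam
  set X := σ * (uy - 2 * lam * r) + s * (2 * lam * r - P) with hX
  have h1 : -X ^ 2 / (2 * ε) + σy * X ≤ ε * D ^ 2 / 2 := by
    have e1 : -X ^ 2 / (2 * ε) + σy * X = ε * σy ^ 2 / 2 - (X - ε * σy) ^ 2 / (2 * ε) := by field_simp; ring
    rw [e1]
    have e2 : 0 ≤ (X - ε * σy) ^ 2 / (2 * ε) := by positivity
    have e3 : σy ^ 2 ≤ D ^ 2 := sq_le_sq' (by linarith [(abs_le.1 hσy).1]) (abs_le.1 hσy).2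
    have : ε * σy ^ 2 ≤ ε * D ^ 2 := by gcongr
    linarith
  have h2 : -(ε * βy) ≤ ε * D := by
    have := mul_le_mul_of_nonneg_left (neg_le_of_abs_le hβy) hε.le
    linarith
  have hr2 : |r| ^ 2 = r ^ 2 := sq_abs r
  have hr0 := abs_nonneg r
  have h3 : 2 * lam * (b - β) * r ≤ lam * ((2 * K + 1) * r ^ 2 + d ^ 2) := by
    have : (b - β) * r ≤ (K * |r| + d) * |r| := by
      calc (b - β) * r ≤ |(b - β) * r| := le_abs_self _
        _ = |b - β| * |r| := abs_mul _ _
        _ ≤ _ := by gcongr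
    have h4 : 2 * ((b - β) * r) ≤ (2 * K + 1) * r ^ 2 + d ^ 2 := by
      rw [← hr2]
      nlinarith [sq_nonneg (|r| - d)]
    have := mul_le_mul_of_nonneg_left h4 hl.le
    linarith
  have h4 : lam * (s - σ) ^ 2 ≤ lam * (2 * (K ^ 2 * r ^ 2 + d ^ 2)) := by
    have : (s - σ) ^ 2 ≤ (K * |r| + d) ^ 2 := by
      rw [← sq_abs (s - σ)]; gcongr
    have h5 : (s - σ) ^ 2 ≤ 2 * (K ^ 2 * r ^ 2 + d ^ 2) := by
      rw [← hr2]
      nlinarith [sq_nonneg (K * |r| - d)]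
    exact mul_le_mul_of_nonneg_left h5 hl.le
  have h5 : fx - fy ≤ lam * r ^ 2 + Lf ^ 2 / (4 * lam0) := by
    have k1 : Lf * |r| ≤ lam0 * r ^ 2 + Lf ^ 2 / (4 * lam0) := by
      have : lam0 * r ^ 2 + Lf ^ 2 / (4 * lam0) - Lf * |r| = (2 * lam0 * |r| - Lf) ^ 2 / (4 * lam0) := by
        rw [← hr2]; field_simp; ring
      have k2 : 0 ≤ (2 * lam0 * |r| - Lf) ^ 2 / (4 * lam0) := by positivity
      linarith
    have k2 : lam0 * r ^ 2 ≤ lam * r ^ 2 := by gcongr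
    linarith [le_abs_self (fx - fy)]
  have id : (ut + lam' * r ^ 2 + b * (2 * lam * r) + s ^ 2 / 2 * (2 * lam) - s ^ 2 / (2 * ε) * (2 * lam * r - P) ^ 2 + fx)
     - ((ε * βy - σ * σy * (uy - 2 * lam * r) - σ ^ 2 / 2 * (uyy + 2 * lam) - s * σy * (2 * lam * r - P) + 2 * lam * (s * σ))
      + (ε * β - σ ^ 2 / 2 * (uy - 2 * lam * r) - s * σ * (2 * lam * r - P)) * (-(uy - 2 * lam * r) / ε)) = 
      (ut + (β * uy + σ ^ 2 / 2 * uyy) + fy) + (fx - fy) + 2 * lam * (b - β) * r + lam * (s - σ) ^ 2 + lam' * r ^ 2 + (-X ^ 2 / (2 * ε) + σy * X) - ε * βy := by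
    rw [hX]
    field_simp
    ring
  have h6 : lam' * r ^ 2 = - lam * ((2 * K ^ 2 + 2 * K + 2) * r ^ 2) := by rw [hlam']; ring
  have h7 : (ut + (β * uy + σ ^ 2 / 2 * uyy) + fy) + (fx - fy) + 2 * lam * (b - β) * r + lam * (s - σ) ^ 2 + lam' * r ^ 2 + (-X ^ 2 / (2 * ε) + σy * X) - ε * βy
      ≤ ε * (D ^ 2 / 2 + D) + 3 * lam * d ^ 2 + Lf ^ 2 / (4 * lam0) := by
    have h8 : lam * ((2 * K + 1) * r ^ 2 + d ^ 2) + lam * (2 * (K ^ 2 * r ^ 2 + d ^ 2)) + - lam * ((2 * K ^ 2 + 2 * K + 2) * r ^ 2) + lam * r ^ 2 = 3 * lam * d ^ 2 := by ring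
    have h9 : ε * (D ^ 2 / 2 + D) = ε * D ^ 2 / 2 + ε * D := by ring
    rw [h9]
    linarith
  rw [← id] at h7
  exact sub_le_iff_le_add'.1 h7

theorem ibp_point {c1 c2 ε : ℝ} (hc : c1 < c2) (hε : 0 < ε) (u ut uy uyy β σ βy σy fy : ℝ → ℝ)
    (cu : Continuous u) (cut : Continuous ut) (cuy : Continuous uy) (cuyy : Continuous uyy) (cβ : Continuous β) (cσ : Continuous σ)
    (cβy : Continuous βy) (cσy : Continuous σy)
    (du : ∀ y ∈ Ioo c1 c2, HasDerivAt u (uy y) y) (duy : ∀ y ∈ Ioo c1 c2, HasDerivAt uy (uyy y) y)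
    (dβ : ∀ y ∈ Ioo c1 c2, HasDerivAt β (βy y) y) (dσ : ∀ y ∈ Ioo c1 c2, HasDerivAt σ (σy y) y)
    (x b s fx P lam lam' lam0 κ0 K d Lf D : ℝ) (hlam0 : 0 < lam0) (hlam : lam0 ≤ lam) (hK : 0 ≤ K) (hd : 0 ≤ d)
    (hsup : ∀ y ∈ Icc c1 c2, ut y + (β y * uy y + σ y ^ 2 / 2 * uyy y) ≤ - fy y) (hb : ∀ y ∈ Icc c1 c2, |b - β y| ≤ K * |x - y| + d)
    (hs : ∀ y ∈ Icc c1 c2, |s - σ y| ≤ K * |x - y| + d) (hf : ∀ y ∈ Icc c1 c2, |fx - fy y| ≤ Lf * |x - y|)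
    (hlam' : lam' = -(2 * K ^ 2 + 2 * K + 2) * lam) (hβy : ∀ y ∈ Icc c1 c2, |βy y| ≤ D) (hσy : ∀ y ∈ Icc c1 c2, |σy y| ≤ D) :
    ∫ y in c1..c2, (ut y + lam' * (x - y) ^ 2 + b * (2 * lam * (x - y)) + s ^ 2 / 2 * (2 * lam) - s ^ 2 / (2 * ε) * (2 * lam * (x - y) - P) ^ 2 + fx)
       * Real.exp (-(u y + lam * (x - y) ^ 2 + κ0) / ε) ≤
      (ε * (D ^ 2 / 2 + D) + 3 * lam * d ^ 2 + Lf ^ 2 / (4 * lam0)) * (∫ y in c1..c2, Real.exp (-(u y + lam * (x - y) ^ 2 + κ0) / ε))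
      + ((ε * β c2 - σ c2 ^ 2 / 2 * (uy c2 - 2 * lam * (x - c2)) - s * σ c2 * (2 * lam * (x - c2) - P)) * Real.exp (-(u c2 + lam * (x - c2) ^ 2 + κ0) / ε)
      - (ε * β c1 - σ c1 ^ 2 / 2 * (uy c1 - 2 * lam * (x - c1)) - s * σ c1 * (2 * lam * (x - c1) - P)) * Real.exp (-(u c1 + lam * (x - c1) ^ 2 + κ0) / ε)) := by
  set E : ℝ → ℝ := fun y => Real.exp (-(u y + lam * (x - y) ^ 2 + κ0) / ε) with hE
  have cE : Continuous E := by rw [hE]; fun_prop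
  let Φ : ℝ → ℝ := fun y => ε * β y - σ y ^ 2 / 2 * (uy y - 2 * lam * (x - y)) - s * σ y * (2 * lam * (x - y) - P)
  let Ψ : ℝ → ℝ := fun y => (ε * βy y - σ y * σy y * (uy y - 2 * lam * (x - y)) - σ y ^ 2 / 2 * (uyy y + 2 * lam) - s * σy y * (2 * lam * (x - y) - P) + 2 * lam * (s * σ y))
      + (ε * β y - σ y ^ 2 / 2 * (uy y - 2 * lam * (x - y)) - s * σ y * (2 * lam * (x - y) - P)) * (-(uy y - 2 * lam * (x - y)) / ε)
  have cΦ : Continuous Φ := by simp only [Φ]; fun_prop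
  have cΨ : Continuous Ψ := by simp only [Ψ]; fun_prop
  have hder : ∀ y ∈ Ioo c1 c2, HasDerivAt (fun y => Φ y * E y) (Ψ y * E y) y := by
    intro y hy
    have hr : HasDerivAt (fun y => x - y) (-1) y := by simpa using (hasDerivAt_id y).const_sub x
    have hEd : HasDerivAt E (E y * (-(uy y - 2 * lam * (x - y)) / ε)) y := by
      have := (((((du y hy).add ((hr.pow 2).const_mul lam)).add_const κ0).neg).div_const ε).exp
      refine this.congr_deriv ?_
      simp only [hE, Pi.neg_apply, Pi.add_apply, Pi.pow_apply]
      ring_nf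
    have hΦd : HasDerivAt Φ (ε * βy y - σ y * σy y * (uy y - 2 * lam * (x - y)) - σ y ^ 2 / 2 * (uyy y + 2 * lam) - s * σy y * (2 * lam * (x - y) - P) + 2 * lam * (s * σ y)) y := by
      have k1 := (dβ y hy).const_mul ε
      have k2 := (((dσ y hy).pow 2).div_const 2).mul ((duy y hy).sub (hr.const_mul (2 * lam)))
      have k3 := ((dσ y hy).const_mul s).mul ((hr.const_mul (2 * lam)).sub_const P)
      refine ((k1.sub k2).sub k3).congr_deriv ?_
      simp only [Pi.pow_apply, Pi.sub_apply]
      ring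
    refine (hΦd.mul hEd).congr_deriv ?_
    simp only [Ψ, Φ]
    ring
  have ftc := intervalIntegral.integral_eq_sub_of_hasDerivAt_of_le hc.le (cΦ.mul cE).continuousOn hder ((cΨ.mul cE).intervalIntegrable _ _)
  set err := ε * (D ^ 2 / 2 + D) + 3 * lam * d ^ 2 + Lf ^ 2 / (4 * lam0) with herr
  have e1 : err * (∫ y in c1..c2, E y) + (Φ c2 * E c2 - Φ c1 * E c1) = ∫ y in c1..c2, (Ψ y * E y + err * E y) := by
    have i1 : IntervalIntegrable (fun y => Ψ y * E y) volume c1 c2 := (cΨ.mul cE).intervalIntegrable _ _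
    have i2 : IntervalIntegrable (fun y => err * E y) volume c1 c2 := (continuous_const.mul cE).intervalIntegrable _ _
    rw [intervalIntegral.integral_add i1 i2, ftc, intervalIntegral.integral_const_mul]
    simp only [Pi.mul_apply]
    ring
  refine le_trans ?_ e1.ge
  apply intervalIntegral.integral_mono_on hc.le
  · apply Continuous.intervalIntegrable
    fun_prop
  · exact ((cΨ.mul cE).add (continuous_const.mul cE)).intervalIntegrable _ _
  · intro y hy
    have := algA ε (ut y) (uy y) (uyy y) b (β y) (βy y) s (σ y) (σy y) fx (fy y) P (x - y) lam lam' lam0 K d Lf D hε hlam0 hlam hK hd (hsup y hy) (hb y hy) (hs y hy) (hf y hy) hlam' (hβy y hy) (hσy y hy)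
    have h0 : 0 ≤ E y := (Real.exp_pos _).le
    have h2 := mul_le_mul_of_nonneg_right this h0
    refine h2.trans (le_of_eq ?_)
    simp only [Ψ]
    ring
end

section
open MeasureTheory Filter Set Topology
open ProbabilityTheory
set_option linter.all false

lemma atom_ineq (M γ c Cb Cg Cf ℓ gt b s f sg h : ℝ) (hM : 0 < M) (hγ : 0 < γ) (hc : 0 < c) (hsg : |sg| = 1) (hb : |b| ≤ Cb) (hs : c ≤ s) (hgt : |gt| ≤ Cg) (hf : |f| ≤ Cf)
    (hγ2 : Cb + 1 ≤ c ^ 2 * γ / 2) (hM2 : Cg + Cf ≤ M * γ * Real.exp (-(γ * ℓ))) (hh : h ≤ ℓ) :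
    gt + b * (M * γ * sg * Real.exp (-(γ * h))) + s ^ 2 / 2 * (-(M * γ ^ 2 * Real.exp (-(γ * h)))) + f ≤ 0 := by
  have he : Real.exp (-(γ * ℓ)) ≤ Real.exp (-(γ * h)) := Real.exp_le_exp.2 (by nlinarith)
  set e := Real.exp (-(γ * h))
  have hMg : 0 < M * γ := by positivity
  have he0 : 0 < e := Real.exp_pos _
  have k1 : M * γ * Real.exp (-(γ * ℓ)) ≤ M * γ * e := by gcongr
  have k2 : b * sg ≤ Cb := by
    calc b * sg ≤ |b * sg| := le_abs_self _
      _ = |b| := by rw [abs_mul, hsg, mul_one]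
      _ ≤ Cb := hb
  have k3 : c ^ 2 ≤ s ^ 2 := by gcongr
  have k4 : b * sg - s ^ 2 / 2 * γ ≤ -1 := by nlinarith
  have k5 : M * γ * e * (b * sg - s ^ 2 / 2 * γ) ≤ M * γ * e * (-1) := by gcongr
  have k6 : b * (M * γ * sg * e) + s ^ 2 / 2 * (-(M * γ ^ 2 * e)) = M * γ * e * (b * sg - s ^ 2 / 2 * γ) := by ring
  linarith [le_abs_self gt, le_abs_self f]

lemma atom_lower (M γ ℓ Lg h : ℝ) (hM : 0 < M) (hγ : 0 < γ) (hM1 : Lg ≤ M * γ * Real.exp (-(γ * ℓ))) (h0 : 0 ≤ h) (hh : h ≤ ℓ) :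
    Lg * h ≤ M * (1 - Real.exp (-(γ * h))) := by
  have he : Real.exp (-(γ * ℓ)) ≤ Real.exp (-(γ * h)) := Real.exp_le_exp.2 (by nlinarith)
  have h1 : γ * h * Real.exp (-(γ * h)) ≤ 1 - Real.exp (-(γ * h)) := by
    have := Real.add_one_le_exp (γ * h)
    have h2 : Real.exp (γ * h) * Real.exp (-(γ * h)) = 1 := by rw [← Real.exp_add]; simp
    have h3 := Real.exp_pos (-(γ * h))
    nlinarith
  calc Lg * h ≤ M * γ * Real.exp (-(γ * ℓ)) * h := by gcongr
    _ ≤ M * γ * Real.exp (-(γ * h)) * h := by gcongr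
    _ = M * (γ * h * Real.exp (-(γ * h))) := by ring
    _ ≤ _ := by gcongr

lemma atom_upper (M γ h : ℝ) (hM : 0 < M) : M * (1 - Real.exp (-(γ * h))) ≤ M * γ * h := by
  have := Real.add_one_le_exp (-(γ * h))
  nlinarith

lemma young (lam0 a r : ℝ) (h : 0 < lam0) : a * r ≤ lam0 * r ^ 2 + a ^ 2 / (4 * lam0) := by
  have : lam0 * r ^ 2 + a ^ 2 / (4 * lam0) - a * r = (2 * lam0 * r - a) ^ 2 / (4 * lam0) := by
    field_simp; ring
  have k2 : 0 ≤ (2 * lam0 * r - a) ^ 2 / (4 * lam0) := by positivity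
  linarith

/-- Hypotheses on the smooth coefficients. -/
structure SmData (T c1 c2 : ℝ) (A : Set ℝ) (β σ βy σy f : ℝ × ℝ × ℝ → ℝ) (g gt : ℝ × ℝ → ℝ) (D Lf Cf Lg Cg : ℝ) : Prop where
  cβ : Continuous β
  cσ : Continuous σ
  cβy : Continuous βy
  cσy : Continuous σy
  cg : Continuous g
  cgt : Continuous gt
  dβ : ∀ t y a, HasDerivAt (fun y => β (t, y, a)) (βy (t, y, a)) y
  dσ : ∀ t y a, HasDerivAt (fun y => σ (t, y, a)) (σy (t, y, a)) y
  dg : ∀ t x, HasDerivAt (fun r => g (r, x)) (gt (t, x)) t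
  bD : ∀ t ∈ Icc 0 T, ∀ x ∈ Icc c1 c2, ∀ a ∈ A, |β (t, x, a)| ≤ D ∧ |σ (t, x, a)| ≤ D ∧ |βy (t, x, a)| ≤ D ∧ |σy (t, x, a)| ≤ D
  fL : ∀ t ∈ Icc 0 T, ∀ x ∈ Icc c1 c2, ∀ y ∈ Icc c1 c2, ∀ a ∈ A, |f (t, x, a) - f (t, y, a)| ≤ Lf * |x - y|
  fC : ∀ t ∈ Icc 0 T, ∀ x ∈ Icc c1 c2, ∀ a ∈ A, |f (t, x, a)| ≤ Cf
  gL : ∀ t ∈ Icc 0 T, ∀ x ∈ Icc c1 c2, ∀ y ∈ Icc c1 c2, |g (t, x) - g (t, y)| ≤ Lg * |x - y|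
  gC : ∀ t ∈ Icc 0 T, ∀ x ∈ Icc c1 c2, |gt (t, x)| ≤ Cg

/-- Hypotheses on the true coefficients. -/
structure TrData (T c1 c2 : ℝ) (A : Set ℝ) (β σ β' σ' : ℝ × ℝ × ℝ → ℝ) (c Cb K : ℝ) (dd : ℝ → ℝ) : Prop where
  hc : 0 < c
  hK : 0 ≤ K
  b : ∀ t ∈ Icc 0 T, ∀ x ∈ Icc c1 c2, ∀ a ∈ A, |β (t, x, a)| ≤ Cb ∧ |σ (t, x, a)| ≤ Cb ∧ c ≤ σ (t, x, a)
  L : ∀ t ∈ Icc 0 T, ∀ x ∈ Icc c1 c2, ∀ y ∈ Icc c1 c2, ∀ a ∈ A, |β (t, x, a) - β (t, y, a)| ≤ K * |x - y| ∧ |σ (t, x, a) - σ (t, y, a)| ≤ K * |x - y|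
  hd : ∀ t, 0 ≤ dd t
  d : ∀ t ∈ Icc 0 T, ∀ x ∈ Icc c1 c2, ∀ a ∈ A, |β (t, x, a) - β' (t, x, a)| ≤ dd t ∧ |σ (t, x, a) - σ' (t, x, a)| ≤ dd t

set_option maxHeartbeats 1600000 in
theorem W_super {T c1 c2 : ℝ} (hT : 0 < T) (hc : c1 < c2) {A : Set ℝ} {β' σ' βy σy f : ℝ × ℝ × ℝ → ℝ} {g gt : ℝ × ℝ → ℝ} {D Lf Cf Lg Cg : ℝ}
    (S : SmData T c1 c2 A β' σ' βy σy f g gt D Lf Cf Lg Cg) {β σ : ℝ × ℝ × ℝ → ℝ} {c Cb K : ℝ} {dd : ℝ → ℝ}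
    (R : TrData T c1 c2 A β σ β' σ' c Cb K dd) {M γ lam0 : ℝ} (hM : 0 < M) (hγ : 0 < γ) (hlam0 : 0 < lam0)
    (hγ2 : Cb + 1 ≤ c ^ 2 * γ / 2) (hM1 : Lg ≤ M * γ * Real.exp (-(γ * (c2 - c1)))) (hM2 : Cg + Cf ≤ M * γ * Real.exp (-(γ * (c2 - c1))))
    {u ut ux uxx : ℝ → ℝ → ℝ} (hu : Tst T (Ioo c1 c2) u ut ux uxx)
    (hsup : ∀ q ∈ Icc 0 T ×ˢ Icc c1 c2 ×ˢ A, ut q.1 q.2.1 + (β' q * ux q.1 q.2.1 + σ' q ^ 2 / 2 * uxx q.1 q.2.1) ≤ - f q)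
    (hug : ∀ p ∈ Icc 0 T ×ˢ Icc c1 c2, g p ≤ u p.1 p.2) :
    ∃ CΦ : ℝ, 0 ≤ CΦ ∧ ∀ ε η : ℝ, 0 < ε → ε ≤ 1 → 0 < η → ∃ W Wt Wx Wxx : ℝ → ℝ → ℝ, IsCb12 T (Ioo c1 c2) W Wt Wx Wxx ∧
      (∀ t ∈ Icc 0 T, ∀ x ∈ Icc c1 c2, ∀ a ∈ A, Wt t x + (β (t, x, a) * Wx t x + σ (t, x, a) ^ 2 / 2 * Wxx t x) + f (t, x, a) ≤
        ε * (D ^ 2 / 2 + D) + 3 * (lam0 * Real.exp ((2 * K ^ 2 + 2 * K + 2) * T)) * dd t ^ 2 + Lf ^ 2 / (4 * lam0) + CΦ * Real.exp (-η / ε)) ∧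
      (∀ t ∈ Icc 0 T, ∀ x ∈ Icc c1 c2, g (t, x) - ε * Real.log (c2 - c1 + 2) ≤ W t x) ∧
      (∀ x ∈ Icc c1 c2, ∀ r ω, 0 < r → r ≤ (c2 - c1) / 2 → (∀ y ∈ Icc c1 c2, |x - y| ≤ r → u 0 y ≤ u 0 x + ω) →
        W 0 x ≤ u 0 x + ((M * γ) ^ 2 / (4 * lam0) + η) + ω + (lam0 * Real.exp ((2 * K ^ 2 + 2 * K + 2) * T)) * r ^ 2 - ε * Real.log r) := by
  have hcl : closure (Ioo c1 c2) = Icc c1 c2 := closure_Ioo hc.ne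
  set CC := 2 * K ^ 2 + 2 * K + 2 with hCC
  have hK := R.hK
  have hCC0 : 0 ≤ CC := by positivity
  obtain ⟨Cu, hCu0, hCu⟩ := hu.b
  set Λ := lam0 * Real.exp (CC * T) with hΛ
  have hΛ0 : 0 < Λ := by positivity
  set ℓ := c2 - c1 with hℓ
  have hℓ0 : 0 < ℓ := by rw [hℓ]; linarith
  set B1 := |D| + |D| ^ 2 / 2 * (Cu + 2 * Λ * ℓ) + |Cb| * |D| * (4 * Λ * ℓ + M * γ) with hB1
  have hB10 : 0 ≤ B1 := by positivity
  refine ⟨2 * B1, by positivity, ?_⟩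
  intro ε η hε hε1 hη
  set lam : ℝ → ℝ := fun t => lam0 * Real.exp (CC * (T - t)) with hlam
  have hlamlo : ∀ t ∈ Icc 0 T, lam0 ≤ lam t := by
    intro t ht
    have : 1 ≤ Real.exp (CC * (T - t)) := Real.one_le_exp (mul_nonneg hCC0 (by linarith [ht.2]))
    calc lam0 = lam0 * 1 := by ring
      _ ≤ lam0 * Real.exp (CC * (T - t)) := by gcongr
  have hlamhi : ∀ t ∈ Icc 0 T, lam t ≤ Λ := by
    intro t ht
    simp only [hlam, hΛ]
    gcongr
    linarith [ht.1]
  have clam : Continuous lam := by rw [hlam]; fun_prop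
  have dlam : ∀ t, HasDerivAt lam (-CC * lam t) t := by
    intro t
    have := ((((hasDerivAt_id t).const_sub T).const_mul CC).exp).const_mul lam0
    refine this.congr_deriv ?_
    simp only [hlam, id]
    ring
  set κ0 := (M * γ) ^ 2 / (4 * lam0) + η with hκ0
  let ci : Fin 2 → ℝ := ![c1, c2]
  let sg : Fin 2 → ℝ := ![1, -1]
  have hci : ∀ i, ci i ∈ Icc c1 c2 := by
    intro i; fin_cases i
    · exact ⟨le_rfl, hc.le⟩
    · exact ⟨hc.le, le_rfl⟩
  have hsg : ∀ i, |sg i| = 1 := by intro i; fin_cases i <;> simp [sg]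
  have hsg2 : ∀ i, sg i ^ 2 = 1 := by intro i; rw [← sq_abs, hsg, one_pow]
  have hh0 : ∀ i, ∀ x ∈ Icc c1 c2, 0 ≤ sg i * (x - ci i) := by
    intro i x hx; fin_cases i
    · simp [sg, ci]; exact hx.1
    · simp [sg, ci]; exact hx.2
  have hhℓ : ∀ i, ∀ x ∈ Icc c1 c2, sg i * (x - ci i) ≤ ℓ := by
    intro i x hx; fin_cases i
    · simp [sg, ci, hℓ]; linarith [hx.2]
    · simp [sg, ci, hℓ]; linarith [hx.1]
  have hhabs : ∀ i, ∀ x ∈ Icc c1 c2, |x - ci i| = sg i * (x - ci i) := by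
    intro i x hx
    rw [← abs_of_nonneg (hh0 i x hx), abs_mul, hsg, one_mul]
  let U : ℝ × ℝ × ℝ → ℝ := fun q => u q.1 q.2.2 + lam q.1 * (q.2.1 - q.2.2) ^ 2 + κ0
  let Ut : ℝ × ℝ × ℝ → ℝ := fun q => ut q.1 q.2.2 + (-CC * lam q.1) * (q.2.1 - q.2.2) ^ 2
  let Ux : ℝ × ℝ × ℝ → ℝ := fun q => 2 * lam q.1 * (q.2.1 - q.2.2)
  let Uxx : ℝ × ℝ × ℝ → ℝ := fun q => 2 * lam q.1
  let e : Fin 2 → ℝ × ℝ → ℝ := fun i p => g (p.1, ci i) + M * (1 - Real.exp (-(γ * (sg i * (p.2 - ci i)))))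
  let et : Fin 2 → ℝ × ℝ → ℝ := fun i p => gt (p.1, ci i)
  let ex : Fin 2 → ℝ × ℝ → ℝ := fun i p => M * γ * sg i * Real.exp (-(γ * (sg i * (p.2 - ci i))))
  let exx : Fin 2 → ℝ × ℝ → ℝ := fun i p => -(M * γ ^ 2 * Real.exp (-(γ * (sg i * (p.2 - ci i)))))
  have cpr : Continuous fun q : ℝ × ℝ × ℝ => (q.1, q.2.2) := by fun_prop
  have cu1 : Continuous fun q : ℝ × ℝ × ℝ => u q.1 q.2.2 := hu.c.comp cpr
  have cu2 : Continuous fun q : ℝ × ℝ × ℝ => ut q.1 q.2.2 := hu.ct.comp cpr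
  have cg := S.cg
  have cU : Continuous U := (cu1.add ((clam.comp continuous_fst).mul (by fun_prop))).add continuous_const
  have cUt : Continuous Ut := cu2.add ((continuous_const.mul (clam.comp continuous_fst)).mul (by fun_prop))
  have cgt := S.cgt
  have expd : ∀ i x, HasDerivAt (fun r => Real.exp (-(γ * (sg i * (r - ci i))))) (-(γ * sg i) * Real.exp (-(γ * (sg i * (x - ci i))))) x := by
    intro i x
    have := (((((hasDerivAt_id x).sub_const (ci i)).const_mul (sg i)).const_mul γ).neg).exp
    refine this.congr_deriv ?_
    simp only [Pi.neg_apply, id]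
    ring
  obtain ⟨W, Wt, Wx, Wxx, hW, hWp⟩ := softmin (T := T) hc hε U Ut Ux Uxx cU cUt (by simp only [Ux]; fun_prop) (by simp only [Uxx]; fun_prop)
    (by
      intro t ht x hx y hy
      have k1 := hu.is.deriv_t t ht y (by rw [hcl]; exact hy)
      exact (k1.add ((dlam t).mul_const ((x - y) ^ 2)).hasDerivWithinAt).add_const κ0)
    (by
      intro t ht x hx y hy
      have k1 := (((((hasDerivAt_id x).sub_const y).pow 2).const_mul (lam t)).const_add (u t y)).add_const κ0
      refine (k1.congr_deriv ?_).hasDerivWithinAt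
      simp only [Ux, id]
      ring)
    (by
      intro t ht x hx y hy
      have k1 := ((hasDerivAt_id x).sub_const y).const_mul (2 * lam t)
      refine (k1.congr_deriv ?_).hasDerivWithinAt
      simp only [Uxx]
      ring)
    e et ex exx (by intro i; simp only [e]; fun_prop) (by intro i; simp only [et]; fun_prop) (by intro i; simp only [ex]; fun_prop) (by intro i; simp only [exx]; fun_prop)
    (by
      intro i t ht x hx
      have k := (S.dg t (ci i)).add_const (M * (1 - Real.exp (-(γ * (sg i * (x - ci i))))))
      exact k.hasDerivWithinAt)
    (by
      intro i t ht x hx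
      refine (((((expd i x).const_sub 1).const_mul M).const_add (g (t, ci i))).congr_deriv ?_).hasDerivWithinAt
      simp only [ex]
      ring)
    (by
      intro i t ht x hx
      refine (((expd i x).const_mul (M * γ * sg i)).congr_deriv ?_).hasDerivWithinAt
      simp only [exx]
      have := hsg2 i
      linear_combination (-M * γ ^ 2 * Real.exp (-(γ * (sg i * (x - ci i))))) * this)
  have hUE : ∀ t x, Continuous fun y => Real.exp (-U (t, x, y) / ε) := by
    intro t x
    apply cont_exp_div
    exact cU.comp (by fun_prop)
  have hUxc : ∀ t x, Continuous fun y => Ux (t, x, y) := by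
    intro t x
    simp only [Ux]
    fun_prop
  -- lower bounds
  have hUi : ∀ i, ∀ t ∈ Icc 0 T, ∀ x ∈ Icc c1 c2, e i (t, x) + η ≤ U (t, x, ci i) := by
    intro i t ht x hx
    have k1 := hug (t, ci i) ⟨ht, hci i⟩
    have k2 := atom_upper M γ (sg i * (x - ci i)) hM
    have k3 := young lam0 (M * γ) (sg i * (x - ci i)) hlam0
    rw [mul_pow, hsg2, one_mul] at k3
    have k4 : lam0 * (x - ci i) ^ 2 ≤ lam t * (x - ci i) ^ 2 := by gcongr; exact hlamlo t ht
    simp only [e, U, hκ0]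
    simp only at k1
    linarith
  have hUg : ∀ t ∈ Icc 0 T, ∀ x ∈ Icc c1 c2, ∀ y ∈ Icc c1 c2, g (t, x) ≤ U (t, x, y) := by
    intro t ht x hx y hy
    have k1 := hug (t, y) ⟨ht, hy⟩
    have k2 := S.gL t ht x hx y hy
    have k3 := young lam0 (M * γ) |x - y| hlam0
    rw [sq_abs] at k3
    have k4 : lam0 * (x - y) ^ 2 ≤ lam t * (x - y) ^ 2 := by gcongr; exact hlamlo t ht
    have k5 : Lg * |x - y| ≤ M * γ * |x - y| := by
      gcongr
      refine hM1.trans ?_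
      have : Real.exp (-(γ * ℓ)) ≤ 1 := Real.exp_le_one_iff.2 (by have : 0 ≤ γ * ℓ := by positivity
                                                                  linarith)
      calc M * γ * Real.exp (-(γ * ℓ)) ≤ M * γ * 1 := by gcongr
        _ = _ := by ring
    simp only [U, hκ0]
    simp only at k1
    linarith [le_abs_self (g (t, x) - g (t, y))]
  have heg : ∀ i, ∀ t ∈ Icc 0 T, ∀ x ∈ Icc c1 c2, g (t, x) ≤ e i (t, x) := by
    intro i t ht x hx
    have k2 := S.gL t ht x hx (ci i) (hci i)
    rw [hhabs i x hx] at k2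
    have := atom_lower M γ ℓ Lg (sg i * (x - ci i)) hM hγ hM1 (hh0 i x hx) (hhℓ i x hx)
    simp only [e]
    linarith [le_abs_self (g (t, x) - g (t, ci i))]
  refine ⟨W, Wt, Wx, Wxx, hW, ?_, ?_, ?_⟩
  · intro t ht x hx a ha
    obtain ⟨Z, hZ0, hZ, -, hP, hmain⟩ := hWp t x
    have hm := hmain (β (t, x, a)) (σ (t, x, a)) (f (t, x, a))
    set P := Wx t x with hPdef
    set I := ∫ y in c1..c2, Real.exp (-U (t, x, y) / ε) with hI
    have hI0 : 0 ≤ I := intervalIntegral.integral_nonneg hc.le (fun y _ => (Real.exp_pos _).le)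
    have hEi0 : ∀ i, 0 < Real.exp (-e i (t, x) / ε) := fun i => Real.exp_pos _
    have hIZ : I ≤ Z := by
      rw [hZ]
      have : 0 ≤ ∑ i, Real.exp (-e i (t, x) / ε) := Finset.sum_nonneg fun i _ => (hEi0 i).le
      linarith
    have hEiZ : ∀ i, Real.exp (-e i (t, x) / ε) ≤ Z := by
      intro i
      rw [hZ]
      have := Finset.single_le_sum (f := fun i => Real.exp (-e i (t, x) / ε)) (fun i _ => (hEi0 i).le) (Finset.mem_univ i)
      linarith
    have hxy : ∀ y ∈ Icc c1 c2, |x - y| ≤ ℓ := by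
      intro y hy
      rw [abs_le, hℓ]
      constructor <;> linarith [hx.1, hx.2, hy.1, hy.2]
    have hlt0 : 0 < lam t := hlam0.trans_le (hlamlo t ht)
    have hUxb : ∀ y ∈ Icc c1 c2, |Ux (t, x, y)| ≤ 2 * Λ * ℓ := by
      intro y hy
      simp only [Ux]
      rw [abs_mul, abs_of_pos (by positivity)]
      have := hlamhi t ht
      have := hxy y hy
      gcongr
    have hexb : ∀ i, |ex i (t, x)| ≤ M * γ := by
      intro i
      simp only [ex]
      rw [abs_mul, abs_mul, hsg, mul_one, abs_of_pos (by positivity : 0 < M * γ), abs_of_pos (Real.exp_pos _)]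
      have : Real.exp (-(γ * (sg i * (x - ci i)))) ≤ 1 := Real.exp_le_one_iff.2 (by
        have : 0 ≤ γ * (sg i * (x - ci i)) := mul_nonneg hγ.le (hh0 i x hx)
        linarith)
      calc _ ≤ M * γ * 1 := by gcongr
        _ = _ := by ring
    have hPb : |P| ≤ 2 * Λ * ℓ + M * γ := by
      have k1 : |∫ y in c1..c2, Ux (t, x, y) * Real.exp (-U (t, x, y) / ε)| ≤ (2 * Λ * ℓ + M * γ) * I := by
        calc _ ≤ ∫ y in c1..c2, |Ux (t, x, y) * Real.exp (-U (t, x, y) / ε)| := intervalIntegral.abs_integral_le_integral_abs hc.le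
          _ ≤ ∫ y in c1..c2, (2 * Λ * ℓ + M * γ) * Real.exp (-U (t, x, y) / ε) := by
            apply intervalIntegral.integral_mono_on hc.le
            · exact (((hUxc t x).mul (hUE t x)).abs).intervalIntegrable _ _
            · exact (continuous_const.mul (hUE t x)).intervalIntegrable _ _
            · intro y hy
              rw [abs_mul, abs_of_pos (Real.exp_pos _)]
              gcongr
              have : 0 < M * γ := by positivity
              linarith [hUxb y hy]
          _ = _ := intervalIntegral.integral_const_mul _ _
      have k2 : |∑ i, ex i (t, x) * Real.exp (-e i (t, x) / ε)| ≤ (2 * Λ * ℓ + M * γ) * ∑ i, Real.exp (-e i (t, x) / ε) := by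
        rw [Finset.mul_sum]
        refine (Finset.abs_sum_le_sum_abs _ _).trans (Finset.sum_le_sum fun i _ => ?_)
        rw [abs_mul, abs_of_pos (Real.exp_pos _)]
        gcongr
        have : 0 < 2 * Λ * ℓ := by positivity
        linarith [hexb i]
      have k3 : Z * |P| ≤ (2 * Λ * ℓ + M * γ) * Z := by
        rw [← abs_of_pos hZ0, ← abs_mul, hP, abs_of_pos hZ0, hZ, mul_add]
        exact (abs_add_le _ _).trans (add_le_add k1 k2)
      rw [mul_comm] at k3
      exact le_of_mul_le_mul_right k3 hZ0
    -- atoms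
    have hat : ∑ i, (et i (t, x) + β (t, x, a) * ex i (t, x) + σ (t, x, a) ^ 2 / 2 * exx i (t, x) - σ (t, x, a) ^ 2 / (2 * ε) * (ex i (t, x) - P) ^ 2 + f (t, x, a)) * Real.exp (-e i (t, x) / ε) ≤ 0 := by
      apply Finset.sum_nonpos
      intro i _
      apply mul_nonpos_of_nonpos_of_nonneg _ (hEi0 i).le
      have k := atom_ineq M γ c Cb Cg Cf ℓ (gt (t, ci i)) (β (t, x, a)) (σ (t, x, a)) (f (t, x, a)) (sg i) (sg i * (x - ci i)) hM hγ R.hc (hsg i) (R.b t ht x hx a ha).1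
        (R.b t ht x hx a ha).2.2 (S.gC t ht _ (hci i)) (S.fC t ht x hx a ha) hγ2 hM2 (hhℓ i x hx)
      have k2 : 0 ≤ σ (t, x, a) ^ 2 / (2 * ε) * (ex i (t, x) - P) ^ 2 := by positivity
      simp only [et, ex, exx] at k k2 ⊢
      linarith
    have cy : Continuous fun y : ℝ => (t, y, a) := by fun_prop
    have cty : Continuous fun y : ℝ => (t, y) := by fun_prop
    have ibp := ibp_point hc hε (fun y => u t y) (fun y => ut t y) (fun y => ux t y) (fun y => uxx t y) (fun y => β' (t, y, a)) (fun y => σ' (t, y, a))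
      (fun y => βy (t, y, a)) (fun y => σy (t, y, a)) (fun y => f (t, y, a)) (hu.c.comp cty) (hu.ct.comp cty) (hu.cx.comp cty) (hu.cxx.comp cty) (S.cβ.comp cy) (S.cσ.comp cy)
      (S.cβy.comp cy) (S.cσy.comp cy) (fun y hy => (hu.is.deriv_x t ht y (subset_closure hy)).hasDerivAt (by rw [hcl]; exact Icc_mem_nhds hy.1 hy.2))
      (fun y hy => (hu.is.deriv_xx t ht y (subset_closure hy)).hasDerivAt (by rw [hcl]; exact Icc_mem_nhds hy.1 hy.2))
      (fun y _ => S.dβ t y a) (fun y _ => S.dσ t y a) x (β (t, x, a)) (σ (t, x, a)) (f (t, x, a)) P (lam t) (-CC * lam t) lam0 κ0 K (dd t) Lf D hlam0 (hlamlo t ht) hK (R.hd t)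
      (fun y hy => hsup (t, y, a) ⟨ht, hy, ha⟩)
      (fun y hy => by
        have k1 := (R.L t ht x hx y hy a ha).1
        have k2 := (R.d t ht y hy a ha).1
        calc |β (t, x, a) - β' (t, y, a)| ≤ |β (t, x, a) - β (t, y, a)| + |β (t, y, a) - β' (t, y, a)| := abs_sub_le _ _ _
          _ ≤ _ := add_le_add k1 k2)
      (fun y hy => by
        have k1 := (R.L t ht x hx y hy a ha).2
        have k2 := (R.d t ht y hy a ha).2
        calc |σ (t, x, a) - σ' (t, y, a)| ≤ |σ (t, x, a) - σ (t, y, a)| + |σ (t, y, a) - σ' (t, y, a)| := abs_sub_le _ _ _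
          _ ≤ _ := add_le_add k1 k2)
      (fun y hy => S.fL t ht x hx y hy a ha) rfl (fun y hy => (S.bD t ht y hy a ha).2.2.1) (fun y hy => (S.bD t ht y hy a ha).2.2.2)
    -- boundary
    have hΦ : ∀ y ∈ Icc c1 c2, |ε * β' (t, y, a) - σ' (t, y, a) ^ 2 / 2 * (ux t y - 2 * lam t * (x - y)) - σ (t, x, a) * σ' (t, y, a) * (2 * lam t * (x - y) - P)| ≤ B1 := by
      intro y hy
      obtain ⟨d1, d2, -, -⟩ := S.bD t ht y hy a ha
      have d1' := d1.trans (le_abs_self D)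
      have d2' := d2.trans (le_abs_self D)
      have d3 := (R.b t ht x hx a ha).2.1.trans (le_abs_self Cb)
      have d4 := hUxb y hy
      simp only [Ux] at d4
      have d5 := (hCu t y).2.2.1
      have t1 : |ε * β' (t, y, a)| ≤ |D| := by
        rw [abs_mul, abs_of_pos hε]
        calc ε * |β' (t, y, a)| ≤ 1 * |D| := by gcongr
          _ = _ := one_mul _
      have t2 : |σ' (t, y, a) ^ 2 / 2 * (ux t y - 2 * lam t * (x - y))| ≤ |D| ^ 2 / 2 * (Cu + 2 * Λ * ℓ) := by
        rw [abs_mul, abs_div, abs_pow, abs_two]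
        have : |ux t y - 2 * lam t * (x - y)| ≤ Cu + 2 * Λ * ℓ := (abs_sub _ _).trans (add_le_add d5 d4)
        gcongr
      have t3 : |σ (t, x, a) * σ' (t, y, a) * (2 * lam t * (x - y) - P)| ≤ |Cb| * |D| * (4 * Λ * ℓ + M * γ) := by
        rw [abs_mul, abs_mul]
        have : |2 * lam t * (x - y) - P| ≤ 4 * Λ * ℓ + M * γ := (abs_sub _ _).trans (by linarith)
        gcongr
      calc _ ≤ |ε * β' (t, y, a)| + |σ' (t, y, a) ^ 2 / 2 * (ux t y - 2 * lam t * (x - y))| + |σ (t, x, a) * σ' (t, y, a) * (2 * lam t * (x - y) - P)| :=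
            (abs_sub _ _).trans (add_le_add (abs_sub _ _) le_rfl)
        _ ≤ _ := by rw [hB1]; linarith
    have hEb : ∀ i, Real.exp (-U (t, x, ci i) / ε) ≤ Real.exp (-η / ε) * Z := by
      intro i
      have k1 : Real.exp (-U (t, x, ci i) / ε) ≤ Real.exp (-η / ε) * Real.exp (-e i (t, x) / ε) := by
        rw [← Real.exp_add, ← add_div]
        apply Real.exp_le_exp.2
        have := hUi i t ht x hx
        gcongr
        linarith
      exact k1.trans (by gcongr; exact hEiZ i)
    have hbd : ∀ (i : Fin 2) (w : ℝ), |w| ≤ B1 → |w * Real.exp (-U (t, x, ci i) / ε)| ≤ B1 * (Real.exp (-η / ε) * Z) := by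
      intro i w hw
      rw [abs_mul, abs_of_pos (Real.exp_pos _)]
      exact mul_le_mul hw (hEb i) (Real.exp_pos _).le hB10
    have hb1 := hbd 0 _ (hΦ c1 (hci 0))
    have hb2 := hbd 1 _ (hΦ c2 (hci 1))
    set err := ε * (D ^ 2 / 2 + D) + 3 * lam t * dd t ^ 2 + Lf ^ 2 / (4 * lam0) with herr
    have herr0 : 0 ≤ err := by
      have : 0 ≤ D := (abs_nonneg _).trans (S.bD t ht x hx a ha).1
      positivity
    have herr2 : err ≤ ε * (D ^ 2 / 2 + D) + 3 * Λ * dd t ^ 2 + Lf ^ 2 / (4 * lam0) := by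
      have := hlamhi t ht
      rw [herr]
      gcongr
    have tot : Z * (Wt t x + (β (t, x, a) * P + σ (t, x, a) ^ 2 / 2 * Wxx t x) + f (t, x, a)) ≤ Z * (err + 2 * B1 * Real.exp (-η / ε)) := by
      rw [hm]
      have k1 : err * I ≤ err * Z := by gcongr
      have k2 := abs_le.1 hb1
      have k3 := abs_le.1 hb2
      have ibp' := ibp
      simp only [ci, Matrix.cons_val_zero, Matrix.cons_val_one, U] at k2 k3
      have hII : I = ∫ y in c1..c2, Real.exp (-(u t y + lam t * (x - y) ^ 2 + κ0) / ε) := rfl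
      rw [← hII] at ibp'
      simp only [Ut, Ux, Uxx, U]
      linarith [k2.1, k3.2]
    have := le_of_mul_le_mul_left tot hZ0
    linarith
  · intro t ht x hx
    obtain ⟨Z, hZ0, hZ, hWZ, -, -⟩ := hWp t x
    have k1 : Z ≤ Real.exp (-g (t, x) / ε) * (ℓ + 2) := by
      rw [hZ, mul_add]
      have m1 : ∫ y in c1..c2, Real.exp (-U (t, x, y) / ε) ≤ Real.exp (-g (t, x) / ε) * ℓ := by
        calc _ ≤ ∫ y in c1..c2, Real.exp (-g (t, x) / ε) := by
              apply intervalIntegral.integral_mono_on hc.le ((hUE t x).intervalIntegrable _ _) intervalIntegrable_const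
              intro y hy
              have := hUg t ht x hx y hy
              apply Real.exp_le_exp.2
              gcongr
          _ = _ := by rw [intervalIntegral.integral_const, smul_eq_mul, mul_comm]
      have m2 : ∑ i, Real.exp (-e i (t, x) / ε) ≤ ∑ i : Fin 2, Real.exp (-g (t, x) / ε) := by
        apply Finset.sum_le_sum
        intro i _
        have := heg i t ht x hx
        apply Real.exp_le_exp.2
        gcongr
      simp only [Finset.sum_const, Finset.card_univ, Fintype.card_fin, nsmul_eq_mul, Nat.cast_ofNat] at m2
      linarith
    have k2 : Real.log Z ≤ -g (t, x) / ε + Real.log (ℓ + 2) := by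
      calc Real.log Z ≤ Real.log (Real.exp (-g (t, x) / ε) * (ℓ + 2)) := Real.log_le_log hZ0 k1
        _ = _ := by rw [Real.log_mul (Real.exp_pos _).ne' (by positivity), Real.log_exp]
    rw [hWZ]
    have k3 := mul_le_mul_of_nonneg_left k2 hε.le
    have k4 : ε * (-g (t, x) / ε + Real.log (ℓ + 2)) = - g (t, x) + ε * Real.log (ℓ + 2) := by field_simp
    linarith
  · intro x hx r ω hr hr2 hω
    obtain ⟨Z, hZ0, hZ, hWZ, -, -⟩ := hWp 0 x
    have h0T : (0:ℝ) ∈ Icc 0 T := ⟨le_rfl, hT.le⟩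
    set H := u 0 x + ω + Λ * r ^ 2 + κ0 with hH
    have hexp : ∀ y ∈ Icc c1 c2, |x - y| ≤ r → Real.exp (-H / ε) ≤ Real.exp (-U (0, x, y) / ε) := by
      intro y hy hxy
      apply Real.exp_le_exp.2
      have k1 := hω y hy hxy
      have k2 : lam 0 * (x - y) ^ 2 ≤ Λ * r ^ 2 := by
        have := hlamhi 0 h0T
        rw [← sq_abs (x - y)]
        gcongr
      have : U (0, x, y) ≤ H := by simp only [U, hH]; linarith
      gcongr
    obtain ⟨a, ha1, ha2, ha3⟩ : ∃ a, c1 ≤ a ∧ a + r ≤ c2 ∧ ∀ y ∈ Icc a (a + r), |x - y| ≤ r := by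
      rcases le_total (x + r) c2 with h | h
      · refine ⟨x, hx.1, h, fun y hy => ?_⟩
        rw [abs_le]
        constructor <;> linarith [hy.1, hy.2]
      · refine ⟨x - r, by linarith, by linarith [hx.2], fun y hy => ?_⟩
        rw [abs_le]
        constructor <;> linarith [hy.1, hy.2]
    have k1 : r * Real.exp (-H / ε) ≤ Z := by
      have m1 : r * Real.exp (-H / ε) ≤ ∫ y in a..(a + r), Real.exp (-U (0, x, y) / ε) := by
        calc r * Real.exp (-H / ε) = ∫ y in a..(a + r), Real.exp (-H / ε) := by rw [intervalIntegral.integral_const, smul_eq_mul]; ring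
          _ ≤ _ := by
            apply intervalIntegral.integral_mono_on (by linarith) intervalIntegrable_const ((hUE 0 x).intervalIntegrable _ _)
            intro y hy
            exact hexp y ⟨ha1.trans hy.1, hy.2.trans ha2⟩ (ha3 y hy)
      have m2 : ∫ y in a..(a + r), Real.exp (-U (0, x, y) / ε) ≤ ∫ y in c1..c2, Real.exp (-U (0, x, y) / ε) := by
        apply intervalIntegral.integral_mono_interval ha1 (by linarith) ha2 (Eventually.of_forall fun y => (Real.exp_pos _).le) ((hUE 0 x).intervalIntegrable _ _)
      have m3 : 0 ≤ ∑ i, Real.exp (-e i (0, x) / ε) := Finset.sum_nonneg fun i _ => (Real.exp_pos _).le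
      rw [hZ]
      linarith
    have k2 : Real.log r + -H / ε ≤ Real.log Z := by
      calc Real.log r + -H / ε = Real.log (r * Real.exp (-H / ε)) := by rw [Real.log_mul hr.ne' (Real.exp_pos _).ne', Real.log_exp]
        _ ≤ _ := Real.log_le_log (by positivity) k1
    rw [hWZ]
    have k3 := mul_le_mul_of_nonneg_left k2 hε.le
    have k4 : ε * (Real.log r + -H / ε) = ε * Real.log r - H := by field_simp; ring
    rw [k4, hH] at k3
    linarith
end

section
open MeasureTheory Filter Set Topology
open ProbabilityTheory
set_option linter.all false

lemma St.integral_const_le {T : ℝ} {O A : Set ℝ} (hT : 0 ≤ T) (y : St T O A) (k : ℝ) (hk : 0 ≤ k) : ∫ q, k ∂y.Q ≤ T * k := by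
  rw [integral_const, smul_eq_mul]
  have : y.Q.real univ ≤ T := by
    have := ENNReal.toReal_mono ENNReal.ofReal_ne_top y.Q_univ
    rwa [ENNReal.toReal_ofReal hT] at this
  gcongr

lemma Tst.meas_L {T : ℝ} {O : Set ℝ} {u ut ux uxx : ℝ → ℝ → ℝ} (h : Tst T O u ut ux uxx) {β s : ℝ × ℝ × ℝ → ℝ} (hβ : Measurable β) (hs : Measurable s) :
    Measurable fun q : ℝ × ℝ × ℝ => ut q.1 q.2.1 + (β q * ux q.1 q.2.1 + s q ^ 2 / 2 * uxx q.1 q.2.1) := by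
  obtain ⟨-, m2, m3, m4⟩ := h.meas
  exact m2.add ((hβ.mul m3).add (((hs.pow_const 2).div_const 2).mul m4))

lemma Tst.bdd_L {T : ℝ} {O : Set ℝ} {u ut ux uxx : ℝ → ℝ → ℝ} (h : Tst T O u ut ux uxx) {β s : ℝ × ℝ × ℝ → ℝ} {C : ℝ} (hβ : ∀ q, |β q| ≤ C) (hs : ∀ q, |s q| ≤ C) :
    ∃ D, ∀ q : ℝ × ℝ × ℝ, |ut q.1 q.2.1 + (β q * ux q.1 q.2.1 + s q ^ 2 / 2 * uxx q.1 q.2.1)| ≤ D := by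
  obtain ⟨D, hD0, hD⟩ := h.b
  refine ⟨D + (C * D + C ^ 2 / 2 * D), fun q => ?_⟩
  obtain ⟨-, k2, k3, k4⟩ := hD q.1 q.2.1
  have hC : 0 ≤ C := (abs_nonneg _).trans (hβ q)
  refine (abs_add_le _ _).trans (add_le_add k2 ((abs_add_le _ _).trans (add_le_add ?_ ?_)))
  · rw [abs_mul]
    exact mul_le_mul (hβ q) k3 (abs_nonneg _) hC
  · rw [abs_mul, abs_div, abs_pow, abs_two]
    have := hs q
    gcongr

lemma ae_m0 {O : Set ℝ} {m0 : Measure ℝ} (hm0 : m0 Oᶜ = 0) : ∀ᵐ x ∂m0, x ∈ O := by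
  rw [ae_iff]; exact hm0

theorem comp_step {T c1 c2 : ℝ} (hT : 0 < T) (hc : c1 < c2) {A : Set ℝ} (hA : MeasurableSet A) {m0 : Measure ℝ} [IsProbabilityMeasure m0] (hm0 : m0 (Ioo c1 c2)ᶜ = 0)
    {β σ f : ℝ × ℝ × ℝ → ℝ} {g : ℝ × ℝ → ℝ} {CB : ℝ} (hβm : Measurable β) (hσm : Measurable σ) (hβb : ∀ q, |β q| ≤ CB) (hσb : ∀ q, |σ q| ≤ CB)
    {dd : ℝ → ℝ} (hdm : Measurable dd) {Dd : ℝ} (hd0 : ∀ t, 0 ≤ dd t) (hdb : ∀ t, dd t ≤ Dd)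
    (hfm : Measurable f) {Cf : ℝ} (hfb : ∀ q, |f q| ≤ Cf) (hgm : Measurable g) {CG : ℝ} (hgb : ∀ p, |g p| ≤ CG)
    (y : St T (Ioo c1 c2) A) (hy : Feas m0 β σ y) {W Wt Wx Wxx : ℝ → ℝ → ℝ} (hW : IsCb12 T (Ioo c1 c2) W Wt Wx Wxx)
    {k0 k1 k2 k3 : ℝ} (hk0 : 0 ≤ k0) (hk1 : 0 ≤ k1) {u0 : ℝ → ℝ} (hu0 : Measurable u0) {Cu : ℝ} (hu0b : ∀ x, |u0 x| ≤ Cu)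
    (h1 : ∀ t ∈ Icc 0 T, ∀ x ∈ Icc c1 c2, ∀ a ∈ A, Wt t x + (β (t, x, a) * Wx t x + σ (t, x, a) ^ 2 / 2 * Wxx t x) + f (t, x, a) ≤ k0 + k1 * dd t ^ 2)
    (h2 : ∀ t ∈ Icc 0 T, ∀ x ∈ Icc c1 c2, g (t, x) - k2 ≤ W t x)
    (h3 : ∀ x ∈ Icc c1 c2, W 0 x ≤ u0 x + k3) :
    ∫ q, f q ∂y.Q + ∫ p, g p ∂y.μ ≤ ∫ x, u0 x ∂m0 + k3 + k2 + T * k0 + k1 * ∫ t in Icc 0 T, dd t ^ 2 := by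
  have hcl : closure (Ioo c1 c2) = Icc c1 c2 := closure_Ioo hc.ne
  obtain ⟨v, vt, vx, vxx, hv, hvW⟩ := hW.ext
  rw [hcl] at hvW
  obtain ⟨Cv, hCv0, hCv⟩ := hv.b
  have hfe := hy v vt vx vxx hv
  have i1 : Integrable f y.Q := St.integrable_bdd _ f hfm Cf hfb
  have i2 : Integrable g y.μ := St.integrable_bdd _ g hgm CG hgb
  have i3 : Integrable (fun p : ℝ × ℝ => v p.1 p.2) y.μ := St.integrable_bdd _ _ hv.c.measurable Cv (fun p => (hCv _ _).1)
  have i4 : Integrable (v 0) m0 := St.integrable_bdd _ _ (hv.c.measurable.comp (f := fun x : ℝ => ((0:ℝ), x)) (by fun_prop)) Cv (fun x => (hCv 0 x).1)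
  have i5 : Integrable u0 m0 := St.integrable_bdd _ _ hu0 Cu hu0b
  obtain ⟨DL, hDL⟩ := hv.bdd_L hβb hσb
  have i6 := St.integrable_bdd y.Q _ (hv.meas_L hβm hσm) DL hDL
  have hdd2 : ∀ t, dd t ^ 2 ≤ Dd ^ 2 := fun t => by have := hdb t; have := hd0 t; gcongr
  have i7 : Integrable (fun q : ℝ × ℝ × ℝ => dd q.1 ^ 2) y.Q :=
    St.integrable_bdd _ _ ((hdm.comp measurable_fst).pow_const 2) (Dd ^ 2) (fun q => by rw [abs_of_nonneg (sq_nonneg _)]; exact hdd2 _)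
  have i7' : IntegrableOn (fun t => dd t ^ 2) (Icc 0 T) :=
    St.integrable_bdd _ _ (hdm.pow_const 2) (Dd ^ 2) (fun q => by rw [abs_of_nonneg (sq_nonneg _)]; exact hdd2 _)
  have e1 : ∫ q, (vt q.1 q.2.1 + (β q * vx q.1 q.2.1 + σ q ^ 2 / 2 * vxx q.1 q.2.1)) ∂y.Q + ∫ q, f q ∂y.Q ≤ T * k0 + k1 * ∫ t in Icc 0 T, dd t ^ 2 := by
    rw [← integral_add i6 i1]
    calc _ ≤ ∫ q, (k0 + k1 * dd q.1 ^ 2) ∂y.Q := by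
          apply integral_mono_ae (i6.add i1) ((integrable_const _).add (i7.const_mul k1))
          filter_upwards [y.Q_ae hA] with q hq
          rw [hcl] at hq
          obtain ⟨hq1, hq2, hq3⟩ := hq
          obtain ⟨-, e2, e3, e4⟩ := hvW q.1 hq1 q.2.1 hq2
          have := h1 q.1 hq1 q.2.1 hq2 q.2.2 hq3
          simp only [Pi.add_apply, e2, e3, e4]
          exact this
      _ = ∫ q, k0 ∂y.Q + k1 * ∫ q, dd q.1 ^ 2 ∂y.Q := by
          rw [integral_add (integrable_const _) (i7.const_mul k1), integral_const_mul]
      _ ≤ _ := by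
          have a1 := y.integral_const_le hT.le k0 hk0
          have a2 := y.integral_time_le (fun t => dd t ^ 2) (hdm.pow_const 2) (fun t => sq_nonneg _) i7'
          have a3 := mul_le_mul_of_nonneg_left a2 hk1
          linarith
  have e2 : ∫ p, g p ∂y.μ - k2 ≤ ∫ p, v p.1 p.2 ∂y.μ := by
    calc ∫ p, g p ∂y.μ - k2 = ∫ p, (g p - k2) ∂y.μ := by rw [integral_sub i2 (integrable_const _)]; simp
      _ ≤ _ := by
        apply integral_mono_ae (i2.sub (integrable_const _)) i3
        filter_upwards [y.μ_ae] with p hp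
        rw [hcl] at hp
        simp only [Pi.sub_apply]
        rw [(hvW p.1 hp.1 p.2 hp.2).1]
        exact h2 p.1 hp.1 p.2 hp.2
  have e3 : ∫ x, v 0 x ∂m0 ≤ ∫ x, u0 x ∂m0 + k3 := by
    calc _ ≤ ∫ x, (u0 x + k3) ∂m0 := by
          apply integral_mono_ae i4 (i5.add (integrable_const _))
          filter_upwards [ae_m0 hm0] with x hx
          have hx' := Ioo_subset_Icc_self hx
          simp only [Pi.add_apply]
          rw [(hvW 0 ⟨le_rfl, hT.le⟩ x hx').1]
          exact h3 x hx'
      _ = _ := by rw [integral_add i5 (integrable_const _)]; simp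
  linarith

lemma eps_lim (K CT τ τ' : ℝ) (hτ : 0 < τ) (hτ' : 0 < τ') : ∃ ε, 0 < ε ∧ ε ≤ 1 ∧ ε * K + CT * Real.exp (-τ / ε) ≤ τ' := by
  have h1 : Tendsto (fun ε : ℝ => ε * K) (𝓝[>] 0) (𝓝 (0 * K)) := (tendsto_id.mono_left nhdsWithin_le_nhds).mul_const K
  have h2 : Tendsto (fun ε : ℝ => CT * Real.exp (-τ / ε)) (𝓝[>] 0) (𝓝 (CT * 0)) := by
    apply Tendsto.const_mul
    apply Real.tendsto_exp_atBot.comp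
    have : Tendsto (fun ε : ℝ => -(τ * ε⁻¹)) (𝓝[>] 0) atBot := tendsto_neg_atTop_atBot.comp (tendsto_inv_nhdsGT_zero.const_mul_atTop hτ)
    refine this.congr fun ε => ?_
    ring
  have h3 := h1.add h2
  simp only [zero_mul, mul_zero, add_zero] at h3
  have h4 := (h3.eventually_le_const hτ').and (Ioc_mem_nhdsGT (one_pos (α := ℝ)))
  obtain ⟨ε, ha, hb⟩ := h4.exists
  exact ⟨ε, hb.1, hb.2, ha⟩

theorem comparison {T c1 c2 : ℝ} (hT : 0 < T) (hc : c1 < c2) {A : Set ℝ} (hA : MeasurableSet A) {m0 : Measure ℝ} [IsProbabilityMeasure m0] (hm0 : m0 (Ioo c1 c2)ᶜ = 0)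
    {β' σ' βy σy f : ℝ × ℝ × ℝ → ℝ} {g gt : ℝ × ℝ → ℝ} {D Lf Cf Lg Cg : ℝ}
    (S : SmData T c1 c2 A β' σ' βy σy f g gt D Lf Cf Lg Cg) {β σ : ℝ × ℝ × ℝ → ℝ} {c Cb K : ℝ} {dd : ℝ → ℝ}
    (R : TrData T c1 c2 A β σ β' σ' c Cb K dd) {M γ lam0 : ℝ} (hM : 0 < M) (hγ : 0 < γ) (hlam0 : 0 < lam0)
    (hγ2 : Cb + 1 ≤ c ^ 2 * γ / 2) (hM1 : Lg ≤ M * γ * Real.exp (-(γ * (c2 - c1)))) (hM2 : Cg + Cf ≤ M * γ * Real.exp (-(γ * (c2 - c1))))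
    {u ut ux uxx : ℝ → ℝ → ℝ} (hu : Tst T (Ioo c1 c2) u ut ux uxx)
    (hsup : ∀ q ∈ Icc 0 T ×ˢ Icc c1 c2 ×ˢ A, ut q.1 q.2.1 + (β' q * ux q.1 q.2.1 + σ' q ^ 2 / 2 * uxx q.1 q.2.1) ≤ - f q)
    (hug : ∀ p ∈ Icc 0 T ×ˢ Icc c1 c2, g p ≤ u p.1 p.2)
    {CB : ℝ} (hβm : Measurable β) (hσm : Measurable σ) (hβb : ∀ q, |β q| ≤ CB) (hσb : ∀ q, |σ q| ≤ CB)
    (hdm : Measurable dd) {Dd : ℝ} (hdb : ∀ t, dd t ≤ Dd)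
    (hfm : Measurable f) {Cf' : ℝ} (hfb : ∀ q, |f q| ≤ Cf') {CG : ℝ} (hgb : ∀ p, |g p| ≤ CG)
    (y : St T (Ioo c1 c2) A) (hy : Feas m0 β σ y) :
    ∫ q, f q ∂y.Q + ∫ p, g p ∂y.μ ≤ ∫ x, u 0 x ∂m0 + (M * γ) ^ 2 / (4 * lam0) + T * (Lf ^ 2 / (4 * lam0)) +
      3 * (lam0 * Real.exp ((2 * K ^ 2 + 2 * K + 2) * T)) * ∫ t in Icc 0 T, dd t ^ 2 := by
  obtain ⟨CΦ, hCΦ, key⟩ := W_super hT hc S R hM hγ hlam0 hγ2 hM1 hM2 hu hsup hug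
  obtain ⟨Cu, hCu0, hCu⟩ := hu.b
  set Λ := lam0 * Real.exp ((2 * K ^ 2 + 2 * K + 2) * T) with hΛ
  have hΛ0 : 0 < Λ := by positivity
  apply le_of_forall_pos_le_add
  intro τ hτ
  have cu0 : Continuous (u 0) := hu.c.comp (g := fun p : ℝ × ℝ => u p.1 p.2) (f := fun x : ℝ => ((0:ℝ), x)) (by fun_prop)
  have huc : UniformContinuousOn (u 0) (Icc c1 c2) := isCompact_Icc.uniformContinuousOn_of_continuous cu0.continuousOn
  rw [Metric.uniformContinuousOn_iff] at huc
  obtain ⟨δ, hδ, hδ2⟩ := huc (τ / 4) (by positivity)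
  obtain ⟨r, hr0, hr1, hr2, hr3⟩ : ∃ r : ℝ, 0 < r ∧ r ≤ (c2 - c1) / 2 ∧ r < δ ∧ Λ * r ^ 2 ≤ τ / 4 := by
    have h1 : Tendsto (fun r : ℝ => Λ * r ^ 2) (𝓝[>] 0) (𝓝 (Λ * 0 ^ 2)) := ((tendsto_id.mono_left nhdsWithin_le_nhds).pow 2).const_mul _
    rw [zero_pow two_ne_zero, mul_zero] at h1
    have h4 := ((h1.eventually_le_const (by positivity : 0 < τ / 4)).and (Ioc_mem_nhdsGT (by linarith : 0 < (c2 - c1) / 2))).and (Ioo_mem_nhdsGT hδ)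
    obtain ⟨r, ⟨ha, hb⟩, hd⟩ := h4.exists
    exact ⟨r, hb.1, hb.2, hd.2, ha⟩
  obtain ⟨ε, hε, hε1, hε2⟩ := eps_lim (Real.log (c2 - c1 + 2) + -Real.log r + T * |D ^ 2 / 2 + D|) (T * CΦ) (τ / 4) (τ / 4) (by positivity) (by positivity)
  obtain ⟨W, Wt, Wx, Wxx, hW, k1, k2, k3⟩ := key ε (τ / 4) hε hε1 (by positivity)
  have := comp_step hT hc hA hm0 hβm hσm hβb hσb hdm R.hd hdb hfm hfb S.cg.measurable hgb y hy hW
    (k0 := ε * |D ^ 2 / 2 + D| + Lf ^ 2 / (4 * lam0) + CΦ * Real.exp (-(τ / 4) / ε)) (k1 := 3 * Λ) (k2 := ε * Real.log (c2 - c1 + 2))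
    (k3 := ((M * γ) ^ 2 / (4 * lam0) + τ / 4) + τ / 4 + Λ * r ^ 2 - ε * Real.log r) (by positivity) (by positivity) cu0.measurable (fun x => (hCu 0 x).1)
    (fun t ht x hx a ha => by
      refine (k1 t ht x hx a ha).trans ?_
      have : ε * (D ^ 2 / 2 + D) ≤ ε * |D ^ 2 / 2 + D| := by gcongr; exact le_abs_self _
      linarith)
    k2
    (fun x hx => by
      refine (k3 x hx r (τ / 4) hr0 hr1 ?_).trans (by linarith)
      intro y hy hxy
      have := hδ2 x hx y hy (by rw [Real.dist_eq]; linarith)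
      rw [Real.dist_eq, abs_lt] at this
      linarith [this.1])
  linarith
end

section
open MeasureTheory Filter Set Topology
open ProbabilityTheory
set_option linter.all false

lemma slice_mid (F : ℝ × ℝ × ℝ → ℝ) (h : Differentiable ℝ F) (t y a : ℝ) :
    HasDerivAt (fun y => F (t, y, a)) (fderiv ℝ F (t, y, a) (0, 1, 0)) y := by
  have h1 : HasDerivAt (fun s : ℝ => (t, s, a)) ((0 : ℝ), (1 : ℝ), (0 : ℝ)) y :=
    (hasDerivAt_const y t).prodMk ((hasDerivAt_id y).prodMk (hasDerivAt_const y a))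
  exact (h (t, y, a)).hasFDerivAt.comp_hasDerivAt y h1

lemma cpt_bound {X : Type*} [TopologicalSpace X] {S : Set X} (hS : IsCompact S) (h : X → ℝ) (hc : Continuous h) :
    ∃ B, 0 ≤ B ∧ ∀ p ∈ S, |h p| ≤ B := by
  obtain ⟨B, hB⟩ := hS.exists_bound_of_continuousOn hc.continuousOn
  exact ⟨|B|, abs_nonneg _, fun p hp => (hB p hp).trans (le_abs_self _)⟩

lemma cont_fd {E : Type*} [NormedAddCommGroup E] [NormedSpace ℝ E] (F : E → ℝ) (h : ContDiff ℝ 2 F) (v : E) : Continuous fun p => fderiv ℝ F p v :=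
  (h.continuous_fderiv (by norm_num)).clm_apply continuous_const

lemma lip_mvt {c1 c2 : ℝ} (φ φ' : ℝ → ℝ) (B : ℝ) (h : ∀ y, HasDerivAt φ (φ' y) y) (hB : ∀ y ∈ Icc c1 c2, |φ' y| ≤ B) :
    ∀ x ∈ Icc c1 c2, ∀ y ∈ Icc c1 c2, |φ x - φ y| ≤ B * |x - y| := by
  intro x hx y hy
  exact (convex_Icc c1 c2).norm_image_sub_le_of_norm_hasDerivWithin_le (f := φ) (f' := φ') (fun z _ => (h z).hasDerivWithinAt) hB hy hx

lemma lip3 (T c1 c2 : ℝ) {A : Set ℝ} (hA : IsCompact A) (F : ℝ × ℝ × ℝ → ℝ) (h : ContDiff ℝ 2 F) :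
    ∃ B, 0 ≤ B ∧ ∀ t ∈ Icc 0 T, ∀ x ∈ Icc c1 c2, ∀ y ∈ Icc c1 c2, ∀ a ∈ A, |F (t, x, a) - F (t, y, a)| ≤ B * |x - y| := by
  obtain ⟨B, hB0, hB⟩ := cpt_bound ((isCompact_Icc (a := (0:ℝ)) (b := T)).prod ((isCompact_Icc (a := c1) (b := c2)).prod hA)) _ (cont_fd F h (0, 1, 0))
  refine ⟨B, hB0, fun t ht x hx y hy a ha => ?_⟩
  exact lip_mvt (fun y => F (t, y, a)) _ B (slice_mid F (h.differentiable (by norm_num)) t · a) (fun y hy => hB (t, y, a) ⟨ht, hy, ha⟩) x hx y hy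

lemma lip2 (T c1 c2 : ℝ) (F : ℝ × ℝ → ℝ) (h : ContDiff ℝ 2 F) :
    ∃ B, 0 ≤ B ∧ ∀ t ∈ Icc 0 T, ∀ x ∈ Icc c1 c2, ∀ y ∈ Icc c1 c2, |F (t, x) - F (t, y)| ≤ B * |x - y| := by
  obtain ⟨B, hB0, hB⟩ := cpt_bound ((isCompact_Icc (a := (0:ℝ)) (b := T)).prod (isCompact_Icc (a := c1) (b := c2))) _ (cont_fd F h (0, 1))
  refine ⟨B, hB0, fun t ht x hx y hy => ?_⟩
  exact lip_mvt (fun y => F (t, y)) _ B (hasDerivAt_slice2 F (h.differentiable (by norm_num)) t ·) (fun y hy => hB (t, y) ⟨ht, hy⟩) x hx y hy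

lemma mkSm {T c1 c2 : ℝ} {A : Set ℝ} (hA : IsCompact A) {β s f : ℝ × ℝ × ℝ → ℝ} {g : ℝ × ℝ → ℝ} (hβ : ContDiff ℝ 2 β) (hs : ContDiff ℝ 2 s) (hg : ContDiff ℝ 2 g) {Lf Cf Lg Cg : ℝ}
    (fL : ∀ t ∈ Icc 0 T, ∀ x ∈ Icc c1 c2, ∀ y ∈ Icc c1 c2, ∀ a ∈ A, |f (t, x, a) - f (t, y, a)| ≤ Lf * |x - y|)
    (fC : ∀ t ∈ Icc 0 T, ∀ x ∈ Icc c1 c2, ∀ a ∈ A, |f (t, x, a)| ≤ Cf)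
    (gL : ∀ t ∈ Icc 0 T, ∀ x ∈ Icc c1 c2, ∀ y ∈ Icc c1 c2, |g (t, x) - g (t, y)| ≤ Lg * |x - y|)
    (gC : ∀ t ∈ Icc 0 T, ∀ x ∈ Icc c1 c2, |fderiv ℝ g (t, x) (1, 0)| ≤ Cg) :
    ∃ βy σy gt D, SmData T c1 c2 A β s βy σy f g gt D Lf Cf Lg Cg := by
  have hcp := (isCompact_Icc (a := (0:ℝ)) (b := T)).prod ((isCompact_Icc (a := c1) (b := c2)).prod hA)
  obtain ⟨B1, hB1, b1⟩ := cpt_bound hcp _ hβ.continuous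
  obtain ⟨B2, hB2, b2⟩ := cpt_bound hcp _ hs.continuous
  obtain ⟨B3, hB3, b3⟩ := cpt_bound hcp _ (cont_fd β hβ (0, 1, 0))
  obtain ⟨B4, hB4, b4⟩ := cpt_bound hcp _ (cont_fd s hs (0, 1, 0))
  refine ⟨_, _, _, B1 + B2 + B3 + B4, hβ.continuous, hs.continuous, cont_fd β hβ (0, 1, 0), cont_fd s hs (0, 1, 0), hg.continuous, cont_fd g hg (1, 0),
    fun t y a => slice_mid β (hβ.differentiable (by norm_num)) t y a, fun t y a => slice_mid s (hs.differentiable (by norm_num)) t y a,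
    fun t x => hasDerivAt_slice1 g (hg.differentiable (by norm_num)) t x, ?_, fL, fC, gL, gC⟩
  intro t ht x hx a ha
  have k1 := b1 (t, x, a) ⟨ht, hx, ha⟩
  have k2 := b2 (t, x, a) ⟨ht, hx, ha⟩
  have k3 := b3 (t, x, a) ⟨ht, hx, ha⟩
  have k4 := b4 (t, x, a) ⟨ht, hx, ha⟩
  refine ⟨?_, ?_, ?_, ?_⟩ <;> linarith

section
variable {T : ℝ} {O A : Set ℝ} {m0 : Measure ℝ}

/-- Stability of the generator in the coefficients. -/
lemma L_diff {u ut ux uxx : ℝ → ℝ → ℝ} (h : Tst T O u ut ux uxx) (C : ℝ) (hC0 : 0 ≤ C) :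
    ∃ D, 0 ≤ D ∧ ∀ (y : St T O A) (β s β' s' : ℝ × ℝ × ℝ → ℝ), Measurable β → Measurable s → Measurable β' → Measurable s' →
      (∀ q, |β q| ≤ C) → (∀ q, |s q| ≤ C) → (∀ q, |β' q| ≤ C) → (∀ q, |s' q| ≤ C) →
      |∫ q, (ut q.1 q.2.1 + (β q * ux q.1 q.2.1 + s q ^ 2 / 2 * uxx q.1 q.2.1)) ∂y.Q -
        ∫ q, (ut q.1 q.2.1 + (β' q * ux q.1 q.2.1 + s' q ^ 2 / 2 * uxx q.1 q.2.1)) ∂y.Q| ≤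
        D * (∫ q, |β q - β' q| ∂y.Q + ∫ q, |s q - s' q| ∂y.Q) := by
  obtain ⟨D, hD0, hD⟩ := h.b
  refine ⟨D + C * D, by positivity, ?_⟩
  intro y β s β' s' m1 m2 m3 m4 b1 b2 b3 b4
  obtain ⟨E1, hE1⟩ := h.bdd_L b1 b2
  obtain ⟨E2, hE2⟩ := h.bdd_L b3 b4
  have i1 := St.integrable_bdd y.Q _ (h.meas_L m1 m2) E1 hE1
  have i2 := St.integrable_bdd y.Q _ (h.meas_L m3 m4) E2 hE2
  have i3 : Integrable (fun q => |β q - β' q|) y.Q := St.integrable_bdd y.Q _ (m1.sub m3).abs (C + C) (fun q => by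
    rw [abs_abs]; exact (abs_sub _ _).trans (add_le_add (b1 q) (b3 q)))
  have i4 : Integrable (fun q => |s q - s' q|) y.Q := St.integrable_bdd y.Q _ (m2.sub m4).abs (C + C) (fun q => by
    rw [abs_abs]; exact (abs_sub _ _).trans (add_le_add (b2 q) (b4 q)))
  rw [← integral_sub i1 i2, ← integral_add i3 i4, ← integral_const_mul]
  refine (abs_integral_le_integral_abs).trans ?_
  apply integral_mono (i1.sub i2).abs ((i3.add i4).const_mul _)
  intro q
  obtain ⟨-, -, k3, k4⟩ := hD q.1 q.2.1
  have e : ut q.1 q.2.1 + (β q * ux q.1 q.2.1 + s q ^ 2 / 2 * uxx q.1 q.2.1) - (ut q.1 q.2.1 + (β' q * ux q.1 q.2.1 + s' q ^ 2 / 2 * uxx q.1 q.2.1))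
    = (β q - β' q) * ux q.1 q.2.1 + (s q - s' q) * ((s q + s' q) / 2 * uxx q.1 q.2.1) := by ring
  simp only [Pi.sub_apply, Pi.add_apply, e]
  have t1 : |(β q - β' q) * ux q.1 q.2.1| ≤ |β q - β' q| * D := by
    rw [abs_mul]; gcongr
  have t2 : |(s q - s' q) * ((s q + s' q) / 2 * uxx q.1 q.2.1)| ≤ |s q - s' q| * (C * D) := by
    rw [abs_mul, abs_mul, abs_div, abs_two]
    have : |s q + s' q| / 2 ≤ C := by
      have := abs_add_le (s q) (s' q)
      linarith [b2 q, b4 q]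
    gcongr
  refine (abs_add_le _ _).trans ?_
  have t3 : 0 ≤ |β q - β' q| * (C * D) := by positivity
  have t4 : 0 ≤ |s q - s' q| * D := by positivity
  nlinarith

/-- Closedness of the constraint. -/
theorem Feas.of_limit (hT : 0 ≤ T) (hA : IsCompact A) [IsProbabilityMeasure m0] (CL : ℝ) (hCL : 0 ≤ CL)
    (y : ℕ → St T O A) (hy : ∀ n, InK m0 CL (y n)) (x : St T O A) (h : St.Conv y x) (β s : ℝ × ℝ × ℝ → ℝ) (mβ : Measurable β) (ms : Measurable s) (C : ℝ)
    (bβ : ∀ q, |β q| ≤ C) (bs : ∀ q, |s q| ≤ C) (cβ : ∀ t, ContinuousOn (fun p => β (t, p)) (closure O ×ˢ A)) (cs : ∀ t, ContinuousOn (fun p => s (t, p)) (closure O ×ˢ A))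
    (hlim : ∀ u ut ux uxx, Tst T O u ut ux uxx → Tendsto (fun n => ∫ p, u p.1 p.2 ∂(y n).μ - (∫ x, u 0 x ∂m0 +
      ∫ q, (ut q.1 q.2.1 + (β q * ux q.1 q.2.1 + s q ^ 2 / 2 * uxx q.1 q.2.1)) ∂(y n).Q)) atTop (𝓝 0)) : Feas m0 β s x := by
  intro u ut ux uxx hu
  obtain ⟨D, hD0, hD⟩ := hu.b
  obtain ⟨E, hE⟩ := hu.bdd_L bβ bs
  have h1 := h.1 _ hu.c ⟨D, fun p => (hD _ _).1⟩
  have h2 := cont_Q hT hA CL hCL y hy x h _ (hu.meas_L mβ ms) E hE (fun t => by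
    have e : ∀ v : ℝ → ℝ → ℝ, (Continuous fun p : ℝ × ℝ => v p.1 p.2) → ContinuousOn (fun p : ℝ × ℝ => v t p.1) (closure O ×ˢ A) := fun v hv =>
      (hv.comp (f := fun p : ℝ × ℝ => (t, p.1)) (by fun_prop)).continuousOn
    exact (e ut hu.ct).add (((cβ t).mul (e ux hu.cx)).add ((((cs t).pow 2).div_const 2).mul (e uxx hu.cxx))))
  have h3 := h1.sub (h2.const_add (∫ x, u 0 x ∂m0))
  have := tendsto_nhds_unique h3 (hlim u ut ux uxx hu)
  linarith

end

lemma int_le_time {T : ℝ} {O A : Set ℝ} (hA : MeasurableSet A) (y : St T O A) (G : ℝ × ℝ × ℝ → ℝ) (hG : Measurable G) (C : ℝ) (hC : ∀ q, |G q| ≤ C)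
    (hh : ℝ → ℝ) (hm : Measurable hh) (h0 : ∀ t, 0 ≤ hh t) (D : ℝ) (hD : ∀ t, hh t ≤ D)
    (hb : ∀ t, ∀ p ∈ closure O ×ˢ A, |G (t, p)| ≤ hh t) : ∫ q, |G q| ∂y.Q ≤ ∫ t in Icc 0 T, hh t := by
  have b : ∀ t, |hh t| ≤ D := fun t => by rw [abs_of_nonneg (h0 t)]; exact hD t
  refine le_trans ?_ (y.integral_time_le hh hm h0 (St.integrable_bdd _ hh hm D b))
  apply integral_mono_ae (St.integrable_bdd y.Q G hG C hC).abs (St.integrable_bdd y.Q _ (hm.comp measurable_fst) D (fun q => b _))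
  filter_upwards [y.Q_ae hA] with q hq
  exact hb q.1 q.2 hq.2
end

section
open MeasureTheory Filter Set Topology
open ProbabilityTheory
set_option linter.all false

/-- Measurable bounded coefficients with continuous slices. -/
structure Cf (O A : Set ℝ) (C : ℝ) (G : ℝ × ℝ × ℝ → ℝ) : Prop where
  m : Measurable G
  b : ∀ q, |G q| ≤ C
  c : ∀ t, ContinuousOn (fun p => G (t, p)) (closure O ×ˢ A)

theorem lsc_core {T c1 c2 : ℝ} (hT : 0 < T) (hc : c1 < c2) {A : Set ℝ} (hA : IsCompact A) {m0 : Measure ℝ} [IsProbabilityMeasure m0] (hm0 : m0 (Ioo c1 c2)ᶜ = 0)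
    {C : ℝ} {β s f : ℝ × ℝ × ℝ → ℝ} (hβ : Cf (Ioo c1 c2) A C β) (hs : Cf (Ioo c1 c2) A C s) (hf : Cf (Ioo c1 c2) A C f)
    {g : ℝ × ℝ → ℝ} (cg : Continuous g) (bg : ∀ p, |g p| ≤ C) {c K : ℝ} (hc0 : 0 < c) (hK : 0 ≤ K)
    (hlow : ∀ t ∈ Icc 0 T, ∀ x ∈ Icc c1 c2, ∀ a ∈ A, c ≤ s (t, x, a))
    (hL : ∀ t ∈ Icc 0 T, ∀ x ∈ Icc c1 c2, ∀ y ∈ Icc c1 c2, ∀ a ∈ A, |β (t, x, a) - β (t, y, a)| ≤ K * |x - y| ∧ |s (t, x, a) - s (t, y, a)| ≤ K * |x - y|)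
    (y : St T (Ioo c1 c2) A) (hy : Feas m0 β s y) (τ : ℝ) (hτ : 0 < τ) :
    ∃ δ > 0, ∀ βk sk, Cf (Ioo c1 c2) A C βk → Cf (Ioo c1 c2) A C sk → ∀ hh : ℝ → ℝ, Measurable hh → (∀ t, 0 ≤ hh t) → (∀ t, hh t ≤ 4 * C) →
      (∀ t, ∀ p ∈ Icc c1 c2 ×ˢ A, |β (t, p) - βk (t, p)| ≤ hh t ∧ |s (t, p) - sk (t, p)| ≤ hh t) → ∫ t in Icc 0 T, hh t ≤ δ →
      ∃ y' : St T (Ioo c1 c2) A, Feas m0 βk sk y' ∧ ∫ q, f q ∂y.Q + ∫ p, g p ∂y.μ - τ ≤ ∫ q, f q ∂y'.Q + ∫ p, g p ∂y'.μ := by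
  have hcl : closure (Ioo c1 c2) = Icc c1 c2 := closure_Ioo hc.ne
  have hC0 : 0 ≤ C := (abs_nonneg _).trans (bg 0)
  have hKc : IsCompact (Icc c1 c2 ×ˢ A) := isCompact_Icc.prod hA
  have hapx : ∀ G, Cf (Ioo c1 c2) A C G → ∀ ε : ℝ, 0 < ε → _ := fun G hG (ε : ℝ) hε =>
    carath_approx hKc T C (fun t p => G (t, p)) (by have := hG.c; rw [hcl] at this; exact this) (fun p => hG.m.comp (by fun_prop)) (fun t p => hG.b _) ε hε
  obtain ⟨f', hf', f'2, f'b, hf'm, hf'b, hf'a, hf'i⟩ := hapx f hf (τ / 10) (by positivity)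
  obtain ⟨g', g'2, g'a, -⟩ := cg.exists_contDiff_approx 2 (continuous_const (y := τ / 10)) (fun _ => by positivity)
  have g'b : ∀ p, |g' p| ≤ C + τ := by
    intro p
    have k1 := g'a p
    rw [Real.dist_eq] at k1
    have k2 := abs_sub_abs_le_abs_sub (g' p) (g p)
    linarith [bg p]
  obtain ⟨Lf, hLf0, hLf⟩ := lip3 T c1 c2 hA f' f'2
  obtain ⟨Lg, hLg0, hLg⟩ := lip2 T c1 c2 g' g'2
  obtain ⟨Cg, hCg0, hCg⟩ := cpt_bound ((isCompact_Icc (a := (0:ℝ)) (b := T)).prod (isCompact_Icc (a := c1) (b := c2))) _ (cont_fd g' g'2 (1, 0))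
  set γ := 2 * (C + 1) / c ^ 2 with hγ
  have hγ0 : 0 < γ := by positivity
  have hγ2 : C + 1 ≤ c ^ 2 * γ / 2 := by
    rw [hγ]
    apply le_of_eq
    field_simp
  set E0 := γ * Real.exp (-(γ * (c2 - c1))) with hE0
  have hE00 : 0 < E0 := by positivity
  set M := (Lg + Cg + (C + 1)) / E0 with hMdef
  have hM0 : 0 < M := by positivity
  have hME : M * γ * Real.exp (-(γ * (c2 - c1))) = Lg + Cg + (C + 1) := by
    rw [mul_assoc, ← hE0, hMdef]
    field_simp
  set lam0 := 10 * ((M * γ) ^ 2 + T * Lf ^ 2 + 1) / (4 * τ) with hlam0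
  have hl0 : 0 < lam0 := by positivity
  have hlam : (M * γ) ^ 2 / (4 * lam0) + T * (Lf ^ 2 / (4 * lam0)) ≤ τ / 10 := by
    have : (M * γ) ^ 2 / (4 * lam0) + T * (Lf ^ 2 / (4 * lam0)) = ((M * γ) ^ 2 + T * Lf ^ 2) / (4 * lam0) := by ring
    rw [this, div_le_iff₀ (by positivity), hlam0]
    have : τ / 10 * (4 * (10 * ((M * γ) ^ 2 + T * Lf ^ 2 + 1) / (4 * τ))) = (M * γ) ^ 2 + T * Lf ^ 2 + 1 := by
      field_simp
    linarith
  set Λ := lam0 * Real.exp ((2 * K ^ 2 + 2 * K + 2) * T) with hΛ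
  have hΛ0 : 0 < Λ := by positivity
  set Dd := 4 * C + 2 * (2 * C + 1) with hDd
  have hDd0 : 0 < Dd := by positivity
  refine ⟨τ / (10 * (3 * Λ * Dd)), by positivity, ?_⟩
  intro βk sk hβk hsk hh hhm hh0 hhb hha hhi
  choose βj hβj β2 βb hβm hβb hβa hβi using fun j : ℕ => hapx βk hβk (1 / ((j:ℝ) + 1)) (by positivity)
  choose sj hsj s2 sb hsm hsb hsa hsi using fun j : ℕ => hapx sk hsk (1 / ((j:ℝ) + 1)) (by positivity)
  have hdual : ∀ j, _ := fun j => dual (T := T) (O := Ioo c1 c2) (A := A) (m0 := m0) hT (by rw [hcl]; exact isCompact_Icc) hA hm0 (βj j) (sj j) f' g' (β2 j).continuous (s2 j).continuous f'2.continuous g'2.continuous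
  choose yj hyj hyu using hdual
  have int_hh : ∀ h : ℝ → ℝ, Measurable h → (∀ t, 0 ≤ h t) → ∀ D, (∀ t, h t ≤ D) → IntegrableOn h (Icc 0 T) := fun h hm h0 D hD =>
    St.integrable_bdd _ h hm D (fun t => by rw [abs_of_nonneg (h0 t)]; exact hD t)
  have ihh := int_hh hh hhm hh0 _ hhb
  have iβ : ∀ j, _ := fun j => int_hh (hβj j) (hβm j) (fun t => (hβb j t).1) _ (fun t => (hβb j t).2)
  have is' : ∀ j, _ := fun j => int_hh (hsj j) (hsm j) (fun t => (hsb j t).1) _ (fun t => (hsb j t).2)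
  -- comparison for each j
  have hcomp : ∀ j, ∫ q, f' q ∂y.Q + ∫ p, g' p ∂y.μ ≤ ∫ q, f' q ∂(yj j).Q + ∫ p, g' p ∂(yj j).μ + 3 * (τ / 10) + 3 * Λ * Dd * (2 * (1 / ((j:ℝ) + 1))) := by
    intro j
    obtain ⟨u, ut, ux, uxx, hu, u1, u2, u3⟩ := hyu j (τ / 10) (by positivity)
    rw [hcl] at u1 u2
    obtain ⟨βy, σy, gt, D, S⟩ := mkSm (T := T) (c1 := c1) (c2 := c2) hA (β2 j) (s2 j) g'2 hLf (fun t ht x hx a ha => f'b (t, x, a)) hLg (fun t ht x hx => hCg (t, x) ⟨ht, hx⟩)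
    set dd : ℝ → ℝ := fun t => hh t + (hβj j t + hsj j t) with hdd
    have dd0 : ∀ t, 0 ≤ dd t := fun t => add_nonneg (hh0 t) (add_nonneg (hβb j t).1 (hsb j t).1)
    have ddb : ∀ t, dd t ≤ Dd := fun t => by
      simp only [hdd, hDd]
      linarith [hhb t, (hβb j t).2, (hsb j t).2]
    have ddm : Measurable dd := hhm.add ((hβm j).add (hsm j))
    have R : TrData T c1 c2 A β s (βj j) (sj j) c C K dd := by
      refine ⟨hc0, hK, fun t ht x hx a ha => ⟨hβ.b _, hs.b _, hlow t ht x hx a ha⟩, hL, dd0, ?_⟩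
      intro t ht x hx a ha
      have p1 := hha t (x, a) ⟨hx, ha⟩
      have p2 := hβa j t (x, a) ⟨hx, ha⟩
      have p3 := hsa j t (x, a) ⟨hx, ha⟩
      rw [abs_sub_comm] at p2 p3
      have q1 := abs_sub_le (β (t, x, a)) (βk (t, x, a)) (βj j (t, x, a))
      have q2 := abs_sub_le (s (t, x, a)) (sk (t, x, a)) (sj j (t, x, a))
      simp only [hdd]
      constructor
      · linarith [p1.1, (hsb j t).1]
      · linarith [p1.2, (hβb j t).1]
    have key := comparison hT hc hA.measurableSet hm0 S R hM0 hγ0 hl0 hγ2 (by rw [hME]; linarith) (by rw [hME]; linarith) hu u1 u2 hβ.m hs.m hβ.b hs.b ddm ddb f'2.continuous.measurable f'b g'b y hy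
    rw [← hΛ] at key
    have i1 : IntegrableOn dd (Icc 0 T) := int_hh dd ddm dd0 Dd ddb
    have k1 : ∫ t in Icc 0 T, dd t ^ 2 ≤ Dd * ∫ t in Icc 0 T, dd t := by
      rw [← integral_const_mul]
      apply integral_mono (int_hh (fun t => dd t ^ 2) (ddm.pow_const 2) (fun t => sq_nonneg _) (Dd ^ 2) (fun t => by have := ddb t; have := dd0 t; gcongr)) (i1.const_mul _)
      intro t
      have := ddb t
      have := dd0 t
      simp only
      nlinarith
    have k2 : ∫ t in Icc 0 T, dd t ≤ τ / (10 * (3 * Λ * Dd)) + 2 * (1 / ((j:ℝ) + 1)) := by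
      have e1 : IntegrableOn (fun t => hβj j t + hsj j t) (Icc 0 T) := (iβ j).add (is' j)
      have : ∫ t in Icc 0 T, dd t = (∫ t in Icc 0 T, hh t) + ((∫ t in Icc 0 T, hβj j t) + ∫ t in Icc 0 T, hsj j t) := by
        rw [hdd, integral_add ihh e1, integral_add (iβ j) (is' j)]
      rw [this]
      linarith [hβi j, hsi j]
    have k3 : 3 * Λ * ∫ t in Icc 0 T, dd t ^ 2 ≤ 3 * Λ * (Dd * (τ / (10 * (3 * Λ * Dd)) + 2 * (1 / ((j:ℝ) + 1)))) := by
      refine mul_le_mul_of_nonneg_left (k1.trans ?_) (by positivity)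
      gcongr
    have k4 : 3 * Λ * (Dd * (τ / (10 * (3 * Λ * Dd)) + 2 * (1 / ((j:ℝ) + 1)))) = τ / 10 + 3 * Λ * Dd * (2 * (1 / ((j:ℝ) + 1))) := by
      field_simp
    linarith
  -- compactness
  set CL := (C + 1) + (C + 1) ^ 2 with hCL
  have hCL0 : 0 ≤ CL := by positivity
  have hyK : ∀ j, InK m0 CL (yj j) := fun j => (hyj j).inK hT.le hA.measurableSet CL (βj j) (sj j) (β2 j).continuous.measurable (s2 j).continuous.measurable
    (fun q => (βb j q).trans (by rw [hCL]; linarith [sq_nonneg (C + 1)]))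
    (fun q => by
      have h1 : sj j q ^ 2 ≤ (C + 1) ^ 2 := by rw [← sq_abs]; have := sb j q; gcongr
      rw [hCL]
      linarith [sq_nonneg (C + 1)])
  obtain ⟨φ, hφ, x, hx⟩ := InK.subseq hT hA CL hCL0 yj hyK
  have hj0 : Tendsto (fun n => 1 / (((φ n : ℕ) : ℝ) + 1)) atTop (𝓝 0) := (tendsto_one_div_add_atTop_nhds_zero_nat (𝕜 := ℝ)).comp hφ.tendsto_atTop
  refine ⟨x, ?_, ?_⟩
  · apply Feas.of_limit hT.le hA CL hCL0 _ (fun n => hyK (φ n)) x hx βk sk hβk.m hsk.m C hβk.b hsk.b hβk.c hsk.c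
    intro u ut ux uxx hu
    obtain ⟨D, hD0, hD⟩ := L_diff (A := A) hu (C + 1) (by positivity)
    have hb : Tendsto (fun n => D * (1 / (((φ n : ℕ) : ℝ) + 1) + 1 / (((φ n : ℕ) : ℝ) + 1))) atTop (𝓝 (D * (0 + 0))) := (hj0.add hj0).const_mul D
    rw [add_zero, mul_zero] at hb
    refine squeeze_zero_norm (fun n => ?_) hb
    have k := hD (yj (φ n)) (βj (φ n)) (sj (φ n)) βk sk (β2 _).continuous.measurable (s2 _).continuous.measurable hβk.m hsk.m (βb _) (sb _)
      (fun q => (hβk.b q).trans (by linarith)) (fun q => (hsk.b q).trans (by linarith))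
    rw [Real.norm_eq_abs, (hyj (φ n)) u ut ux uxx hu, add_sub_add_left_eq_sub]
    refine k.trans (mul_le_mul_of_nonneg_left (add_le_add ?_ ?_) hD0)
    · refine le_trans (int_le_time hA.measurableSet (yj (φ n)) (fun q => βj (φ n) q - βk q) ((β2 _).continuous.measurable.sub hβk.m) ((C + 1) + C)
        (fun q => (abs_sub _ _).trans (add_le_add (βb _ q) (hβk.b q))) (hβj (φ n)) (hβm _) (fun t => (hβb _ t).1) _ (fun t => (hβb _ t).2) ?_) (hβi (φ n))
      rw [hcl]
      exact hβa (φ n)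
    · refine le_trans (int_le_time hA.measurableSet (yj (φ n)) (fun q => sj (φ n) q - sk q) ((s2 _).continuous.measurable.sub hsk.m) ((C + 1) + C)
        (fun q => (abs_sub _ _).trans (add_le_add (sb _ q) (hsk.b q))) (hsj (φ n)) (hsm _) (fun t => (hsb _ t).1) _ (fun t => (hsb _ t).2) ?_) (hsi (φ n))
      rw [hcl]
      exact hsa (φ n)
  · have l1 := hx.2 f' f'2.continuous ⟨_, f'b⟩
    have l2 := hx.1 g' g'2.continuous ⟨_, g'b⟩
    have l3 := (((l1.add l2).add_const (3 * (τ / 10))).add ((hj0.const_mul 2).const_mul (3 * Λ * Dd)))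
    have l4 := ge_of_tendsto' l3 (fun n => hcomp (φ n))
    rw [mul_zero, mul_zero, add_zero] at l4
    have ff : ∀ z : St T (Ioo c1 c2) A, |∫ q, f' q ∂z.Q - ∫ q, f q ∂z.Q| ≤ τ / 10 := by
      intro z
      rw [← integral_sub (St.integrable_bdd _ f' f'2.continuous.measurable _ f'b) (St.integrable_bdd _ f hf.m _ hf.b)]
      refine (abs_integral_le_integral_abs).trans (le_trans (int_le_time hA.measurableSet z (fun q => f' q - f q) (f'2.continuous.measurable.sub hf.m) ((C + 1) + C)
        (fun q => (abs_sub _ _).trans (add_le_add (f'b q) (hf.b q))) hf' hf'm (fun t => (hf'b t).1) _ (fun t => (hf'b t).2) ?_) hf'i)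
      rw [hcl]
      exact hf'a
    have gg : ∀ z : St T (Ioo c1 c2) A, |∫ p, g' p ∂z.μ - ∫ p, g p ∂z.μ| ≤ τ / 10 := by
      intro z
      rw [← integral_sub (St.integrable_bdd _ g' g'2.continuous.measurable _ g'b) (St.integrable_bdd _ g cg.measurable _ bg)]
      have := norm_integral_le_of_norm_le_const (μ := z.μ) (f := fun p => g' p - g p) (C := τ / 10) (Eventually.of_forall fun p => (g'a p).le)
      simpa using this
    have a1 := abs_le.1 (ff y)
    have a2 := abs_le.1 (gg y)
    have a3 := abs_le.1 (ff x)
    have a4 := abs_le.1 (gg x)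
    linarith [a1.1, a1.2, a2.1, a2.2, a3.1, a3.2, a4.1, a4.2]
end

section
open MeasureTheory Filter Set Topology
open ProbabilityTheory
set_option linter.all false

/-! ### The abstract game -/

structure Game (T : ℝ) (O A : Set ℝ) (m0 : Measure ℝ) (ι ι' : Type) [Fintype ι] [Fintype ι'] where
  B : ℝ → ℝ → (ι → ℝ) → ℝ → ℝ
  S : ℝ → ℝ → (ι → ℝ) → ℝ → ℝ
  F : ℝ → ℝ → (ι → ℝ) → ℝ → ℝ
  G : ℝ × ℝ → (ι' → ℝ) → ℝ
  hat : ι → ℝ × ℝ → ℝ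
  ghat : ι' → ℝ × ℝ → ℝ
  C : ℝ
  H : ℝ
  hT : 0 < T
  hA : IsCompact A
  pm : IsProbabilityMeasure m0
  hm0 : m0 Oᶜ = 0
  hC0 : 0 ≤ C
  hH0 : 0 ≤ H
  mB : Measurable fun q : ℝ × ℝ × (ι → ℝ) × ℝ => B q.1 q.2.1 q.2.2.1 q.2.2.2
  mS : Measurable fun q : ℝ × ℝ × (ι → ℝ) × ℝ => S q.1 q.2.1 q.2.2.1 q.2.2.2
  mF : Measurable fun q : ℝ × ℝ × (ι → ℝ) × ℝ => F q.1 q.2.1 q.2.2.1 q.2.2.2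
  bB : ∀ t x z a, |B t x z a| ≤ C
  bS : ∀ t x z a, |S t x z a| ≤ C
  bF : ∀ t x z a, |F t x z a| ≤ C
  cB : ∀ t, ContinuousOn (fun q : (ι → ℝ) × ℝ × ℝ => B t q.2.1 q.1 q.2.2) (univ ×ˢ (closure O ×ˢ A))
  cS : ∀ t, ContinuousOn (fun q : (ι → ℝ) × ℝ × ℝ => S t q.2.1 q.1 q.2.2) (univ ×ˢ (closure O ×ˢ A))
  cF : ∀ t, ContinuousOn (fun q : (ι → ℝ) × ℝ × ℝ => F t q.2.1 q.1 q.2.2) (univ ×ˢ (closure O ×ˢ A))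
  cG : Continuous fun q : (ℝ × ℝ) × (ι' → ℝ) => G q.1 q.2
  bG : ∀ p w, |G p w| ≤ C
  chat : ∀ i, Continuous (hat i)
  bhat : ∀ i p, |hat i p| ≤ H
  cghat : ∀ i, Continuous (ghat i)
  bghat : ∀ i p, |ghat i p| ≤ H
  alt : (∀ k k' : St T O A, ∀ t ∈ Icc 0 T, ∀ x ∈ closure O, ∀ a ∈ A,
      B t x (k.z hat t) a = B t x (k'.z hat t) a ∧ S t x (k.z hat t) a = S t x (k'.z hat t) a) ∨
    ∃ c1 c2 c K, c1 < c2 ∧ O = Ioo c1 c2 ∧ 0 < c ∧ 0 ≤ K ∧ ∀ k : St T O A, ∀ t ∈ Icc 0 T, ∀ x ∈ closure O, ∀ a ∈ A,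
      c ≤ S t x (k.z hat t) a ∧ ∀ y ∈ closure O, |B t x (k.z hat t) a - B t y (k.z hat t) a| ≤ K * |x - y| ∧
        |S t x (k.z hat t) a - S t y (k.z hat t) a| ≤ K * |x - y|

namespace Game
variable {T : ℝ} {O A : Set ℝ} {m0 : Measure ℝ} {ι ι' : Type} [Fintype ι] [Fintype ι'] (M : Game T O A m0 ι ι')

noncomputable def β (k : St T O A) : ℝ × ℝ × ℝ → ℝ := fun q => M.B q.1 q.2.1 (k.z M.hat q.1) q.2.2
noncomputable def s (k : St T O A) : ℝ × ℝ × ℝ → ℝ := fun q => M.S q.1 q.2.1 (k.z M.hat q.1) q.2.2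
noncomputable def f (k : St T O A) : ℝ × ℝ × ℝ → ℝ := fun q => M.F q.1 q.2.1 (k.z M.hat q.1) q.2.2
noncomputable def w (k : St T O A) : ι' → ℝ := fun i => ∫ p, M.ghat i p ∂k.μ
noncomputable def g (k : St T O A) : ℝ × ℝ → ℝ := fun p => M.G p (M.w k)
def R (k y : St T O A) : Prop := Feas m0 (M.β k) (M.s k) y
noncomputable def Γ (k y : St T O A) : ℝ := ∫ q, M.f k q ∂y.Q + ∫ p, M.g k p ∂y.μ
noncomputable def CL : ℝ := M.C + M.C ^ 2
noncomputable def D (k x : St T O A) : ℝ := (∫ t in Icc 0 T, ‖k.z M.hat t - x.z M.hat t‖) + ‖M.w k - M.w x‖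

lemma mz (k : St T O A) : Measurable (k.z M.hat) := k.measurable_z M.hat M.chat

lemma bz (k : St T O A) (t : ℝ) : ‖k.z M.hat t‖ ≤ M.H :=
  (pi_norm_le_iff_of_nonneg M.hH0).2 fun i => k.abs_z_le M.hat M.H M.bhat t i

lemma bw (k : St T O A) : ‖M.w k‖ ≤ M.H := by
  refine (pi_norm_le_iff_of_nonneg M.hH0).2 fun i => ?_
  have := norm_integral_le_of_norm_le_const (μ := k.μ) (f := M.ghat i) (C := M.H) (Eventually.of_forall (M.bghat i))
  simpa [w] using this

lemma cf_gen (N : ℝ → ℝ → (ι → ℝ) → ℝ → ℝ) (C : ℝ) (mN : Measurable fun q : ℝ × ℝ × (ι → ℝ) × ℝ => N q.1 q.2.1 q.2.2.1 q.2.2.2)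
    (bN : ∀ t x z a, |N t x z a| ≤ C)
    (cN : ∀ t, ContinuousOn (fun q : (ι → ℝ) × ℝ × ℝ => N t q.2.1 q.1 q.2.2) (univ ×ˢ (closure O ×ˢ A)))
    (ζ : ℝ → ι → ℝ) (hζ : Measurable ζ) : Cf O A C (fun q => N q.1 q.2.1 (ζ q.1) q.2.2) := by
  refine ⟨?_, fun q => bN _ _ _ _, fun t => ?_⟩
  · exact mN.comp (f := fun q : ℝ × ℝ × ℝ => (q.1, q.2.1, ζ q.1, q.2.2)) (by fun_prop)
  · exact (cN t).comp (f := fun p : ℝ × ℝ => (ζ t, p)) (by fun_prop) (fun p hp => ⟨mem_univ _, hp⟩)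

lemma cfβ (k : St T O A) : Cf O A M.C (M.β k) := cf_gen M.B M.C M.mB M.bB M.cB _ (M.mz k)
lemma cfs (k : St T O A) : Cf O A M.C (M.s k) := cf_gen M.S M.C M.mS M.bS M.cS _ (M.mz k)
lemma cff (k : St T O A) : Cf O A M.C (M.f k) := cf_gen M.F M.C M.mF M.bF M.cF _ (M.mz k)

lemma cg (k : St T O A) : Continuous (M.g k) :=
  M.cG.comp (f := fun p : ℝ × ℝ => (p, M.w k)) (by fun_prop)

lemma bg (k : St T O A) (p : ℝ × ℝ) : |M.g k p| ≤ M.C := M.bG _ _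

lemma CL0 : 0 ≤ M.CL := by have := M.hC0; unfold CL; positivity

lemma R_inK {k y : St T O A} (h : M.R k y) : InK m0 M.CL y := by
  refine Feas.inK M.hT.le M.hA.measurableSet M.CL _ _ (M.cfβ k).m (M.cfs k).m (fun q => ((M.cfβ k).b q).trans ?_) (fun q => ?_) y h
  · unfold CL; linarith [sq_nonneg M.C]
  · have h1 : M.s k q ^ 2 ≤ M.C ^ 2 := by rw [← sq_abs]; have := (M.cfs k).b q; gcongr
    unfold CL
    linarith [sq_nonneg M.C, M.hC0]

lemma int_norm (a b : ℝ → ι → ℝ) (H : ℝ) (ha : Measurable a) (hb : Measurable b) (h1 : ∀ t, ‖a t‖ ≤ H) (h2 : ∀ t, ‖b t‖ ≤ H) :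
    IntegrableOn (fun t => ‖a t - b t‖) (Icc 0 T) :=
  St.integrable_bdd _ _ (ha.sub hb).norm (H + H) (fun t => by
    rw [abs_of_nonneg (norm_nonneg _)]
    exact (norm_sub_le _ _).trans (add_le_add (h1 t) (h2 t)))

lemma int_D (k x : St T O A) : IntegrableOn (fun t => ‖k.z M.hat t - x.z M.hat t‖) (Icc 0 T) :=
  int_norm _ _ M.H (M.mz k) (M.mz x) (M.bz k) (M.bz x)

lemma D_comm (k x : St T O A) : M.D k x = M.D x k := by
  unfold D
  simp only [norm_sub_rev]

lemma D_self (k : St T O A) : M.D k k = 0 := by simp [D]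

lemma D_tri (k x y : St T O A) : M.D k y ≤ M.D k x + M.D x y := by
  unfold D
  have h1 : ∫ t in Icc 0 T, ‖k.z M.hat t - y.z M.hat t‖ ≤ (∫ t in Icc 0 T, ‖k.z M.hat t - x.z M.hat t‖) + ∫ t in Icc 0 T, ‖x.z M.hat t - y.z M.hat t‖ := by
    rw [← integral_add (M.int_D k x) (M.int_D x y)]
    have : IntegrableOn (fun t => ‖k.z M.hat t - x.z M.hat t‖ + ‖x.z M.hat t - y.z M.hat t‖) (Icc 0 T) := (M.int_D k x).add (M.int_D x y)
    exact integral_mono (M.int_D k y) this (fun t => norm_sub_le_norm_sub_add_norm_sub _ _ _)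
  have h2 := norm_sub_le_norm_sub_add_norm_sub (M.w k) (M.w x) (M.w y)
  linarith

lemma D_ge1 (k x : St T O A) : ∫ t in Icc 0 T, ‖k.z M.hat t - x.z M.hat t‖ ≤ M.D k x := by
  unfold D; linarith [norm_nonneg (M.w k - M.w x)]

lemma D_ge2 (k x : St T O A) : ‖M.w k - M.w x‖ ≤ M.D k x := by
  unfold D
  have : 0 ≤ ∫ t in Icc 0 T, ‖k.z M.hat t - x.z M.hat t‖ := integral_nonneg fun t => norm_nonneg _
  linarith

lemma D_conv (y : ℕ → St T O A) (hy : ∀ n, InK m0 M.CL (y n)) (x : St T O A) (h : St.Conv y x) :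
    Tendsto (fun n => M.D (y n) x) atTop (𝓝 0) := by
  haveI := M.pm
  have h1 := z_conv M.hT M.hA M.CL M.CL0 y hy x h M.hat M.chat M.H M.bhat
  have h2 : Tendsto (fun n => M.w (y n)) atTop (𝓝 (M.w x)) := by
    rw [tendsto_pi_nhds]
    intro i
    exact h.1 _ (M.cghat i) ⟨_, M.bghat i⟩
  have h3 := h1.add (h2.sub_const (M.w x)).norm
  simpa [D] using h3

lemma int_f (k y : St T O A) : Integrable (M.f k) y.Q := St.integrable_bdd _ _ (M.cff k).m _ (M.cff k).b
lemma int_g (k y : St T O A) : Integrable (M.g k) y.μ := St.integrable_bdd _ _ (M.cg k).measurable _ (M.bg k)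

/-- Uniform continuity of the reward in the frozen argument. -/
theorem cont_Γ (x : St T O A) (τ : ℝ) (hτ : 0 < τ) : ∃ δ > 0, ∀ k, M.D k x < δ → ∀ y, InK m0 M.CL y → |M.Γ k y - M.Γ x y| ≤ τ := by
  haveI := M.pm
  have hC0 := M.hC0
  obtain ⟨δ1, hδ1, k1⟩ := cont_coeff (O := O) (m0 := m0) M.hT.le M.hA M.CL M.CL0 M.F M.mF M.C M.bF M.cF M.H (x.z M.hat) (M.mz x) (M.bz x) (τ / 2) (by positivity)
  obtain ⟨R, hR1, hR⟩ := InK.tail (O := O) (A := A) (m0 := m0) M.hT.le M.hA.measurableSet M.CL M.CL0 (τ / (4 * (2 * M.C + 1))) (by positivity)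
  have hKc : IsCompact ((Icc 0 T ×ˢ Icc (-R) R) ×ˢ Metric.closedBall (0 : ι' → ℝ) M.H) :=
    (isCompact_Icc.prod isCompact_Icc).prod (isCompact_closedBall _ _)
  have huc := hKc.uniformContinuousOn_of_continuous M.cG.continuousOn
  rw [Metric.uniformContinuousOn_iff] at huc
  obtain ⟨δ2, hδ2, k2⟩ := huc (τ / 4) (by positivity)
  refine ⟨min δ1 δ2, lt_min hδ1 hδ2, fun k hk y hy => ?_⟩
  have hf := k1 (k.z M.hat) (M.mz k) (M.bz k) ((M.D_ge1 k x).trans_lt (hk.trans_le (min_le_left _ _))) y hy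
  have hw := (M.D_ge2 k x).trans_lt (hk.trans_le (min_le_right _ _))
  have e1 : |∫ q, M.f k q ∂y.Q - ∫ q, M.f x q ∂y.Q| ≤ τ / 2 := by
    rw [← integral_sub (M.int_f k y) (M.int_f x y)]
    exact abs_integral_le_integral_abs.trans hf
  have e2 : |∫ q, M.g k q ∂y.μ - ∫ q, M.g x q ∂y.μ| ≤ τ / 2 := by
    rw [← integral_sub (M.int_g k y) (M.int_g x y)]
    refine abs_integral_le_integral_abs.trans ?_
    have hms : MeasurableSet {p : ℝ × ℝ | R < |p.2|} := measurableSet_lt measurable_const (by fun_prop)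
    have i1 : Integrable ({p : ℝ × ℝ | R < |p.2|}.indicator fun _ => 2 * M.C) y.μ := (integrable_const _).indicator hms
    have i2 : Integrable (fun p => τ / 4 + {p : ℝ × ℝ | R < |p.2|}.indicator (fun _ => 2 * M.C) p) y.μ := (integrable_const _).add i1
    have : ∫ p, |M.g k p - M.g x p| ∂y.μ ≤ ∫ p, (τ / 4 + {p : ℝ × ℝ | R < |p.2|}.indicator (fun _ => 2 * M.C) p) ∂y.μ := by
      apply integral_mono_ae ((M.int_g k y).sub (M.int_g x y)).abs i2
      filter_upwards [y.μ_ae] with p hp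
      simp only [Pi.sub_apply]
      by_cases h : R < |p.2|
      · rw [indicator_of_mem (by exact h)]
        have := abs_sub (M.g k p) (M.g x p)
        linarith [M.bg k p, M.bg x p]
      · rw [indicator_of_notMem (by exact h), add_zero]
        push Not at h
        have hp2 := abs_le.1 h
        have := k2 (p, M.w k) ⟨⟨hp.1, hp2⟩, by simpa using M.bw k⟩ (p, M.w x) ⟨⟨hp.1, hp2⟩, by simpa using M.bw x⟩
          (by rw [Prod.dist_eq, dist_self, dist_eq_norm]; exact max_lt hδ2 hw)
        exact this.le
    refine this.trans ?_
    rw [integral_add (integrable_const _) i1, integral_indicator_const _ hms]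
    have h1 := (hR y hy).1
    simp only [integral_const, probReal_univ, smul_eq_mul, one_mul]
    have h2 : y.μ.real {p | R < |p.2|} * (2 * M.C) ≤ τ / (4 * (2 * M.C + 1)) * (2 * M.C + 1) := by
      gcongr
      linarith
    have h3 : τ / (4 * (2 * M.C + 1)) * (2 * M.C + 1) = τ / 4 := by field_simp
    linarith
  have := abs_add_le (∫ q, M.f k q ∂y.Q - ∫ q, M.f x q ∂y.Q) (∫ q, M.g k q ∂y.μ - ∫ q, M.g x q ∂y.μ)
  have e3 : M.Γ k y - M.Γ x y = (∫ q, M.f k q ∂y.Q - ∫ q, M.f x q ∂y.Q) + (∫ q, M.g k q ∂y.μ - ∫ q, M.g x q ∂y.μ) := by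
    unfold Γ; ring
  rw [e3]
  linarith

/-- Lower semicontinuity of the constraint correspondence. -/
theorem lsc (x y : St T O A) (hy : M.R x y) (τ : ℝ) (hτ : 0 < τ) :
    ∃ δ > 0, ∀ k, M.D k x < δ → ∃ y', M.R k y' ∧ M.Γ x y - τ ≤ M.Γ x y' := by
  haveI := M.pm
  rcases M.alt with h | ⟨c1, c2, c, K, hc, rfl, hc0, hK, hall⟩
  · refine ⟨1, one_pos, fun k _ => ⟨y, ?_, by linarith⟩⟩
    intro u ut ux uxx hu
    rw [hy u ut ux uxx hu]
    congr 1
    apply integral_congr_ae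
    filter_upwards [y.Q_ae M.hA.measurableSet] with q hq
    have := h x k q.1 hq.1 q.2.1 hq.2.1 q.2.2 hq.2.2
    simp only [β, s]
    rw [this.1, this.2]
  · have hcl : closure (Ioo c1 c2) = Icc c1 c2 := closure_Ioo hc.ne
    obtain ⟨δ, hδ, key⟩ := lsc_core M.hT hc M.hA M.hm0 (M.cfβ x) (M.cfs x) (M.cff x) (M.cg x) (M.bg x) hc0 hK
      (fun t ht z hz a ha => (hall x t ht z (by rw [hcl]; exact hz) a ha).1)
      (fun t ht z hz z' hz' a ha => (hall x t ht z (by rw [hcl]; exact hz) a ha).2 z' (by rw [hcl]; exact hz')) y hy τ hτ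
    have hKc : IsCompact (Icc c1 c2 ×ˢ A) := isCompact_Icc.prod M.hA
    obtain ⟨δ1, hδ1, k1⟩ := sup_close T _ hKc M.B M.mB M.C M.bB (by have := M.cB; rw [hcl] at this; exact this) M.H (x.z M.hat) (M.mz x) (M.bz x) (δ / 2) (by positivity)
    obtain ⟨δ2, hδ2, k2⟩ := sup_close T _ hKc M.S M.mS M.C M.bS (by have := M.cS; rw [hcl] at this; exact this) M.H (x.z M.hat) (M.mz x) (M.bz x) (δ / 2) (by positivity)
    refine ⟨min δ1 δ2, lt_min hδ1 hδ2, fun k hk => ?_⟩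
    obtain ⟨h1, a1, a2, a3, a4, a5⟩ := k1 (k.z M.hat) (M.mz k) (M.bz k) ((M.D_ge1 k x).trans_lt (hk.trans_le (min_le_left _ _)))
    obtain ⟨h2, b1, b2, b3, b4, b5⟩ := k2 (k.z M.hat) (M.mz k) (M.bz k) ((M.D_ge1 k x).trans_lt (hk.trans_le (min_le_right _ _)))
    have i1 : IntegrableOn h1 (Icc 0 T) := St.integrable_bdd _ h1 a1 _ (fun t => by rw [abs_of_nonneg (a2 t)]; exact a3 t)
    have i2 : IntegrableOn h2 (Icc 0 T) := St.integrable_bdd _ h2 b1 _ (fun t => by rw [abs_of_nonneg (b2 t)]; exact b3 t)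
    refine key (M.β k) (M.s k) (M.cfβ k) (M.cfs k) (fun t => h1 t + h2 t) (a1.add b1) (fun t => add_nonneg (a2 t) (b2 t)) (fun t => by linarith [a3 t, b3 t]) ?_ ?_
    · intro t p hp
      have u1 := a4 t p hp
      have u2 := b4 t p hp
      rw [abs_sub_comm] at u1 u2
      exact ⟨u1.trans (by linarith [b2 t]), u2.trans (by linarith [a2 t])⟩
    · rw [integral_add i1 i2]
      linarith

end Game
end

section
open MeasureTheory Filter Set Topology
open ProbabilityTheory
set_option linter.all false

/-- The trivial state. -/
noncomputable def St.triv {T : ℝ} (hT : 0 < T) {O A : Set ℝ} {m0 : Measure ℝ} (h : IsProbabilityMeasure m0) (hm : m0 Oᶜ = 0) : St T O A where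
  μ := m0.map (fun x => ((0:ℝ), x))
  κ := 0
  hμ := Measure.isProbabilityMeasure_map (by fun_prop)
  hμs := by
    rw [Measure.map_apply (by fun_prop) (measurableSet_Icc.prod isClosed_closure.measurableSet).compl]
    refine measure_mono_null ?_ hm
    intro x hx hxO
    exact hx ⟨⟨le_refl _, hT.le⟩, subset_closure hxO⟩
  hκ := fun t => by simp
  hκs := fun t => by simp

lemma St.triv_feas {T : ℝ} (hT : 0 < T) {O A : Set ℝ} {m0 : Measure ℝ} (h : IsProbabilityMeasure m0) (hm : m0 Oᶜ = 0) (β s : ℝ × ℝ × ℝ → ℝ) :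
    Feas m0 β s (St.triv hT h hm : St T O A) := by
  intro u ut ux uxx hu
  have hQ : (St.triv hT h hm : St T O A).Q = 0 := by
    unfold St.Q St.triv
    exact Measure.compProd_zero_right _
  rw [hQ, integral_zero_measure, add_zero]
  show ∫ p, u p.1 p.2 ∂(m0.map (fun x => ((0:ℝ), x))) = _
  rw [integral_map (by fun_prop) hu.c.aestronglyMeasurable]

namespace Game
variable {T : ℝ} {O A : Set ℝ} {m0 : Measure ℝ} {ι ι' : Type} [Fintype ι] [Fintype ι'] (M : Game T O A m0 ι ι')

lemma R_nonempty (k : St T O A) : ∃ y, M.R k y := ⟨St.triv M.hT M.pm M.hm0, St.triv_feas M.hT M.pm M.hm0 _ _⟩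

lemma Γ_le (k y : St T O A) : M.Γ k y ≤ T * M.C + M.C := by
  unfold Γ
  have h1 : ∫ q, M.f k q ∂y.Q ≤ T * M.C :=
    (integral_mono (M.int_f k y) (integrable_const M.C) (fun q => (le_abs_self _).trans ((M.cff k).b q))).trans (St.integral_const_le M.hT.le y M.C M.hC0)
  have h2 : ∫ q, M.g k q ∂y.μ ≤ M.C := by
    have := integral_mono (M.int_g k y) (integrable_const M.C) (fun q => (le_abs_self _).trans (M.bg k q))
    simpa using this
  linarith

lemma eps_opt (k : St T O A) (ε : ℝ) (hε : 0 < ε) : ∃ y, M.R k y ∧ ∀ y', M.R k y' → M.Γ k y' ≤ M.Γ k y + ε := by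
  obtain ⟨y0, hy0⟩ := M.R_nonempty k
  have hne : (M.Γ k '' {y | M.R k y}).Nonempty := ⟨_, y0, hy0, rfl⟩
  have hbd : BddAbove (M.Γ k '' {y | M.R k y}) := ⟨T * M.C + M.C, by rintro _ ⟨y, -, rfl⟩; exact M.Γ_le k y⟩
  obtain ⟨_, ⟨y, hy, rfl⟩, h⟩ := exists_lt_of_lt_csSup hne (show sSup (M.Γ k '' {y | M.R k y}) - ε < sSup (M.Γ k '' {y | M.R k y}) by linarith)
  refine ⟨y, hy, fun y' hy' => ?_⟩
  have := le_csSup hbd ⟨y', hy', rfl⟩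
  linarith

lemma net (ε : ℝ) (hε : 0 < ε) : ∃ S : Finset (St T O A), ∀ x, InK m0 M.CL x → ∃ k ∈ S, M.D k x < ε := by
  haveI := M.pm
  by_contra hcon
  push Not at hcon
  obtain ⟨f, hf, hr⟩ := exists_seq_of_forall_finset_exists (fun x : St T O A => InK m0 M.CL x) (fun k x => ε ≤ M.D k x) (fun S _ => hcon S)
  obtain ⟨φ, hφ, x, hx⟩ := InK.subseq M.hT M.hA M.CL M.CL0 f hf
  have h1 := M.D_conv _ (fun n => hf (φ n)) x hx
  obtain ⟨N, hN⟩ := (h1.eventually (gt_mem_nhds (show (0:ℝ) < ε / 2 by positivity))).exists_forall_of_atTop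
  have a := hN N le_rfl
  have b := hN (N + 1) (Nat.le_succ _)
  have c := hr (φ N) (φ (N + 1)) (hφ (Nat.lt_succ_self _))
  have d := M.D_tri (f (φ N)) x (f (φ (N + 1)))
  rw [M.D_comm x] at d
  linarith

/-- Approximate equilibria. -/
def QN (ε : ℝ) (x : St T O A) : Prop :=
  ∃ (J : Type) (_ : Fintype J) (w : J → ℝ) (ys ks : J → St T O A), w ∈ stdSimplex ℝ J ∧ (∀ j, M.R (ks j) (ys j)) ∧
    (∀ j y, M.R (ks j) y → M.Γ (ks j) y ≤ M.Γ (ks j) (ys j) + ε) ∧ (∀ j, 0 < w j → M.D (ks j) x ≤ ε) ∧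
    (∀ h : ℝ × ℝ → ℝ, Measurable h → ∀ C, (∀ p, |h p| ≤ C) → ∫ p, h p ∂x.μ = ∑ j, w j * ∫ p, h p ∂(ys j).μ) ∧
    (∀ h : ℝ × ℝ × ℝ → ℝ, Measurable h → ∀ C, (∀ p, |h p| ≤ C) → ∫ p, h p ∂x.Q = ∑ j, w j * ∫ p, h p ∂(ys j).Q)

lemma mix_D {J : Type} [Fintype J] (w : J → ℝ) (hw : w ∈ stdSimplex ℝ J) (ys : J → St T O A) (k : St T O A) :
    M.D k (St.mix w hw ys) = (∫ t in Icc 0 T, ‖k.z M.hat t - ∑ j, w j • (ys j).z M.hat t‖) + ‖M.w k - ∑ j, w j • M.w (ys j)‖ := by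
  have h1 : ∀ t, (St.mix w hw ys).z M.hat t = ∑ j, w j • (ys j).z M.hat t := by
    intro t
    ext i
    rw [St.mix_z w hw ys M.hat M.chat M.H M.bhat]
    simp
  have h2 : M.w (St.mix w hw ys) = ∑ j, w j • M.w (ys j) := by
    ext i
    simp only [Game.w, Finset.sum_apply, Pi.smul_apply, smul_eq_mul]
    exact St.mix_int_μ w hw ys _ (M.cghat i).measurable M.H (M.bghat i)
  unfold D
  simp only [h1, h2]

lemma mix_cont {J : Type} [Fintype J] (ys : J → St T O A) (k : St T O A) :
    ContinuousOn (fun w : J → ℝ => (∫ t in Icc 0 T, ‖k.z M.hat t - ∑ j, w j • (ys j).z M.hat t‖) + ‖M.w k - ∑ j, w j • M.w (ys j)‖) (stdSimplex ℝ J) := by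
  refine ContinuousOn.add ?_ (by fun_prop)
  apply continuousOn_of_dominated (bound := fun _ => M.H + M.H)
  · intro w _
    have : Measurable fun t => ∑ j, w j • (ys j).z M.hat t := Finset.measurable_sum _ fun j _ => (M.mz (ys j)).const_smul (w j)
    exact ((M.mz k).sub this).norm.aestronglyMeasurable
  · intro w hw
    refine Eventually.of_forall fun t => ?_
    rw [norm_norm]
    refine (norm_sub_le _ _).trans (add_le_add (M.bz k t) ?_)
    calc ‖∑ j, w j • (ys j).z M.hat t‖ ≤ ∑ j, ‖w j • (ys j).z M.hat t‖ := norm_sum_le _ _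
      _ ≤ ∑ j, w j * M.H := by
        apply Finset.sum_le_sum
        intro j _
        rw [norm_smul, Real.norm_eq_abs, abs_of_nonneg (hw.1 j)]
        exact mul_le_mul_of_nonneg_left (M.bz _ t) (hw.1 j)
      _ = M.H := by rw [← Finset.sum_mul, hw.2, one_mul]
  · exact integrable_const _
  · exact Eventually.of_forall fun t => by fun_prop

theorem exists_QN (ε : ℝ) (hε : 0 < ε) : ∃ x, InK m0 M.CL x ∧ M.QN ε x := by
  obtain ⟨S, hS⟩ := M.net (ε / 2) (by positivity)
  choose Y hY1 hY2 using fun k => M.eps_opt k ε hε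
  have hne : Nonempty S := by
    obtain ⟨y, hy⟩ := M.R_nonempty (St.triv M.hT M.pm M.hm0)
    obtain ⟨k, hk, -⟩ := hS y (M.R_inK hy)
    exact ⟨⟨k, hk⟩⟩
  set ys : S → St T O A := fun j => Y j.1 with hys
  have hyK : ∀ j, InK m0 M.CL (ys j) := fun j => M.R_inK (hY1 j.1)
  set E : (S → ℝ) → S → ℝ := fun w i => (∫ t in Icc 0 T, ‖i.1.z M.hat t - ∑ j, w j • (ys j).z M.hat t‖) + ‖M.w i.1 - ∑ j, w j • M.w (ys j)‖ with hE
  have hEc : ∀ i, ContinuousOn (fun w => E w i) (stdSimplex ℝ S) := fun i => M.mix_cont ys i.1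
  have hED : ∀ w (hw : w ∈ stdSimplex ℝ S) i, M.D i.1 (St.mix w hw ys) = E w i := fun w hw i => M.mix_D w hw ys i.1
  set α : (S → ℝ) → S → ℝ := fun w i => max 0 (ε - E w i) with hα
  have hαc : ∀ i, ContinuousOn (fun w => α w i) (stdSimplex ℝ S) := fun i => ContinuousOn.sup continuousOn_const (ContinuousOn.sub continuousOn_const (hEc i))
  have hα0 : ∀ w i, 0 ≤ α w i := fun w i => le_max_left _ _
  have hpos : ∀ w ∈ stdSimplex ℝ S, 0 < ∑ i, α w i := by
    intro w hw
    obtain ⟨k, hk, hkD⟩ := hS _ (InK.mix w hw ys hyK)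
    rw [hED w hw ⟨k, hk⟩] at hkD
    have h1 : 0 < α w ⟨k, hk⟩ := lt_max_of_lt_right (by linarith)
    exact Finset.sum_pos' (fun i _ => hα0 w i) ⟨⟨k, hk⟩, Finset.mem_univ _, h1⟩
  obtain ⟨w, hw, hfix⟩ := brouwer_simplex (fun w i => α w i / ∑ j, α w j)
    (by
      refine continuousOn_pi.2 fun i => ?_
      exact (hαc i).div (continuousOn_finset_sum _ fun j _ => hαc j) (fun w hw => (hpos w hw).ne'))
    (by
      intro w hw
      refine ⟨fun i => div_nonneg (hα0 w i) (hpos w hw).le, ?_⟩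
      simp only
      rw [← Finset.sum_div, div_self (hpos w hw).ne'])
  refine ⟨St.mix w hw ys, InK.mix w hw ys hyK, S, inferInstance, w, ys, fun j => j.1, hw, fun j => hY1 j.1, fun j y hy => hY2 j.1 y hy, ?_,
    fun h hm C hC => St.mix_int_μ w hw ys h hm C hC, fun h hm C hC => St.mix_int_Q w hw ys h hm C hC⟩
  intro j hj
  rw [hED w hw j]
  have h1 := congrFun hfix j
  by_contra hcon
  push Not at hcon
  have h2 : α w j = 0 := max_eq_left (by linarith)
  rw [h2, zero_div] at h1
  linarith

lemma QN_of_nash {x : St T O A} (h1 : M.R x x) (h2 : ∀ y, M.R x y → M.Γ x y ≤ M.Γ x x) : M.QN 0 x := by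
  refine ⟨Unit, inferInstance, fun _ => 1, fun _ => x, fun _ => x, ⟨fun _ => zero_le_one, by simp⟩, fun _ => h1, fun _ y hy => by linarith [h2 y hy], fun _ _ => (M.D_self x).le, ?_, ?_⟩
  · intro h _ C _; simp
  · intro h _ C _; simp

lemma QN_mono {x : St T O A} {ε ε' : ℝ} (h : M.QN ε x) (hle : ε ≤ ε') : M.QN ε' x := by
  obtain ⟨J, iJ, w, ys, ks, a, b, c, d, e, f⟩ := h
  exact ⟨J, iJ, w, ys, ks, a, b, fun j y hy => (c j y hy).trans (by linarith), fun j hj => (d j hj).trans hle, e, f⟩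

lemma cont_Γ2 (y : ℕ → St T O A) (hy : ∀ n, InK m0 M.CL (y n)) (x : St T O A) (h : St.Conv y x) :
    Tendsto (fun n => M.Γ x (y n)) atTop (𝓝 (M.Γ x x)) := by
  haveI := M.pm
  exact (cont_Q M.hT.le M.hA M.CL M.CL0 y hy x h (M.f x) (M.cff x).m M.C (M.cff x).b (M.cff x).c).add (h.1 _ (M.cg x) ⟨_, M.bg x⟩)

theorem closure_QN (ε : ℕ → ℝ) (hε : Tendsto ε atTop (𝓝 0)) (x : ℕ → St T O A) (hx : ∀ n, InK m0 M.CL (x n)) (hq : ∀ n, M.QN (ε n) (x n))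
    (l : St T O A) (hl : St.Conv x l) : M.R l l ∧ ∀ y, M.R l y → M.Γ l y ≤ M.Γ l l := by
  haveI := M.pm
  have hD := M.D_conv x hx l hl
  have hsum : ∀ δ > 0, ∀ᶠ n in atTop, ε n + M.D (x n) l < δ := by
    intro δ hδ
    have := hε.add hD
    rw [add_zero] at this
    exact this.eventually (gt_mem_nhds hδ)
  constructor
  · refine Feas.of_limit M.hT.le M.hA M.CL M.CL0 x hx l hl _ _ (M.cfβ l).m (M.cfs l).m M.C (M.cfβ l).b (M.cfs l).b (M.cfβ l).c (M.cfs l).c ?_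
    intro u ut ux uxx hu
    obtain ⟨Du, hDu0, hDu⟩ := L_diff (A := A) hu M.C M.hC0
    obtain ⟨Bu, hBu0, hBu⟩ := hu.b
    obtain ⟨Eu, hEu⟩ := hu.bdd_L (M.cfβ l).b (M.cfs l).b
    rw [Metric.tendsto_atTop]
    intro τ hτ
    obtain ⟨δ1, hδ1, k1⟩ := cont_coeff (O := O) (m0 := m0) M.hT.le M.hA M.CL M.CL0 M.B M.mB M.C M.bB M.cB M.H (l.z M.hat) (M.mz l) (M.bz l) (τ / (4 * (Du + 1))) (by positivity)
    obtain ⟨δ2, hδ2, k2⟩ := cont_coeff (O := O) (m0 := m0) M.hT.le M.hA M.CL M.CL0 M.S M.mS M.C M.bS M.cS M.H (l.z M.hat) (M.mz l) (M.bz l) (τ / (4 * (Du + 1))) (by positivity)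
    obtain ⟨N, hN⟩ := (hsum (min δ1 δ2) (lt_min hδ1 hδ2)).exists_forall_of_atTop
    refine ⟨N, fun n hn => ?_⟩
    have hn' := hN n hn
    obtain ⟨J, iJ, w, ys, ks, hw, hR, hopt, hwD, hμ, hQ⟩ := hq n
    rw [Real.dist_eq, sub_zero, hμ _ hu.c.measurable Bu (fun p => (hBu _ _).1), hQ _ (hu.meas_L (M.cfβ l).m (M.cfs l).m) Eu hEu]
    have e : ∀ j, w j * ∫ p, u p.1 p.2 ∂(ys j).μ = w j * ∫ x, u 0 x ∂m0 + w j * ∫ q, (ut q.1 q.2.1 + (M.β (ks j) q * ux q.1 q.2.1 + M.s (ks j) q ^ 2 / 2 * uxx q.1 q.2.1)) ∂(ys j).Q := by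
      intro j
      rw [(hR j) u ut ux uxx hu]
      ring
    rw [Finset.sum_congr rfl fun j _ => e j, Finset.sum_add_distrib, ← Finset.sum_mul, hw.2, one_mul, add_sub_add_left_eq_sub, ← Finset.sum_sub_distrib]
    have hterm : ∀ j, |w j * (∫ q, (ut q.1 q.2.1 + (M.β (ks j) q * ux q.1 q.2.1 + M.s (ks j) q ^ 2 / 2 * uxx q.1 q.2.1)) ∂(ys j).Q) -
        w j * (∫ q, (ut q.1 q.2.1 + (M.β l q * ux q.1 q.2.1 + M.s l q ^ 2 / 2 * uxx q.1 q.2.1)) ∂(ys j).Q)| ≤ w j * (τ / 2) := by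
      intro j
      rw [← mul_sub, abs_mul, abs_of_nonneg (hw.1 j)]
      rcases (hw.1 j).eq_or_lt with h0 | h0
      · have : w j = 0 := h0.symm
        rw [this]; simp
      · have hd : M.D (ks j) l < min δ1 δ2 := by
          have := M.D_tri (ks j) (x n) l
          have := hwD j h0
          linarith
        refine mul_le_mul_of_nonneg_left ?_ (hw.1 j)
        refine (hDu (ys j) _ _ _ _ (M.cfβ (ks j)).m (M.cfs (ks j)).m (M.cfβ l).m (M.cfs l).m (M.cfβ (ks j)).b (M.cfs (ks j)).b (M.cfβ l).b (M.cfs l).b).trans ?_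
        have a1 := k1 _ (M.mz (ks j)) (M.bz (ks j)) ((M.D_ge1 _ _).trans_lt (hd.trans_le (min_le_left _ _))) (ys j) (M.R_inK (hR j))
        have a2 := k2 _ (M.mz (ks j)) (M.bz (ks j)) ((M.D_ge1 _ _).trans_lt (hd.trans_le (min_le_right _ _))) (ys j) (M.R_inK (hR j))
        calc _ ≤ Du * (τ / (4 * (Du + 1)) + τ / (4 * (Du + 1))) := mul_le_mul_of_nonneg_left (add_le_add a1 a2) hDu0
          _ ≤ (Du + 1) * (τ / (4 * (Du + 1)) + τ / (4 * (Du + 1))) := by gcongr; linarith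
          _ = τ / 2 := by field_simp; ring
    refine lt_of_le_of_lt ((Finset.abs_sum_le_sum_abs _ _).trans (Finset.sum_le_sum fun j _ => hterm j)) ?_
    rw [← Finset.sum_mul, hw.2]
    linarith
  · intro y hy
    apply le_of_forall_pos_le_add
    intro τ hτ
    obtain ⟨δ1, hδ1, k1⟩ := M.cont_Γ l (τ / 4) (by positivity)
    obtain ⟨δ2, hδ2, k2⟩ := M.lsc l y hy (τ / 4) (by positivity)
    have h1 : ∀ᶠ n in atTop, M.Γ l y - (τ / 4 + τ / 4 + τ / 4 + ε n) ≤ M.Γ l (x n) := by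
      filter_upwards [hsum (min δ1 δ2) (lt_min hδ1 hδ2)] with n hn'
      obtain ⟨J, iJ, w, ys, ks, hw, hR, hopt, hwD, hμ, hQ⟩ := hq n
      have e : M.Γ l (x n) = ∑ j, w j * M.Γ l (ys j) := by
        simp only [Γ, mul_add, Finset.sum_add_distrib]
        rw [hμ _ (M.cg l).measurable _ (M.bg l), hQ _ (M.cff l).m _ (M.cff l).b]
      rw [e]
      have e2 : M.Γ l y - (τ / 4 + τ / 4 + τ / 4 + ε n) = ∑ j, w j * (M.Γ l y - (τ / 4 + τ / 4 + τ / 4 + ε n)) := by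
        rw [← Finset.sum_mul, hw.2, one_mul]
      rw [e2]
      apply Finset.sum_le_sum
      intro j _
      rcases (hw.1 j).eq_or_lt with h0 | h0
      · have : w j = 0 := h0.symm
        rw [this]; simp
      · have hd : M.D (ks j) l < min δ1 δ2 := by
          have := M.D_tri (ks j) (x n) l
          have := hwD j h0
          linarith
        refine mul_le_mul_of_nonneg_left ?_ (hw.1 j)
        obtain ⟨y', hy', hy2⟩ := k2 (ks j) (hd.trans_le (min_le_right _ _))
        have a1 := abs_le.1 (k1 (ks j) (hd.trans_le (min_le_left _ _)) y' (M.R_inK hy'))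
        have a2 := abs_le.1 (k1 (ks j) (hd.trans_le (min_le_left _ _)) (ys j) (M.R_inK (hR j)))
        have a3 := hopt j y' hy'
        linarith [a1.1, a2.2]
    have h2 : Tendsto (fun n => M.Γ l y - (τ / 4 + τ / 4 + τ / 4 + ε n)) atTop (𝓝 (M.Γ l y - (τ / 4 + τ / 4 + τ / 4 + 0))) := (hε.const_add _).const_sub _
    have := le_of_tendsto_of_tendsto h2 (M.cont_Γ2 x hx l hl) h1
    linarith

theorem exists_nash : ∃ x, M.R x x ∧ ∀ y, M.R x y → M.Γ x y ≤ M.Γ x x := by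
  haveI := M.pm
  choose x hx hq using fun n : ℕ => M.exists_QN (1 / ((n:ℝ) + 1)) (by positivity)
  obtain ⟨φ, hφ, l, hl⟩ := InK.subseq M.hT M.hA M.CL M.CL0 x hx
  exact ⟨l, M.closure_QN (fun n => 1 / (((φ n : ℕ):ℝ) + 1)) ((tendsto_one_div_add_atTop_nhds_zero_nat (𝕜 := ℝ)).comp hφ.tendsto_atTop) _ (fun n => hx (φ n)) (fun n => hq (φ n)) l hl⟩

theorem nash_compact (x : ℕ → St T O A) (h1 : ∀ n, M.R (x n) (x n)) (h2 : ∀ n y, M.R (x n) y → M.Γ (x n) y ≤ M.Γ (x n) (x n)) :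
    ∃ φ : ℕ → ℕ, StrictMono φ ∧ ∃ l, (M.R l l ∧ ∀ y, M.R l y → M.Γ l y ≤ M.Γ l l) ∧ St.Conv (fun n => x (φ n)) l := by
  haveI := M.pm
  have hx : ∀ n, InK m0 M.CL (x n) := fun n => M.R_inK (h1 n)
  obtain ⟨φ, hφ, l, hl⟩ := InK.subseq M.hT M.hA M.CL M.CL0 x hx
  exact ⟨φ, hφ, l, M.closure_QN (fun _ => 0) tendsto_const_nhds _ (fun n => hx (φ n)) (fun n => M.QN_of_nash (h1 _) (h2 _)) l hl, hl⟩

end Game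
end

section
open MeasureTheory Filter Set Topology
open ProbabilityTheory
set_option linter.all false

/-! ### Link with the frozen definitions -/

lemma ext_hat {T C : ℝ} {O : Set ℝ} {d : ℕ} (c : ℝ → ℝ → Fin d → ℝ)
    (hc : ContinuousOn (fun p : ℝ × ℝ => c p.1 p.2) (Icc 0 T ×ˢ closure O)) (hC0 : 0 ≤ C) (hC : ∀ t x, ‖c t x‖ ≤ C) :
    ∃ h : Fin d → ℝ × ℝ → ℝ, (∀ i, Continuous (h i)) ∧ (∀ i p, |h i p| ≤ C) ∧ ∀ i, ∀ p ∈ Icc 0 T ×ˢ closure O, h i p = c p.1 p.2 i := by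
  choose h h1 h2 h3 using fun i : Fin d => tietze_bdd (Icc 0 T ×ˢ closure O) (isClosed_Icc.prod isClosed_closure) (fun p : ℝ × ℝ => c p.1 p.2 i)
    ((continuousOn_pi.1 hc) i) C hC0 (fun p _ => (norm_le_pi_norm (c p.1 p.2) i).trans (hC _ _))
  exact ⟨h, h1, h2, h3⟩

theorem mkGame (T : ℝ) (hT : 0 < T) (O A : Set ℝ) (hA : IsCompact A) (d : ℕ)
    (b σ f : ℝ → ℝ → Measure (ℝ × ℝ) → ℝ → ℝ) (g : ℝ → ℝ → Measure (ℝ × ℝ) → ℝ)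
    (bbar σbar fbar : ℝ → ℝ → (Fin d → ℝ) → ℝ → ℝ)
    (bhat σhat fhat ghat : ℝ → ℝ → Fin d → ℝ)
    (gbar : ℝ → ℝ → (Fin d → ℝ) → ℝ)
    (hb : MFCoeff T O A d b bbar bhat) (hσ : MFCoeff T O A d σ σbar σhat)
    (hf : MFRunning T O A d f fbar fhat) (hg : MFTerminal T O d g gbar ghat)
    (halt : MeasIndepOrInterval O b σ)
    (m0 : Measure ℝ) (hm0 : InitAssumption2 O m0) :
    ∃ M : Game T O A m0 (Fin 3 × Fin d) (Fin d), ∀ k : St T O A,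
      (∀ t ∈ Icc 0 T, ∀ x a, M.β k (t, x, a) = b t x (k.κ t) a ∧ M.s k (t, x, a) = σ t x (k.κ t) a ∧ M.f k (t, x, a) = f t x (k.κ t) a) ∧
      ∀ p ∈ Icc 0 T ×ˢ closure O, M.g k p = g p.1 p.2 k.μ := by
  obtain ⟨⟨Kb, hKb⟩, b1, ⟨Cb, b2⟩, b3, b4, b5, ⟨Hb, b6⟩⟩ := hb
  obtain ⟨⟨Ks, hKs⟩, s1, ⟨Cs, s2⟩, s3, s4, s5, ⟨Hs, s6⟩⟩ := hσ
  obtain ⟨f1, ⟨Cf', f2⟩, f3, f4, f5, ⟨Hf, f6⟩⟩ := hf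
  obtain ⟨g1, g2, ⟨Cg, g3⟩, g4, ⟨Hg, g5⟩⟩ := hg
  obtain ⟨C, hC0, hCb, hCs, hCf, hCg⟩ : ∃ C : ℝ, 0 ≤ C ∧ Cb ≤ C ∧ Cs ≤ C ∧ Cf' ≤ C ∧ Cg ≤ C :=
    ⟨|Cb| + |Cs| + |Cf'| + |Cg|, by positivity, by linarith [le_abs_self Cb, abs_nonneg Cs, abs_nonneg Cf', abs_nonneg Cg],
      by linarith [le_abs_self Cs, abs_nonneg Cb, abs_nonneg Cf', abs_nonneg Cg], by linarith [le_abs_self Cf', abs_nonneg Cs, abs_nonneg Cb, abs_nonneg Cg],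
      by linarith [le_abs_self Cg, abs_nonneg Cs, abs_nonneg Cf', abs_nonneg Cb]⟩
  obtain ⟨H, hH0, hHb, hHs, hHf, hHg⟩ : ∃ C : ℝ, 0 ≤ C ∧ Hb ≤ C ∧ Hs ≤ C ∧ Hf ≤ C ∧ Hg ≤ C :=
    ⟨|Hb| + |Hs| + |Hf| + |Hg|, by positivity, by linarith [le_abs_self Hb, abs_nonneg Hs, abs_nonneg Hf, abs_nonneg Hg],
      by linarith [le_abs_self Hs, abs_nonneg Hb, abs_nonneg Hf, abs_nonneg Hg], by linarith [le_abs_self Hf, abs_nonneg Hs, abs_nonneg Hb, abs_nonneg Hg],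
      by linarith [le_abs_self Hg, abs_nonneg Hs, abs_nonneg Hf, abs_nonneg Hb]⟩
  obtain ⟨xb, xb1, xb2, xb3⟩ := ext_hat bhat b5 hH0 (fun t x => (b6 t x).trans hHb)
  obtain ⟨xs, xs1, xs2, xs3⟩ := ext_hat σhat s5 hH0 (fun t x => (s6 t x).trans hHs)
  obtain ⟨xf, xf1, xf2, xf3⟩ := ext_hat fhat f5 hH0 (fun t x => (f6 t x).trans hHf)
  obtain ⟨xg, xg1, xg2, xg3⟩ := ext_hat ghat g4 hH0 (fun t x => (g5 t x).trans hHg)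
  obtain ⟨G, G1, G2, G3⟩ := tietze_bdd ((Icc 0 T ×ˢ closure O) ×ˢ (univ : Set (Fin d → ℝ))) ((isClosed_Icc.prod isClosed_closure).prod isClosed_univ)
    (fun q : (ℝ × ℝ) × (Fin d → ℝ) => gbar q.1.1 q.1.2 q.2)
    (g2.comp (f := fun q : (ℝ × ℝ) × (Fin d → ℝ) => (q.1.1, q.1.2, q.2)) (by fun_prop) (fun q hq => ⟨hq.1.1, hq.1.2, mem_univ _⟩)) C hC0
    (fun q _ => (g3 _ _ _).trans hCg)
  set hat : Fin 3 × Fin d → ℝ × ℝ → ℝ := fun i => ![xb i.2, xs i.2, xf i.2] i.1 with hhat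
  have key : ∀ (c : ℝ → ℝ → Fin d → ℝ) (xc : Fin d → ℝ × ℝ → ℝ), (∀ i, ∀ p ∈ Icc 0 T ×ˢ closure O, xc i p = c p.1 p.2 i) → ∀ k : St T O A, ∀ t ∈ Icc 0 T,
      (fun i => ∫ p, xc i (t, p.1) ∂(k.κ t)) = fun i => ∫ p, c t p.1 i ∂(k.κ t) := by
    intro c xc h k t ht
    ext i
    apply integral_congr_ae
    have : ∀ᵐ p ∂(k.κ t), p ∈ closure O ×ˢ A := by
      rw [ae_iff]; exact k.hκs t
    filter_upwards [this] with p hp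
    exact h i (t, p.1) ⟨ht, hp.1⟩
  have keyB : ∀ k : St T O A, ∀ t ∈ Icc 0 T, ∀ x a, bbar t x (fun i => k.z hat t (0, i)) a = b t x (k.κ t) a := by
    intro k t ht x a
    rw [b1, ← key bhat xb xb3 k t ht]
    rfl
  have keyS : ∀ k : St T O A, ∀ t ∈ Icc 0 T, ∀ x a, σbar t x (fun i => k.z hat t (1, i)) a = σ t x (k.κ t) a := by
    intro k t ht x a
    rw [s1, ← key σhat xs xs3 k t ht]
    rfl
  have keyF : ∀ k : St T O A, ∀ t ∈ Icc 0 T, ∀ x a, fbar t x (fun i => k.z hat t (2, i)) a = f t x (k.κ t) a := by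
    intro k t ht x a
    rw [f1, ← key fhat xf xf3 k t ht]
    rfl
  have meas : ∀ (j : Fin 3) (c : ℝ → ℝ → (Fin d → ℝ) → ℝ → ℝ), Measurable (fun q : ℝ × ℝ × (Fin d → ℝ) × ℝ => c q.1 q.2.1 q.2.2.1 q.2.2.2) →
      Measurable (fun q : ℝ × ℝ × (Fin 3 × Fin d → ℝ) × ℝ => c q.1 q.2.1 (fun i => q.2.2.1 (j, i)) q.2.2.2) := by
    intro j c hc
    exact hc.comp (f := fun q : ℝ × ℝ × (Fin 3 × Fin d → ℝ) × ℝ => (q.1, q.2.1, (fun i => q.2.2.1 (j, i)), q.2.2.2)) (by fun_prop)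
  have cont : ∀ (j : Fin 3) (c : ℝ → ℝ → (Fin d → ℝ) → ℝ → ℝ), (∀ t, ContinuousOn (fun q : ℝ × (Fin d → ℝ) × ℝ => c t q.1 q.2.1 q.2.2)
      (closure O ×ˢ Set.univ ×ˢ A)) → ∀ t, ContinuousOn (fun q : (Fin 3 × Fin d → ℝ) × ℝ × ℝ => c t q.2.1 (fun i => q.1 (j, i)) q.2.2) (univ ×ˢ (closure O ×ˢ A)) := by
    intro j c hc t
    exact (hc t).comp (f := fun q : (Fin 3 × Fin d → ℝ) × ℝ × ℝ => (q.2.1, (fun i => q.1 (j, i)), q.2.2)) (by fun_prop) (fun q hq => ⟨hq.2.1, mem_univ _, hq.2.2⟩)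
  have sub : closure O ×ˢ (Set.univ : Set (Fin d → ℝ)) ×ˢ A ⊆ Set.univ ×ˢ Set.univ ×ˢ A := prod_mono (subset_univ _) le_rfl
  refine ⟨{ B := fun t x z a => bbar t x (fun i => z (0, i)) a
            S := fun t x z a => σbar t x (fun i => z (1, i)) a
            F := fun t x z a => fbar t x (fun i => z (2, i)) a
            G := fun p w => G (p, w)
            hat := hat
            ghat := xg
            C := C
            H := H
            hT := hT
            hA := hA
            pm := hm0.1
            hm0 := hm0.2.1
            hC0 := hC0
            hH0 := hH0
            mB := meas 0 bbar b3
            mS := meas 1 σbar s3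
            mF := meas 2 fbar f3
            bB := fun t x z a => (b2 _ _ _ _).trans hCb
            bS := fun t x z a => (s2 _ _ _ _).trans hCs
            bF := fun t x z a => (f2 _ _ _ _).trans hCf
            cB := cont 0 bbar (fun t => (b4 t).mono sub)
            cS := cont 1 σbar (fun t => (s4 t).mono sub)
            cF := cont 2 fbar f4
            cG := G1
            bG := fun p w => G2 _
            chat := ?_
            bhat := ?_
            cghat := xg1
            bghat := xg2
            alt := ?_ }, ?_⟩
  · rintro ⟨j, i⟩
    fin_cases j
    · exact xb1 i
    · exact xs1 i
    · exact xf1 i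
  · rintro ⟨j, i⟩
    fin_cases j
    · exact xb2 i
    · exact xs2 i
    · exact xf2 i
  · rcases halt with h | ⟨⟨c1, c2, hc, hO⟩, -, cs, hcs, hlow⟩
    · left
      intro k k' t ht x hx a ha
      simp only [keyB _ t ht, keyS _ t ht]
      exact h t x _ _ a
    · right
      refine ⟨c1, c2, cs, |Kb| + |Ks|, hc, hO, hcs, by positivity, ?_⟩
      intro k t ht x hx a ha
      simp only [keyB _ t ht, keyS _ t ht]
      refine ⟨hlow _ _ _ _, fun y hy => ⟨(hKb t _ a x y).trans ?_, (hKs t _ a x y).trans ?_⟩⟩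
      · gcongr
        linarith [le_abs_self Kb, abs_nonneg Ks]
      · gcongr
        linarith [le_abs_self Ks, abs_nonneg Kb]
  · intro k
    refine ⟨fun t ht x a => ⟨keyB k t ht x a, keyS k t ht x a, keyF k t ht x a⟩, fun p hp => ?_⟩
    have e : (fun i => ∫ p, xg i p ∂k.μ) = fun i => ∫ p, ghat p.1 p.2 i ∂k.μ := by
      ext i
      apply integral_congr_ae
      filter_upwards [k.μ_ae] with p hp
      exact xg3 i p hp
    show G (p, fun i => ∫ p, xg i p ∂k.μ) = _
    rw [g1, e, G3 _ ⟨hp, mem_univ _⟩]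

/-- A state representing a pair `(μ, m)`. -/
def SRep {T : ℝ} {O A : Set ℝ} (y : St T O A) (μ : Measure (ℝ × ℝ)) (m : ℝ → Measure (ℝ × ℝ)) : Prop :=
  y.μ = μ ∧ ∀ᵐ t ∂(volume.restrict (Icc 0 T)), y.κ t = m t

lemma SRep.refl {T : ℝ} {O A : Set ℝ} (y : St T O A) : SRep y y.μ (fun t => y.κ t) := ⟨rfl, Eventually.of_forall fun t => rfl⟩

lemma St.memV {T : ℝ} {O A : Set ℝ} (y : St T O A) : MemV T O A (fun t => y.κ t) := by
  refine ⟨fun t => (y.hκ t).trans_lt ENNReal.one_lt_top, y.hκs, fun B hB => y.κ.measurable_coe hB, ?_⟩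
  exact St.integrable_bdd _ _ (y.κ.measurable_coe MeasurableSet.univ).ennreal_toReal 1 (fun t => by
    rw [abs_of_nonneg ENNReal.toReal_nonneg]; exact y.κ_real_le t)

theorem exists_rep {T : ℝ} (hT : 0 < T) {O A : Set ℝ} {b σ : ℝ → ℝ → Measure (ℝ × ℝ) → ℝ → ℝ} {m0 : Measure ℝ} [IsProbabilityMeasure m0]
    {mbar : ℝ → Measure (ℝ × ℝ)} {μ : Measure (ℝ × ℝ)} {m : ℝ → Measure (ℝ × ℝ)} (h : MemRm T O A b σ m0 mbar μ m) :
    ∃ y : St T O A, SRep y μ m := by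
  obtain ⟨hp, hs, ⟨v1, v2, v3, v4⟩, hu⟩ := h
  have mm : Measurable m := Measure.measurable_of_measurable_coe _ v3
  have mu : Measurable fun t => m t univ := v3 _ MeasurableSet.univ
  have hle : ∀ᵐ t ∂(volume.restrict (Icc 0 T)), m t univ ≤ 1 := by
    set ν := (volume.restrict (Icc 0 T)).withDensity fun t => m t univ with hν
    have hfin : ∫⁻ t in Icc 0 T, m t univ ≠ ⊤ := by
      have : ∫⁻ t in Icc 0 T, m t univ = ∫⁻ t in Icc 0 T, ENNReal.ofReal (m t univ).toReal :=
        lintegral_congr fun t => (ENNReal.ofReal_toReal (v1 t).ne).symm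
      rw [this]
      exact v4.lintegral_lt_top.ne
    haveI : IsFiniteMeasure ν := isFiniteMeasure_withDensity hfin
    have hνle : ν ≤ volume.restrict (Icc 0 T) := by
      apply measure_le_of_cont
      intro h hc h0 h1
      set η : ℝ → ℝ := fun t => ∫ s in T..t, h s with hη
      have hd : ∀ t, HasDerivAt η (h t) t := fun t => (hc.integral_hasStrictDerivAt T t).hasDerivAt
      have hηc : Continuous η := continuous_iff_continuousAt.2 fun t => (hd t).continuousAt
      have hcb : IsCb12 T O (fun t _ => η t) (fun t _ => h t) (fun _ _ => 0) (fun _ _ => 0) := by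
        refine ⟨(hηc.comp continuous_fst).continuousOn, (hc.comp continuous_fst).continuousOn, continuousOn_const, continuousOn_const,
          fun t _ x _ => (hd t).hasDerivWithinAt, fun t _ x _ => hasDerivWithinAt_const _ _ _, fun t _ x _ => hasDerivWithinAt_const _ _ _, T + 1, ?_⟩
        intro t ht x _
        have e1 : |η t| ≤ 1 * |t - T| := intervalIntegral.norm_integral_le_of_norm_le_const (fun s _ => by
          rw [Real.norm_eq_abs, abs_of_nonneg (h0 s)]; exact h1 s)
        have e2 : |t - T| ≤ T := by rw [abs_le]; constructor <;> linarith [ht.1, ht.2]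
        refine ⟨by linarith, ?_, ?_, ?_⟩
        · rw [abs_of_nonneg (h0 t)]; linarith [h1 t]
        · simp; linarith
        · simp; linarith
      have e := hu _ _ _ _ hcb
      simp only [mul_zero, add_zero, integral_const, smul_eq_mul, probReal_univ, one_mul] at e
      have e3 : ∫ t, h t ∂ν = ∫ t in Icc 0 T, (m t).real univ * h t := by
        rw [hν, integral_withDensity_eq_integral_toReal_smul mu (Eventually.of_forall fun t => v1 t)]
        rfl
      have e4 : ∫ p, η p.1 ∂μ ≤ 0 := by
        apply integral_nonpos_of_ae
        have : ∀ᵐ p ∂μ, p ∈ Icc 0 T ×ˢ closure O := by rw [ae_iff]; exact hs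
        filter_upwards [this] with p hp
        show ∫ s in T..p.1, h s ≤ 0
        rw [intervalIntegral.integral_symm]
        have := intervalIntegral.integral_nonneg (μ := volume) hp.1.2 (fun s _ => h0 s)
        linarith
      have e5 : η 0 = - ∫ t in Icc 0 T, h t := by
        show ∫ s in T..0, h s = _
        rw [intervalIntegral.integral_symm, intervalIntegral.integral_of_le hT.le, integral_Icc_eq_integral_Ioc]
      rw [e3]
      linarith
    refine ae_le_of_forall_setLIntegral_le_of_sigmaFinite mu ?_
    intro s hs _
    have := hνle s
    rw [hν, withDensity_apply _ hs] at this
    refine this.trans (by simp)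
  classical
  have ms : MeasurableSet {t | m t univ ≤ 1} := measurableSet_le mu measurable_const
  refine ⟨⟨μ, ⟨fun t => if m t univ ≤ 1 then m t else 0, Measurable.ite ms mm measurable_const⟩, hp, hs, ?_, ?_⟩, rfl, ?_⟩
  · intro t
    show (if m t univ ≤ 1 then m t else 0 : Measure (ℝ × ℝ)) univ ≤ 1
    split_ifs with h
    · exact h
    · simp
  · intro t
    show (if m t univ ≤ 1 then m t else 0 : Measure (ℝ × ℝ)) _ = 0
    split_ifs with h
    · exact v2 t
    · simp
  · filter_upwards [hle] with t ht
    exact if_pos ht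

section
variable {T : ℝ} {O A : Set ℝ} {m0 : Measure ℝ} {ι ι' : Type} [Fintype ι] [Fintype ι'] (M : Game T O A m0 ι ι')
  {b σ f : ℝ → ℝ → Measure (ℝ × ℝ) → ℝ → ℝ} {g : ℝ → ℝ → Measure (ℝ × ℝ) → ℝ}

lemma link_L (hM : ∀ k : St T O A,
      (∀ t ∈ Icc 0 T, ∀ x a, M.β k (t, x, a) = b t x (k.κ t) a ∧ M.s k (t, x, a) = σ t x (k.κ t) a ∧ M.f k (t, x, a) = f t x (k.κ t) a) ∧
      ∀ p ∈ Icc 0 T ×ˢ closure O, M.g k p = g p.1 p.2 k.μ)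
    {k y : St T O A} {μs μ : Measure (ℝ × ℝ)} {ms m : ℝ → Measure (ℝ × ℝ)} (hk : SRep k μs ms) (hy : SRep y μ m)
    {u ut ux uxx v vt vx vxx : ℝ → ℝ → ℝ} (hv : Tst T O v vt vx vxx)
    (he : ∀ t ∈ Icc 0 T, ∀ x ∈ closure O, v t x = u t x ∧ vt t x = ut t x ∧ vx t x = ux t x ∧ vxx t x = uxx t x) :
    ∫ t in Icc 0 T, (∫ p, (ut t p.1 + (b t p.1 (ms t) p.2 * ux t p.1 + σ t p.1 (ms t) p.2 ^ 2 / 2 * uxx t p.1)) ∂(m t)) =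
      ∫ q, (vt q.1 q.2.1 + (M.β k q * vx q.1 q.2.1 + M.s k q ^ 2 / 2 * vxx q.1 q.2.1)) ∂y.Q := by
  obtain ⟨E, hE⟩ := hv.bdd_L (M.cfβ k).b (M.cfs k).b
  rw [y.integral_Q _ (St.integrable_bdd _ _ (hv.meas_L (M.cfβ k).m (M.cfs k).m) E hE)]
  apply integral_congr_ae
  filter_upwards [hk.2, hy.2, ae_restrict_mem measurableSet_Icc] with t h1 h2 ht
  rw [← h1, ← h2]
  apply integral_congr_ae
  have : ∀ᵐ p ∂(y.κ t), p ∈ closure O ×ˢ A := by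
    rw [ae_iff]; exact y.hκs t
  filter_upwards [this] with p hp
  obtain ⟨-, e1, e2, e3⟩ := he t ht p.1 hp.1
  obtain ⟨c1, c2, -⟩ := (hM k).1 t ht p.1 p.2
  show _ = vt t p.1 + (M.β k (t, p.1, p.2) * vx t p.1 + M.s k (t, p.1, p.2) ^ 2 / 2 * vxx t p.1)
  rw [e1, e2, e3, c1, c2]

lemma link_R (hM : ∀ k : St T O A,
      (∀ t ∈ Icc 0 T, ∀ x a, M.β k (t, x, a) = b t x (k.κ t) a ∧ M.s k (t, x, a) = σ t x (k.κ t) a ∧ M.f k (t, x, a) = f t x (k.κ t) a) ∧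
      ∀ p ∈ Icc 0 T ×ˢ closure O, M.g k p = g p.1 p.2 k.μ)
    {k y : St T O A} {μs μ : Measure (ℝ × ℝ)} {ms m : ℝ → Measure (ℝ × ℝ)} (hk : SRep k μs ms) (hy : SRep y μ m) (hm : MemV T O A m) :
    MemRm T O A b σ m0 ms μ m ↔ M.R k y := by
  constructor
  · rintro ⟨-, -, -, h⟩ u ut ux uxx hu
    rw [hy.1, h u ut ux uxx hu.is, link_L M hM hk hy hu (fun t _ x _ => ⟨rfl, rfl, rfl, rfl⟩)]
  · intro h
    refine ⟨hy.1 ▸ y.hμ, hy.1 ▸ y.hμs, hm, ?_⟩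
    intro u ut ux uxx hu
    obtain ⟨v, vt, vx, vxx, hv, he⟩ := hu.ext
    have e := h v vt vx vxx hv
    rw [link_L M hM hk hy hv he, ← hy.1]
    have e1 : ∫ p, u p.1 p.2 ∂y.μ = ∫ p, v p.1 p.2 ∂y.μ := by
      apply integral_congr_ae
      filter_upwards [y.μ_ae] with p hp
      exact (he p.1 hp.1 p.2 hp.2).1.symm
    have e2 : ∫ x, u 0 x ∂m0 = ∫ x, v 0 x ∂m0 := by
      apply integral_congr_ae
      have : ∀ᵐ x ∂m0, x ∈ O := by rw [ae_iff]; exact M.hm0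
      filter_upwards [this] with x hx
      exact (he 0 ⟨le_rfl, M.hT.le⟩ x (subset_closure hx)).1.symm
    rw [e1, e2, e]

lemma link_Γ (hM : ∀ k : St T O A,
      (∀ t ∈ Icc 0 T, ∀ x a, M.β k (t, x, a) = b t x (k.κ t) a ∧ M.s k (t, x, a) = σ t x (k.κ t) a ∧ M.f k (t, x, a) = f t x (k.κ t) a) ∧
      ∀ p ∈ Icc 0 T ×ˢ closure O, M.g k p = g p.1 p.2 k.μ)
    {k y : St T O A} {μs μ : Measure (ℝ × ℝ)} {ms m : ℝ → Measure (ℝ × ℝ)} (hk : SRep k μs ms) (hy : SRep y μ m) :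
    GammaMF T f g μs ms μ m = M.Γ k y := by
  unfold GammaMF Game.Γ
  congr 1
  · rw [y.integral_Q _ (M.int_f k y)]
    apply integral_congr_ae
    filter_upwards [hk.2, hy.2, ae_restrict_mem measurableSet_Icc] with t h1 h2 ht
    rw [← h1, ← h2]
    apply integral_congr_ae
    refine Eventually.of_forall fun p => ?_
    exact ((hM k).1 t ht p.1 p.2).2.2.symm
  · rw [← hy.1, ← hk.1]
    apply integral_congr_ae
    filter_upwards [y.μ_ae] with p hp
    exact ((hM k).2 p hp).symm
end

theorem final_thm
    (T : ℝ) (hT : 0 < T) (O A : Set ℝ) (hO : IsOpen O) (hA : IsCompact A)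
    (d : ℕ) (hd : 0 < d)
    (b σ f : ℝ → ℝ → Measure (ℝ × ℝ) → ℝ → ℝ) (g : ℝ → ℝ → Measure (ℝ × ℝ) → ℝ)
    (bbar σbar fbar : ℝ → ℝ → (Fin d → ℝ) → ℝ → ℝ)
    (bhat σhat fhat ghat : ℝ → ℝ → Fin d → ℝ)
    (gbar : ℝ → ℝ → (Fin d → ℝ) → ℝ)
    (hb : MFCoeff T O A d b bbar bhat) (hσ : MFCoeff T O A d σ σbar σhat)
    (hσpos : ∀ t x ν a, 0 ≤ σ t x ν a)
    (hf : MFRunning T O A d f fbar fhat) (hg : MFTerminal T O d g gbar ghat)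
    (halt : MeasIndepOrInterval O b σ)
    (m0 : Measure ℝ) (hm0 : InitAssumption2 O m0) :
    (∃ (μs : Measure (ℝ × ℝ)) (ms : ℝ → Measure (ℝ × ℝ)),
      IsLPNash T O A b σ f g m0 μs ms) ∧
    (∀ (μn : ℕ → Measure (ℝ × ℝ)) (mn : ℕ → ℝ → Measure (ℝ × ℝ)),
      (∀ n, IsLPNash T O A b σ f g m0 (μn n) (mn n)) →
      ∃ φ : ℕ → ℕ, StrictMono φ ∧
        ∃ (μ : Measure (ℝ × ℝ)) (m : ℝ → Measure (ℝ × ℝ)),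
          IsLPNash T O A b σ f g m0 μ m ∧
          WeakConv (fun k => μn (φ k)) μ ∧ ConvV T (fun k => mn (φ k)) m) := by
  obtain ⟨M, hM⟩ := mkGame T hT O A hA d b σ f g bbar σbar fbar bhat σhat fhat ghat gbar hb hσ hf hg halt m0 hm0
  haveI := hm0.1
  have nash : ∀ x : St T O A, (M.R x x ∧ ∀ y, M.R x y → M.Γ x y ≤ M.Γ x x) → IsLPNash T O A b σ f g m0 x.μ (fun t => x.κ t) := by
    rintro x ⟨h1, h2⟩
    refine ⟨(link_R M hM (SRep.refl x) (SRep.refl x) x.memV).2 h1, ?_⟩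
    intro μ m hm
    obtain ⟨y, hy⟩ := exists_rep hT hm
    rw [link_Γ M hM (SRep.refl x) hy, link_Γ M hM (SRep.refl x) (SRep.refl x)]
    exact h2 y ((link_R M hM (SRep.refl x) hy hm.2.2.1).1 hm)
  constructor
  · obtain ⟨x, hx⟩ := M.exists_nash
    exact ⟨_, _, nash x hx⟩
  · intro μn mn hn
    choose x hx using fun n => exists_rep hT (hn n).1
    obtain ⟨φ, hφ, l, hl, hc⟩ := M.nash_compact x (fun n => (link_R M hM (hx n) (hx n) (hn n).1.2.2.1).1 (hn n).1)
      (fun n y hy => by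
        rw [← link_Γ M hM (hx n) (SRep.refl y), ← link_Γ M hM (hx n) (hx n)]
        exact (hn n).2 _ _ ((link_R M hM (hx n) (SRep.refl y) y.memV).2 hy))
    refine ⟨φ, hφ, _, _, nash l hl, ?_, ?_⟩
    · intro h hcont hb
      have := hc.1 h hcont hb
      simp only [(hx _).1] at this
      exact this
    · rintro h hcont ⟨C, hC⟩
      have := hc.2 (fun q => h q.1 q.2) hcont ⟨C, fun q => hC _ _⟩
      have e : ∀ y : St T O A, ∫ q, h q.1 q.2 ∂y.Q = ∫ t in Icc 0 T, ∫ p, h t p ∂(y.κ t) := fun y =>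
        y.integral_Q _ (St.integrable_bdd _ _ hcont.measurable C (fun q => hC _ _))
      simp only [e] at this
      refine this.congr fun n => ?_
      apply integral_congr_ae
      filter_upwards [(hx (φ n)).2] with t ht
      rw [ht]
end

/-- Existence of LP MFG equilibria: under the mean-field
assumptions and the additional assumption (a) or (c), the set of LP MFG Nash
equilibria is nonempty and (sequentially) compact. -/
theorem exists_LPNash
    (T : ℝ) (hT : 0 < T) (O A : Set ℝ) (hO : IsOpen O) (hA : IsCompact A)
    (d : ℕ) (hd : 0 < d)
    (b σ f : ℝ → ℝ → Measure (ℝ × ℝ) → ℝ → ℝ) (g : ℝ → ℝ → Measure (ℝ × ℝ) → ℝ)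
    (bbar σbar fbar : ℝ → ℝ → (Fin d → ℝ) → ℝ → ℝ)
    (bhat σhat fhat ghat : ℝ → ℝ → Fin d → ℝ)
    (gbar : ℝ → ℝ → (Fin d → ℝ) → ℝ)
    (hb : MFCoeff T O A d b bbar bhat) (hσ : MFCoeff T O A d σ σbar σhat)
    (hσpos : ∀ t x ν a, 0 ≤ σ t x ν a)
    (hf : MFRunning T O A d f fbar fhat) (hg : MFTerminal T O d g gbar ghat)
    (halt : MeasIndepOrInterval O b σ)
    (m0 : Measure ℝ) (hm0 : InitAssumption2 O m0) :
    -- nonemptiness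
    (∃ (μs : Measure (ℝ × ℝ)) (ms : ℝ → Measure (ℝ × ℝ)),
      IsLPNash T O A b σ f g m0 μs ms) ∧
    -- sequential compactness of the set of equilibria
    (∀ (μn : ℕ → Measure (ℝ × ℝ)) (mn : ℕ → ℝ → Measure (ℝ × ℝ)),
      (∀ n, IsLPNash T O A b σ f g m0 (μn n) (mn n)) →
      ∃ φ : ℕ → ℕ, StrictMono φ ∧
        ∃ (μ : Measure (ℝ × ℝ)) (m : ℝ → Measure (ℝ × ℝ)),
          IsLPNash T O A b σ f g m0 μ m ∧
          WeakConv (fun k => μn (φ k)) μ ∧ ConvV T (fun k => mn (φ k)) m) := by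
  exact final_thm T hT O A hO hA d hd b σ f g bbar σbar fbar bhat σhat fhat ghat gbar hb hσ hσpos hf hg halt m0 hm0
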